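/- Let M be a compact connected oriented n-manifold obtained by gluing compact connected oriented n-manifolds M_1,…,M_k along boundary components via orientation-reversing compatible homeomorphisms (a gluing f : S_1 → S_2 is compatible if f_*(K_1) = K_2, where K_i is the kernel of the inclusion-induced map π₁(S_i) → π₁ of the manifold containing S_i), and assume the fundamental group of every boundary component of every M_j is amenable. Then for every n ≥ 2 and every (φ_1,…,φ_k) ∈ ⊕_{v=1}^k H_b^n(M_v,∂M_v) there exists φ ∈ H_b^n(M,∂M) such that ‖φ‖_∞ ≤ max_v ‖φ_v‖_∞ and ζ^n_v(φ) = φ_v for every v = 1,…,k. -/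

import Mathlib

noncomputable section

namespace BddCoh

/-! ### Singular chains and homology -/

/-- The standard `n`-simplex. -/
abbrev Δ (n : ℕ) : Set (Fin (n + 1) → ℝ) := stdSimplex ℝ (Fin (n + 1))

/-- Singular `n`-simplices in `X`. -/
abbrev SSimplex (X : Type) [TopologicalSpace X] (n : ℕ) := C(Δ n, X)

/-- Singular `n`-chains in `X` with coefficients in `R`. -/
def SChain (R : Type) [Ring R] (X : Type) [TopologicalSpace X] (n : ℕ) : Type :=
  SSimplex X n →₀ R

instance (R : Type) [Ring R] (X : Type) [TopologicalSpace X] (n : ℕ) :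
    AddCommGroup (SChain R X n) := Finsupp.instAddCommGroup

instance (R : Type) [Ring R] (X : Type) [TopologicalSpace X] (n : ℕ) :
    Module R (SChain R X n) := Finsupp.module (SSimplex X n) R

/-- Chains are finitely supported functions on simplices. -/
def chainEquiv (R : Type) [Ring R] (X : Type) [TopologicalSpace X] (n : ℕ) :
    (SSimplex X n →₀ R) ≃ₗ[R] SChain R X n := LinearEquiv.refl R (SChain R X n)

/-- The `i`-th face inclusion of standard simplices. -/
def face {n : ℕ} (i : Fin (n + 2)) : C(Δ n, Δ (n + 1)) where
  toFun x := ⟨i.insertNth 0 x.1, by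
    refine ⟨fun j => ?_, ?_⟩
    · refine Fin.succAboveCases i ?_ (fun j => ?_) j
      · simp
      · simp [x.2.1 j]
    · rw [Fin.sum_univ_succAbove _ i]
      simp [x.2.2]⟩
  continuous_toFun := by
    refine Continuous.subtype_mk ?_ _
    exact Continuous.finInsertNth i continuous_const continuous_subtype_val

variable {X : Type} [TopologicalSpace X] {R : Type} [Ring R]

/-- The `i`-th face of a singular `(n+1)`-simplex. -/
def faceOf {n : ℕ} (σ : SSimplex X (n + 1)) (i : Fin (n + 2)) : SSimplex X n :=
  σ.comp (face i)

/-- The boundary of a singular `(n+1)`-simplex, as a chain. -/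
def bdryChain (R : Type) [Ring R] {n : ℕ} (σ : SSimplex X (n + 1)) : SChain R X n :=
  chainEquiv R X n (∑ i : Fin (n + 2), Finsupp.single (faceOf σ i) ((-1 : R) ^ (i : ℕ)))

/-- The singular boundary operator. -/
def bdry (R : Type) [Ring R] (X : Type) [TopologicalSpace X] (n : ℕ) :
    SChain R X (n + 1) →ₗ[R] SChain R X n :=
  (Finsupp.linearCombination R (bdryChain R)).comp (chainEquiv R X (n + 1)).symm.toLinearMap

/-- The ℓ¹-norm of a real singular chain. -/
def l1 {n : ℕ} (c : SChain ℝ X n) : ℝ :=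
  ((chainEquiv ℝ X n).symm c).sum fun _ r => |r|

/-- The submodule of chains supported on simplices with image contained in `Y`. -/
def chainsIn (R : Type) [Ring R] (X : Type) [TopologicalSpace X] (Y : Set X) (n : ℕ) :
    Submodule R (SChain R X n) :=
  (Finsupp.supported R R {σ : SSimplex X n | Set.range σ ⊆ Y}).map (chainEquiv R X n).toLinearMap

/-- Relative `(n+1)`-cycles of the pair `(X, Y)`. -/
def relCycles (R : Type) [Ring R] (X : Type) [TopologicalSpace X] (Y : Set X) (n : ℕ) :
    Submodule R (SChain R X (n + 1)) :=
  (chainsIn R X Y n).comap (bdry R X n)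

/-- Relative `(n+1)`-boundaries of the pair `(X, Y)`. -/
def relBdries (R : Type) [Ring R] (X : Type) [TopologicalSpace X] (Y : Set X) (n : ℕ) :
    Submodule R (SChain R X (n + 1)) :=
  LinearMap.range (bdry R X (n + 1)) ⊔ chainsIn R X Y (n + 1)

/-- Relative singular homology `H_{n+1}(X, Y; R)`. -/
def relHomology (R : Type) [Ring R] (X : Type) [TopologicalSpace X] (Y : Set X) (n : ℕ) :=
  relCycles R X Y n ⧸ ((relBdries R X Y n).comap (relCycles R X Y n).subtype)

instance (Y : Set X) (n : ℕ) : AddCommGroup (relHomology R X Y n) :=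
  Submodule.Quotient.addCommGroup _

instance (Y : Set X) (n : ℕ) : Module R (relHomology R X Y n) :=
  Submodule.Quotient.module _

/-- The class of a relative cycle in relative homology. -/
def relHomClass {Y : Set X} {n : ℕ} (c : relCycles R X Y n) : relHomology R X Y n :=
  Submodule.Quotient.mk c

/-- The ℓ¹-seminorm on relative singular homology. -/
def l1HomNorm {Y : Set X} {n : ℕ} (α : relHomology ℝ X Y n) : ℝ :=
  sInf {r : ℝ | ∃ c : relCycles ℝ X Y n, relHomClass c = α ∧ r = l1 c.1}


/-! ### Amenability and countable CW pairs -/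

/-- A group is amenable if it admits a left-invariant finitely additive
probability measure defined on all subsets. -/
def IsAmenable (G : Type*) [Group G] : Prop :=
  ∃ m : Set G → ℝ, (∀ A, 0 ≤ m A) ∧ m Set.univ = 1 ∧
    (∀ A B, Disjoint A B → m (A ∪ B) = m A + m B) ∧
    (∀ (g : G) (A : Set G), m ((g * ·) '' A) = m A)

universe u

open CategoryTheory in
/-- A type witnessing that `X'` is obtained from `X` by attaching generalized cells `f : S ⟶ D`. -/
structure RelativeCWComplex.AttachGeneralizedCells {S D : TopCat.{u}} (f : S ⟶ D)
    (X X' : TopCat.{u}) where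
  /-- The index type over the generalized cells -/
  cells : Type u
  /-- An attaching map for each generalized cell -/
  attachMaps : cells → (S ⟶ X)
  /-- `X'` is the pushout of `∐ S ⟶ X` and `∐ S ⟶ ∐ D`. -/
  iso_pushout : X' ≅ Limits.pushout (Limits.Sigma.desc attachMaps)
    (Limits.Sigma.map fun (_ : cells) => f)

/-- A relative CW-complex: `sk n` is usually called the `(n - 1)`-skeleton, and `sk (n + 1)` is
obtained from `sk n` by attaching `n`-disks. -/
structure RelativeCWComplex where
  /-- The skeletons. -/
  sk : ℕ → TopCat.{u}
  /-- Each `sk (n + 1)` is obtained from `sk n` by attaching `n`-disks. -/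
  attachCells : ∀ n : ℕ, RelativeCWComplex.AttachGeneralizedCells
    (TopCat.diskBoundaryInclusion.{u} n) (sk n) (sk (n + 1))

/-- A CW-complex is a relative CW-complex whose `sk 0` (the `(-1)`-skeleton) is empty. -/
structure CWComplex extends RelativeCWComplex.{u} where
  /-- `sk 0` is empty. -/
  isEmpty_sk_zero : IsEmpty (sk 0)

open CategoryTheory in
/-- The inclusion map from `sk n` to `sk (n + 1)`. -/
def RelativeCWComplex.skInclusion (C : RelativeCWComplex.{u}) (n : ℕ) : C.sk n ⟶ C.sk (n + 1) :=
  Limits.pushout.inl _ _ ≫ (C.attachCells n).iso_pushout.inv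

open CategoryTheory in
/-- The topology on a relative CW-complex. -/
def RelativeCWComplex.toTopCat (C : RelativeCWComplex.{u}) : TopCat.{u} :=
  Limits.colimit (Functor.ofSequence C.skInclusion)

open CategoryTheory in
/-- `X` carries the structure of a countable CW-complex. -/
def IsCountableCW (X : Type) [TopologicalSpace X] : Prop :=
  ∃ C : CWComplex.{0}, (∀ n, Countable ((C.attachCells n).cells)) ∧
    Nonempty ((RelativeCWComplex.toTopCat C.toRelativeCWComplex : TopCat) ≅ TopCat.of X)

open CategoryTheory in
/-- `(X, Y)` is a pair of countable CW-complexes, i.e. `X` is a countable CW-complex and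
`Y` is a subcomplex of `X` (realized as the `(-1)`-skeleton of a relative CW-structure on `X`),
which is itself a countable CW-complex. -/
def IsCountableCWPair (X : Type) [TopologicalSpace X] (Y : Set X) : Prop :=
  IsCountableCW X ∧ IsCountableCW Y ∧
  ∃ (C : RelativeCWComplex.{0}) (φ : (RelativeCWComplex.toTopCat C : TopCat) ≅ TopCat.of X),
    (∀ n, Countable ((C.attachCells n).cells)) ∧
    Set.range (fun y => φ.hom ((Limits.colimit.ι (Functor.ofSequence C.skInclusion) 0) y)) = Y

/-- Every connected component of `Y` has amenable fundamental group. -/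
def AmenableComponents (Y : Type) [TopologicalSpace Y] : Prop :=
  ∀ y : Y, IsAmenable (FundamentalGroup (connectedComponent y) ⟨y, mem_connectedComponent⟩)
/-! ### Sup-seminorm on real-valued functions -/

/-- The sup-"norm" of a real valued function (the infimum of its bounds). -/
def supN {S : Type*} (f : S → ℝ) : ℝ := sInf {C : ℝ | 0 ≤ C ∧ ∀ s, |f s| ≤ C}

/-! ### Singular bounded cochains and bounded cohomology of pairs -/

variable {X : Type} [TopologicalSpace X]

/-- Singular (unbounded) `n`-cochains. -/
abbrev SCochain (X : Type) [TopologicalSpace X] (n : ℕ) := SSimplex X n → ℝ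

/-- The singular coboundary operator. -/
def scob (X : Type) [TopologicalSpace X] (n : ℕ) : SCochain X n →ₗ[ℝ] SCochain X (n + 1) where
  toFun f := fun τ => ∑ i : Fin (n + 2), ((-1 : ℝ) ^ (i : ℕ)) * f (faceOf τ i)
  map_add' f g := by
    funext τ
    simp [mul_add, Finset.sum_add_distrib]
  map_smul' r f := by
    funext τ
    simp [Finset.mul_sum]
    congr 1
    funext i
    ring

/-- Bounded cochains. -/
def bddCochains (X : Type) [TopologicalSpace X] (n : ℕ) : Submodule ℝ (SCochain X n) where
  carrier := {f | ∃ C, ∀ σ, |f σ| ≤ C}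
  zero_mem' := ⟨0, fun σ => by simp⟩
  add_mem' := by
    rintro f g ⟨C, hC⟩ ⟨D, hD⟩
    exact ⟨C + D, fun σ => (abs_add_le _ _).trans (add_le_add (hC σ) (hD σ))⟩
  smul_mem' := by
    rintro r f ⟨C, hC⟩
    refine ⟨|r| * C, fun σ => ?_⟩
    have : |r • f σ| = |r| * |f σ| := by rw [smul_eq_mul, abs_mul]
    calc |(r • f) σ| = |r| * |f σ| := this
    _ ≤ |r| * C := mul_le_mul_of_nonneg_left (hC σ) (abs_nonneg r)

/-- Cochains vanishing on simplices with image contained in `Y`. -/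
def vanishingOn (X : Type) [TopologicalSpace X] (Y : Set X) (n : ℕ) :
    Submodule ℝ (SCochain X n) where
  carrier := {f | ∀ σ : SSimplex X n, Set.range ⇑σ ⊆ Y → f σ = 0}
  zero_mem' := fun _ _ => rfl
  add_mem' := by
    intro f g hf hg σ hσ
    simp [Pi.add_apply, hf σ hσ, hg σ hσ]
  smul_mem' := by
    intro r f hf σ hσ
    simp [Pi.smul_apply, hf σ hσ]

/-- Relative bounded cochains of the pair `(X, Y)`. -/
def relBC (X : Type) [TopologicalSpace X] (Y : Set X) (n : ℕ) : Submodule ℝ (SCochain X n) :=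
  bddCochains X n ⊓ vanishingOn X Y n

/-- Relative bounded cocycles. -/
def relBZ (X : Type) [TopologicalSpace X] (Y : Set X) (n : ℕ) : Submodule ℝ (SCochain X n) :=
  relBC X Y n ⊓ LinearMap.ker (scob X n)

/-- Relative bounded coboundaries. -/
def relBB (X : Type) [TopologicalSpace X] (Y : Set X) : ∀ n : ℕ, Submodule ℝ (SCochain X n)
  | 0 => ⊥
  | (m + 1) => (relBC X Y m).map (scob X m)

/-- The relative bounded cohomology `H_b^n(X, Y)` of the pair `(X, Y)`.
For `Y = ∅` this is the bounded cohomology of `X`. -/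
def relBCoh (X : Type) [TopologicalSpace X] (Y : Set X) (n : ℕ) :=
  relBZ X Y n ⧸ ((relBB X Y n).comap (relBZ X Y n).subtype)

instance (Y : Set X) (n : ℕ) : AddCommGroup (relBCoh X Y n) :=
  Submodule.Quotient.addCommGroup _

instance (Y : Set X) (n : ℕ) : Module ℝ (relBCoh X Y n) :=
  Submodule.Quotient.module _

/-- The class of a relative bounded cocycle. -/
def relBCohClass {Y : Set X} {n : ℕ} (f : relBZ X Y n) : relBCoh X Y n :=
  Submodule.Quotient.mk f

/-- The canonical seminorm (`ℓ^∞`-seminorm) on relative bounded cohomology. -/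
def bcohNorm {Y : Set X} {n : ℕ} (φ : relBCoh X Y n) : ℝ :=
  sInf {r : ℝ | ∃ f : relBZ X Y n, relBCohClass f = φ ∧ r = supN f.1}

/-! ### Functoriality of bounded cohomology of pairs -/

variable {X' : Type} [TopologicalSpace X']

/-- Pullback of cochains along a continuous map. -/
def pb (f : C(X, X')) (n : ℕ) : SCochain X' n →ₗ[ℝ] SCochain X n where
  toFun g := fun σ => g (f.comp σ)
  map_add' g h := rfl
  map_smul' r g := rfl

lemma pb_scob (f : C(X, X')) (n : ℕ) (g : SCochain X' n) :
    scob X n (pb f n g) = pb f (n + 1) (scob X' n g) := rfl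

lemma pb_mem_relBZ (f : C(X, X')) {Y : Set X} {Y' : Set X'} (hf : Set.MapsTo f Y Y') (n : ℕ)
    {g : SCochain X' n} (hg : g ∈ relBZ X' Y' n) : pb f n g ∈ relBZ X Y n := by
  obtain ⟨⟨⟨C, hC⟩, hvan⟩, hker⟩ := hg
  refine ⟨⟨⟨C, fun σ => hC _⟩, fun σ hσ => ?_⟩, ?_⟩
  · refine hvan (f.comp σ) ?_
    rintro - ⟨x, rfl⟩
    exact hf (hσ ⟨x, rfl⟩)
  · have : scob X n (pb f n g) = 0 := by
      rw [pb_scob, LinearMap.mem_ker.1 hker]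
      rfl
    exact LinearMap.mem_ker.2 this

lemma pb_mem_relBB (f : C(X, X')) {Y : Set X} {Y' : Set X'} (hf : Set.MapsTo f Y Y') (n : ℕ)
    {g : SCochain X' n} (hg : g ∈ relBB X' Y' n) : pb f n g ∈ relBB X Y n := by
  cases n with
  | zero =>
    have : g = 0 := hg
    simp [this, relBB]
  | succ m =>
    obtain ⟨u, hu, rfl⟩ := hg
    refine ⟨pb f m u, ?_, (pb_scob f m u).symm⟩
    obtain ⟨⟨C, hC⟩, hvan⟩ := hu
    refine ⟨⟨C, fun σ => hC _⟩, fun σ hσ => ?_⟩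
    refine hvan (f.comp σ) ?_
    rintro - ⟨x, rfl⟩
    exact hf (hσ ⟨x, rfl⟩)

/-- The map induced on relative bounded cohomology by a continuous map of pairs. -/
def relBCohPull (f : C(X, X')) {Y : Set X} {Y' : Set X'} (hf : Set.MapsTo f Y Y') (n : ℕ) :
    relBCoh X' Y' n →ₗ[ℝ] relBCoh X Y n :=
  Submodule.mapQ _ _ ((pb f n).restrict (fun g hg => pb_mem_relBZ f hf n hg))
    (fun g hg => pb_mem_relBB f hf n hg)



/-- The inclusion of a subspace, as a continuous map. -/
def subIncl {X : Type} [TopologicalSpace X] (Y : Set X) : C(↥Y, X) :=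
  ⟨Subtype.val, continuous_subtype_val⟩

open CategoryTheory in
/-- The map induced by a continuous map on fundamental groups. -/
def pi1Map {X Y : Type} [TopologicalSpace X] [TopologicalSpace Y] (f : C(X, Y)) (x : X) :
    FundamentalGroup X x →* FundamentalGroup Y (f x) :=
  (FundamentalGroupoid.fundamentalGroupoidFunctor.map
    (show TopCat.of X ⟶ TopCat.of Y from TopCat.ofHom f)).mapEnd ⟨x⟩

/-! ### Topological manifolds with boundary and fundamental classes -/

/-- The closed upper half space `ℍⁿ = {x : ℝⁿ | x₀ ≥ 0}`. -/
def halfSpace (n : ℕ) : Set (Fin n → ℝ) := {x | ∀ j : Fin n, (j : ℕ) = 0 → 0 ≤ x j}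

/-- `M` is a topological `n`-manifold with boundary `B`: every point has an open
neighbourhood homeomorphic to an open subset of the closed half space `ℍⁿ`, with points of
`B` (and only those) corresponding to points of the boundary hyperplane. -/
def IsTopMfdWithBdry (n : ℕ) (M : Type) [TopologicalSpace M] (B : Set M) : Prop :=
  T2Space M ∧
  ∀ x : M, ∃ (U : Set M) (V : Set ↥(halfSpace n)) (e : ↥U ≃ₜ ↥V),
    IsOpen U ∧ IsOpen V ∧ x ∈ U ∧
    ∀ y : ↥U, ((∀ j : Fin n, (j : ℕ) = 0 → ((e y : ↥(halfSpace n)) : Fin n → ℝ) j = 0) ↔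
      (y : M) ∈ B)

/-- Extension of coefficients from `ℤ` to `ℝ` on singular chains. -/
def intChain {M : Type} [TopologicalSpace M] {m : ℕ} (z : SChain ℤ M m) : SChain ℝ M m :=
  chainEquiv ℝ M m
    (Finsupp.mapRange (Int.cast : ℤ → ℝ) (by simp) ((chainEquiv ℤ M m).symm z))

/-- `μ ∈ H_{n+1}(M, B; ℝ)` is a fundamental class (with regular set `reg`): it is the
image of an integral relative homology class which induces a generator of the local
homology group `H_{n+1}(M, M ∖ {x}; ℤ)` at every point `x ∈ reg`. For a compact connected
oriented `(n+1)`-manifold `M` with boundary `B` one takes `reg = Bᶜ` (the interior), and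
for the pseudomanifolds arising from generalized Dehn fillings one takes `reg` to be the
image of the interior of the filled manifold. -/
def IsFundClassOn (M : Type) [TopologicalSpace M] (B : Set M) (reg : Set M) (n : ℕ)
    (μ : relHomology ℝ M B n) : Prop :=
  ∃ (z : SChain ℤ M (n + 1)) (hz : z ∈ relCycles ℤ M B n),
    (∃ hzr : intChain z ∈ relCycles ℝ M B n, relHomClass ⟨intChain z, hzr⟩ = μ) ∧
    ∀ x ∈ reg,
      ∃ hloc : z ∈ relCycles ℤ M ({x}ᶜ) n,
        ∀ β : relHomology ℤ M ({x}ᶜ) n, ∃ k : ℤ, β = k • relHomClass ⟨z, hloc⟩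

/-- The fundamental class of a compact connected oriented manifold with boundary:
its regular points are all the interior points. -/
def IsFundClass (M : Type) [TopologicalSpace M] (B : Set M) (n : ℕ)
    (μ : relHomology ℝ M B n) : Prop :=
  IsFundClassOn M B Bᶜ n μ

/-! ### Gluings of manifolds along boundary components -/

/-- The data of a gluing of the manifolds-with-boundary `(piece j, bdry j)`, `j < k`,
along (some of) their boundary components: a finite set `E` of gluings, each of which
identifies a boundary component `S₁ e` of the piece `j₁ e` with a boundary component
`S₂ e` of the piece `j₂ e` via a homeomorphism `glue e`; each boundary component is used
at most once. -/
structure GluingData (k : ℕ) where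
  piece : Fin k → Type
  top : ∀ j, TopologicalSpace (piece j)
  bdry : ∀ j, Set (piece j)
  E : Type
  finE : Finite E
  j₁ : E → Fin k
  j₂ : E → Fin k
  S₁ : (e : E) → Set (piece (j₁ e))
  S₂ : (e : E) → Set (piece (j₂ e))
  comp₁ : ∀ e, ∃ y ∈ bdry (j₁ e), S₁ e = connectedComponentIn (bdry (j₁ e)) y
  comp₂ : ∀ e, ∃ y ∈ bdry (j₂ e), S₂ e = connectedComponentIn (bdry (j₂ e)) y
  sub₁ : ∀ e, S₁ e ⊆ bdry (j₁ e)
  sub₂ : ∀ e, S₂ e ⊆ bdry (j₂ e)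
  glue : (e : E) → ↥(S₁ e) ≃ₜ ↥(S₂ e)
  used_inj : Function.Injective (fun x : E ⊕ E =>
    match x with
    | Sum.inl e => (⟨j₁ e, S₁ e⟩ : Σ j : Fin k, Set (piece j))
    | Sum.inr e => ⟨j₂ e, S₂ e⟩)

attribute [instance] GluingData.top

namespace GluingData

variable {k : ℕ} (D : GluingData k)

/-- The identifications performed by the gluing. -/
def rel : (Σ j, D.piece j) → (Σ j, D.piece j) → Prop := fun a b =>
  ∃ (e : D.E) (s : ↥(D.S₁ e)), a = ⟨D.j₁ e, (s : D.piece (D.j₁ e))⟩ ∧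
    b = ⟨D.j₂ e, (D.glue e s : D.piece (D.j₂ e))⟩

/-- The glued space: the quotient of the disjoint union of the pieces by the
identifications given by the gluing homeomorphisms. -/
def Glued : Type := Quot D.rel

instance : TopologicalSpace D.Glued := by unfold Glued; infer_instance

/-- The canonical map from a piece to the glued space. -/
def emb (j : Fin k) : C(D.piece j, D.Glued) :=
  ⟨fun x => Quot.mk D.rel ⟨j, x⟩, by exact continuous_quot_mk.comp continuous_sigmaMk⟩

/-- The union `𝒮` of the glued hypersurfaces inside the glued space. -/
def gluedSet : Set D.Glued := ⋃ e : D.E, (D.emb (D.j₁ e)) '' (D.S₁ e)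

/-- The boundary of the glued space: what remains of the boundaries of the pieces after
removing the glued hypersurfaces. -/
def gluedBdry : Set D.Glued := (⋃ j, (D.emb j) '' (D.bdry j)) \ D.gluedSet

lemma emb_mapsTo_bdry (j : Fin k) :
    Set.MapsTo (D.emb j) (D.bdry j) (D.gluedBdry ∪ D.gluedSet) := by
  intro y hy
  by_cases hx : D.emb j y ∈ D.gluedSet
  · exact Or.inr hx
  · exact Or.inl ⟨Set.mem_iUnion.2 ⟨j, ⟨y, hy, rfl⟩⟩, hx⟩

/-- A gluing is compatible if every gluing homeomorphism `f : S₁ → S₂` satisfies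
`f_*(K₁) = K₂`, where `K_i` is the kernel of the map induced on fundamental groups by the
inclusion `S_i → M_{j_i}`. -/
def Compatible : Prop :=
  ∀ (e : D.E) (s : ↥(D.S₁ e)),
    Subgroup.map (pi1Map ((D.glue e) : C(↥(D.S₁ e), ↥(D.S₂ e))) s)
      (MonoidHom.ker (pi1Map (subIncl (D.S₁ e)) s)) =
    MonoidHom.ker (pi1Map (subIncl (D.S₂ e)) ((D.glue e) s))

end GluingData

end BddCoh

end

noncomputable section
namespace BddCoh

/-! ### Chains of tuples -/

/-- Formal real combinations of `(k+1)`-tuples in `V`. -/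
abbrev TChain (V : Type*) (k : ℕ) := (Fin (k + 1) → V) →₀ ℝ

/-- The boundary of chains of tuples. -/
def tbdry (V : Type*) (k : ℕ) : TChain V (k + 1) →ₗ[ℝ] TChain V k :=
  Finsupp.linearCombination ℝ fun a =>
    ∑ i : Fin (k + 2), Finsupp.single (a ∘ i.succAbove) ((-1 : ℝ) ^ (i : ℕ))

/-- Coning off a chain of tuples. -/
def tcone {V : Type*} (v : V) (k : ℕ) : TChain V k →ₗ[ℝ] TChain V (k + 1) :=
  Finsupp.lmapDomain ℝ ℝ (fun a => Fin.cons v a)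

/-- Push forward of chains of tuples. -/
def tmap {V V' : Type*} (φ : V → V') (k : ℕ) : TChain V k →ₗ[ℝ] TChain V' k :=
  Finsupp.lmapDomain ℝ ℝ (fun a => φ ∘ a)

@[simp] lemma tbdry_single {V : Type*} {k : ℕ} (a : Fin (k + 2) → V) (r : ℝ) :
    tbdry V k (Finsupp.single a r) =
      ∑ i : Fin (k + 2), Finsupp.single (a ∘ i.succAbove) (r * (-1 : ℝ) ^ (i : ℕ)) := by
  simp [tbdry, Finset.smul_sum]

@[simp] lemma tcone_single {V : Type*} {k : ℕ} (v : V) (a : Fin (k + 1) → V) (r : ℝ) :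
    tcone v k (Finsupp.single a r) = Finsupp.single (Fin.cons v a) r := by
  simp [tcone]

@[simp] lemma tmap_single {V V' : Type*} {k : ℕ} (φ : V → V') (a : Fin (k + 1) → V) (r : ℝ) :
    tmap φ k (Finsupp.single a r) = Finsupp.single (φ ∘ a) r := by
  simp [tmap]

/-- The cancellation behind `∂ ∘ ∂ = 0`. -/
lemma sum_succAbove_succAbove {A : Type*} [AddCommGroup A] [Module ℝ A] {k : ℕ}
    (F : (Fin (k + 1) → Fin (k + 3)) → A) :
    ∑ i : Fin (k + 3), ∑ j : Fin (k + 2),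
      ((-1 : ℝ) ^ (i : ℕ) * (-1 : ℝ) ^ (j : ℕ)) • F (i.succAbove ∘ j.succAbove) = 0 := by
  rw [← Fintype.sum_prod_type' (f := fun (i : Fin (k + 3)) (j : Fin (k + 2)) =>
      ((-1 : ℝ) ^ (i : ℕ) * (-1 : ℝ) ^ (j : ℕ)) • F (i.succAbove ∘ j.succAbove))]
  let g : Fin (k + 3) × Fin (k + 2) → Fin (k + 3) × Fin (k + 2) := fun x =>
    if h : x.2.castSucc < x.1 then (x.2.castSucc, x.1.pred (Fin.ne_zero_of_lt h))
    else (x.2.succ, x.1.castPred (Fin.ne_last_of_lt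
      (lt_of_le_of_lt (not_lt.1 h) (Fin.castSucc_lt_succ (i := x.2)))))
  have key : ∀ (i : Fin (k + 3)) (j : Fin (k + 2)) (h : j.castSucc < i),
      i.succAbove ∘ j.succAbove =
        (j.castSucc).succAbove ∘ (i.pred (Fin.ne_zero_of_lt h)).succAbove := by
    intro i j h
    funext l
    have := Fin.lt_def.1 h
    simp only [Function.comp, Fin.succAbove, Fin.ext_iff, Fin.lt_def]
    split_ifs <;> simp_all <;> omega
  refine Finset.sum_involution (fun x _ => g x) ?_ ?_ (fun _ _ => Finset.mem_univ _) ?_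
  · rintro ⟨i, j⟩ -
    by_cases h : j.castSucc < i
    · have h' := Fin.lt_def.1 h
      simp only [g, h, dite_true]
      rw [key i j h, ← add_smul]
      have hi : (i : ℕ) = ((i.pred (Fin.ne_zero_of_lt h) : Fin (k + 2)) : ℕ) + 1 := by
        simp at h' ⊢; omega
      rw [hi, pow_succ]
      simp [mul_comm]
    · have h' := not_lt.1 h
      simp only [g, h, dite_false]
      have hne : i ≠ Fin.last _ := Fin.ne_last_of_lt
        (lt_of_le_of_lt (not_lt.1 h) (Fin.castSucc_lt_succ (i := j)))
      have hlt : (i.castPred hne).castSucc < j.succ := by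
        rw [Fin.castSucc_castPred]; exact lt_of_le_of_lt h' (Fin.castSucc_lt_succ (i := j))
      have hk : j.succ.succAbove ∘ (i.castPred hne).succAbove = i.succAbove ∘ j.succAbove := by
        rw [key j.succ (i.castPred hne) hlt, Fin.pred_succ, Fin.castSucc_castPred]
      rw [hk, ← add_smul]
      simp [pow_succ, mul_comm]
  · rintro ⟨i, j⟩ - - hg
    by_cases h : j.castSucc < i
    · simp only [g, h, dite_true, Prod.mk.injEq] at hg
      exact absurd hg.1 (ne_of_lt h)
    · simp only [g, h, dite_false, Prod.mk.injEq] at hg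
      rw [← hg.1] at h
      exact h (Fin.castSucc_lt_succ (i := j))
  · rintro ⟨i, j⟩ -
    by_cases h : j.castSucc < i
    · have : ¬ ((i.pred (Fin.ne_zero_of_lt h)).castSucc < j.castSucc) := by
        rw [not_lt, Fin.le_def]; have := Fin.lt_def.1 h; simp at this ⊢; omega
      simp [g, h, this]
    · have hne : i ≠ Fin.last _ := Fin.ne_last_of_lt
        (lt_of_le_of_lt (not_lt.1 h) (Fin.castSucc_lt_succ (i := j)))
      have : (i.castPred hne).castSucc < j.succ := by
        rw [Fin.castSucc_castPred]; exact lt_of_le_of_lt (not_lt.1 h) (Fin.castSucc_lt_succ (i := j))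
      simp only [g, h, dite_false]
      rw [dif_pos this]
      simp

lemma tbdry_tbdry {V : Type*} {k : ℕ} (c : TChain V (k + 2)) :
    tbdry V k (tbdry V (k + 1) c) = 0 := by
  suffices h : (tbdry V k).comp (tbdry V (k + 1)) = 0 from LinearMap.congr_fun h c
  refine Finsupp.lhom_ext fun a r => ?_
  simp only [LinearMap.comp_apply, tbdry_single, map_sum, LinearMap.zero_apply]
  have := sum_succAbove_succAbove (A := TChain V k) (k := k)
    (fun b => Finsupp.single (a ∘ b) r)
  rw [← this]
  refine Finset.sum_congr rfl fun i _ => Finset.sum_congr rfl fun j _ => ?_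
  rw [Finsupp.smul_single]
  congr 1
  simp; ring

lemma tbdry_tmap {V V' : Type*} (φ : V → V') {k : ℕ} (c : TChain V (k + 1)) :
    tbdry V' k (tmap φ (k + 1) c) = tmap φ k (tbdry V k c) := by
  suffices h : (tbdry V' k).comp (tmap φ (k + 1)) = (tmap φ k).comp (tbdry V k) from
    LinearMap.congr_fun h c
  refine Finsupp.lhom_ext fun a r => ?_
  simp [Function.comp_assoc, -Finsupp.single_mul]

lemma tbdry_tcone {V : Type*} (v : V) {k : ℕ} (c : TChain V (k + 1)) :
    tbdry V (k + 1) (tcone v (k + 1) c) = c - tcone v k (tbdry V k c) := by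
  suffices h : (tbdry V (k + 1)).comp (tcone v (k + 1)) =
      LinearMap.id - (tcone v k).comp (tbdry V k) from LinearMap.congr_fun h c
  refine Finsupp.lhom_ext fun a r => ?_
  simp only [LinearMap.comp_apply, tcone_single, tbdry_single, LinearMap.sub_apply,
    LinearMap.id_apply, map_sum]
  rw [Fin.sum_univ_succ]
  have h0 : (Fin.cons v a : Fin (k + 3) → V) ∘ (0 : Fin (k + 3)).succAbove = a := by
    funext l; simp
  have hs : ∀ i : Fin (k + 2), (Fin.cons v a : Fin (k + 3) → V) ∘ i.succ.succAbove =
      Fin.cons v (a ∘ i.succAbove) := by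
    intro i; funext l
    refine Fin.cases ?_ (fun l => ?_) l <;> simp
  rw [h0]
  simp only [hs, Fin.val_zero, pow_zero, mul_one, Fin.val_succ, pow_succ, mul_neg,
    Finsupp.single_neg, Finset.sum_neg_distrib]
  abel

lemma tbdry_tcone_zero {V : Type*} (v : V) (c : TChain V 0) :
    tbdry V 0 (tcone v 0 c) =
      c - Finsupp.single (fun _ => v) (Finsupp.linearCombination ℝ (fun _ => (1 : ℝ)) c) := by
  suffices h : (tbdry V 0).comp (tcone v 0) = LinearMap.id -
      (Finsupp.lsingle (fun _ => v)).comp (Finsupp.linearCombination ℝ (fun _ => (1 : ℝ))) from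
    LinearMap.congr_fun h c
  refine Finsupp.lhom_ext fun a r => ?_
  have h0 : (Fin.cons v a : Fin 2 → V) ∘ (0 : Fin 2).succAbove = a := by
    funext l; simp
  have h1 : (Fin.cons v a : Fin 2 → V) ∘ (1 : Fin 2).succAbove = fun _ => v := by
    funext l; fin_cases l; simp [Fin.succAbove]
  rw [LinearMap.comp_apply, tcone_single, tbdry_single, Fin.sum_univ_two]
  erw [h0, h1]
  simp [sub_eq_add_neg, -Finsupp.single_mul]

/-- The homotopy operator obtained by coning, showing that an augmentation-killing chain map `W`
between tuple complexes is null-homotopic. -/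
def coneHtpy {V V' : Type*} (v : V → V') (W : ∀ k, TChain V k →ₗ[ℝ] TChain V' k) :
    ∀ k, TChain V k →ₗ[ℝ] TChain V' (k + 1)
  | 0 => Finsupp.linearCombination ℝ fun a => tcone (v (a 0)) 0 (W 0 (Finsupp.single a 1))
  | k + 1 => Finsupp.linearCombination ℝ fun a =>
      tcone (v (a 0)) (k + 1) (W (k + 1) (Finsupp.single a 1) -
        coneHtpy v W k (tbdry V k (Finsupp.single a 1)))

lemma tbdry_coneHtpy_zero {V V' : Type*} (v : V → V') (W : ∀ k, TChain V k →ₗ[ℝ] TChain V' k)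
    (hε : ∀ a, Finsupp.linearCombination ℝ (fun _ => (1 : ℝ)) (W 0 (Finsupp.single a 1)) = 0)
    (c : TChain V 0) : tbdry V' 0 (coneHtpy v W 0 c) = W 0 c := by
  suffices h : (tbdry V' 0).comp (coneHtpy v W 0) = W 0 from LinearMap.congr_fun h c
  refine Finsupp.lhom_ext' fun a => LinearMap.ext_ring ?_
  simp [coneHtpy, tbdry_tcone_zero, hε]

lemma tbdry_coneHtpy {V V' : Type*} (v : V → V') (W : ∀ k, TChain V k →ₗ[ℝ] TChain V' k)
    (hε : ∀ a, Finsupp.linearCombination ℝ (fun _ => (1 : ℝ)) (W 0 (Finsupp.single a 1)) = 0)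
    (hW : ∀ k c, tbdry V' k (W (k + 1) c) = W k (tbdry V k c)) :
    ∀ (k : ℕ) (c : TChain V (k + 1)),
    tbdry V' (k + 1) (coneHtpy v W (k + 1) c) = W (k + 1) c - coneHtpy v W k (tbdry V k c) := by
  intro k
  induction k with
  | zero =>
    intro c
    suffices h : (tbdry V' 1).comp (coneHtpy v W 1) =
        W 1 - (coneHtpy v W 0).comp (tbdry V 0) from LinearMap.congr_fun h c
    refine Finsupp.lhom_ext' fun a => LinearMap.ext_ring ?_
    simp only [LinearMap.comp_apply, Finsupp.lsingle_apply, LinearMap.sub_apply]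
    rw [show coneHtpy v W 1 = _ from coneHtpy.eq_2 v W 0, Finsupp.linearCombination_single,
      one_smul, tbdry_tcone, map_sub, hW, tbdry_coneHtpy_zero v W hε]
    simp
  | succ k ih =>
    intro c
    suffices h : (tbdry V' (k + 2)).comp (coneHtpy v W (k + 2)) =
        W (k + 2) - (coneHtpy v W (k + 1)).comp (tbdry V (k + 1)) from LinearMap.congr_fun h c
    refine Finsupp.lhom_ext' fun a => LinearMap.ext_ring ?_
    simp only [LinearMap.comp_apply, Finsupp.lsingle_apply, LinearMap.sub_apply]
    rw [coneHtpy, Finsupp.linearCombination_single, one_smul, tbdry_tcone, map_sub, hW, ih,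
      tbdry_tbdry]
    simp

lemma tmap_tcone {V V' : Type*} (φ : V → V') (v : V) {k : ℕ} (c : TChain V k) :
    tmap φ (k + 1) (tcone v k c) = tcone (φ v) k (tmap φ k c) := by
  suffices h : (tmap φ (k + 1)).comp (tcone v k) = (tcone (φ v) k).comp (tmap φ k) from
    LinearMap.congr_fun h c
  refine Finsupp.lhom_ext fun a r => ?_
  simp only [LinearMap.comp_apply, tcone_single, tmap_single]
  congr 1
  funext l
  refine Fin.cases ?_ (fun l => ?_) l <;> simp

lemma coneHtpy_natural {V V' U U' : Type*} (v : V → V') (u : U → U')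
    (W : ∀ k, TChain V k →ₗ[ℝ] TChain V' k) (W' : ∀ k, TChain U k →ₗ[ℝ] TChain U' k)
    (φ : V → U) (φ' : V' → U') (hv : ∀ x, φ' (v x) = u (φ x))
    (hW : ∀ k c, tmap φ' k (W k c) = W' k (tmap φ k c)) :
    ∀ (k : ℕ) (c : TChain V k),
    tmap φ' (k + 1) (coneHtpy v W k c) = coneHtpy u W' k (tmap φ k c) := by
  intro k
  induction k with
  | zero =>
    intro c
    suffices h : (tmap φ' 1).comp (coneHtpy v W 0) = (coneHtpy u W' 0).comp (tmap φ 0) from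
      LinearMap.congr_fun h c
    refine Finsupp.lhom_ext' fun a => LinearMap.ext_ring ?_
    simp only [LinearMap.comp_apply, Finsupp.lsingle_apply]
    simp [coneHtpy, tmap_tcone, hv, hW]
  | succ k ih =>
    intro c
    suffices h : (tmap φ' (k + 2)).comp (coneHtpy v W (k + 1)) =
        (coneHtpy u W' (k + 1)).comp (tmap φ (k + 1)) from LinearMap.congr_fun h c
    refine Finsupp.lhom_ext' fun a => LinearMap.ext_ring ?_
    simp only [LinearMap.comp_apply, Finsupp.lsingle_apply]
    rw [coneHtpy, Finsupp.linearCombination_single, one_smul, tmap_tcone, map_sub, hW, ih,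
      ← tbdry_tmap, tmap_single, coneHtpy, Finsupp.linearCombination_single, one_smul, hv]
    rfl

/-- Pairing of a function on tuples with a chain of tuples. -/
def tpair {V : Type*} {k : ℕ} (g : (Fin (k + 1) → V) → ℝ) : TChain V k →ₗ[ℝ] ℝ :=
  Finsupp.linearCombination ℝ g

@[simp] lemma tpair_single {V : Type*} {k : ℕ} (g : (Fin (k + 1) → V) → ℝ)
    (a : Fin (k + 1) → V) (r : ℝ) : tpair g (Finsupp.single a r) = r * g a := by
  simp [tpair]

lemma tpair_tmap {V V' : Type*} {k : ℕ} (φ : V → V') (g : (Fin (k + 1) → V') → ℝ)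
    (c : TChain V k) : tpair g (tmap φ k c) = tpair (fun a => g (φ ∘ a)) c := by
  suffices h : (tpair g).comp (tmap φ k) = tpair (fun a => g (φ ∘ a)) from LinearMap.congr_fun h c
  refine Finsupp.lhom_ext fun a r => ?_
  simp

lemma tpair_tbdry {V : Type*} {k : ℕ} (g : (Fin (k + 1) → V) → ℝ) (c : TChain V (k + 1)) :
    tpair g (tbdry V k c) =
      tpair (fun a => ∑ i : Fin (k + 2), (-1 : ℝ) ^ (i : ℕ) * g (a ∘ i.succAbove)) c := by
  suffices h : (tpair g).comp (tbdry V k) =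
      tpair (fun a => ∑ i : Fin (k + 2), (-1 : ℝ) ^ (i : ℕ) * g (a ∘ i.succAbove)) from
    LinearMap.congr_fun h c
  refine Finsupp.lhom_ext fun a r => ?_
  simp [Finset.mul_sum, mul_assoc, -Finsupp.single_mul]

/-- The `ℓ¹`-norm of a chain of tuples. -/
def tnorm {V : Type*} {k : ℕ} (c : TChain V k) : ℝ := c.sum fun _ r => |r|

lemma abs_tpair_le {V : Type*} {k : ℕ} {g : (Fin (k + 1) → V) → ℝ} {C : ℝ}
    (hg : ∀ a, |g a| ≤ C) (c : TChain V k) : |tpair g c| ≤ tnorm c * C := by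
  rw [tpair, Finsupp.linearCombination_apply, Finsupp.sum, tnorm, Finsupp.sum, Finset.sum_mul]
  refine (Finset.abs_sum_le_sum_abs _ _).trans (Finset.sum_le_sum fun a _ => ?_)
  rw [smul_eq_mul, abs_mul]
  exact mul_le_mul_of_nonneg_left (hg a) (abs_nonneg _)

lemma tpair_eq_zero {V : Type*} {k : ℕ} {g : (Fin (k + 1) → V) → ℝ}
    (hg : ∀ a, g a = 0) (c : TChain V k) : tpair g c = 0 := by
  rw [tpair, Finsupp.linearCombination_apply]
  exact Finset.sum_eq_zero fun a _ => by simp [hg a]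

end BddCoh

end

noncomputable section
namespace BddCoh
local notation "I" => unitInterval

/-! ### Maps of simplices induced by maps of vertices -/

/-- The affine map of simplices induced by a map of vertices. -/
def smap {l k : ℕ} (a : Fin (l + 1) → Fin (k + 1)) : C(Δ l, Δ k) :=
  ⟨stdSimplex.map a, stdSimplex.continuous_map a⟩

lemma smap_apply {l k : ℕ} (a : Fin (l + 1) → Fin (k + 1)) (x : Δ l) (j : Fin (k + 1)) :
    (smap a x : Δ k) j = ∑ i with a i = j, x i := by
  change (stdSimplex.map a x : stdSimplex ℝ _) j = _
  rw [stdSimplex.map_coe, FunOnFinite.linearMap_apply_apply]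

@[simp] lemma smap_id {k : ℕ} : smap (id : Fin (k + 1) → Fin (k + 1)) = ContinuousMap.id _ := by
  ext1 x; exact stdSimplex.map_id_apply x

lemma smap_comp {l k m : ℕ} (a : Fin (k + 1) → Fin (m + 1)) (b : Fin (l + 1) → Fin (k + 1)) :
    (smap a).comp (smap b) = smap (a ∘ b) := by
  ext1 x; exact stdSimplex.map_comp_apply b a x

lemma smap_smap {l k m : ℕ} (a : Fin (k + 1) → Fin (m + 1)) (b : Fin (l + 1) → Fin (k + 1))
    (x : Δ l) : smap a (smap b x) = smap (a ∘ b) x := by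
  rw [← smap_comp]; rfl

lemma simplex_ext {k : ℕ} {x y : Δ k} (h : ∀ i, x i = y i) : x = y :=
  Subtype.ext (funext h)

lemma face_eq_smap {n : ℕ} (i : Fin (n + 2)) : face i = smap i.succAbove := by
  ext1 x
  refine simplex_ext fun j => ?_
  rw [smap_apply]
  change Fin.insertNth (α := fun _ => ℝ) i 0 x.1 j = _
  refine Fin.succAboveCases i ?_ (fun j => ?_) j
  · rw [Fin.insertNth_apply_same, Finset.sum_eq_zero]
    intro l hl
    exact absurd (Finset.mem_filter.1 hl).2 (Fin.succAbove_ne i l)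
  · rw [Fin.insertNth_apply_succAbove, Finset.sum_eq_single j]
    · rfl
    · intro b hb hbj
      exact absurd (Fin.succAbove_right_injective (Finset.mem_filter.1 hb).2) hbj
    · intro h; simp at h

/-- The affine map from a simplex to a prism induced by a map of vertices. -/
def paff {l k : ℕ} (a : Fin (l + 1) → Fin (k + 1) × Bool) : C(Δ l, I × Δ k) where
  toFun x := (⟨(stdSimplex.map (Prod.snd ∘ a) x : stdSimplex ℝ Bool) true,
    stdSimplex.zero_le _ _, stdSimplex.le_one _ _⟩, smap (Prod.fst ∘ a) x)
  continuous_toFun := by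
    refine Continuous.prodMk (Continuous.subtype_mk ?_ _) (smap (Prod.fst ∘ a)).continuous
    have h := (continuous_apply true).comp
      (continuous_subtype_val.comp (stdSimplex.continuous_map (S := ℝ) (Prod.snd ∘ a)))
    exact h

lemma paff_smap {l k m : ℕ} (a : Fin (k + 1) → Fin (m + 1) × Bool) (b : Fin (l + 1) → Fin (k + 1)) :
    (paff a).comp (smap b) = paff (a ∘ b) := by
  ext1 x
  refine Prod.ext (Subtype.ext ?_) ?_
  · change (stdSimplex.map (Prod.snd ∘ a) (stdSimplex.map b x) : stdSimplex ℝ Bool) true = _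
    rw [stdSimplex.map_comp_apply]; rfl
  · exact smap_smap _ _ _

lemma paff_const {k : ℕ} (β : Bool) (x : Δ k) :
    paff (fun i : Fin (k + 1) => (i, β)) x = (if β then 1 else 0, x) := by
  refine Prod.ext (Subtype.ext ?_) ?_
  · change (stdSimplex.map (fun _ : Fin (k + 1) => β) x : stdSimplex ℝ Bool) true = _
    have := x.2.2
    rw [show ((stdSimplex.map (fun _ : Fin (k + 1) => β) x : stdSimplex ℝ Bool) true) =
      ∑ i : Fin (k + 1) with β = true, x i by
        rw [stdSimplex.map_coe, FunOnFinite.linearMap_apply_apply]]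
    cases β
    · simp
    · simp
  · change smap id x = x
    simp

lemma paff_prodMap {l k m : ℕ} (φ : Fin (k + 1) → Fin (m + 1)) (a : Fin (l + 1) → Fin (k + 1) × Bool)
    (x : Δ l) : paff (Prod.map φ id ∘ a) x = ((paff a x).1, smap φ (paff a x).2) := by
  refine Prod.ext (Subtype.ext ?_) ?_
  · rfl
  · exact (smap_smap _ _ _).symm

/-! ### Labelled cochains and homotopy systems -/

variable {X : Type} [TopologicalSpace X] {L : Type}

/-- Cochains on singular simplices with labelled vertices. -/
abbrev LCo (X : Type) [TopologicalSpace X] (L : Type) (k : ℕ) :=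
  SSimplex X k → (Fin (k + 1) → L) → ℝ

/-- The coboundary of labelled cochains. -/
def lcob {k : ℕ} (f : LCo X L k) : LCo X L (k + 1) := fun σ l =>
  ∑ i : Fin (k + 2), (-1 : ℝ) ^ (i : ℕ) * f (faceOf σ i) (l ∘ i.succAbove)

/-- A compatible family of homotopies of all labelled simplices. -/
structure IsSystem (H : ∀ k, SSimplex X k → (Fin (k + 1) → L) → C(I × Δ k, X)) : Prop where
  start : ∀ k σ l x, H k σ l (0, x) = σ x
  face : ∀ k σ l (i : Fin (k + 2)) t x,
    H k (faceOf σ i) (l ∘ i.succAbove) (t, x) = H (k + 1) σ l (t, BddCoh.face i x)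

/-- The end of a homotopy. -/
def hend {Y : Type*} [TopologicalSpace Y] (h : C(I × Y, X)) : C(Y, X) :=
  h.comp ⟨fun x => (1, x), by fun_prop⟩

/-- The difference of top and bottom of a prism. -/
def prismW (V : Type*) (k : ℕ) : TChain V k →ₗ[ℝ] TChain (V × Bool) k :=
  tmap (fun x => (x, true)) k - tmap (fun x => (x, false)) k

/-- The prism decomposition. -/
def prismChain (k : ℕ) : TChain (Fin (k + 1) × Bool) (k + 1) :=
  coneHtpy (fun x => (x, false)) (prismW (Fin (k + 1))) k (Finsupp.single id 1)

/-- The prism operator of a homotopy system. -/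
def prismOp (H : ∀ k, SSimplex X k → (Fin (k + 1) → L) → C(I × Δ k, X)) {k : ℕ}
    (f : LCo X L (k + 1)) : LCo X L k := fun σ l =>
  tpair (fun a : Fin (k + 2) → Fin (k + 1) × Bool =>
    f ((H k σ l).comp (paff a)) (l ∘ Prod.fst ∘ a)) (prismChain k)

lemma prismW_aug {V : Type*} (a : Fin 1 → V) :
    Finsupp.linearCombination ℝ (fun _ => (1 : ℝ)) (prismW V 0 (Finsupp.single a 1)) = 0 := by
  simp [prismW]

lemma prismW_chain {V : Type*} (k : ℕ) (c : TChain V (k + 1)) :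
    tbdry (V × Bool) k (prismW V (k + 1) c) = prismW V k (tbdry V k c) := by
  simp [prismW, tbdry_tmap]

lemma tmap_tmap {V V' V'' : Type*} (φ : V → V') (ψ : V' → V'') {k : ℕ} (c : TChain V k) :
    tmap ψ k (tmap φ k c) = tmap (ψ ∘ φ) k c := by
  suffices h : (tmap ψ k).comp (tmap φ k) = tmap (ψ ∘ φ) k from LinearMap.congr_fun h c
  refine Finsupp.lhom_ext fun a r => ?_
  simp [Function.comp_assoc]

/-- The homotopy formula for a homotopy system. -/
theorem IsSystem.homotopy {H : ∀ k, SSimplex X k → (Fin (k + 1) → L) → C(I × Δ k, X)}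
    (hH : IsSystem H) {k : ℕ} (f : LCo X L (k + 1)) (σ : SSimplex X (k + 1))
    (l : Fin (k + 2) → L) :
    f (hend (H (k + 1) σ l)) l - f σ l =
      lcob (prismOp H f) σ l + prismOp H (lcob f) σ l := by
  set g : (Fin (k + 2) → Fin (k + 2) × Bool) → ℝ := fun a =>
    f ((H (k + 1) σ l).comp (paff a)) (l ∘ Prod.fst ∘ a) with hg
  have hmain := congrArg (tpair g) (tbdry_coneHtpy (fun x : Fin (k + 2) => (x, false))
    (prismW (Fin (k + 2))) prismW_aug prismW_chain k (Finsupp.single id 1))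
  rw [tpair_tbdry, map_sub] at hmain
  have h1 : tpair (fun a : Fin (k + 3) → Fin (k + 2) × Bool =>
      ∑ i : Fin (k + 3), (-1 : ℝ) ^ (i : ℕ) * g (a ∘ i.succAbove))
      (coneHtpy (fun x => (x, false)) (prismW (Fin (k + 2))) (k + 1) (Finsupp.single id 1)) =
      prismOp H (lcob f) σ l := by
    rw [prismOp, prismChain]
    congr 2
    funext a
    refine Finset.sum_congr rfl fun i _ => ?_
    rw [hg]
    congr 2
    rw [faceOf, face_eq_smap, ContinuousMap.comp_assoc, paff_smap]
    rfl
  have h2 : tpair g (prismW (Fin (k + 2)) (k + 1) (Finsupp.single id 1)) =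
      f (hend (H (k + 1) σ l)) l - f σ l := by
    simp only [prismW, LinearMap.sub_apply, tmap_single, map_sub, tpair_single, one_mul, hg]
    congr 2
    · ext1 x
      change H (k + 1) σ l (paff (fun i : Fin (k + 2) => (i, true)) x) = _
      rw [paff_const]; rfl
    · ext1 x
      change H (k + 1) σ l (paff (fun i : Fin (k + 2) => (i, false)) x) = _
      rw [paff_const]
      exact hH.start _ _ _ _
  have h3 : tpair g (coneHtpy (fun x => (x, false)) (prismW (Fin (k + 2))) k
      (tbdry (Fin (k + 2)) k (Finsupp.single id 1))) = lcob (prismOp H f) σ l := by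
    simp only [tbdry_single, map_sum, Function.id_comp, one_mul, lcob]
    refine Finset.sum_congr rfl fun i _ => ?_
    have hs : (Finsupp.single i.succAbove ((-1 : ℝ) ^ (i : ℕ)) : TChain (Fin (k + 2)) k) =
        (-1 : ℝ) ^ (i : ℕ) • tmap i.succAbove k (Finsupp.single id 1) := by
      simp
    rw [hs, map_smul, map_smul, smul_eq_mul, ← coneHtpy_natural (fun x => (x, false))
      (fun x => (x, false)) (prismW (Fin (k + 1))) (prismW (Fin (k + 2))) i.succAbove
      (Prod.map i.succAbove id) (fun _ => rfl), tpair_tmap]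
    · rw [prismOp, prismChain]
      congr 3
      funext a
      change f _ _ = f _ _
      congr 1
      ext1 x
      change H (k + 1) σ l (paff (Prod.map i.succAbove id ∘ a) x) = H k _ _ (paff a x)
      rw [paff_prodMap, ← face_eq_smap, ← hH.face]
    · intro k' c
      simp only [prismW, LinearMap.sub_apply, map_sub, tmap_tmap]
      rfl
  rw [h1, h2, h3] at hmain
  linarith

lemma abs_prismOp_le (H : ∀ k, SSimplex X k → (Fin (k + 1) → L) → C(I × Δ k, X)) {k : ℕ}
    {f : LCo X L (k + 1)} {C : ℝ} (hf : ∀ σ l, |f σ l| ≤ C) (σ : SSimplex X k)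
    (l : Fin (k + 1) → L) : |prismOp H f σ l| ≤ tnorm (prismChain k) * C :=
  abs_tpair_le (fun _ => hf _ _) _

/-! ### Alternation -/

/-- Antisymmetrization of tuples. -/
def talt (V : Type*) (k : ℕ) : TChain V k →ₗ[ℝ] TChain V k :=
  Finsupp.linearCombination ℝ fun a => ((k + 1).factorial : ℝ)⁻¹ •
    ∑ π : Equiv.Perm (Fin (k + 1)), Finsupp.single (a ∘ π) ((Equiv.Perm.sign π : ℤ) : ℝ)

lemma talt_single {V : Type*} {k : ℕ} (a : Fin (k + 1) → V) :
    talt V k (Finsupp.single a 1) = ((k + 1).factorial : ℝ)⁻¹ •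
    ∑ π : Equiv.Perm (Fin (k + 1)), Finsupp.single (a ∘ π) ((Equiv.Perm.sign π : ℤ) : ℝ) := by
  simp [talt]

/-- The permutation sending `i` to `j` and inducing `π` on the complements. -/
def permInsert {k : ℕ} (i j : Fin (k + 1)) (π : Equiv.Perm (Fin k)) : Equiv.Perm (Fin (k + 1)) :=
  (j.cycleRange)⁻¹ * Equiv.Perm.decomposeFin.symm (0, π) * i.cycleRange

lemma permInsert_self {k : ℕ} (i j : Fin (k + 1)) (π : Equiv.Perm (Fin k)) :
    permInsert i j π i = j := by
  simp [permInsert, Equiv.Perm.inv_def]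

lemma permInsert_succAbove {k : ℕ} (i j : Fin (k + 1)) (π : Equiv.Perm (Fin k)) :
    permInsert i j π ∘ i.succAbove = j.succAbove ∘ π := by
  funext l
  simp [permInsert, Equiv.Perm.inv_def]

lemma sign_permInsert {k : ℕ} (i j : Fin (k + 1)) (π : Equiv.Perm (Fin k)) :
    ((Equiv.Perm.sign (permInsert i j π) : ℤ) : ℝ) =
      (-1) ^ (i : ℕ) * (-1) ^ (j : ℕ) * ((Equiv.Perm.sign π : ℤ) : ℝ) := by
  simp [permInsert, Equiv.Perm.decomposeFin.symm_sign, Fin.sign_cycleRange]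
  ring

lemma permInsert_bijective {k : ℕ} (i : Fin (k + 1)) :
    Function.Bijective (fun x : Fin (k + 1) × Equiv.Perm (Fin k) => permInsert i x.1 x.2) := by
  rw [Fintype.bijective_iff_injective_and_card]
  constructor
  · rintro ⟨j, π⟩ ⟨j', π'⟩ h
    have hj : j = j' := by
      rw [← permInsert_self i j π, ← permInsert_self i j' π']
      exact congrArg (fun e : Equiv.Perm (Fin (k + 1)) => e i) h
    subst hj
    have h2 : j.succAbove ∘ π = j.succAbove ∘ π' := by
      rw [← permInsert_succAbove i j π, ← permInsert_succAbove i j π']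
      exact congrArg (fun e : Equiv.Perm (Fin (k + 1)) => e ∘ i.succAbove) h
    refine Prod.ext rfl (Equiv.ext fun l => ?_)
    exact Fin.succAbove_right_injective (congrFun h2 l)
  · simp [Fintype.card_perm, Nat.factorial_succ]

lemma tbdry_talt {V : Type*} {k : ℕ} (c : TChain V (k + 1)) :
    tbdry V k (talt V (k + 1) c) = talt V k (tbdry V k c) := by
  suffices h : (tbdry V k).comp (talt V (k + 1)) = (talt V k).comp (tbdry V k) from
    LinearMap.congr_fun h c
  refine Finsupp.lhom_ext' fun a => LinearMap.ext_ring ?_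
  simp only [LinearMap.comp_apply, Finsupp.lsingle_apply, talt_single, map_smul, map_sum,
    tbdry_single, one_mul]
  rw [Finset.sum_comm]
  have h1 : ∀ i : Fin (k + 2), ∑ π : Equiv.Perm (Fin (k + 2)),
      (Finsupp.single ((a ∘ π) ∘ i.succAbove)
        (((Equiv.Perm.sign π : ℤ) : ℝ) * (-1) ^ (i : ℕ)) : TChain V k) =
      ∑ j : Fin (k + 2), ∑ π : Equiv.Perm (Fin (k + 1)),
        Finsupp.single (a ∘ j.succAbove ∘ π) ((-1) ^ (j : ℕ) * ((Equiv.Perm.sign π : ℤ) : ℝ)) := by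
    intro i
    rw [← (permInsert_bijective i).sum_comp, Fintype.sum_prod_type]
    refine Finset.sum_congr rfl fun j _ => Finset.sum_congr rfl fun π _ => ?_
    rw [Function.comp_assoc, permInsert_succAbove, sign_permInsert]
    congr 1
    have : ((-1 : ℝ) ^ (i : ℕ)) * (-1) ^ (i : ℕ) = 1 := by rw [← mul_pow]; simp
    linear_combination (-1) ^ (j : ℕ) * ((Equiv.Perm.sign π : ℤ) : ℝ) * this
  rw [Finset.sum_congr rfl fun i _ => h1 i, Finset.sum_const, Finset.card_univ, Fintype.card_fin]
  have h2 : ∀ j : Fin (k + 2), talt V k (Finsupp.single (a ∘ j.succAbove) ((-1 : ℝ) ^ (j : ℕ))) =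
      ((k + 1).factorial : ℝ)⁻¹ • ∑ π : Equiv.Perm (Fin (k + 1)),
        Finsupp.single (a ∘ j.succAbove ∘ π) ((-1) ^ (j : ℕ) * ((Equiv.Perm.sign π : ℤ) : ℝ)) := by
    intro j
    have : (Finsupp.single (a ∘ j.succAbove) ((-1 : ℝ) ^ (j : ℕ)) : TChain V k) =
      (-1 : ℝ) ^ (j : ℕ) • Finsupp.single (a ∘ j.succAbove) 1 := by simp
    rw [this, map_smul, talt_single, smul_comm, Finset.smul_sum]
    congr 1
    refine Finset.sum_congr rfl fun π _ => ?_
    rw [Finsupp.smul_single, Function.comp_assoc, smul_eq_mul]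
  rw [Finset.sum_congr rfl fun j _ => h2 j, ← Finset.smul_sum, ← Nat.cast_smul_eq_nsmul ℝ,
    smul_smul]
  congr 1
  rw [Nat.factorial_succ (k + 1)]
  have : ((k + 1).factorial : ℝ) ≠ 0 := by positivity
  push_cast
  field_simp
  ring

/-- Antisymmetrization of cochains. -/
def altCo {k : ℕ} (f : SCochain X k) : SCochain X k := fun σ =>
  ((k + 1).factorial : ℝ)⁻¹ * ∑ π : Equiv.Perm (Fin (k + 1)),
    ((Equiv.Perm.sign π : ℤ) : ℝ) * f (σ.comp (smap π))

/-- Alternating cochains. -/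
def IsAlt {k : ℕ} (f : SCochain X k) : Prop :=
  ∀ (σ : SSimplex X k) (π : Equiv.Perm (Fin (k + 1))),
    f (σ.comp (smap π)) = ((Equiv.Perm.sign π : ℤ) : ℝ) * f σ

lemma isAlt_altCo {k : ℕ} (f : SCochain X k) : IsAlt (altCo f) := by
  intro σ π
  simp only [altCo]
  rw [mul_left_comm]
  congr 1
  rw [Finset.mul_sum, ← Equiv.sum_comp (Equiv.mulLeft π⁻¹)]
  refine Finset.sum_congr rfl fun π' _ => ?_
  rw [ContinuousMap.comp_assoc, smap_comp]
  have : (π : Fin (k + 1) → Fin (k + 1)) ∘ ((Equiv.mulLeft π⁻¹) π') = π' := by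
    funext x; simp
  rw [this]
  simp [Equiv.Perm.sign_mul]
  ring

lemma abs_altCo_le {k : ℕ} {f : SCochain X k} {C : ℝ} (hf : ∀ σ, |f σ| ≤ C) (σ : SSimplex X k) :
    |altCo f σ| ≤ C := by
  have hpos : (0 : ℝ) < ((k + 1).factorial : ℝ) := by positivity
  rw [altCo, abs_mul, abs_inv, abs_of_pos hpos, inv_mul_le_iff₀ hpos]
  refine (Finset.abs_sum_le_sum_abs _ _).trans ?_
  refine (Finset.sum_le_card_nsmul _ _ C fun π _ => ?_).trans ?_
  · rw [abs_mul]
    have : |((Equiv.Perm.sign π : ℤ) : ℝ)| = 1 := by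
      rcases Int.units_eq_one_or (Equiv.Perm.sign π) with h | h <;> simp [h]
    rw [this, one_mul]; exact hf _
  · simp [Fintype.card_perm]

/-- The homotopy chain between antisymmetrization and the identity. -/
def altChain (k : ℕ) : TChain (Fin (k + 1)) (k + 1) :=
  coneHtpy id (fun k => talt (Fin _) k - LinearMap.id) k (Finsupp.single id 1)

/-- The homotopy operator between antisymmetrization and the identity. -/
def altOp {k : ℕ} (f : SCochain X (k + 1)) : SCochain X k := fun σ =>
  tpair (fun a : Fin (k + 2) → Fin (k + 1) => f (σ.comp (smap a))) (altChain k)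

lemma tmap_talt {V V' : Type*} (φ : V → V') {k : ℕ} (c : TChain V k) :
    tmap φ k (talt V k c) = talt V' k (tmap φ k c) := by
  suffices h : (tmap φ k).comp (talt V k) = (talt V' k).comp (tmap φ k) from
    LinearMap.congr_fun h c
  refine Finsupp.lhom_ext' fun a => LinearMap.ext_ring ?_
  simp [talt_single, Function.comp_assoc]

theorem altCo_sub {k : ℕ} (f : SCochain X (k + 1)) :
    altCo f - f = scob X k (altOp f) + altOp (scob X (k + 1) f) := by
  funext σ
  set W : ∀ k' : ℕ, TChain (Fin (k + 2)) k' →ₗ[ℝ] TChain (Fin (k + 2)) k' :=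
    fun k' => talt (Fin (k + 2)) k' - LinearMap.id with hW
  set g : (Fin (k + 2) → Fin (k + 2)) → ℝ := fun a => f (σ.comp (smap a)) with hg
  have hmain := congrArg (tpair g) (tbdry_coneHtpy id W
    (by
      intro a
      simp [hW, talt_single])
    (by intro k' c; simp [hW, tbdry_talt]) k (Finsupp.single id 1))
  rw [tpair_tbdry, map_sub] at hmain
  have h1 : tpair (fun a : Fin (k + 3) → Fin (k + 2) =>
      ∑ i : Fin (k + 3), (-1 : ℝ) ^ (i : ℕ) * g (a ∘ i.succAbove))
      (coneHtpy id W (k + 1) (Finsupp.single id 1)) = altOp (scob X (k + 1) f) σ := by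
    rw [altOp, altChain]
    congr 2
    funext a
    refine Finset.sum_congr rfl fun i _ => ?_
    rw [hg, faceOf, face_eq_smap, ContinuousMap.comp_assoc, smap_comp]
  have h2 : tpair g (W (k + 1) (Finsupp.single id 1)) = altCo f σ - f σ := by
    simp only [hW, LinearMap.sub_apply, LinearMap.id_apply, map_sub, talt_single, map_smul,
      map_sum, tpair_single, one_mul, hg, altCo, smul_eq_mul, smap_id, ContinuousMap.comp_id]
    rfl
  have h3 : tpair g (coneHtpy id W k (tbdry (Fin (k + 2)) k (Finsupp.single id 1))) =
      scob X k (altOp f) σ := by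
    simp only [tbdry_single, map_sum, Function.id_comp, one_mul]
    refine Finset.sum_congr rfl fun i _ => ?_
    have hs : (Finsupp.single i.succAbove ((-1 : ℝ) ^ (i : ℕ)) : TChain (Fin (k + 2)) k) =
        (-1 : ℝ) ^ (i : ℕ) • tmap i.succAbove k (Finsupp.single id 1) := by
      simp
    rw [hs, map_smul, map_smul, smul_eq_mul, ← coneHtpy_natural id id
      (fun k' => talt (Fin (k + 1)) k' - LinearMap.id) W i.succAbove i.succAbove
      (fun _ => rfl), tpair_tmap]
    · rw [altOp, altChain]
      congr 3
      funext a
      rw [hg, faceOf, face_eq_smap, ContinuousMap.comp_assoc, smap_comp]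
    · intro k' c
      simp [hW, tmap_talt]
  rw [h1, h2, h3] at hmain
  simp only [Pi.sub_apply, Pi.add_apply]
  linarith

lemma abs_altOp_le {k : ℕ} {f : SCochain X (k + 1)} {C : ℝ} (hf : ∀ σ, |f σ| ≤ C)
    (σ : SSimplex X k) : |altOp f σ| ≤ tnorm (altChain k) * C :=
  abs_tpair_le (fun _ => hf _) _

lemma scob_scob (k : ℕ) (f : SCochain X k) : scob X (k + 1) (scob X k f) = 0 := by
  funext σ
  change ∑ i : Fin (k + 3), (-1 : ℝ) ^ (i : ℕ) *
    ∑ j : Fin (k + 2), (-1 : ℝ) ^ (j : ℕ) * f (faceOf (faceOf σ i) j) = 0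
  rw [← sum_succAbove_succAbove (A := ℝ) (fun b => f (σ.comp (smap b)))]
  refine Finset.sum_congr rfl fun i _ => ?_
  rw [Finset.mul_sum]
  refine Finset.sum_congr rfl fun j _ => ?_
  rw [faceOf, faceOf, face_eq_smap, face_eq_smap, ContinuousMap.comp_assoc, smap_comp, smul_eq_mul,
    mul_assoc]

end BddCoh

end

noncomputable section
namespace BddCoh
open Filter Topology

/-! ### Means -/

/-- Bounded real functions. -/
def Bdd {G : Type*} (f : G → ℝ) : Prop := ∃ C, ∀ x, |f x| ≤ C

/-- `M` restricts to a mean on the bounded functions on `G`. -/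
structure IsMean {G : Type*} (M : (G → ℝ) → ℝ) : Prop where
  add : ∀ f g, Bdd f → Bdd g → M (fun x => f x + g x) = M f + M g
  smul : ∀ (c : ℝ) f, Bdd f → M (fun x => c * f x) = c * M f
  const : ∀ c : ℝ, M (fun _ => c) = c
  abs_le : ∀ f C, (∀ x, |f x| ≤ C) → |M f| ≤ C

section Bdd
variable {G : Type*} {f g : G → ℝ}

lemma Bdd.add (hf : Bdd f) (hg : Bdd g) : Bdd fun x => f x + g x := by
  obtain ⟨C, hC⟩ := hf
  obtain ⟨D, hD⟩ := hg
  exact ⟨C + D, fun x => (abs_add_le _ _).trans (add_le_add (hC x) (hD x))⟩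

lemma Bdd.smul (c : ℝ) (hf : Bdd f) : Bdd fun x => c * f x := by
  obtain ⟨C, hC⟩ := hf
  exact ⟨|c| * C, fun x => by rw [abs_mul]; exact mul_le_mul_of_nonneg_left (hC x) (abs_nonneg c)⟩

lemma Bdd.comp (hf : Bdd f) {H : Type*} (r : H → G) : Bdd fun x => f (r x) := by
  obtain ⟨C, hC⟩ := hf
  exact ⟨C, fun x => hC _⟩

lemma bdd_const (c : ℝ) : Bdd fun _ : G => c := ⟨|c|, fun _ => le_rfl⟩

lemma Bdd.sum {ι : Type*} (s : Finset ι) {F : ι → G → ℝ} (hF : ∀ i ∈ s, Bdd (F i)) :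
    Bdd fun x => ∑ i ∈ s, F i x := by
  classical
  induction s using Finset.induction_on with
  | empty => simpa using bdd_const 0
  | insert a s ha ih =>
    simp only [Finset.sum_insert ha]
    exact (hF a (Finset.mem_insert_self _ _)).add
      (ih fun i hi => hF i (Finset.mem_insert_of_mem hi))

end Bdd

namespace IsMean
variable {G : Type*} {M : (G → ℝ) → ℝ}

lemma sub (hM : IsMean M) {f g : G → ℝ} (hf : Bdd f) (hg : Bdd g) :
    M (fun x => f x - g x) = M f - M g := by
  have h := hM.add f (fun x => -1 * g x) hf (hg.smul (-1))
  rw [hM.smul (-1) g hg] at h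
  simpa [sub_eq_add_neg] using h

lemma sum (hM : IsMean M) {ι : Type*} (s : Finset ι) {F : ι → G → ℝ} (hF : ∀ i ∈ s, Bdd (F i)) :
    M (fun x => ∑ i ∈ s, F i x) = ∑ i ∈ s, M (F i) := by
  classical
  induction s using Finset.induction_on with
  | empty => simpa using hM.const 0
  | insert a s ha ih =>
    have h1 := hF a (Finset.mem_insert_self _ _)
    have h2 : ∀ i ∈ s, Bdd (F i) := fun i hi => hF i (Finset.mem_insert_of_mem hi)
    simp only [Finset.sum_insert ha]
    rw [hM.add _ _ h1 (Bdd.sum s h2), ih h2]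

/-- Averaging a family of means. -/
lemma bind {J : Type*} {N : (J → ℝ) → ℝ} (hN : IsMean N) {P : J → (G → ℝ) → ℝ}
    (hP : ∀ j, IsMean (P j)) : IsMean fun f : G → ℝ => N fun j => P j f := by
  have hb : ∀ f : G → ℝ, Bdd f → Bdd fun j => P j f := by
    rintro f ⟨C, hC⟩
    exact ⟨C, fun j => (hP j).abs_le f C hC⟩
  refine ⟨fun f g hf hg => ?_, fun c f hf => ?_, fun c => ?_, fun f C hC => ?_⟩
  · rw [← hN.add _ _ (hb f hf) (hb g hg)]
    congr 1; funext j; exact (hP j).add f g hf hg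
  · rw [← hN.smul c _ (hb f hf)]
    congr 1; funext j; exact (hP j).smul c f hf
  · rw [← hN.const c]
    congr 1; funext j; rw [(hP j).const, hN.const c]
  · exact hN.abs_le _ C fun j => (hP j).abs_le f C hC

lemma map (hM : IsMean M) {H : Type*} (r : G → H) : IsMean fun f : H → ℝ => M fun x => f (r x) :=
  ⟨fun _ _ hf hg => hM.add _ _ (hf.comp r) (hg.comp r), fun c _ hf => hM.smul c _ (hf.comp r),
    hM.const, fun _ C hC => hM.abs_le _ C fun _ => hC _⟩

end IsMean

/-- Evaluation at a point is a mean. -/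
lemma isMean_eval {G : Type*} (x : G) : IsMean fun f : G → ℝ => f x :=
  ⟨fun _ _ _ _ => rfl, fun _ _ _ => rfl, fun _ => rfl, fun _ _ h => h x⟩

/-- Limits along an ultrafilter. -/
def ulim {J : Type*} (u : Ultrafilter J) (f : J → ℝ) : ℝ := limUnder (u : Filter J) f

lemma tendsto_ulim {J : Type*} (u : Ultrafilter J) {f : J → ℝ} (hf : Bdd f) :
    Tendsto f u (𝓝 (ulim u f)) := by
  obtain ⟨C, hC⟩ := hf
  have hmem : ∀ j, f j ∈ Set.Icc (-C) C := fun j => abs_le.1 (hC j)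
  obtain ⟨x, -, hx⟩ := (isCompact_Icc (a := -C) (b := C)).ultrafilter_le_nhds (u.map f)
    (le_principal_iff.2 (Filter.mem_map.2 (Filter.univ_mem' hmem)))
  exact tendsto_nhds_limUnder ⟨x, hx⟩

lemma ulim_eq {J : Type*} (u : Ultrafilter J) {f : J → ℝ} {x : ℝ} (h : Tendsto f u (𝓝 x)) :
    ulim u f = x := h.limUnder_eq

lemma isMean_ulim {J : Type*} (u : Ultrafilter J) : IsMean (ulim u) := by
  refine ⟨fun f g hf hg => ?_, fun c f hf => ?_, fun c => ?_, fun f C hC => ?_⟩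
  · exact ulim_eq u ((tendsto_ulim u hf).add (tendsto_ulim u hg))
  · exact ulim_eq u ((tendsto_ulim u hf).const_mul c)
  · exact ulim_eq u tendsto_const_nhds
  · exact le_of_tendsto (tendsto_ulim u ⟨C, hC⟩).abs (Filter.Eventually.of_forall hC)

lemma ulim_congr {J : Type*} (u : Ultrafilter J) {f g : J → ℝ} (h : f =ᶠ[u] g) :
    ulim u f = ulim u g := by
  rw [ulim, ulim, limUnder, limUnder, Filter.map_congr h]

/-- The existence of a right invariant mean. -/
def HasInvMean (G : Type*) [Group G] : Prop :=
  ∃ M : (G → ℝ) → ℝ, IsMean M ∧ ∀ (g : G) (f : G → ℝ), Bdd f → M (fun x => f (x * g)) = M f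

/-! ### Means from finitely additive measures -/

section FinAdd
variable {G : Type*}

/-- The atoms of the finite field of sets generated by `S`. -/
def atomOf (S T : Finset (Set G)) : Set G := {x | ∀ A ∈ S, x ∈ A ↔ A ∈ T}

open Classical in
lemma measure_eq_sum_atoms {m : Set G → ℝ}
    (hadd : ∀ A B, Disjoint A B → m (A ∪ B) = m A + m B) (S : Finset (Set G)) :
    ∀ A : Set G, m A = ∑ T ∈ S.powerset, m (A ∩ atomOf S T) := by
  induction S using Finset.induction_on with
  | empty => intro A; simp [atomOf]
  | insert B S hB ih =>
    intro A
    rw [Finset.sum_powerset_insert hB, ← Finset.sum_add_distrib, ih A]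
    refine Finset.sum_congr rfl fun T hT => ?_
    have hBT : B ∉ T := fun h => hB (Finset.mem_powerset.1 hT h)
    have h1 : atomOf (insert B S) T = atomOf S T ∩ Bᶜ := by
      ext x
      simp only [atomOf, Set.mem_ofPred_eq, Finset.mem_insert, Set.mem_inter_iff, Set.mem_compl_iff]
      constructor
      · intro h
        exact ⟨fun A hA => h A (Or.inr hA), fun hx => hBT ((h B (Or.inl rfl)).1 hx)⟩
      · rintro ⟨h, hx⟩ A (rfl | hA)
        · exact ⟨fun h' => absurd h' hx, fun h' => absurd h' hBT⟩
        · exact h A hA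
    have h2 : atomOf (insert B S) (insert B T) = atomOf S T ∩ B := by
      ext x
      simp only [atomOf, Set.mem_ofPred_eq, Finset.mem_insert, Set.mem_inter_iff]
      constructor
      · intro h
        refine ⟨fun A hA => (h A (Or.inr hA)).trans ⟨?_, Or.inr⟩, (h B (Or.inl rfl)).2 (Or.inl rfl)⟩
        rintro (rfl | h')
        · exact absurd hA hB
        · exact h'
      · rintro ⟨h, hx⟩ A (rfl | hA)
        · exact ⟨fun _ => Or.inl rfl, fun _ => hx⟩
        · refine (h A hA).trans ⟨Or.inr, ?_⟩
          rintro (rfl | h')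
          · exact absurd hA hB
          · exact h'
    rw [h1, h2, ← hadd]
    · congr 1
      ext x
      simp only [Set.mem_inter_iff, Set.mem_union, Set.mem_compl_iff]
      tauto
    · rw [Set.disjoint_left]
      rintro x ⟨_, _, hx⟩ ⟨_, _, hx'⟩
      exact hx hx'

open Classical in
/-- A finitely additive probability measure extends to a mean. -/
theorem exists_mean_of_measure [Nonempty G] {m : Set G → ℝ} (h0 : ∀ A, 0 ≤ m A)
    (h1 : m Set.univ = 1) (hadd : ∀ A B, Disjoint A B → m (A ∪ B) = m A + m B) :
    ∃ M : (G → ℝ) → ℝ, IsMean M ∧ ∀ A : Set G, M (A.indicator fun _ => 1) = m A := by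
  let pt : Finset (Set G) → Finset (Set G) → G := fun S T =>
    if h : (atomOf S T).Nonempty then h.some else Classical.arbitrary G
  have hpt : ∀ S T, (atomOf S T).Nonempty → pt S T ∈ atomOf S T := by
    intro S T h; simp only [pt, dif_pos h]; exact h.some_mem
  have hempty : m ∅ = 0 := by
    have := hadd ∅ ∅ (by simp)
    simp at this; exact this
  let J : Finset (Set G) → (G → ℝ) → ℝ := fun S f =>
    ∑ T ∈ S.powerset, m (atomOf S T) * f (pt S T)
  have hsum : ∀ S : Finset (Set G), ∑ T ∈ S.powerset, m (atomOf S T) = 1 := by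
    intro S
    have := measure_eq_sum_atoms hadd S Set.univ
    simpa [h1] using this.symm
  have hJ : ∀ S, IsMean (J S) := by
    intro S
    refine ⟨fun f g _ _ => ?_, fun c f _ => ?_, fun c => ?_, fun f C hC => ?_⟩
    · simp only [J, mul_add, Finset.sum_add_distrib]
    · simp only [J, Finset.mul_sum]
      refine Finset.sum_congr rfl fun T _ => by ring
    · simp only [J]; rw [← Finset.sum_mul, hsum, one_mul]
    · refine (Finset.abs_sum_le_sum_abs _ _).trans ?_
      rw [← one_mul C, ← hsum S, Finset.sum_mul]
      refine Finset.sum_le_sum fun T _ => ?_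
      rw [abs_mul, abs_of_nonneg (h0 _)]
      exact mul_le_mul_of_nonneg_left (hC _) (h0 _)
  let u : Ultrafilter (Finset (Set G)) := Ultrafilter.of atTop
  have hu : (u : Filter (Finset (Set G))) ≤ atTop := Ultrafilter.of_le _
  refine ⟨fun f => ulim u fun S => J S f, (isMean_ulim u).bind hJ, fun A => ?_⟩
  refine ulim_eq u (tendsto_const_nhds.congr' ?_)
  refine hu ((eventually_ge_atTop {A}).mono fun S hS => ?_)
  have hA : A ∈ S := hS (Finset.mem_singleton_self A)
  rw [measure_eq_sum_atoms hadd S A]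
  refine Finset.sum_congr rfl fun T _ => ?_
  by_cases hne : (atomOf S T).Nonempty
  · have hp := hpt S T hne
    by_cases hAT : A ∈ T
    · have : A ∩ atomOf S T = atomOf S T :=
        Set.inter_eq_right.2 fun x hx => (hx A hA).2 hAT
      rw [this, Set.indicator_of_mem ((hp A hA).2 hAT), mul_one]
    · have : A ∩ atomOf S T = ∅ := by
        ext x; simp only [Set.mem_inter_iff, Set.mem_empty_iff_false, iff_false, not_and]
        exact fun hx hx' => hAT ((hx' A hA).1 hx)
      rw [this, hempty, Set.indicator_of_notMem (fun h => hAT ((hp A hA).1 h)), mul_zero]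
  · rw [Set.not_nonempty_iff_eq_empty.1 hne]; simp [hempty]

/-- Two means agreeing on indicator functions along a map agree. -/
lemma IsMean.eq_of_indicator {M N : (G → ℝ) → ℝ} (hM : IsMean M) (hN : IsMean N)
    (h : ∀ A : Set G, M (A.indicator fun _ => 1) = N (A.indicator fun _ => 1))
    {f : G → ℝ} (hf : Bdd f) : M f = N f := by
  obtain ⟨C, hC⟩ := id hf
  by_contra hne
  set ε : ℝ := |M f - N f| / 3 with hε
  have hε0 : 0 < ε := by
    have := abs_pos.2 (sub_ne_zero.2 hne); positivity
  let c : G → ℤ := fun x => ⌊f x / ε⌋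
  obtain ⟨n, hn⟩ := exists_nat_gt (C / ε + 1)
  have hcmem : ∀ x, c x ∈ Finset.Icc (-(n : ℤ)) n := by
    intro x
    have h1 := _root_.abs_le.1 (hC x)
    have h2 : -(C / ε) ≤ f x / ε := by
      rw [← neg_div]; exact div_le_div_of_nonneg_right h1.1 hε0.le
    have h3 : f x / ε ≤ C / ε := div_le_div_of_nonneg_right h1.2 hε0.le
    rw [Finset.mem_Icc]
    constructor
    · rw [Int.le_floor]; push_cast; linarith
    · have := Int.floor_le (f x / ε)
      have h4 : ((c x : ℤ) : ℝ) ≤ (n : ℝ) := by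
        have : ((c x : ℤ) : ℝ) ≤ f x / ε := this
        linarith
      exact_mod_cast h4
  have hbi : ∀ i : ℤ, Bdd ((c ⁻¹' {i}).indicator fun _ => (1 : ℝ)) := fun i =>
    ⟨1, fun x => by by_cases hx : x ∈ c ⁻¹' {i} <;> simp [Set.indicator, hx]⟩
  let fe : G → ℝ := fun x => ∑ i ∈ Finset.Icc (-(n : ℤ)) n,
    ((i : ℝ) * ε) * (c ⁻¹' {i}).indicator (fun _ => (1 : ℝ)) x
  have hfe : ∀ x, fe x = (c x : ℝ) * ε := by
    intro x
    simp only [fe]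
    rw [Finset.sum_eq_single (c x)]
    · simp
    · intro i _ hi
      rw [Set.indicator_of_notMem (by simpa using fun h => hi h.symm), mul_zero]
    · intro h; exact absurd (hcmem x) h
  have hbfe : Bdd fe := Bdd.sum _ fun i _ => (hbi i).smul _
  have hMN : M fe = N fe := by
    rw [hM.sum _ fun i _ => (hbi i).smul _, hN.sum _ fun i _ => (hbi i).smul _]
    refine Finset.sum_congr rfl fun i _ => ?_
    rw [hM.smul _ _ (hbi i), hN.smul _ _ (hbi i), h]
  have hclose : ∀ x, |f x - fe x| ≤ ε := by
    intro x
    rw [hfe]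
    have h1 := Int.floor_le (f x / ε)
    have h2 := Int.lt_floor_add_one (f x / ε)
    rw [le_div_iff₀ hε0] at h1
    rw [div_lt_iff₀ hε0] at h2
    rw [_root_.abs_le]; constructor <;> nlinarith
  have e1 := hM.abs_le _ _ hclose
  have e2 := hN.abs_le _ _ hclose
  rw [hM.sub hf hbfe] at e1
  rw [hN.sub hf hbfe] at e2
  have e3 : |M f - N f| ≤ ε + ε := by
    have : M f - N f = (M f - M fe) - (N f - N fe) := by rw [hMN]; ring
    rw [this]
    exact (abs_sub _ _).trans (add_le_add e1 e2)
  have : |M f - N f| = 3 * ε := by rw [hε]; ring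
  linarith

theorem IsAmenable.hasInvMean {G : Type*} [Group G] (h : IsAmenable G) : HasInvMean G := by
  obtain ⟨m, h0, h1, hadd, hinv⟩ := h
  obtain ⟨M, hM, hMm⟩ := exists_mean_of_measure h0 h1 hadd
  refine ⟨fun f => M fun x => f x⁻¹, hM.map _, fun g f hf => ?_⟩
  have key : ∀ f : G → ℝ, Bdd f → M (fun x => f (g⁻¹ * x)) = M f := by
    intro f hf
    refine (hM.map (fun x => g⁻¹ * x)).eq_of_indicator hM (fun A => ?_) hf
    have : (fun x => A.indicator (fun _ => (1 : ℝ)) (g⁻¹ * x)) =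
        ((g * ·) '' A).indicator fun _ => 1 := by
      funext x
      by_cases hx : g⁻¹ * x ∈ A
      · rw [Set.indicator_of_mem hx, Set.indicator_of_mem]
        exact ⟨_, hx, by simp⟩
      · rw [Set.indicator_of_notMem hx, Set.indicator_of_notMem]
        rintro ⟨y, hy, rfl⟩
        exact hx (by simpa using hy)
    rw [this, hMm, hMm, hinv]
  have := key (fun x => f x⁻¹) (hf.comp _)
  change M (fun x => f (x⁻¹ * g)) = M (fun x => f x⁻¹)
  rw [← this]
  congr 1; funext x; simp

end FinAdd

lemma HasInvMean.of_surjective {G H : Type*} [Group G] [Group H] (φ : G →* H)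
    (hφ : Function.Surjective φ) (hG : HasInvMean G) : HasInvMean H := by
  obtain ⟨M, hM, hinv⟩ := hG
  refine ⟨fun f => M fun x => f (φ x), hM.map _, fun h f hf => ?_⟩
  obtain ⟨g, rfl⟩ := hφ h
  change M (fun x => f (φ x * φ g)) = M fun x => f (φ x)
  rw [← hinv g (fun x => f (φ x)) (hf.comp _)]
  simp

/-! ### Averaging nets -/

/-- Iterated averaging over a list of indices. -/
def iterAvg {U : Type*} {Λ : Type*} (E : Λ → (U → ℝ) → (U → ℝ)) :
    List Λ → (U → ℝ) → (U → ℝ)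
  | [] => id
  | a :: L => fun F => E a (iterAvg E L F)

/-- Means on `U` obtained by successively averaging along a family of parametrized self maps. -/
theorem exists_mean_of_averages {U : Type*} (u₀ : U) {Λ : Type*} {T : Λ → Type*}
    (N : ∀ a, (T a → ℝ) → ℝ) (hN : ∀ a, IsMean (N a)) (act : ∀ a, T a → U → U)
    {ρ : Type*} (idx : ρ → Λ) (r : ρ → U → U)
    (hsame : ∀ i F, Bdd F → ∀ u, N (idx i) (fun x => F (r i (act (idx i) x u))) =
      N (idx i) (fun x => F (act (idx i) x u)))
    (hcomm : ∀ i a, a ≠ idx i → ∀ x u, r i (act a x u) = act a x (r i u)) :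
    ∃ M : (U → ℝ) → ℝ, IsMean M ∧ ∀ i F, Bdd F → M (fun u => F (r i u)) = M F := by
  classical
  let E : Λ → (U → ℝ) → (U → ℝ) := fun a F u => N a fun x => F (act a x u)
  have hE : ∀ (L : List Λ) (u : U), IsMean fun F => iterAvg E L F u := by
    intro L
    induction L with
    | nil => intro u; exact isMean_eval u
    | cons a L ih => intro u; exact (hN a).bind fun x => ih (act a x u)
  have hbd : ∀ (L : List Λ) F, Bdd F → Bdd (iterAvg E L F) := by
    rintro L F ⟨C, hC⟩
    exact ⟨C, fun u => (hE L u).abs_le F C hC⟩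
  have hinv : ∀ (L : List Λ) i F, Bdd F →
      (iterAvg E L (fun u => F (r i u)) = iterAvg E L F ∧ idx i ∈ L) ∨
      (iterAvg E L (fun u => F (r i u)) = (fun u => iterAvg E L F (r i u)) ∧ idx i ∉ L) := by
    intro L
    induction L with
    | nil => intro i F _; exact Or.inr ⟨rfl, by simp⟩
    | cons a L ih =>
      intro i F hF
      rcases ih i F hF with ⟨h1, h2⟩ | ⟨h1, h2⟩
      · left
        refine ⟨?_, List.mem_cons_of_mem _ h2⟩
        simp only [iterAvg, h1]
      · by_cases ha : a = idx i
        · left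
          subst ha
          refine ⟨?_, List.mem_cons_self⟩
          simp only [iterAvg, h1]
          funext u
          exact hsame i _ (hbd L F hF) u
        · right
          refine ⟨?_, by simp [h2, Ne.symm ha]⟩
          simp only [iterAvg, h1]
          funext u
          simp only [E]
          congr 1
          funext x
          rw [hcomm i a ha]
  let v : Ultrafilter (Finset Λ) := Ultrafilter.of atTop
  have hv : (v : Filter (Finset Λ)) ≤ atTop := Ultrafilter.of_le _
  refine ⟨fun F => ulim v fun A => iterAvg E A.toList F u₀,
    (isMean_ulim v).bind fun A => hE A.toList u₀, fun i F hF => ?_⟩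
  refine ulim_congr v (hv ((eventually_ge_atTop {idx i}).mono fun A hA => ?_))
  have hi : idx i ∈ A := hA (Finset.mem_singleton_self _)
  rcases hinv A.toList i F hF with ⟨h1, _⟩ | ⟨_, h2⟩
  · exact congrFun h1 u₀
  · exact absurd (Finset.mem_toList.2 hi) h2

/-- A mean on a product of groups with invariant means, invariant under finitely supported
translations. -/
theorem exists_product_mean {Λ : Type*} (G : Λ → Type*) [∀ a, Group (G a)]
    (hG : ∀ a, HasInvMean (G a)) :
    ∃ M : ((∀ a, G a) → ℝ) → ℝ, IsMean M ∧ ∀ (s : Finset Λ) (g : ∀ a, G a),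
      (∀ a ∉ s, g a = 1) → ∀ F, Bdd F → M (fun u => F (u * g)) = M F := by
  classical
  choose N hN hinv using hG
  obtain ⟨M, hM, h⟩ := exists_mean_of_averages (U := ∀ a, G a) 1 N hN
    (fun a x u => Function.update u a x) (ρ := Σ a, G a) Sigma.fst
    (fun i u => Function.update u i.1 (u i.1 * i.2))
    (by
      rintro ⟨a, g⟩ F hF u
      simp only [Function.update_self, Function.update_idem]
      exact hinv a g (fun x => F (Function.update u a x)) (hF.comp _))
    (by
      rintro ⟨a, g⟩ b hb x u
      simp only
      rw [Function.update_of_ne (Ne.symm hb), Function.update_comm hb])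
  refine ⟨M, hM, fun s => ?_⟩
  induction s using Finset.induction_on with
  | empty =>
    intro g hg F _
    have : g = 1 := funext fun a => hg a (by simp)
    simp [this]
  | insert b s hb ih =>
    intro g hg F hF
    have h1 := ih (Function.update g b 1) (by
      intro a ha
      by_cases hab : a = b
      · subst hab; simp
      · rw [Function.update_of_ne hab]; exact hg a (by simp [hab, ha])) F hF
    rw [← h1, ← h ⟨b, g b⟩ (fun u => F (u * Function.update g b 1)) (hF.comp _)]
    congr 1
    funext u
    congr 1
    funext a
    by_cases hab : a = b
    · subst hab; simp
    · simp [Function.update_of_ne hab]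

/-- A shift invariant mean on `ℕ`. -/
lemma exists_shift_mean : ∃ M : (ℕ → ℝ) → ℝ, IsMean M ∧
    ∀ F, Bdd F → M (fun n => F (n + 1)) = M F := by
  let v : Ultrafilter ℕ := Ultrafilter.of atTop
  have hv : (v : Filter ℕ) ≤ atTop := Ultrafilter.of_le _
  let P : ℕ → (ℕ → ℝ) → ℝ := fun n F => ((n : ℝ) + 1)⁻¹ * ∑ i ∈ Finset.range (n + 1), F i
  have hP : ∀ n, IsMean (P n) := by
    intro n
    have hn : (0 : ℝ) < (n : ℝ) + 1 := by positivity
    refine ⟨fun f g _ _ => ?_, fun c f _ => ?_, fun c => ?_, fun f C hC => ?_⟩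
    · simp only [P, Finset.sum_add_distrib, mul_add]
    · simp only [P, ← Finset.mul_sum]; ring
    · simp only [P, Finset.sum_const, Finset.card_range, nsmul_eq_mul]
      push_cast; field_simp
    · simp only [P]
      rw [abs_mul, abs_inv, abs_of_pos hn, inv_mul_le_iff₀ hn]
      refine (Finset.abs_sum_le_sum_abs _ _).trans ?_
      refine (Finset.sum_le_card_nsmul _ _ C fun i _ => hC i).trans ?_
      simp
  refine ⟨fun F => ulim v fun n => P n F, (isMean_ulim v).bind hP, fun F hF => ?_⟩
  obtain ⟨C, hC⟩ := id hF
  have hb : ∀ F, Bdd F → Bdd fun n => P n F := by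
    rintro F ⟨C, hC⟩; exact ⟨C, fun n => (hP n).abs_le F C hC⟩
  rw [← sub_eq_zero, ← (isMean_ulim v).sub (hb _ (hF.comp _)) (hb F hF)]
  refine ulim_eq v ?_
  refine Tendsto.mono_left ?_ hv
  have hdiff : ∀ n, P n (fun n => F (n + 1)) - P n F = ((n : ℝ) + 1)⁻¹ * (F (n + 1) - F 0) := by
    intro n
    simp only [P, ← mul_sub]
    congr 1
    rw [← Finset.sum_sub_distrib, Finset.sum_range_sub]
  refine squeeze_zero_norm (a := fun n : ℕ => ((n : ℝ) + 1)⁻¹ * (C + C)) (fun n => ?_) ?_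
  · rw [hdiff, Real.norm_eq_abs, abs_mul, abs_inv, abs_of_pos (by positivity : (0 : ℝ) < (n : ℝ) + 1)]
    refine mul_le_mul_of_nonneg_left ?_ (by positivity)
    exact (abs_sub _ _).trans (add_le_add (hC _) (hC _))
  · have := (tendsto_one_div_add_atTop_nhds_zero_nat (𝕜 := ℝ)).mul_const (C + C)
    simpa using this

/-- Groups in which any two elements commute have invariant means. -/
theorem hasInvMean_of_comm {G : Type*} [Group G] (hc : ∀ a b : G, a * b = b * a) :
    HasInvMean G := by
  obtain ⟨N, hN, hinv⟩ := exists_shift_mean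
  obtain ⟨M, hM, h⟩ := exists_mean_of_averages (U := G) 1 (T := fun _ : G => ℕ) (fun _ => N)
    (fun _ => hN) (fun a n u => u * a ^ n) (ρ := G) id (fun g u => u * g)
    (by
      intro g F hF u
      simp only [id, mul_assoc, ← pow_succ]
      exact hinv (fun n => F (u * g ^ n)) (hF.comp _))
    (by
      intro g a _ n u
      simp only [mul_assoc]
      rw [hc (a ^ n) g])
  exact ⟨M, hM, fun g F hF => h g F hF⟩

end BddCoh

end

noncomputable section
namespace BddCoh
local notation "I" => unitInterval

/-! ### Extending maps from facets -/

/-- A finite family of maps agreeing on overlaps of closed sets extends along a retraction. -/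
lemma exists_extension_of_retraction {T Z J : Type*} [TopologicalSpace T] [TopologicalSpace Z]
    [Finite J] (F : J → Set T) (hF : ∀ j, IsClosed (F j)) (r : T → T) (hr : Continuous r)
    (hrF : ∀ t, ∃ j, r t ∈ F j) (hid : ∀ j, ∀ t ∈ F j, r t = t) (g : J → C(T, Z))
    (hg : ∀ i j t, t ∈ F i → t ∈ F j → g i t = g j t) :
    ∃ G : C(T, Z), ∀ j, ∀ t ∈ F j, G t = g j t := by
  choose c hc using hrF
  have key : ∀ j t, r t ∈ F j → g (c t) (r t) = g j (r t) := fun j t h => hg _ _ _ (hc t) h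
  refine ⟨⟨fun t => g (c t) (r t), ?_⟩, fun j t ht => ?_⟩
  · rw [continuous_iff_isClosed]
    intro s hs
    have : (fun t => g (c t) (r t)) ⁻¹' s = ⋃ j, (r ⁻¹' F j ∩ (fun t => g j (r t)) ⁻¹' s) := by
      ext t
      simp only [Set.mem_preimage, Set.mem_iUnion, Set.mem_inter_iff]
      constructor
      · intro h; exact ⟨c t, hc t, h⟩
      · rintro ⟨j, h1, h2⟩; rw [key j t h1]; exact h2
    rw [this]
    exact isClosed_iUnion_of_finite fun j => ((hF j).preimage hr).inter
      (hs.preimage ((g j).continuous.comp hr))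
  · have := hid j t ht
    change g (c t) (r t) = _
    rw [key j t (by rw [this]; exact ht), this]

/-- Radial projection of a polytope, seen from an outer point `c`, onto the union of facets
`{L j = 0}`. -/
lemma exists_extension_of_facets {T Z J V : Type*} [TopologicalSpace T] [TopologicalSpace Z]
    [Finite J] [Nonempty J] [AddCommGroup V] [Module ℝ V] [TopologicalSpace V]
    [IsTopologicalAddGroup V] [ContinuousSMul ℝ V]
    (e : T → V) (he : Topology.IsEmbedding e) (c : V) (L : J → V → ℝ)
    (hLc : ∀ j, Continuous (L j))
    (hL : ∀ j v s, L j (c + s • (v - c)) = L j c + s * (L j v - L j c))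
    (hc : ∀ j, 0 < L j c) (hpos : ∀ j t, 0 ≤ L j (e t)) (hlt : ∀ t, ∃ j, L j (e t) < L j c)
    (hran : ∀ t (s : ℝ), 1 ≤ s → (∀ j, 0 ≤ L j (c + s • (e t - c))) →
      ∃ t', e t' = c + s • (e t - c))
    (g : J → C(T, Z))
    (hg : ∀ i j t, L i (e t) = 0 → L j (e t) = 0 → g i t = g j t) :
    ∃ G : C(T, Z), ∀ j t, L j (e t) = 0 → G t = g j t := by
  classical
  have := Fintype.ofFinite J
  let m : J → T → ℝ := fun j t => 1 - L j (e t) / L j c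
  let μ : T → ℝ := fun t => Finset.univ.sup' Finset.univ_nonempty fun j => m j t
  have hμm : ∀ j t, m j t ≤ μ t := fun j t =>
    Finset.le_sup' (f := fun j => m j t) (Finset.mem_univ j)
  have hμ0 : ∀ t, 0 < μ t := by
    intro t
    obtain ⟨j, hj⟩ := hlt t
    refine lt_of_lt_of_le ?_ (hμm j t)
    simp only [m]
    rw [sub_pos, div_lt_one (hc j)]
    exact hj
  have hμ1 : ∀ t, μ t ≤ 1 := by
    intro t
    refine Finset.sup'_le _ _ fun j _ => ?_
    simp only [m]
    have := div_nonneg (hpos j t) (hc j).le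
    linarith
  have hμc : Continuous μ := by
    refine Continuous.finset_sup'_apply _ fun j _ => ?_
    exact continuous_const.sub (((hLc j).comp he.continuous).div_const _)
  have hval : ∀ t j, L j (c + (μ t)⁻¹ • (e t - c)) = L j c * (1 - m j t / μ t) := by
    intro t j
    rw [hL]
    have h1 := (hμ0 t).ne'
    have h2 := (hc j).ne'
    simp only [m]
    field_simp
    ring
  have hr0 : ∀ t, ∃ t', e t' = c + (μ t)⁻¹ • (e t - c) := by
    intro t
    refine hran t _ ((one_le_inv₀ (hμ0 t)).2 (hμ1 t)) fun j => ?_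
    rw [hval]
    refine mul_nonneg (hc j).le (sub_nonneg.2 ?_)
    rw [div_le_one (hμ0 t)]
    exact hμm j t
  choose r hr using hr0
  have hrc : Continuous r := by
    rw [he.continuous_iff]
    have : e ∘ r = fun t => c + (μ t)⁻¹ • (e t - c) := funext hr
    rw [this]
    exact continuous_const.add ((hμc.inv₀ fun t => (hμ0 t).ne').smul
      (he.continuous.sub continuous_const))
  obtain ⟨G, hG⟩ := exists_extension_of_retraction (fun j => {t | L j (e t) = 0})
    (fun j => isClosed_eq ((hLc j).comp he.continuous) continuous_const) r hrc
    (by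
      intro t
      obtain ⟨j, -, hj⟩ := Finset.exists_mem_eq_sup' Finset.univ_nonempty (fun j => m j t)
      refine ⟨j, ?_⟩
      change L j (e (r t)) = 0
      have hj' : μ t = m j t := hj
      rw [hr, hval, ← hj', div_self (hμ0 t).ne', sub_self, mul_zero])
    (by
      intro j t ht
      have ht' : L j (e t) = 0 := ht
      have h1 : m j t = 1 := by simp [m, ht']
      have h2 : μ t = 1 := le_antisymm (hμ1 t) (h1 ▸ hμm j t)
      apply he.injective
      rw [hr, h2]
      simp)
    g (fun i j t hi hj => hg i j t hi hj)
  exact ⟨G, fun j t ht => hG j t ht⟩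

/-! ### Faces of simplices -/

/-- The boundary of a simplex. -/
def bd (n : ℕ) : Set (Δ n) := {x | ∃ i, x i = 0}

lemma face_apply_self {n : ℕ} (i : Fin (n + 2)) (x : Δ n) : (face i x : Δ (n + 1)) i = 0 :=
  Fin.insertNth_apply_same (α := fun _ => ℝ) i 0 x.1

lemma face_apply_succAbove {n : ℕ} (i : Fin (n + 2)) (x : Δ n) (j : Fin (n + 1)) :
    (face i x : Δ (n + 1)) (i.succAbove j) = x j :=
  Fin.insertNth_apply_succAbove (α := fun _ => ℝ) i 0 x.1 j

lemma face_mem_bd {n : ℕ} (i : Fin (n + 2)) (x : Δ n) : face i x ∈ bd (n + 1) :=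
  ⟨i, face_apply_self i x⟩

lemma face_injective {n : ℕ} (i : Fin (n + 2)) : Function.Injective (face i) := fun x y h =>
  simplex_ext fun j => by rw [← face_apply_succAbove i x, h, face_apply_succAbove]

/-- A continuous retraction of a simplex onto a face. -/
def drop {n : ℕ} (i : Fin (n + 2)) : C(Δ (n + 1), Δ n) :=
  smap (Function.invFun i.succAbove)

lemma face_drop {n : ℕ} {i : Fin (n + 2)} {x : Δ (n + 1)} (h : x i = 0) : face i (drop i x) = x := by
  have hinv : Function.invFun i.succAbove ∘ i.succAbove = id :=
    Function.invFun_comp Fin.succAbove_right_injective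
  refine simplex_ext fun j => ?_
  refine Fin.succAboveCases i ?_ (fun j => ?_) j
  · rw [face_apply_self, h]
  · rw [face_apply_succAbove, drop, smap_apply, Finset.sum_filter, Fin.sum_univ_succAbove _ i, h]
    have : ∀ l, Function.invFun i.succAbove (i.succAbove l) = l := fun l => congrFun hinv l
    simp [this]

lemma drop_face {n : ℕ} (i : Fin (n + 2)) (x : Δ n) : drop i (face i x) = x :=
  face_injective i (face_drop (face_apply_self i x))

lemma exists_face_eq {n : ℕ} {i : Fin (n + 2)} {x : Δ (n + 1)} (h : x i = 0) :
    ∃ y, face i y = x := ⟨_, face_drop h⟩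

lemma mem_bd_iff {n : ℕ} {x : Δ (n + 1)} : x ∈ bd (n + 1) ↔ ∃ i y, face i y = x := by
  constructor
  · rintro ⟨i, hi⟩; exact ⟨i, exists_face_eq hi⟩
  · rintro ⟨i, y, rfl⟩; exact face_mem_bd i y

lemma notMem_bd_zero (x : Δ 0) : x ∉ bd 0 := by
  rintro ⟨i, hi⟩
  have := x.2.2
  rw [Fin.sum_univ_one] at this
  rw [Subsingleton.elim (α := Fin 1) i 0] at hi
  have h2 : x.1 0 = 0 := hi
  linarith

instance : Subsingleton (Δ 0) := ⟨fun x y => simplex_ext fun i => by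
  have hx := x.2.2
  have hy := y.2.2
  rw [Fin.sum_univ_one] at hx hy
  rw [Subsingleton.elim (α := Fin 1) i 0]
  exact hx.trans hy.symm⟩

/-- Points on two different faces lie in the boundary of either face. -/
lemma mem_bd_of_face_eq {n : ℕ} {i j : Fin (n + 2)} (hij : i ≠ j) {x y : Δ n}
    (h : face i x = face j y) : x ∈ bd n := by
  obtain ⟨l, hl⟩ := Fin.exists_succAbove_eq (Ne.symm hij)
  refine ⟨l, ?_⟩
  rw [← face_apply_succAbove i x l, h, hl, face_apply_self]

/-- Points on two different faces come from a common face. -/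
lemma exists_common_face {n : ℕ} {i j : Fin (n + 3)} (hij : i ≠ j) {x y : Δ (n + 1)}
    (h : face i x = face j y) : ∃ (a b : Fin (n + 2)) (z : Δ n),
      x = face a z ∧ y = face b z ∧ i.succAbove ∘ a.succAbove = j.succAbove ∘ b.succAbove := by
  wlog hlt : i < j generalizing i j x y
  · obtain ⟨a, b, z, h1, h2, h3⟩ := this (Ne.symm hij) h.symm
      (lt_of_le_of_ne (not_lt.1 hlt) (Ne.symm hij))
    exact ⟨b, a, z, h2, h1, h3.symm⟩
  obtain ⟨a, ha⟩ := Fin.exists_succAbove_eq (Ne.symm hij)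
  obtain ⟨b, hb⟩ := Fin.exists_succAbove_eq hij
  have hx : x a = 0 := by rw [← face_apply_succAbove i x, ha, h, face_apply_self]
  obtain ⟨z, rfl⟩ := exists_face_eq hx
  have hcomp : i.succAbove ∘ a.succAbove = j.succAbove ∘ b.succAbove := by
    funext l
    simp only [Function.comp]
    have ha' := congrArg Fin.val ha
    have hb' := congrArg Fin.val hb
    apply Fin.ext
    simp only [Fin.succAbove, Fin.lt_def, Fin.val_castSucc, apply_ite Fin.val, Fin.val_succ] at *
    grind
  refine ⟨a, b, z, rfl, ?_, hcomp⟩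
  apply face_injective j
  rw [← h]
  simp only [face_eq_smap, smap_smap, hcomp]

/-! ### Three extension lemmas -/

lemma isEmbedding_prism (n : ℕ) :
    Topology.IsEmbedding fun p : I × Δ n => ((p.1 : ℝ), (p.2 : Fin (n + 1) → ℝ)) :=
  Topology.IsEmbedding.subtypeVal.prodMap Topology.IsEmbedding.subtypeVal

lemma isEmbedding_prism2 (n : ℕ) :
    Topology.IsEmbedding fun p : I × I × Δ n =>
      ((p.1 : ℝ), (p.2.1 : ℝ), (p.2.2 : Fin (n + 1) → ℝ)) :=
  Topology.IsEmbedding.subtypeVal.prodMap (isEmbedding_prism n)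

variable {X : Type} [TopologicalSpace X]

/-- The homotopy extension property of the boundary of a simplex. -/
theorem exists_htpy_extension {n : ℕ} (σ : SSimplex X (n + 1)) (h : Fin (n + 2) → C(I × Δ n, X))
    (h0 : ∀ i x, h i (0, x) = σ (face i x))
    (hc : ∀ i j x y t, face i x = face j y → h i (t, x) = h j (t, y)) :
    ∃ H : C(I × Δ (n + 1), X), (∀ x, H (0, x) = σ x) ∧
      ∀ i t x, H (t, face i x) = h i (t, x) := by
  let b : ℝ := ((n : ℝ) + 2)⁻¹
  have hb : 0 < b := by positivity
  obtain ⟨G, hG⟩ := exists_extension_of_facets (Z := X) (J := Option (Fin (n + 2)))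
    (V := ℝ × (Fin (n + 2) → ℝ)) _ (isEmbedding_prism (n + 1)) (2, fun _ => b)
    (fun j v => j.elim v.1 fun i => v.2 i)
    (by rintro (_ | i) <;> simp only [Option.elim] <;> fun_prop)
    (by rintro (_ | i) v s <;> simp)
    (by rintro (_ | i) <;> simp [hb])
    (by
      rintro (_ | i) ⟨t, x⟩
      · exact t.2.1
      · exact x.2.1 i)
    (fun t => ⟨none, by have := t.1.2.2; simp only [Option.elim]; linarith⟩)
    (by
      rintro ⟨t, x⟩ s hs hpos
      have ht := t.2.2
      have h1 := hpos none
      simp only [Option.elim, Prod.fst_add, Prod.smul_fst, Prod.fst_sub, smul_eq_mul] at h1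
      refine ⟨(⟨2 + s * ((t : ℝ) - 2), h1, by nlinarith⟩, ⟨fun i => b + s * (x i - b),
        fun i => ?_, ?_⟩), ?_⟩
      · simpa using hpos (some i)
      · have hx := x.2.2
        have hx' : ∑ i, x i = 1 := hx
        rw [Finset.sum_add_distrib, ← Finset.mul_sum, Finset.sum_sub_distrib, hx']
        simp only [Finset.sum_const, Finset.card_univ, Fintype.card_fin, nsmul_eq_mul]
        have : ((n + 2 : ℕ) : ℝ) * b = 1 := by simp only [b]; push_cast; field_simp
        rw [this]; ring
      · rfl)
    (fun j => j.elim (σ.comp ⟨Prod.snd, continuous_snd⟩)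
      fun i => (h i).comp ((ContinuousMap.id I).prodMap (drop i)))
    (by
      have key : ∀ (i : Fin (n + 2)) (t : I) (x : Δ (n + 1)), (t : ℝ) = 0 → x i = 0 →
          h i (t, drop i x) = σ x := by
        intro i t x ht hx
        have : t = 0 := Subtype.ext ht
        rw [this, h0, face_drop hx]
      rintro (_ | i) (_ | j) ⟨t, x⟩ hi hj
      · rfl
      · exact (key j t x hi hj).symm
      · exact key i t x hj hi
      · exact hc i j _ _ t ((face_drop hi).trans (face_drop hj).symm))
  refine ⟨G, fun x => hG none (0, x) rfl, fun i t x => ?_⟩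
  rw [hG (some i) (t, face i x) (face_apply_self i x)]
  change h i (t, drop i (face i x)) = _
  rw [drop_face]

/-- The homotopy extension property, one dimension higher. -/
theorem exists_htpy_extension_square {n : ℕ} (k : C(I × Δ (n + 1), X))
    (p q : C(I × Δ (n + 1), X)) (h : Fin (n + 2) → C(I × I × Δ n, X))
    (hkp : ∀ x, k (0, x) = p (0, x)) (hkq : ∀ x, k (1, x) = q (0, x))
    (hk : ∀ i s x, h i (s, 0, x) = k (s, face i x))
    (hp : ∀ i t x, h i (0, t, x) = p (t, face i x))
    (hq : ∀ i t x, h i (1, t, x) = q (t, face i x))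
    (hc : ∀ i j x y s t, face i x = face j y → h i (s, t, x) = h j (s, t, y)) :
    ∃ H : C(I × I × Δ (n + 1), X), (∀ t x, H (0, t, x) = p (t, x)) ∧
      (∀ t x, H (1, t, x) = q (t, x)) ∧ ∀ i s t x, H (s, t, face i x) = h i (s, t, x) := by
  let b : ℝ := ((n : ℝ) + 2)⁻¹
  have hb : 0 < b := by positivity
  obtain ⟨G, hG⟩ := exists_extension_of_facets (Z := X) (J := Fin 3 ⊕ (Fin (n + 2)))
    (V := ℝ × ℝ × (Fin (n + 2) → ℝ)) _ (isEmbedding_prism2 (n + 1)) (1 / 2, 2, fun _ => b)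
    (fun j v => j.elim ![v.2.1, v.1, 1 - v.1] fun i => v.2.2 i)
    (by
      rintro (j | i)
      · fin_cases j <;> simp <;> fun_prop
      · simp only [Sum.elim_inr]; fun_prop)
    (by
      rintro (j | i) v s
      · fin_cases j <;> simp
        ring
      · simp)
    (by
      rintro (j | i)
      · fin_cases j <;> simp; norm_num
      · simp [hb])
    (by
      rintro (j | i) ⟨s, t, x⟩
      · fin_cases j
        · exact t.2.1
        · exact s.2.1
        · exact sub_nonneg.2 s.2.2
      · exact x.2.1 i)
    (fun t => ⟨Sum.inl 0, by have := t.2.1.2.2; simp; linarith⟩)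
    (by
      rintro ⟨u, t, x⟩ s hs hpos
      have ht := t.2.2
      have h1 := hpos (Sum.inl 0)
      have h2 := hpos (Sum.inl 1)
      have h3 := hpos (Sum.inl 2)
      simp at h1 h2 h3
      refine ⟨(⟨1 / 2 + s * ((u : ℝ) - 1 / 2), by simpa using h2, by simpa using h3⟩,
        ⟨2 + s * ((t : ℝ) - 2), h1, by nlinarith⟩, ⟨fun i => b + s * (x i - b),
        fun i => ?_, ?_⟩), ?_⟩
      · simpa using hpos (Sum.inr i)
      · have hx := x.2.2
        have hx' : ∑ i, x i = 1 := hx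
        rw [Finset.sum_add_distrib, ← Finset.mul_sum, Finset.sum_sub_distrib, hx']
        simp only [Finset.sum_const, Finset.card_univ, Fintype.card_fin, nsmul_eq_mul]
        have : ((n + 2 : ℕ) : ℝ) * b = 1 := by simp only [b]; push_cast; field_simp
        rw [this]; ring
      · rfl)
    (fun j => j.elim ![k.comp ⟨fun v => (v.1, v.2.2), by fun_prop⟩,
        p.comp ⟨fun v => v.2, by fun_prop⟩, q.comp ⟨fun v => v.2, by fun_prop⟩]
      fun i => (h i).comp ((ContinuousMap.id I).prodMap ((ContinuousMap.id I).prodMap (drop i))))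
    (by
      have e0 : ∀ t : I, (t : ℝ) = 0 → t = 0 := fun t ht => Subtype.ext ht
      have e1 : ∀ t : I, 1 - (t : ℝ) = 0 → t = 1 := fun t ht =>
        Subtype.ext (sub_eq_zero.1 ht).symm
      have k0 : ∀ (i : Fin (n + 2)) (s t : I) (x : Δ (n + 1)), t = 0 → x i = 0 →
          h i (s, t, drop i x) = k (s, x) := by
        rintro i s t x rfl hx; rw [hk, face_drop hx]
      have k1 : ∀ (i : Fin (n + 2)) (s t : I) (x : Δ (n + 1)), s = 0 → x i = 0 →
          h i (s, t, drop i x) = p (t, x) := by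
        rintro i s t x rfl hx; rw [hp, face_drop hx]
      have k2 : ∀ (i : Fin (n + 2)) (s t : I) (x : Δ (n + 1)), s = 1 → x i = 0 →
          h i (s, t, drop i x) = q (t, x) := by
        rintro i s t x rfl hx; rw [hq, face_drop hx]
      have k01 : ∀ (s t : I) (x : Δ (n + 1)), t = 0 → s = 0 → k (s, x) = p (t, x) := by
        rintro s t x rfl rfl; exact hkp x
      have k02 : ∀ (s t : I) (x : Δ (n + 1)), t = 0 → s = 1 → k (s, x) = q (t, x) := by
        rintro s t x rfl rfl; exact hkq x
      have k12 : ∀ s : I, s = 0 → s = 1 → False := by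
        rintro s rfl h; exact zero_ne_one h
      rintro (i | i) (j | j) ⟨s, t, x⟩ hi hj
      · fin_cases i <;> fin_cases j
        · rfl
        · exact k01 s t x (e0 t hi) (e0 s hj)
        · exact k02 s t x (e0 t hi) (e1 s hj)
        · exact (k01 s t x (e0 t hj) (e0 s hi)).symm
        · rfl
        · exact (k12 s (e0 s hi) (e1 s hj)).elim
        · exact (k02 s t x (e0 t hj) (e1 s hi)).symm
        · exact (k12 s (e0 s hj) (e1 s hi)).elim
        · rfl
      · fin_cases i
        · exact (k0 j s t x (e0 t hi) hj).symm
        · exact (k1 j s t x (e0 s hi) hj).symm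
        · exact (k2 j s t x (e1 s hi) hj).symm
      · fin_cases j
        · exact k0 i s t x (e0 t hj) hi
        · exact k1 i s t x (e0 s hj) hi
        · exact k2 i s t x (e1 s hj) hi
      · exact hc i j _ _ s t ((face_drop hi).trans (face_drop hj).symm))
  refine ⟨G, fun t x => hG (Sum.inl 1) (0, t, x) rfl,
    fun t x => hG (Sum.inl 2) (1, t, x) (sub_self _), fun i s t x => ?_⟩
  rw [hG (Sum.inr i) (s, t, face i x) (face_apply_self i x)]
  change h i (s, t, drop i (face i x)) = _
  rw [drop_face]

/-- Filling of a box: all facets of a prism over a simplex but the one opposite to the vertex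
`0` are prescribed. -/
theorem exists_box_filling {n : ℕ} (α β : SSimplex X (n + 1)) (h : Fin (n + 1) → C(I × Δ n, X))
    (h0 : ∀ i x, h i (0, x) = α (face i.succ x))
    (h1 : ∀ i x, h i (1, x) = β (face i.succ x))
    (hc : ∀ i j x y t, face i.succ x = face j.succ y → h i (t, x) = h j (t, y)) :
    ∃ H : C(I × Δ (n + 1), X), (∀ x, H (0, x) = α x) ∧ (∀ x, H (1, x) = β x) ∧
      ∀ i t x, H (t, face i.succ x) = h i (t, x) := by
  let b : ℝ := ((n : ℝ) + 1)⁻¹ * 2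
  have hb : 0 < b := by positivity
  have hnb : ((n : ℝ) + 1) * b = 2 := by simp only [b]; field_simp
  obtain ⟨G, hG⟩ := exists_extension_of_facets (Z := X) (J := Fin 2 ⊕ (Fin (n + 1)))
    (V := ℝ × (Fin (n + 2) → ℝ)) _ (isEmbedding_prism (n + 1))
    (1 / 2, Fin.cons (-1) fun _ => b)
    (fun j v => j.elim ![v.1, 1 - v.1] fun i => v.2 i.succ)
    (by
      rintro (j | i)
      · fin_cases j <;> simp <;> fun_prop
      · simp only [Sum.elim_inr]; fun_prop)
    (by
      rintro (j | i) v s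
      · fin_cases j <;> simp
        ring
      · simp)
    (by
      rintro (j | i)
      · fin_cases j <;> simp; norm_num
      · simp [hb])
    (by
      rintro (j | i) ⟨t, x⟩
      · fin_cases j
        · exact t.2.1
        · exact sub_nonneg.2 t.2.2
      · exact x.2.1 i.succ)
    (by
      rintro ⟨t, x⟩
      by_contra! hcon
      have hx : ∑ i, x i = 1 := x.2.2
      rw [Fin.sum_univ_succ] at hx
      have h0 : 0 ≤ x 0 := x.2.1 0
      have : ∑ i : Fin (n + 1), b ≤ ∑ i : Fin (n + 1), x i.succ := by
        refine Finset.sum_le_sum fun i _ => ?_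
        simpa using hcon (Sum.inr i)
      simp only [Finset.sum_const, Finset.card_univ, Fintype.card_fin, nsmul_eq_mul] at this
      push_cast at this
      linarith)
    (by
      rintro ⟨t, x⟩ s hs hpos
      have h1 := hpos (Sum.inl 0)
      have h2 := hpos (Sum.inl 1)
      simp at h1 h2
      refine ⟨(⟨1 / 2 + s * ((t : ℝ) - 1 / 2), by simpa using h1, by simpa using h2⟩,
        ⟨Fin.cons (-1 + s * (x 0 + 1)) fun i => b + s * (x i.succ - b), fun i => ?_, ?_⟩), ?_⟩
      · refine Fin.cases ?_ (fun i => ?_) i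
        · have h0 : 0 ≤ x 0 := x.2.1 0
          simp only [Fin.cons_zero]; nlinarith
        · simpa using hpos (Sum.inr i)
      · have hx : ∑ i, x i = 1 := x.2.2
        rw [Fin.sum_univ_succ] at hx
        rw [Fin.sum_univ_succ]
        simp only [Fin.cons_zero, Fin.cons_succ]
        have hsum : ∑ i : Fin (n + 1), (b + s * (x i.succ - b)) =
            ((n : ℝ) + 1) * b + s * (∑ i : Fin (n + 1), x i.succ - ((n : ℝ) + 1) * b) := by
          rw [Finset.sum_add_distrib (f := fun _ => b), ← Finset.mul_sum (a := s),
            Finset.sum_sub_distrib]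
          simp only [Finset.sum_const, Finset.card_univ, Fintype.card_fin, nsmul_eq_mul]
          push_cast
          rfl
        rw [hsum, hnb]
        linear_combination s * hx
      · refine Prod.ext ?_ (funext fun i => ?_)
        · rfl
        · refine Fin.cases ?_ (fun i => ?_) i
          · change (-1 + s * (x 0 + 1) : ℝ) = _
            simp
          · change (b + s * (x i.succ - b) : ℝ) = _
            simp)
    (fun j => j.elim ![α.comp ⟨Prod.snd, continuous_snd⟩, β.comp ⟨Prod.snd, continuous_snd⟩]
      fun i => (h i).comp ((ContinuousMap.id I).prodMap (drop i.succ)))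
    (by
      have e0 : ∀ t : I, (t : ℝ) = 0 → t = 0 := fun t ht => Subtype.ext ht
      have e1 : ∀ t : I, 1 - (t : ℝ) = 0 → t = 1 := fun t ht =>
        Subtype.ext (sub_eq_zero.1 ht).symm
      have k0 : ∀ (i : Fin (n + 1)) (t : I) (x : Δ (n + 1)), t = 0 → x i.succ = 0 →
          h i (t, drop i.succ x) = α x := by
        rintro i t x rfl hx; rw [h0, face_drop hx]
      have k1 : ∀ (i : Fin (n + 1)) (t : I) (x : Δ (n + 1)), t = 1 → x i.succ = 0 →
          h i (t, drop i.succ x) = β x := by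
        rintro i t x rfl hx; rw [h1, face_drop hx]
      have k12 : ∀ s : I, s = 0 → s = 1 → False := by
        rintro s rfl h; exact zero_ne_one h
      rintro (i | i) (j | j) ⟨t, x⟩ hi hj
      · fin_cases i <;> fin_cases j
        · rfl
        · exact (k12 t (e0 t hi) (e1 t hj)).elim
        · exact (k12 t (e0 t hj) (e1 t hi)).elim
        · rfl
      · fin_cases i
        · exact (k0 j t x (e0 t hi) hj).symm
        · exact (k1 j t x (e1 t hi) hj).symm
      · fin_cases j
        · exact k0 i t x (e0 t hj) hi
        · exact k1 i t x (e1 t hj) hi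
      · exact hc i j _ _ t ((face_drop hi).trans (face_drop hj).symm))
  refine ⟨G, fun x => hG (Sum.inl 0) (0, x) rfl,
    fun x => hG (Sum.inl 1) (1, x) (sub_self _), fun i t x => ?_⟩
  rw [hG (Sum.inr i) (t, face i.succ x) (face_apply_self i.succ x)]
  change h i (t, drop i.succ (face i.succ x)) = _
  rw [drop_face]

end BddCoh

end

noncomputable section
namespace BddCoh
local notation "I" => unitInterval

variable {X : Type} [TopologicalSpace X] {L : Type}

/-! ### Existence of homotopy systems -/

/-- The constant homotopy. -/
def stat {k : ℕ} (σ : SSimplex X k) : C(I × Δ k, X) := σ.comp ⟨Prod.snd, continuous_snd⟩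

/-- Coherence of a family of homotopies of labelled `k`-simplices on common faces. -/
def IsCoherent {k : ℕ} (H : SSimplex X k → (Fin (k + 1) → L) → C(I × Δ k, X)) : Prop :=
  ∀ (σ : SSimplex X (k + 1)) (l : Fin (k + 2) → L) (i j : Fin (k + 2)) (x y : Δ k) (t : I),
    face i x = face j y →
      H (faceOf σ i) (l ∘ i.succAbove) (t, x) = H (faceOf σ j) (l ∘ j.succAbove) (t, y)

lemma exists_coherent_succ {k : ℕ} (H : SSimplex X k → (Fin (k + 1) → L) → C(I × Δ k, X))
    (h0 : ∀ σ l x, H σ l (0, x) = σ x) (hc : IsCoherent H) :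
    ∃ H' : SSimplex X (k + 1) → (Fin (k + 2) → L) → C(I × Δ (k + 1), X),
      ((∀ σ l x, H' σ l (0, x) = σ x) ∧ IsCoherent H') ∧
      ∀ σ l (i : Fin (k + 2)) t x,
        H (faceOf σ i) (l ∘ i.succAbove) (t, x) = H' σ l (t, face i x) := by
  have := fun (σ : SSimplex X (k + 1)) (l : Fin (k + 2) → L) =>
    exists_htpy_extension σ (fun i => H (faceOf σ i) (l ∘ i.succAbove))
      (fun i x => h0 _ _ _) (fun i j x y t => hc σ l i j x y t)
  choose H' h0' hf using this
  refine ⟨H', ⟨h0', ?_⟩, fun σ l i t x => (hf σ l i t x).symm⟩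
  intro σ l i j x y t hxy
  by_cases hij : i = j
  · subst hij
    rw [face_injective i hxy]
  · obtain ⟨a, b, z, rfl, rfl, hab⟩ := exists_common_face hij hxy
    rw [hf, hf]
    have e1 : faceOf (faceOf σ i) a = faceOf (faceOf σ j) b := by
      simp only [faceOf, face_eq_smap, ContinuousMap.comp_assoc, smap_comp, hab]
    rw [e1, Function.comp_assoc, Function.comp_assoc, hab]

theorem exists_system (Θ : ∀ k, SSimplex X k → (Fin (k + 1) → L) → C(I × Δ k, X)) (i : ℕ)
    (h0 : ∀ k ≤ i, ∀ σ l x, Θ k σ l (0, x) = σ x)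
    (hf : ∀ k < i, ∀ σ l (j : Fin (k + 2)) t x,
      Θ k (faceOf σ j) (l ∘ j.succAbove) (t, x) = Θ (k + 1) σ l (t, face j x))
    (hc : IsCoherent (Θ i)) :
    ∃ H : ∀ k, SSimplex X k → (Fin (k + 1) → L) → C(I × Δ k, X),
      IsSystem H ∧ ∀ k ≤ i, H k = Θ k := by
  have hcΘ : ∀ k ≤ i, IsCoherent (Θ k) := by
    intro k hk
    rcases hk.lt_or_eq with h | rfl
    · intro σ l a b x y t hxy
      rw [hf k h, hf k h, hxy]
    · exact hc
  let P : ∀ k, (SSimplex X k → (Fin (k + 1) → L) → C(I × Δ k, X)) → Prop := fun k H =>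
    (∀ σ l x, H σ l (0, x) = σ x) ∧ IsCoherent H
  have step : ∀ (k : ℕ) (H : {H // P k H}), ∃ H' : {H // P (k + 1) H},
      (k + 1 ≤ i → H'.1 = Θ (k + 1)) ∧ ((i < k + 1 ∨ H.1 = Θ k) → ∀ σ l (j : Fin (k + 2)) t x,
        H.1 (faceOf σ j) (l ∘ j.succAbove) (t, x) = H'.1 σ l (t, face j x)) := by
    intro k H
    by_cases hk : k + 1 ≤ i
    · refine ⟨⟨Θ (k + 1), h0 _ hk, hcΘ _ hk⟩, fun _ => rfl, ?_⟩
      rintro (h | h)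
      · omega
      · rw [h]; exact hf k hk
    · obtain ⟨H', hP, hH'⟩ := exists_coherent_succ H.1 H.2.1 H.2.2
      exact ⟨⟨H', hP⟩, fun h => absurd h hk, fun _ => hH'⟩
  choose S hS1 hS2 using step
  let A : ∀ k, {H // P k H} := fun k =>
    Nat.rec ⟨Θ 0, h0 0 (Nat.zero_le _), hcΘ 0 (Nat.zero_le _)⟩ S k
  have hA : ∀ k ≤ i, (A k).1 = Θ k := by
    intro k hk
    cases k with
    | zero => rfl
    | succ k => exact hS1 k (A k) hk
  refine ⟨fun k => (A k).1, ⟨fun k => (A k).2.1, fun k σ l j t x => ?_⟩, hA⟩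
  refine hS2 k (A k) ?_ σ l j t x
  by_cases hk : k ≤ i
  · exact Or.inr (hA k hk)
  · exact Or.inl (by omega)

/-- Homotopies of labelled `i`-simplices relative to the boundary extend to a homotopy system. -/
theorem exists_system_of_rel {i : ℕ} (θ : SSimplex X i → (Fin (i + 1) → L) → C(I × Δ i, X))
    (h0 : ∀ σ l x, θ σ l (0, x) = σ x) (hb : ∀ σ l t, ∀ x ∈ bd i, θ σ l (t, x) = σ x) :
    ∃ H : ∀ k, SSimplex X k → (Fin (k + 1) → L) → C(I × Δ k, X),
      IsSystem H ∧ H i = θ ∧ ∀ k < i, ∀ σ l, H k σ l = stat σ := by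
  classical
  let Θ : ∀ k, SSimplex X k → (Fin (k + 1) → L) → C(I × Δ k, X) := fun k =>
    if h : k = i then h ▸ θ else fun σ _ => stat σ
  have hΘi : Θ i = θ := by simp [Θ]
  have hΘ : ∀ k < i, Θ k = fun σ _ => stat σ := by
    intro k hk; simp [Θ, hk.ne]
  obtain ⟨H, hH, hHΘ⟩ := exists_system Θ i
    (by
      intro k hk σ l x
      rcases hk.lt_or_eq with h | rfl
      · rw [hΘ k h]; rfl
      · rw [hΘi]; exact h0 σ l x)
    (by
      intro k hk σ l j t x
      rw [hΘ k hk]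
      change σ (face j x) = _
      rcases (Nat.succ_le_of_lt hk).lt_or_eq with h | rfl
      · rw [hΘ _ h]; rfl
      · rw [hΘi, hb _ _ _ _ (face_mem_bd j x)])
    (by
      rw [hΘi]
      intro σ l a b x y t hxy
      by_cases hab : a = b
      · subst hab; rw [face_injective a hxy]
      · rw [hb _ _ _ _ (mem_bd_of_face_eq hab hxy),
          hb _ _ _ _ (mem_bd_of_face_eq (Ne.symm hab) hxy.symm)]
        exact congrArg σ hxy)
  refine ⟨H, hH, (hHΘ i le_rfl).trans hΘi, fun k hk σ l => ?_⟩
  rw [hHΘ k hk.le, hΘ k hk]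

lemma strictMono_fin_cases {j k : ℕ} {a : Fin (j + 1) → Fin (k + 2)} (ha : StrictMono a) :
    (∃ h : j = k + 1, ∀ x, a x = Fin.cast (by rw [h]) x) ∨
      ∃ (i : Fin (k + 2)) (b : Fin (j + 1) → Fin (k + 1)), StrictMono b ∧ a = i.succAbove ∘ b := by
  by_cases hs : Function.Surjective a
  · left
    have hjk : j = k + 1 := by
      have := Fintype.card_of_bijective ⟨ha.injective, hs⟩
      simpa using this
    refine ⟨hjk, fun x => ?_⟩
    subst hjk
    let e : Fin (k + 2) ≃o Fin (k + 2) := StrictMono.orderIsoOfSurjective a ha hs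
    have : e = OrderIso.refl _ := Subsingleton.elim _ _
    exact congrArg (fun f => f x) (congrArg (fun e : Fin (k + 2) ≃o Fin (k + 2) => (e : _ → _)) this)
  · right
    simp only [Function.Surjective, not_forall, not_exists] at hs
    obtain ⟨i, hi⟩ := hs
    choose b hb using fun x => Fin.exists_succAbove_eq (hi x)
    refine ⟨i, b, fun x y hxy => ?_, (funext hb).symm⟩
    rw [← (Fin.strictMono_succAbove i).lt_iff_lt, hb, hb]
    exact ha hxy

/-- Homotopy systems restrict to all faces. -/
lemma IsSystem.restrict {H : ∀ k, SSimplex X k → (Fin (k + 1) → L) → C(I × Δ k, X)}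
    (hH : IsSystem H) {j k : ℕ} {a : Fin (j + 1) → Fin (k + 1)} (ha : StrictMono a)
    (σ : SSimplex X k) (l : Fin (k + 1) → L) (t : I) (x : Δ j) :
    H j (σ.comp (smap a)) (l ∘ a) (t, x) = H k σ l (t, smap a x) := by
  induction k with
  | zero =>
    have hj : j = 0 := by
      have := Fintype.card_le_of_injective a ha.injective
      simpa using this
    subst hj
    have : a = id := funext fun x => Subsingleton.elim (α := Fin 1) _ _
    subst this
    simp
  | succ k ih =>
    rcases strictMono_fin_cases ha with ⟨h, hx⟩ | ⟨i, b, hb, rfl⟩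
    · subst h
      have : a = id := funext hx
      subst this
      simp
    · rw [← smap_comp, ← ContinuousMap.comp_assoc, ← Function.comp_assoc,
        ih hb (σ.comp (smap i.succAbove))]
      have := hH.face k σ l i t (smap b x)
      rw [faceOf, face_eq_smap] at this
      rw [this]
      rfl

/-! ### Paths of simplices -/

/-- The path of simplices described by a homotopy. -/
def hpath {Y : Type*} [TopologicalSpace Y] (h : C(I × Y, X)) {α : C(Y, X)}
    (h0 : ∀ x, h (0, x) = α x) {β : C(Y, X)} (h1 : ∀ x, h (1, x) = β x) : Path α β where
  toContinuousMap := h.curry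
  source' := ContinuousMap.ext h0
  target' := ContinuousMap.ext h1

/-- Homotopy relative to the boundary of a simplex. -/
abbrev HRel {n : ℕ} (α β : SSimplex X n) : Prop := α.HomotopicRel β (bd n)

lemma hRel_of {n : ℕ} {α β : SSimplex X n} (h : C(I × Δ n, X)) (h0 : ∀ x, h (0, x) = α x)
    (h1 : ∀ x, h (1, x) = β x) (hb : ∀ t, ∀ x ∈ bd n, h (t, x) = α x) : HRel α β :=
  ⟨{ toContinuousMap := h, map_zero_left := h0, map_one_left := h1, prop' := hb }⟩

lemma HRel.exists {n : ℕ} {α β : SSimplex X n} (h : HRel α β) :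
    ∃ h : C(I × Δ n, X), (∀ x, h (0, x) = α x) ∧ (∀ x, h (1, x) = β x) ∧
      ∀ t, ∀ x ∈ bd n, h (t, x) = α x := by
  obtain ⟨F⟩ := h
  exact ⟨F.toContinuousMap, F.map_zero_left, F.map_one_left, fun t x hx => F.eq_fst t hx⟩

/-- Filling a box relative to the boundaries of the facets. -/
lemma exists_box_filling_rel {n : ℕ} (α β : SSimplex X (n + 1)) (K : Fin (n + 1) → C(I × Δ n, X))
    (h0 : ∀ i x, K i (0, x) = α (face i.succ x)) (h1 : ∀ i x, K i (1, x) = β (face i.succ x))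
    (hb : ∀ i t, ∀ x ∈ bd n, K i (t, x) = α (face i.succ x)) :
    ∃ H : C(I × Δ (n + 1), X), (∀ x, H (0, x) = α x) ∧ (∀ x, H (1, x) = β x) ∧
      (∀ i t x, H (t, face i.succ x) = K i (t, x)) ∧
      ∀ t, ∀ x ∈ bd n, H (t, face 0 x) = α (face 0 x) := by
  obtain ⟨H, H0, H1, Hf⟩ := exists_box_filling α β K h0 h1 (by
    intro i j x y t hxy
    by_cases hij : i = j
    · subst hij; rw [face_injective _ hxy]
    · have hij' : i.succ ≠ j.succ := fun h => hij (Fin.succ_injective _ h)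
      rw [hb _ _ _ (mem_bd_of_face_eq hij' hxy),
        hb _ _ _ (mem_bd_of_face_eq (Ne.symm hij') hxy.symm), hxy])
  refine ⟨H, H0, H1, Hf, ?_⟩
  rintro t x ⟨i, hi⟩
  have h2 : (face 0 x : Δ (n + 1)) i.succ = 0 := by
    have := face_apply_succAbove 0 x i
    rw [Fin.zero_succAbove] at this
    rw [this]; exact hi
  obtain ⟨y, hy⟩ := exists_face_eq h2
  rw [← hy, Hf, hb _ _ _ (mem_bd_of_face_eq (Fin.succ_ne_zero i) hy)]

lemma hRel_face_zero {n : ℕ} {α β : SSimplex X (n + 1)}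
    (h : ∀ i : Fin (n + 1), HRel (faceOf α i.succ) (faceOf β i.succ)) :
    HRel (faceOf α 0) (faceOf β 0) := by
  choose K h0 h1 hb using fun i => (h i).exists
  obtain ⟨H, H0, H1, -, Hb⟩ := exists_box_filling_rel α β K h0 h1 hb
  exact hRel_of (H.comp ((ContinuousMap.id I).prodMap (face 0))) (fun x => H0 _) (fun x => H1 _)
    fun t x hx => Hb t x hx

section Transport

variable {Z : Type} [TopologicalSpace Z] {n : ℕ}

/-- A path of simplices as a homotopy. -/
def unpath {Y : Type*} [TopologicalSpace Y] [LocallyCompactSpace Y] {α β : C(Y, X)}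
    (h : Path α β) : C(I × Y, X) := ContinuousMap.uncurry h.toContinuousMap

lemma unpath_apply {Y : Type*} [TopologicalSpace Y] [LocallyCompactSpace Y] {α β : C(Y, X)}
    (h : Path α β) (t : I) (x : Y) : unpath h (t, x) = h t x := rfl

/-- Homotopies starting at simplices which are homotopic relative to the boundary, and which agree
up to homotopy on the facets, have ends which are homotopic relative to the boundary. -/
theorem HRel.transport (val : C(Z, C(Δ n, X)))
    (hrel : ∀ z z', Joined z z' → ∀ x ∈ bd n, val z x = val z' x)
    {α α' β β' : SSimplex X (n + 1)} (hα : HRel α α') (h : Path α β) (h' : Path α' β')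
    (hF : ∀ j, ∃ F : C(I × I, Z), (∀ t, val (F (0, t)) = (h t).comp (face j)) ∧
      (∀ t, val (F (1, t)) = (h' t).comp (face j)) ∧ (∀ s, F (s, 0) = F (0, 0)) ∧
      ∀ s, F (s, 1) = F (0, 1)) : HRel β β' := by
  obtain ⟨K, K0, K1, Kb⟩ := hα.exists
  choose F F0 F1 Fs Ft using hF
  have hjoin : ∀ j s t, Joined (F j (s, t)) (F j (0, t)) := by
    intro j s t
    refine ⟨⟨(F j).comp ⟨fun r => (unitInterval.symm r * s, t), by fun_prop⟩, ?_, ?_⟩⟩ <;> simp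
  obtain ⟨H, H0, H1, Hf⟩ := exists_htpy_extension_square K (unpath h) (unpath h')
    (fun j => (val.comp (F j)).uncurry.comp ⟨fun p => ((p.1, p.2.1), p.2.2), by fun_prop⟩)
    (by intro x; rw [K0, unpath_apply, h.source])
    (by intro x; rw [K1, unpath_apply, h'.source])
    (by
      intro j s x
      change val (F j (s, 0)) x = _
      rw [Fs, F0, h.source, Kb _ _ (face_mem_bd j x)]; rfl)
    (by intro j t x; change val (F j (0, t)) x = _; rw [F0]; rfl)
    (by intro j t x; change val (F j (1, t)) x = _; rw [F1]; rfl)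
    (by
      intro i j x y s t hxy
      change val (F i (s, t)) x = val (F j (s, t)) y
      by_cases hij : i = j
      · subst hij; rw [face_injective _ hxy]
      · rw [hrel _ _ (hjoin i s t) _ (mem_bd_of_face_eq hij hxy),
          hrel _ _ (hjoin j s t) _ (mem_bd_of_face_eq (Ne.symm hij) hxy.symm), F0, F0]
        exact congrArg (h t) hxy)
  refine hRel_of (H.comp ⟨fun p => (p.1, 1, p.2), by fun_prop⟩) (fun x => ?_) (fun x => ?_) ?_
  · change H (0, 1, x) = _
    rw [H0, unpath_apply, h.target]
  · change H (1, 1, x) = _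
    rw [H1, unpath_apply, h'.target]
  · intro s x hx
    obtain ⟨j, y, rfl⟩ := mem_bd_iff.1 hx
    change H (s, 1, face j y) = _
    rw [Hf]
    change val (F j (s, 1)) y = _
    rw [Ft, F0, h.target]; rfl

end Transport

/-! ### Relations between simplices -/

/-- Simplices agreeing on all `i`-faces, and up to homotopy relative to the boundary on all
`(i+1)`-faces. -/
def RelR (i : ℕ) {k : ℕ} (σ σ' : SSimplex X k) : Prop :=
  (∀ a : Fin (i + 1) → Fin (k + 1), StrictMono a → σ.comp (smap a) = σ'.comp (smap a)) ∧
  ∀ a : Fin (i + 2) → Fin (k + 1), StrictMono a → HRel (σ.comp (smap a)) (σ'.comp (smap a))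

/-- `σ` can be moved along paths of its `i`-faces to a simplex related to `σ'`. -/
def RelP {Z : Type} [TopologicalSpace Z] {i : ℕ} (val : C(Z, C(Δ i, X))) {k : ℕ}
    (σ σ' : SSimplex X k) : Prop :=
  ∃ (β : SSimplex X k) (h : Path σ β),
    (∀ a : Fin (i + 1) → Fin (k + 1), StrictMono a →
      ∃ c : C(I, Z), ∀ t, val (c t) = (h t).comp (smap a)) ∧ RelR i β σ'

lemma relR_self_iff {k : ℕ} {σ σ' : SSimplex X k} : RelR k σ σ' ↔ σ = σ' := by
  constructor
  · intro h
    have := h.1 id strictMono_id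
    simpa using this
  · rintro rfl
    exact ⟨fun _ _ => rfl, fun _ _ => .refl _⟩

lemma strictMono_cons_zero {n k : ℕ} {a : Fin (n + 1) → Fin (k + 1)} (ha : StrictMono a)
    (h0 : a 0 ≠ 0) : StrictMono (Fin.cons 0 a : Fin (n + 2) → Fin (k + 1)) := by
  have hpos : ∀ x, 0 < a x := fun x =>
    lt_of_lt_of_le (Fin.pos_iff_ne_zero.2 h0) (ha.monotone (Fin.zero_le x))
  intro x y hxy
  induction y using Fin.cases with
  | zero => exact absurd hxy (Fin.not_lt_zero x)
  | succ y =>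
    induction x using Fin.cases with
    | zero => simpa using hpos y
    | succ x => simpa using ha (Fin.succ_lt_succ_iff.1 hxy)

lemma comp_smap_face {n k : ℕ} (σ : SSimplex X k) (a : Fin (n + 2) → Fin (k + 1)) (j : Fin (n + 2)) :
    faceOf (σ.comp (smap a)) j = σ.comp (smap (a ∘ j.succAbove)) := by
  rw [faceOf, face_eq_smap, ContinuousMap.comp_assoc, smap_comp]

/-- Moving a single simplex along prescribed homotopies of its `i`-faces. -/
lemma exists_move {i k : ℕ} (σ : SSimplex X k)
    (θ : (Fin (i + 1) → Fin (k + 1)) → C(I × Δ i, X))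
    (h0 : ∀ a, StrictMono a → ∀ x, θ a (0, x) = σ (smap a x))
    (hb : ∀ a, StrictMono a → ∀ t, ∀ x ∈ bd i, θ a (t, x) = σ (smap a x)) :
    ∃ h : C(I × Δ k, X), (∀ x, h (0, x) = σ x) ∧
      ∀ a, StrictMono a → ∀ t x, h (t, smap a x) = θ a (t, x) := by
  classical
  obtain ⟨H, hH, hHi, -⟩ := exists_system_of_rel (L := Fin (k + 1)) (i := i)
    (fun τ l => if StrictMono l ∧ τ = σ.comp (smap l) then θ l else stat τ)
    (by
      intro τ l x
      split_ifs with h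
      · rw [h0 l h.1, h.2]; rfl
      · rfl)
    (by
      intro τ l t x hx
      split_ifs with h
      · rw [hb l h.1 t x hx, h.2]; rfl
      · rfl)
  refine ⟨H k σ id, hH.start k σ id, fun a ha t x => ?_⟩
  rw [← hH.restrict ha, hHi]
  simp [ha]

theorem relP_of_relR {Z : Type} [TopologicalSpace Z] {n : ℕ} (val : C(Z, C(Δ (n + 1), X)))
    (hrel : ∀ z z', Joined z z' → ∀ x ∈ bd (n + 1), val z x = val z' x)
    (hlift : ∀ p : C(I, C(Δ (n + 1), X)), (∀ t, ∀ x ∈ bd (n + 1), p t x = p 0 x) →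
      ∃ c : C(I, Z), ∀ t, val (c t) = p t)
    {k : ℕ} {σ σ' : SSimplex X k} (h : RelR n σ σ') : RelP val σ σ' := by
  classical
  have hK : ∀ a : Fin (n + 2) → Fin (k + 1), ∃ K : C(I × Δ (n + 1), X), StrictMono a →
      (∀ x, K (0, x) = σ (smap a x)) ∧ (∀ x, K (1, x) = σ' (smap a x)) ∧
      ∀ t, ∀ x ∈ bd (n + 1), K (t, x) = σ (smap a x) := by
    intro a
    by_cases ha : StrictMono a
    · obtain ⟨K, h⟩ := (h.2 a ha).exists
      exact ⟨K, fun _ => h⟩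
    · exact ⟨stat (σ.comp (smap a)), fun h => absurd h ha⟩
  choose K hK using hK
  have hsm : ∀ {B : Fin (n + 3) → Fin (k + 1)} (_ : StrictMono B) (j : Fin (n + 3)),
      StrictMono (B ∘ j.succAbove) := fun hB j => hB.comp (Fin.strictMono_succAbove j)
  have hfs : ∀ (τ : SSimplex X k) (B : Fin (n + 3) → Fin (k + 1)) (j : Fin (n + 3)) (x : Δ (n + 1)),
      τ (smap (B ∘ j.succAbove) x) = τ (smap B (face j x)) := by
    intro τ B j x; rw [face_eq_smap, smap_smap]
  have hG : ∀ B : Fin (n + 3) → Fin (k + 1), ∃ G : C(I × Δ (n + 2), X), StrictMono B →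
      (∀ x, G (0, x) = σ (smap B x)) ∧ (∀ x, G (1, x) = σ' (smap B x)) ∧
      (∀ (i : Fin (n + 2)) t x, G (t, face i.succ x) = K (B ∘ i.succ.succAbove) (t, x)) ∧
      ∀ t, ∀ x ∈ bd (n + 1), G (t, face 0 x) = σ (smap B (face 0 x)) := by
    intro B
    by_cases hB : StrictMono B
    · obtain ⟨G, hG⟩ := exists_box_filling_rel (σ.comp (smap B)) (σ'.comp (smap B))
        (fun i => K (B ∘ i.succ.succAbove))
        (fun i x => by rw [(hK _ (hsm hB _)).1, hfs]; rfl)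
        (fun i x => by rw [(hK _ (hsm hB _)).2.1, hfs]; rfl)
        (fun i t x hx => by rw [(hK _ (hsm hB _)).2.2 t x hx, hfs]; rfl)
      exact ⟨G, fun _ => hG⟩
    · exact ⟨stat (σ.comp (smap B)), fun h => absurd h hB⟩
  choose G hG using hG
  let θ : (Fin (n + 2) → Fin (k + 1)) → C(I × Δ (n + 1), X) := fun a =>
    if a 0 = 0 then K a else (G (Fin.cons 0 a)).comp ((ContinuousMap.id I).prodMap (face 0))
  have hcons : ∀ a : Fin (n + 2) → Fin (k + 1),
      (Fin.cons 0 a : Fin (n + 3) → Fin (k + 1)) ∘ (0 : Fin (n + 3)).succAbove = a := by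
    intro a; funext x; simp
  have hθ : ∀ a, StrictMono a → (∀ x, θ a (0, x) = σ (smap a x)) ∧
      (∀ x, θ a (1, x) = σ' (smap a x)) ∧
      ∀ t, ∀ x ∈ bd (n + 1), θ a (t, x) = σ (smap a x) := by
    intro a ha
    by_cases h0 : a 0 = 0
    · simp only [θ, h0, if_true]; exact hK a ha
    · have hB := strictMono_cons_zero ha h0
      have e : ∀ (τ : SSimplex X k) (x : Δ (n + 1)),
          τ (smap (Fin.cons 0 a : Fin (n + 3) → Fin (k + 1)) (face 0 x)) = τ (smap a x) := by
        intro τ x; rw [← hfs, hcons]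
      simp only [θ, h0, if_false]
      refine ⟨fun x => ?_, fun x => ?_, fun t x hx => ?_⟩
      · exact ((hG _ hB).1 _).trans (e σ x)
      · exact ((hG _ hB).2.1 _).trans (e σ' x)
      · exact ((hG _ hB).2.2.2 t x hx).trans (e σ x)
  obtain ⟨m, m0, mθ⟩ := exists_move σ θ (fun a ha => (hθ a ha).1) (fun a ha => (hθ a ha).2.2)
  have hc : ∀ a : Fin (n + 2) → Fin (k + 1), StrictMono a →
      ∃ c : C(I, Z), ∀ t x, val (c t) x = θ a (t, x) := by
    intro a ha
    obtain ⟨c, hc⟩ := hlift (θ a).curry (fun t x hx =>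
      ((hθ a ha).2.2 t x hx).trans ((hθ a ha).1 x).symm)
    exact ⟨c, fun t x => by rw [hc]; rfl⟩
  have hmain : ∀ B : Fin (n + 3) → Fin (k + 1), StrictMono B → B 0 = 0 →
      HRel ((hend m).comp (smap B)) (σ'.comp (smap B)) := by
    intro B hB hB0
    have hBc : (Fin.cons 0 (B ∘ Fin.succ) : Fin (n + 3) → Fin (k + 1)) = B := by
      funext x; refine Fin.cases ?_ (fun x => ?_) x <;> simp [hB0]
    have hGθ : ∀ (j : Fin (n + 3)) t x, G B (t, face j x) = θ (B ∘ j.succAbove) (t, x) := by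
      intro j t x
      refine Fin.cases ?_ (fun j => ?_) j
      · have hne : (B ∘ (0 : Fin (n + 3)).succAbove) 0 ≠ 0 := by
          simp only [Function.comp, Fin.zero_succAbove]
          rw [← hB0]
          exact (hB (Fin.succ_pos 0)).ne'
        simp only [θ, hne, if_false]
        have : (Fin.cons 0 (B ∘ (0 : Fin (n + 3)).succAbove) : Fin (n + 3) → Fin (k + 1)) = B := by
          rw [← hBc]; congr 1
        rw [this]; rfl
      · have h0 : (B ∘ j.succ.succAbove) 0 = 0 := by simp [hB0]
        simp only [θ, h0, if_true]
        exact (hG B hB).2.2.1 j t x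
    refine HRel.transport val hrel (ContinuousMap.HomotopicRel.refl (σ.comp (smap B)))
      (hpath (m.comp ((ContinuousMap.id I).prodMap (smap B))) (α := σ.comp (smap B))
        (β := (hend m).comp (smap B)) (fun x => m0 _) (fun x => rfl))
      (hpath (G B) (hG B hB).1 (hG B hB).2.1) fun j => ?_
    obtain ⟨c, hc⟩ := hc (B ∘ j.succAbove) (hsm hB j)
    refine ⟨c.comp ⟨Prod.snd, continuous_snd⟩, fun t => ?_, fun t => ?_, fun _ => rfl, fun _ => rfl⟩
    · ext x
      change val (c t) x = m (t, smap B (face j x))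
      rw [hc, ← mθ _ (hsm hB j), face_eq_smap, smap_smap]
    · ext x
      change val (c t) x = G B (t, face j x)
      rw [hc, hGθ]
  refine ⟨hend m, hpath m m0 (fun _ => rfl), fun a ha => ?_, fun a ha => ?_, fun B hB => ?_⟩
  · obtain ⟨c, hc⟩ := hc a ha
    refine ⟨c, fun t => ?_⟩
    ext x
    rw [hc, ← mθ a ha]; rfl
  · ext x
    change m (1, smap a x) = _
    rw [mθ a ha, (hθ a ha).2.1]; rfl
  · by_cases hB0 : B 0 = 0
    · exact hmain B hB hB0
    · have hC := strictMono_cons_zero hB hB0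
      have e : (Fin.cons 0 B : Fin (n + 4) → Fin (k + 1)) ∘ (0 : Fin (n + 4)).succAbove = B := by
        funext x; simp
      have := hRel_face_zero (α := (hend m).comp (smap (Fin.cons 0 B : Fin (n + 4) → Fin (k + 1))))
        (β := σ'.comp (smap (Fin.cons 0 B : Fin (n + 4) → Fin (k + 1)))) (fun j => by
          rw [comp_smap_face, comp_smap_face]
          exact hmain _ (hC.comp (Fin.strictMono_succAbove _)) (by simp))
      rwa [comp_smap_face, comp_smap_face, e] at this

end BddCoh

end

noncomputable section
namespace BddCoh
local notation "I" => unitInterval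

variable {X : Type} [TopologicalSpace X]

/-! ### Cochains vanishing on simplices with an inessential edge -/

/-- Edges which are constant or contained in `Y`. -/
def AdmEdge (Y : Set X) (e : SSimplex X 1) : Prop := (∀ x y, e x = e y) ∨ ∀ x, e x ∈ Y

/-- Cochains vanishing on simplices with an edge which is constant or contained in `Y`. -/
def VanEdge (Y : Set X) {k : ℕ} (G : SCochain X k) : Prop :=
  ∀ (σ : SSimplex X k) (a b : Fin (k + 1)), a ≠ b → AdmEdge Y (σ.comp (smap ![a, b])) → G σ = 0

lemma prismOp_eq_zero {L : Type} {Y : Set X}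
    {H : ∀ k, SSimplex X k → (Fin (k + 1) → L) → C(I × Δ k, X)} (hH : IsSystem H)
    (h0 : ∀ σ l, (∀ t t' x, H 0 σ l (t, x) = H 0 σ l (t', x)) ∨ ∀ t x, H 0 σ l (t, x) ∈ Y)
    {k : ℕ} {G : SCochain X (k + 1)} (hG : VanEdge Y G) (σ : SSimplex X k) (l : Fin (k + 1) → L) :
    prismOp H (fun σ _ => G σ) σ l = 0 := by
  refine tpair_eq_zero (fun a => ?_) _
  obtain ⟨p, q, hpq, hv⟩ := Fintype.exists_ne_map_eq_of_card_lt (fun x => (a x).1) (by simp)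
  refine hG _ p q hpq ?_
  rw [ContinuousMap.comp_assoc, paff_smap]
  set v := (a p).1 with hvdef
  have hconst : (Prod.fst ∘ a ∘ ![p, q]) = (fun _ : Fin 1 => v) ∘ fun _ : Fin 2 => (0 : Fin 1) := by
    funext x; fin_cases x
    · rfl
    · exact hv.symm
  have hval : ∀ x : Δ 1, (H k σ l) (paff (a ∘ ![p, q]) x) =
      H 0 (σ.comp (smap fun _ : Fin 1 => v)) (l ∘ fun _ => v)
        ((paff (a ∘ ![p, q]) x).1, smap (fun _ : Fin 2 => (0 : Fin 1)) x) := by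
    intro x
    have hsm : StrictMono fun _ : Fin 1 => v := fun x y h =>
      absurd (Subsingleton.elim x y) h.ne
    rw [hH.restrict hsm, smap_smap]
    congr 1
    refine Prod.ext rfl ?_
    change smap (Prod.fst ∘ a ∘ ![p, q]) x = _
    rw [hconst]
  rcases h0 (σ.comp (smap fun _ : Fin 1 => v)) (l ∘ fun _ => v) with h | h
  · left
    intro x y
    change (H k σ l) (paff _ x) = (H k σ l) (paff _ y)
    rw [hval, hval, h _ (paff (a ∘ ![p, q]) y).1]
    congr 2
    exact Subsingleton.elim (α := Δ 0) _ _
  · right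
    intro x
    change (H k σ l) (paff _ x) ∈ Y
    rw [hval]
    exact h _ _

/-! ### Averaging over homotopies of `i`-simplices -/

/-- A family of elements indexed by an injection extends by one to a finitely supported family. -/
lemma exists_extend_one {κ Λ : Type*} [Finite κ] (G : Λ → Type*) [∀ a, One (G a)] (idx : κ → Λ)
    (hidx : Function.Injective idx) (g : ∀ x, G (idx x)) :
    ∃ (s : Finset Λ) (g' : ∀ a, G a), (∀ x, g' (idx x) = g x) ∧ ∀ a ∉ s, g' a = 1 := by
  classical
  have hex : ∀ a, ∃ y : G a, (∀ x (h : idx x = a), y = h ▸ g x) ∧ (a ∉ Set.range idx → y = 1) := by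
    intro a
    by_cases ha : a ∈ Set.range idx
    · obtain ⟨x, rfl⟩ := ha
      refine ⟨g x, fun x' h => ?_, fun h => absurd ⟨x, rfl⟩ h⟩
      have := hidx h
      subst this
      rfl
    · exact ⟨1, fun x h => absurd ⟨x, h⟩ ha, fun _ => rfl⟩
  choose g' h1 h2 using hex
  refine ⟨(Set.finite_range idx).toFinset, g', fun x => h1 _ x rfl, fun a ha => h2 a ?_⟩
  simpa using ha

section Stage

variable {Z : Type} [TopologicalSpace Z]

/-- A representative of the path component of a point. -/
def rep (z : Z) : Z := (Quotient.mk (pathSetoid Z) z).out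

lemma joined_rep (z : Z) : Joined z (rep z) :=
  Setoid.symm' (pathSetoid Z) (Quotient.exact (Quotient.out_eq (Quotient.mk (pathSetoid Z) z)))

lemma rep_eq {z z' : Z} (h : Joined z z') : rep z = rep z' := by
  unfold rep
  rw [show Quotient.mk (pathSetoid Z) z = Quotient.mk (pathSetoid Z) z' from Quotient.sound h]

/-- A path to the representative. -/
def repPath (z : Z) : Path z (rep z) := (joined_rep z).somePath

/-- A path representing an element of the fundamental group. -/
def loopOf {z : Z} (g : FundamentalGroup Z z) : Path z z :=
  Quotient.out (FundamentalGroup.toPath g)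

lemma mk_loopOf {z : Z} (g : FundamentalGroup Z z) :
    Path.Homotopic.Quotient.mk (loopOf g) = FundamentalGroup.toPath g := Quotient.out_eq _

lemma exists_translation {z z' r r' : Z} (hr : r = r') (q : Path z r) (q' : Path z' r')
    (c : Path z z') : ∃ g : FundamentalGroup Z r, ∀ U : ∀ r, FundamentalGroup Z r,
      ∃ F : C(I × I, Z), (∀ t, F (0, t) = (c.symm.trans (q.trans (loopOf (U r * g)))) t) ∧
        (∀ t, F (1, t) = (q'.trans (loopOf (U r'))) t) ∧ (∀ s, F (s, 0) = F (0, 0)) ∧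
        ∀ s, F (s, 1) = F (0, 1) := by
  subst hr
  refine ⟨FundamentalGroup.fromPath (((Path.Homotopic.Quotient.mk q).symm.trans (Path.Homotopic.Quotient.mk c)).trans
    (Path.Homotopic.Quotient.mk q')), fun U => ?_⟩
  have h : Path.Homotopic.Quotient.mk (c.symm.trans (q.trans (loopOf (U r * FundamentalGroup.fromPath
      (((Path.Homotopic.Quotient.mk q).symm.trans (Path.Homotopic.Quotient.mk c)).trans (Path.Homotopic.Quotient.mk q')))))) =
      Path.Homotopic.Quotient.mk (q'.trans (loopOf (U r))) := by
    rw [Path.Homotopic.Quotient.mk_trans, Path.Homotopic.Quotient.mk_trans, Path.Homotopic.Quotient.mk_trans, mk_loopOf, mk_loopOf,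
      FundamentalGroup.mul_def]
    change (Path.Homotopic.Quotient.mk c.symm).trans ((Path.Homotopic.Quotient.mk q).trans
      ((((Path.Homotopic.Quotient.mk q).symm.trans (Path.Homotopic.Quotient.mk c)).trans (Path.Homotopic.Quotient.mk q')).trans (U r))) =
      (Path.Homotopic.Quotient.mk q').trans (U r)
    rw [Path.Homotopic.Quotient.mk_symm]
    simp only [Path.Homotopic.Quotient.trans_assoc]
    rw [← Path.Homotopic.Quotient.trans_assoc (Path.Homotopic.Quotient.mk q) (Path.Homotopic.Quotient.mk q).symm, Path.Homotopic.Quotient.trans_symm,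
      Path.Homotopic.Quotient.refl_trans, ← Path.Homotopic.Quotient.trans_assoc (Path.Homotopic.Quotient.mk c).symm, Path.Homotopic.Quotient.symm_trans,
      Path.Homotopic.Quotient.refl_trans]
  obtain ⟨F⟩ := Path.Homotopic.Quotient.exact h
  refine ⟨F.toContinuousMap, F.map_zero_left, F.map_one_left, fun s => ?_, fun s => ?_⟩
  · exact (F.source s).trans (F.source 0).symm
  · exact (F.target s).trans (F.target 0).symm

variable {i : ℕ} (val : C(Z, C(Δ i, X)))

/-- The point of `Z` representing a simplex. -/
def ptOf (hval : Function.Bijective val) (τ : SSimplex X i) : Z := (Equiv.ofBijective val hval).symm τ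

lemma val_ptOf (hval : Function.Bijective val) (τ : SSimplex X i) : val (ptOf val hval τ) = τ :=
  (Equiv.ofBijective val hval).apply_symm_apply τ

/-- Averaging over homotopies of the `i`-faces in the space `Z`. -/
theorem exists_averaged (hval : Function.Bijective val)
    (hrel : ∀ z z', Joined z z' → ∀ x ∈ bd i, val z x = val z' x)
    (hπ : ∀ z : Z, HasInvMean (FundamentalGroup Z z)) (Y : Set X)
    (hedge : i = 0 → ∀ c : C(I, Z), (∀ t t', val (c t) = val (c t')) ∨ ∀ t x, val (c t) x ∈ Y)
    {k : ℕ} (f : LCo X ℕ (k + 1)) {C : ℝ} (hf : ∀ σ l, |f σ l| ≤ C) {G : SCochain X (k + 2)}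
    (hG : VanEdge Y G) (hfG : ∀ σ l, lcob f σ l = G σ)
    (hinv : ∀ σ σ' l, Function.Injective l → RelR i σ σ' → f σ l = f σ' l) :
    ∃ (f' : LCo X ℕ (k + 1)) (b : LCo X ℕ k), (∀ σ l, |f' σ l| ≤ C) ∧ (∃ B, ∀ σ l, |b σ l| ≤ B) ∧
      (∀ σ l, f' σ l - f σ l = lcob b σ l) ∧
      ∀ σ σ' l, Function.Injective l → RelP val σ σ' → f' σ l = f' σ' l := by
  classical
  let Gp : Z × (Fin (i + 1) → ℕ) → Type := fun a => FundamentalGroup Z a.1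
  let _ : ∀ a, Group (Gp a) := fun a => inferInstanceAs (Group (FundamentalGroup Z a.1))
  obtain ⟨M, hM, hMinv⟩ := exists_product_mean Gp (fun a => hπ a.1)
  let pin : (∀ a, Gp a) → ∀ z : Z, (Fin (i + 1) → ℕ) → Path z (rep z) := fun u z l =>
    (repPath z).trans (loopOf (u (rep z, l)))
  let θ : (∀ a, Gp a) → SSimplex X i → (Fin (i + 1) → ℕ) → C(I × Δ i, X) := fun u τ l =>
    (val.comp (pin u (ptOf val hval τ) l).toContinuousMap).uncurry
  have hθ : ∀ u τ l t x, θ u τ l (t, x) = val (pin u (ptOf val hval τ) l t) x := fun _ _ _ _ _ => rfl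
  have hjoin : ∀ {z w : Z} (p : Path z w) t, Joined (p t) z := by
    intro z w p t
    refine Joined.symm ⟨⟨p.toContinuousMap.comp ⟨fun r => r * t, by fun_prop⟩, ?_, ?_⟩⟩ <;> simp
  have hsys := fun u => exists_system_of_rel (θ u)
    (by intro τ l x; rw [hθ, Path.source, val_ptOf])
    (by
      intro τ l t x hx
      rw [hθ, hrel _ _ (hjoin _ t) x hx, val_ptOf])
  choose H hH hHi hHlt using hsys
  have hH0 : ∀ u σ l, (∀ t t' x, H u 0 σ l (t, x) = H u 0 σ l (t', x)) ∨
      ∀ t x, H u 0 σ l (t, x) ∈ Y := by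
    intro u σ l
    rcases Nat.eq_zero_or_pos i with hi | hi
    · subst hi
      rw [hHi]
      rcases hedge rfl (pin u (ptOf val hval σ) l).toContinuousMap with h | h
      · left; intro t t' x; rw [hθ, hθ]; exact congrArg (fun g : C(Δ 0, X) => g x) (h t t')
      · right; intro t x; rw [hθ]; exact h t x
    · left; intro t t' x; rw [hHlt u 0 hi]; rfl
  have hbf : ∀ σ l, Bdd fun u => f (hend (H u (k + 1) σ l)) l := fun σ l => ⟨C, fun u => hf _ _⟩
  let B := tnorm (prismChain k) * C
  have hbp : ∀ u σ l, |prismOp (H u) f σ l| ≤ B := fun u σ l => abs_prismOp_le (H u) hf σ l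
  refine ⟨fun σ l => M fun u => f (hend (H u (k + 1) σ l)) l, fun σ l => M fun u => prismOp (H u) f σ l,
    fun σ l => hM.abs_le _ _ fun u => hf _ _, ⟨B, fun σ l => hM.abs_le _ _ fun u => hbp _ _ _⟩, ?_, ?_⟩
  · intro σ l
    have h1 : ∀ u, f (hend (H u (k + 1) σ l)) l - f σ l = lcob (prismOp (H u) f) σ l := by
      intro u
      have h2 := (hH u).homotopy f σ l
      have h3 : lcob f = fun σ _ => G σ := by funext σ l; exact hfG σ l
      rw [h3, prismOp_eq_zero (hH u) (hH0 u) hG, add_zero] at h2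
      exact h2
    have h2 := hM.sub (hbf σ l) (bdd_const (f σ l))
    rw [hM.const] at h2
    rw [← h2]
    simp only [h1, lcob]
    rw [hM.sum _ fun j _ => Bdd.smul _ ⟨B, fun u => hbp u _ _⟩]
    exact Finset.sum_congr rfl fun j _ => hM.smul _ _ ⟨B, fun u => hbp u _ _⟩
  · rintro σ σ' l hl ⟨β, h, hc, hβ⟩
    let Fc := {a : Fin (i + 1) → Fin (k + 2) // StrictMono a}
    have hc' : ∀ a : Fc, ∃ c : Path (ptOf val hval (σ.comp (smap a.1)))
        (ptOf val hval (σ'.comp (smap a.1))), ∀ t, val (c t) = (h t).comp (smap a.1) := by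
      rintro ⟨a, ha⟩
      obtain ⟨c, hc⟩ := hc a ha
      refine ⟨⟨c, hval.1 ?_, hval.1 ?_⟩, hc⟩
      · change val (c 0) = _
        rw [hc, h.source, val_ptOf]
      · change val (c 1) = _
        rw [hc, h.target, val_ptOf, hβ.1 a ha]
    choose c hc using hc'
    have hrepa : ∀ a : Fc, rep (ptOf val hval (σ.comp (smap a.1))) =
        rep (ptOf val hval (σ'.comp (smap a.1))) := fun a => rep_eq ⟨c a⟩
    choose g hg using fun a : Fc => exists_translation (hrepa a)
      (repPath (ptOf val hval (σ.comp (smap a.1)))) (repPath (ptOf val hval (σ'.comp (smap a.1)))) (c a)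
    obtain ⟨s, g', hg', hs⟩ := exists_extend_one Gp
      (fun a : Fc => (rep (ptOf val hval (σ.comp (smap a.1))), l ∘ a.1))
      (by
        rintro ⟨a, ha⟩ ⟨a', ha'⟩ haa
        have := (Prod.ext_iff.1 haa).2
        refine Subtype.ext (funext fun x => hl ?_)
        exact congrFun this x) g
    beta_reduce
    rw [← hMinv s g' hs _ (hbf σ l)]
    congr 1
    funext u
    refine hinv _ _ l hl ⟨fun a ha => ?_, fun b hb => ?_⟩
    · ext x
      change H (u * g') (k + 1) σ l (1, smap a x) = H u (k + 1) σ' l (1, smap a x)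
      rw [← (hH _).restrict ha, ← (hH _).restrict ha, hHi, hHi, hθ, hθ, Path.target, Path.target,
        hrepa ⟨a, ha⟩]
    · let p1 : Path (σ.comp (smap b)) ((hend (H (u * g') (k + 1) σ l)).comp (smap b)) :=
        hpath (α := σ.comp (smap b)) (β := (hend (H (u * g') (k + 1) σ l)).comp (smap b))
          ((H (u * g') (k + 1) σ l).comp ((ContinuousMap.id I).prodMap (smap b)))
          (fun x => (hH _).start _ σ l (smap b x)) (fun x => rfl)
      let p2 : Path (σ'.comp (smap b)) ((hend (H u (k + 1) σ' l)).comp (smap b)) :=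
        hpath (α := σ'.comp (smap b)) (β := (hend (H u (k + 1) σ' l)).comp (smap b))
          ((H u (k + 1) σ' l).comp ((ContinuousMap.id I).prodMap (smap b)))
          (fun x => (hH _).start _ σ' l (smap b x)) (fun x => rfl)
      let p0 : Path (σ.comp (smap b)) (β.comp (smap b)) :=
        h.map (ContinuousMap.continuous_precomp (smap b))
      refine HRel.transport val hrel (hβ.2 b hb) (p0.symm.trans p1) p2 fun j => ?_
      have ha : StrictMono (b ∘ j.succAbove) := hb.comp (Fin.strictMono_succAbove j)
      obtain ⟨F, F0, F1, Fs, Ft⟩ := hg ⟨b ∘ j.succAbove, ha⟩ (fun r => u (r, l ∘ b ∘ j.succAbove))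
      have hp1 : ∀ t, (p1 t).comp (face j) = val (pin (u * g')
          (ptOf val hval (σ.comp (smap (b ∘ j.succAbove)))) (l ∘ b ∘ j.succAbove) t) := by
        intro t
        ext x
        change H (u * g') (k + 1) σ l (t, smap b (face j x)) = _
        rw [face_eq_smap, smap_smap, ← (hH _).restrict ha, hHi]
        rfl
      have hp2 : ∀ t, (p2 t).comp (face j) = val (pin u
          (ptOf val hval (σ'.comp (smap (b ∘ j.succAbove)))) (l ∘ b ∘ j.succAbove) t) := by
        intro t
        ext x
        change H u (k + 1) σ' l (t, smap b (face j x)) = _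
        rw [face_eq_smap, smap_smap, ← (hH _).restrict ha, hHi]
        rfl
      have hp0 : ∀ t, (p0 t).comp (face j) = val (c ⟨b ∘ j.succAbove, ha⟩ t) := by
        intro t
        rw [hc]
        change ((h t).comp (smap b)).comp (face j) = _
        rw [face_eq_smap, ContinuousMap.comp_assoc, smap_comp]
      refine ⟨F, fun t => ?_, fun t => ?_, Fs, Ft⟩
      · rw [F0]
        have hu : (u * g') (rep (ptOf val hval (σ.comp (smap (b ∘ j.succAbove)))), l ∘ b ∘ j.succAbove)
            = u (rep (ptOf val hval (σ.comp (smap (b ∘ j.succAbove)))), l ∘ b ∘ j.succAbove) *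
              g ⟨b ∘ j.succAbove, ha⟩ := by
          rw [← hg' ⟨b ∘ j.succAbove, ha⟩]; rfl
        rw [Path.trans_apply, Path.trans_apply]
        split_ifs with ht
        · exact (hp0 _).symm
        · rw [hp1]
          simp only [pin]
          rw [hu]
      · rw [F1, hp2]

end Stage

end BddCoh

end

noncomputable section
namespace BddCoh
local notation "I" => unitInterval

/-! ### Commutativity of fundamental groups of spaces with a multiplication -/

section Mult

variable {Z : Type} [TopologicalSpace Z]

/-- The fundamental group of a space with a multiplication which has a homotopy unit is
commutative. -/
theorem comm_of_mult (μ : C(Z × Z, Z)) (τ : Z)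
    (F : (ContinuousMap.id Z).Homotopy (μ.comp ⟨fun z => (τ, z), by fun_prop⟩))
    (F' : (ContinuousMap.id Z).Homotopy (μ.comp ⟨fun z => (z, τ), by fun_prop⟩))
    (a b : FundamentalGroup Z τ) : a * b = b * a := by
  set f : C(Z, Z) := μ.comp ⟨fun z => (τ, z), by fun_prop⟩ with hf
  set f' : C(Z, Z) := μ.comp ⟨fun z => (z, τ), by fun_prop⟩ with hf'
  have hsurj : ∀ (g : C(Z, Z)) (G : (ContinuousMap.id Z).Homotopy g)
      (x : Path.Homotopic.Quotient (g τ) (g τ)), ∃ c : Path τ τ,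
      x = Path.Homotopic.Quotient.mk (c.map g.continuous) := by
    intro g G x
    let β : Path τ (g τ) := G.evalAt τ
    obtain ⟨c, hc⟩ := Path.Homotopic.Quotient.mk_surjective
      (((Path.Homotopic.Quotient.mk β).trans x).trans (Path.Homotopic.Quotient.mk β).symm)
    refine ⟨c, ?_⟩
    have h : (Path.Homotopic.Quotient.mk c).trans (Path.Homotopic.Quotient.mk β) =
        (Path.Homotopic.Quotient.mk β).trans (Path.Homotopic.Quotient.mk (c.map g.continuous)) := by
      rw [← Path.Homotopic.Quotient.mk_trans, ← Path.Homotopic.Quotient.mk_trans]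
      refine Path.Homotopic.Quotient.eq.2 ?_
      exact Path.Homotopic.map_trans_evalAt G c
    rw [hc, Path.Homotopic.Quotient.trans_assoc, Path.Homotopic.Quotient.symm_trans,
      Path.Homotopic.Quotient.trans_refl] at h
    have h2 := congrArg (fun y => (Path.Homotopic.Quotient.mk β).symm.trans y) h
    simpa only [← Path.Homotopic.Quotient.trans_assoc, Path.Homotopic.Quotient.symm_trans,
      Path.Homotopic.Quotient.refl_trans] using h2
  have hcomm : ∀ x y : Path.Homotopic.Quotient (μ (τ, τ)) (μ (τ, τ)), x.trans y = y.trans x := by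
    intro x y
    obtain ⟨c, rfl⟩ := hsurj f F x
    obtain ⟨d, rfl⟩ := hsurj f' F' y
    let G : f.Homotopy f :=
      { toFun := fun p => μ (d p.1, p.2)
        map_zero_left := fun z => by simp [hf]
        map_one_left := fun z => by simp [hf] }
    have := Path.Homotopic.map_trans_evalAt G c
    have h2 := Path.Homotopic.Quotient.eq.2 this
    rw [Path.Homotopic.Quotient.mk_trans, Path.Homotopic.Quotient.mk_trans] at h2
    exact h2
  let β : Path τ (μ (τ, τ)) := F.evalAt τ
  set B := Path.Homotopic.Quotient.mk β
  have key : ∀ p q : Path.Homotopic.Quotient τ τ, p.trans q = q.trans p := by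
    intro p q
    have h := hcomm ((B.symm.trans p).trans B) ((B.symm.trans q).trans B)
    have h2 := congrArg (fun y => (B.trans y).trans B.symm) h
    have e : ∀ p q : Path.Homotopic.Quotient τ τ,
        (B.trans (((B.symm.trans p).trans B).trans ((B.symm.trans q).trans B))).trans B.symm =
          p.trans q := by
      intro p q
      simp only [Path.Homotopic.Quotient.trans_assoc, Path.Homotopic.Quotient.trans_symm,
        Path.Homotopic.Quotient.trans_refl]
      rw [← Path.Homotopic.Quotient.trans_assoc B B.symm q, Path.Homotopic.Quotient.trans_symm,
        Path.Homotopic.Quotient.refl_trans,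
        ← Path.Homotopic.Quotient.trans_assoc B B.symm, Path.Homotopic.Quotient.trans_symm,
        Path.Homotopic.Quotient.refl_trans]
    simp only [e] at h2
    exact h2
  rw [FundamentalGroup.mul_def, FundamentalGroup.mul_def]
  exact key b a

end Mult

/-! ### Chords of a simplex -/

section Chord

variable {n : ℕ}

/-- The distance, along the chord direction, to the facet opposite to the vertex `0`. -/
def chA (x : Δ (n + 1)) : ℝ := x 0 / ((n : ℝ) + 1)

/-- The distance, along the chord direction, to the other facets. -/
def chB (x : Δ (n + 1)) : ℝ :=
  Finset.univ.inf' Finset.univ_nonempty fun i : Fin (n + 1) => x i.succ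

/-- The length of the chord. -/
def chL (x : Δ (n + 1)) : ℝ := chA x + chB x

lemma continuous_coord {k : ℕ} (i : Fin (k + 1)) : Continuous fun x : Δ k => x i :=
  (continuous_apply i).comp continuous_subtype_val

@[fun_prop] lemma continuous_chA : Continuous (chA (n := n)) := (continuous_coord 0).div_const _

@[fun_prop] lemma continuous_chB : Continuous (chB (n := n)) :=
  Continuous.finset_inf'_apply _ fun i _ => continuous_coord i.succ

@[fun_prop] lemma continuous_chL : Continuous (chL (n := n)) := continuous_chA.add continuous_chB

lemma chA_nonneg (x : Δ (n + 1)) : 0 ≤ chA x := div_nonneg (x.2.1 0) (by positivity)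

lemma chB_nonneg (x : Δ (n + 1)) : 0 ≤ chB x := Finset.le_inf' _ _ fun i _ => x.2.1 i.succ

lemma chB_le (x : Δ (n + 1)) (i : Fin (n + 1)) : chB x ≤ x i.succ :=
  Finset.inf'_le _ (Finset.mem_univ i)

lemma mem_bd_iff_ch {x : Δ (n + 1)} : x ∈ bd (n + 1) ↔ chA x = 0 ∨ chB x = 0 := by
  have hn : ((n : ℝ) + 1) ≠ 0 := by positivity
  constructor
  · rintro ⟨i, hi⟩
    induction i using Fin.cases with
    | zero => left; simp [chA, hi]
    | succ i => right; exact le_antisymm (hi ▸ chB_le x i) (chB_nonneg x)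
  · rintro (h | h)
    · refine ⟨0, ?_⟩
      rw [chA, div_eq_zero_iff] at h
      exact h.resolve_right hn
    · obtain ⟨i, -, hi⟩ := Finset.exists_mem_eq_inf' Finset.univ_nonempty
        (fun i : Fin (n + 1) => x i.succ)
      exact ⟨i.succ, hi.symm.trans h⟩

/-- Truncation of a real number to the chord. -/
def clampL (x : Δ (n + 1)) (w : ℝ) : ℝ := max 0 (min w (chL x))

lemma clampL_mem (x : Δ (n + 1)) (w : ℝ) : 0 ≤ clampL x w ∧ clampL x w ≤ chL x :=
  ⟨le_max_left _ _, max_le (add_nonneg (chA_nonneg x) (chB_nonneg x)) (min_le_right _ _)⟩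

/-- The point of the chord through `x` at position `w`. -/
def chord (x : Δ (n + 1)) (w : ℝ) : Δ (n + 1) :=
  ⟨Fin.cons (x 0 + ((n : ℝ) + 1) * (clampL x w - chA x))
    fun i => x i.succ - (clampL x w - chA x), by
    have hn : (0 : ℝ) < (n : ℝ) + 1 := by positivity
    have hA : ((n : ℝ) + 1) * chA x = x 0 := by rw [chA]; field_simp
    obtain ⟨h0, h1⟩ := clampL_mem x w
    refine ⟨fun i => ?_, ?_⟩
    · refine Fin.cases ?_ (fun i => ?_) i
      · simp only [Fin.cons_zero]
        nlinarith
      · simp only [Fin.cons_succ]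
        have := chB_le x i
        rw [chL] at h1
        linarith
    · have hx : ∑ i, x i = 1 := x.2.2
      rw [Fin.sum_univ_succ] at hx ⊢
      simp only [Fin.cons_zero, Fin.cons_succ, Finset.sum_sub_distrib, Finset.sum_const,
        Finset.card_univ, Fintype.card_fin, nsmul_eq_mul]
      push_cast
      linarith⟩

lemma chord_zero_coord (x : Δ (n + 1)) (w : ℝ) :
    (chord x w) 0 = x 0 + ((n : ℝ) + 1) * (clampL x w - chA x) := rfl

lemma chord_succ_coord (x : Δ (n + 1)) (w : ℝ) (i : Fin (n + 1)) :
    (chord x w) i.succ = x i.succ - (clampL x w - chA x) := rfl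

lemma continuous_chord : Continuous fun p : Δ (n + 1) × ℝ => chord p.1 p.2 := by
  have hcl : Continuous fun p : Δ (n + 1) × ℝ => clampL p.1 p.2 := by
    unfold clampL; fun_prop
  refine Continuous.subtype_mk ?_ _
  refine continuous_pi fun i => ?_
  have hc := fun i => (continuous_coord (k := n + 1) i).comp
    (continuous_fst (X := Δ (n + 1)) (Y := ℝ))
  have hA : Continuous fun p : Δ (n + 1) × ℝ => chA p.1 := by fun_prop
  refine Fin.cases ?_ (fun i => ?_) i
  · exact (hc 0).add (continuous_const.mul (hcl.sub hA))
  · exact (hc i.succ).sub (hcl.sub hA)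

@[fun_prop] lemma Continuous.chord {T : Type*} [TopologicalSpace T] {f : T → Δ (n + 1)}
    {g : T → ℝ} (hf : Continuous f) (hg : Continuous g) :
    Continuous fun t => BddCoh.chord (f t) (g t) := continuous_chord.comp (hf.prodMk hg)

lemma chord_congr {x : Δ (n + 1)} {w w' : ℝ} (h : clampL x w = clampL x w') :
    chord x w = chord x w' := by
  refine simplex_ext fun i => ?_
  refine Fin.cases ?_ (fun i => ?_) i
  · rw [chord_zero_coord, chord_zero_coord, h]
  · rw [chord_succ_coord, chord_succ_coord, h]

lemma clampL_of_mem {x : Δ (n + 1)} {w : ℝ} (h0 : 0 ≤ w) (h1 : w ≤ chL x) : clampL x w = w := by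
  rw [clampL, min_eq_left h1, max_eq_right h0]

lemma clampL_of_le {x : Δ (n + 1)} {w : ℝ} (h0 : w ≤ 0) : clampL x w = 0 :=
  max_eq_left ((min_le_left _ _).trans h0)

lemma clampL_of_ge {x : Δ (n + 1)} {w : ℝ} (h : chL x ≤ w) : clampL x w = chL x := by
  rw [clampL, min_eq_right h]
  exact max_eq_right (add_nonneg (chA_nonneg x) (chB_nonneg x))

lemma chord_eq {x : Δ (n + 1)} {w : ℝ} (h : clampL x w = chA x) : chord x w = x := by
  refine simplex_ext fun i => ?_
  refine Fin.cases ?_ (fun i => ?_) i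
  · rw [chord_zero_coord, h, sub_self, mul_zero, add_zero]
  · rw [chord_succ_coord, h, sub_self, sub_zero]

lemma chord_mem_bd_of_le {x : Δ (n + 1)} {w : ℝ} (h : w ≤ 0) : chord x w ∈ bd (n + 1) := by
  refine ⟨0, ?_⟩
  rw [chord_zero_coord, clampL_of_le h, chA]
  field_simp
  ring

lemma chord_mem_bd_of_ge {x : Δ (n + 1)} {w : ℝ} (h : chL x ≤ w) : chord x w ∈ bd (n + 1) := by
  obtain ⟨i, -, hi⟩ := Finset.exists_mem_eq_inf' Finset.univ_nonempty
    (fun i : Fin (n + 1) => x i.succ)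
  refine ⟨i.succ, ?_⟩
  rw [chord_succ_coord, clampL_of_ge h, chL, ← hi]
  change chB x - _ = 0
  ring

end Chord

/-! ### Simplices with prescribed boundary -/

section PrescribedBoundary

variable {X : Type} [TopologicalSpace X] {n : ℕ}

/-- The space of simplices with prescribed boundary. -/
def BdFibre (X : Type) [TopologicalSpace X] (i : ℕ) (c : bd i → X) : Type :=
  {g : C(Δ i, X) // ∀ x (hx : x ∈ bd i), g x = c ⟨x, hx⟩}

instance (i : ℕ) (c : bd i → X) : TopologicalSpace (BdFibre X i c) := instTopologicalSpaceSubtype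

variable {c : bd (n + 1) → X}

lemma BdFibre.eq_on_bd {i : ℕ} {c : bd i → X} (g h : BdFibre X i c) {x : Δ i} (hx : x ∈ bd i) :
    g.1 x = h.1 x := (g.2 x hx).trans (h.2 x hx).symm

/-- Continuous maps to the space of simplices with prescribed boundary. -/
def BdFibre.mkMap {i : ℕ} {c : bd i → X} {T : Type} [TopologicalSpace T] (F : T × Δ i → X)
    (hF : Continuous F) (hb : ∀ t x (hx : x ∈ bd i), F (t, x) = c ⟨x, hx⟩) : C(T, BdFibre X i c) where
  toFun t := ⟨(ContinuousMap.mk F hF).curry t, hb t⟩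
  continuous_toFun := (ContinuousMap.curry ⟨F, hF⟩).continuous.subtype_mk _

lemma BdFibre.continuous_eval {i : ℕ} {c : bd i → X} {T : Type} [TopologicalSpace T]
    {f : T → BdFibre X i c} (hf : Continuous f) {g : T → Δ i} (hg : Continuous g) :
    Continuous fun t => (f t).1 (g t) := by
  have h1 : Continuous fun t => (f t).1 := continuous_subtype_val.comp hf
  fun_prop

theorem BdFibre.comm (z : BdFibre X (n + 1) c) (a b : FundamentalGroup (BdFibre X (n + 1) c) z) :
    a * b = b * a := by
  have hL : ∀ x : Δ (n + 1), 0 ≤ chL x := fun x => add_nonneg (chA_nonneg x) (chB_nonneg x)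
  have hbd : ∀ {x : Δ (n + 1)}, x ∈ bd (n + 1) → chA x = 0 ∨ (0 < chA x ∧ chL x = chA x) := by
    intro x hx
    rcases mem_bd_iff_ch.1 hx with h | h
    · exact Or.inl h
    · rcases (chA_nonneg x).eq_or_lt with h' | h'
      · exact Or.inl h'.symm
      · exact Or.inr ⟨h', by rw [chL, h, add_zero]⟩
  have hAL : ∀ x : Δ (n + 1), chA x ≤ chL x := fun x => le_add_of_nonneg_right (chB_nonneg x)
  have hid : ∀ x : Δ (n + 1), ∀ w, w = chA x → chord x w = x := fun x w h => by
    subst h; exact chord_eq (clampL_of_mem (chA_nonneg x) (hAL x))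
  have e := @BdFibre.eq_on_bd X _ (n + 1) c
  let Z := BdFibre X (n + 1) c
  let μ : C(Z × Z, Z) := BdFibre.mkMap
    (fun p => if 3 * chA p.2 ≤ chL p.2 then p.1.1.1 (chord p.2 (3 * chA p.2)) else
      if 3 * chA p.2 ≤ 2 * chL p.2 then z.1 (chord p.2 (2 * chL p.2 - 3 * chA p.2)) else
        p.1.2.1 (chord p.2 (3 * chA p.2 - 2 * chL p.2)))
    (by
      refine Continuous.if_le ?_ (Continuous.if_le ?_ ?_ ?_ ?_ ?_) ?_ ?_ ?_
      · exact BdFibre.continuous_eval (by fun_prop) (by fun_prop)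
      · exact z.1.continuous.comp (by fun_prop)
      · exact BdFibre.continuous_eval (by fun_prop) (by fun_prop)
      · fun_prop
      · fun_prop
      · rintro ⟨⟨g, h⟩, x⟩ hx
        simp only at hx ⊢
        rw [hx, sub_self]
        exact e z h (chord_mem_bd_of_le le_rfl)
      · fun_prop
      · fun_prop
      · rintro ⟨⟨g, h⟩, x⟩ hx
        simp only at hx ⊢
        have := hL x
        rw [if_pos (by linarith), hx, show 2 * chL x - chL x = chL x by ring]
        exact e g z (chord_mem_bd_of_ge le_rfl))
    (by
      rintro ⟨g, h⟩ x hx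
      simp only
      rcases hbd hx with h0 | ⟨h0, h1⟩
      · have := hL x
        rw [if_pos (by rw [h0]; linarith), hid x _ (by rw [h0]; ring), g.2 x hx]
      · rw [if_neg (by rw [h1]; linarith), if_neg (by rw [h1]; linarith),
          hid x _ (by rw [h1]; ring), h.2 x hx])
  let H₁ : C(I × Z, Z) := BdFibre.mkMap
    (fun p => p.1.2.1 (chord p.2 ((1 - p.1.1) * chA p.2 + p.1.1 * (3 * chA p.2 - 2 * chL p.2))))
    (BdFibre.continuous_eval (by fun_prop) (by fun_prop))
    (by
      rintro ⟨w, h⟩ x hx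
      simp only
      rcases hbd hx with h0 | ⟨h0, h1⟩
      · rw [chord_eq, h.2 x hx]
        rw [h0]
        refine clampL_of_le ?_
        have := mul_nonneg w.2.1 (hL x)
        linarith
      · rw [hid x _ (by rw [h1]; ring), h.2 x hx])
  let H₂ : C(I × Z, Z) := BdFibre.mkMap
    (fun p => if 3 * chA p.2 ≤ 2 * chL p.2 then
        z.1 (chord p.2 (p.1.1 * min (3 * chA p.2) (2 * chL p.2 - 3 * chA p.2))) else
        p.1.2.1 (chord p.2 (3 * chA p.2 - 2 * chL p.2)))
    (by
      refine Continuous.if_le ?_ ?_ ?_ ?_ ?_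
      · exact z.1.continuous.comp (by fun_prop)
      · exact BdFibre.continuous_eval (by fun_prop) (by fun_prop)
      · fun_prop
      · fun_prop
      · rintro ⟨⟨w, h⟩, x⟩ hx
        simp only at hx ⊢
        have := hL x
        rw [hx, sub_self, min_eq_right (by linarith), mul_zero]
        exact e z h (chord_mem_bd_of_le le_rfl))
    (by
      rintro ⟨w, h⟩ x hx
      simp only
      rcases hbd hx with h0 | ⟨h0, h1⟩
      · have := hL x
        rw [if_pos (by rw [h0]; linarith), h0, min_eq_left (by linarith),
          hid x _ (by rw [h0]; ring), z.2 x hx]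
      · rw [if_neg (by rw [h1]; linarith), hid x _ (by rw [h1]; ring), h.2 x hx])
  let H₃ : C(I × Z, Z) := BdFibre.mkMap
    (fun p => p.1.2.1 (chord p.2 ((1 - p.1.1) * chA p.2 + p.1.1 * (3 * chA p.2))))
    (BdFibre.continuous_eval (by fun_prop) (by fun_prop))
    (by
      rintro ⟨w, h⟩ x hx
      simp only
      rcases hbd hx with h0 | ⟨h0, h1⟩
      · rw [hid x _ (by rw [h0]; ring), h.2 x hx]
      · rw [chord_eq, h.2 x hx]
        rw [← h1]
        refine clampL_of_ge ?_
        have := mul_nonneg w.2.1 (hL x)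
        linarith)
  let H₄ : C(I × Z, Z) := BdFibre.mkMap
    (fun p => if 3 * chA p.2 ≤ chL p.2 then p.1.2.1 (chord p.2 (3 * chA p.2)) else
        z.1 (chord p.2 (chL p.2 - p.1.1 * (chL p.2 - |3 * chA p.2 - 2 * chL p.2|))))
    (by
      refine Continuous.if_le ?_ ?_ ?_ ?_ ?_
      · exact BdFibre.continuous_eval (by fun_prop) (by fun_prop)
      · exact z.1.continuous.comp (by fun_prop)
      · fun_prop
      · fun_prop
      · rintro ⟨⟨w, h⟩, x⟩ hx
        simp only at hx ⊢
        have := hL x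
        rw [hx, show chL x - 2 * chL x = -chL x by ring, abs_neg, abs_of_nonneg this, sub_self,
          mul_zero, sub_zero]
        exact e h z (chord_mem_bd_of_ge le_rfl))
    (by
      rintro ⟨w, h⟩ x hx
      simp only
      rcases hbd hx with h0 | ⟨h0, h1⟩
      · have := hL x
        rw [if_pos (by rw [h0]; linarith), hid x _ (by rw [h0]; ring), h.2 x hx]
      · rw [if_neg (by rw [h1]; linarith), h1, hid x _, z.2 x hx]
        rw [show 3 * chA x - 2 * chA x = chA x by ring, abs_of_pos h0]
        ring)
  let F₁ : (ContinuousMap.id Z).Homotopy (hend H₁) :=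
    { toContinuousMap := H₁
      map_zero_left := fun h => Subtype.ext (ContinuousMap.ext fun x => by
        change h.1 (chord x ((1 - ((0 : I) : ℝ)) * chA x + ((0 : I) : ℝ) * _)) = h.1 x
        rw [hid x _ (by simp)])
      map_one_left := fun h => rfl }
  let F₂ : (hend H₁).Homotopy (μ.comp ⟨fun h => (z, h), by fun_prop⟩) :=
    { toContinuousMap := H₂
      map_zero_left := fun h => Subtype.ext (ContinuousMap.ext fun x => by
        change (if 3 * chA x ≤ 2 * chL x then z.1 (chord x (((0 : I) : ℝ) * _)) else
          h.1 (chord x (3 * chA x - 2 * chL x))) =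
          h.1 (chord x ((1 - ((1 : I) : ℝ)) * chA x + ((1 : I) : ℝ) * _))
        simp only [Set.Icc.coe_zero, zero_mul, Set.Icc.coe_one, sub_self, one_mul, zero_add]
        split_ifs with hx
        · rw [chord_congr (w := 3 * chA x - 2 * chL x) (w' := 0)]
          · exact e z h (chord_mem_bd_of_le le_rfl)
          · rw [clampL_of_le (by linarith), clampL_of_le le_rfl]
        · rfl)
      map_one_left := fun h => Subtype.ext (ContinuousMap.ext fun x => by
        change (if 3 * chA x ≤ 2 * chL x then z.1 (chord x (((1 : I) : ℝ) * _)) else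
          h.1 (chord x (3 * chA x - 2 * chL x))) = (if 3 * chA x ≤ chL x then
          z.1 (chord x (3 * chA x)) else if 3 * chA x ≤ 2 * chL x then
          z.1 (chord x (2 * chL x - 3 * chA x)) else h.1 (chord x (3 * chA x - 2 * chL x)))
        have := hL x
        simp only [Set.Icc.coe_one, one_mul]
        by_cases h1 : 3 * chA x ≤ chL x
        · rw [if_pos h1, if_pos (by linarith), min_eq_left (by linarith)]
        · rw [if_neg h1]
          split_ifs with h2
          · rw [min_eq_right (by linarith)]
          · rfl) }
  let F₃ : (ContinuousMap.id Z).Homotopy (hend H₃) :=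
    { toContinuousMap := H₃
      map_zero_left := fun h => Subtype.ext (ContinuousMap.ext fun x => by
        change h.1 (chord x ((1 - ((0 : I) : ℝ)) * chA x + ((0 : I) : ℝ) * _)) = h.1 x
        rw [hid x _ (by simp)])
      map_one_left := fun h => rfl }
  let F₄ : (hend H₃).Homotopy (μ.comp ⟨fun h => (h, z), by fun_prop⟩) :=
    { toContinuousMap := H₄
      map_zero_left := fun h => Subtype.ext (ContinuousMap.ext fun x => by
        change (if 3 * chA x ≤ chL x then h.1 (chord x (3 * chA x)) else
          z.1 (chord x (chL x - ((0 : I) : ℝ) * _))) =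
          h.1 (chord x ((1 - ((1 : I) : ℝ)) * chA x + ((1 : I) : ℝ) * _))
        simp only [Set.Icc.coe_zero, zero_mul, Set.Icc.coe_one, sub_self, one_mul, zero_add, sub_zero]
        split_ifs with hx
        · rfl
        · rw [chord_congr (w := 3 * chA x) (w' := chL x)]
          · exact e z h (chord_mem_bd_of_ge le_rfl)
          · rw [clampL_of_ge (by linarith), clampL_of_ge le_rfl])
      map_one_left := fun h => Subtype.ext (ContinuousMap.ext fun x => by
        change (if 3 * chA x ≤ chL x then h.1 (chord x (3 * chA x)) else
          z.1 (chord x (chL x - ((1 : I) : ℝ) * (chL x - |3 * chA x - 2 * chL x|)))) =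
          (if 3 * chA x ≤ chL x then
          h.1 (chord x (3 * chA x)) else if 3 * chA x ≤ 2 * chL x then
          z.1 (chord x (2 * chL x - 3 * chA x)) else z.1 (chord x (3 * chA x - 2 * chL x)))
        have := hL x
        simp only [Set.Icc.coe_one, one_mul, sub_sub_cancel]
        by_cases h1 : 3 * chA x ≤ chL x
        · rw [if_pos h1, if_pos h1]
        · rw [if_neg h1, if_neg h1]
          split_ifs with h2
          · rw [abs_of_nonpos (by linarith), neg_sub]
          · rw [abs_of_pos (by linarith)]) }
  exact comm_of_mult μ z (F₁.trans F₂) (F₃.trans F₄) a b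

end PrescribedBoundary

/-! ### Disjoint unions -/

lemma hasInvMean_sigma {ι : Type} {Z : ι → Type} [∀ i, TopologicalSpace (Z i)] (i : ι) (z : Z i)
    (h : HasInvMean (FundamentalGroup (Z i) z)) :
    HasInvMean (FundamentalGroup (Σ i, Z i) ⟨i, z⟩) := by
  refine h.of_surjective (FundamentalGroup.map (ContinuousMap.sigmaMk i) z) fun p => ?_
  obtain ⟨p, rfl⟩ := Path.Homotopic.Quotient.mk_surjective (FundamentalGroup.toPath p)
  obtain ⟨j, g, hg⟩ := ContinuousMap.exists_lift_sigma p.toContinuousMap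
  have h0 : (⟨j, g 0⟩ : Σ i, Z i) = ⟨i, z⟩ := by
    have := congrArg (fun f : C(I, Σ i, Z i) => f 0) hg
    exact this.symm.trans p.source
  have h1 : (⟨j, g 1⟩ : Σ i, Z i) = ⟨i, z⟩ := by
    have := congrArg (fun f : C(I, Σ i, Z i) => f 1) hg
    exact this.symm.trans p.target
  obtain rfl : j = i := congrArg Sigma.fst h0
  have h0' : g 0 = z := by simpa using h0
  have h1' : g 1 = z := by simpa using h1
  refine ⟨FundamentalGroup.fromPath (Path.Homotopic.Quotient.mk ⟨g, h0', h1'⟩), ?_⟩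
  refine (FundamentalGroup.map_apply _ _ _).trans ?_
  change Path.Homotopic.Quotient.map (Path.Homotopic.Quotient.mk _) _ = _
  rw [← Path.Homotopic.Quotient.mk_map]
  congr 1
  refine Path.ext (funext fun t => ?_)
  exact (congrArg (fun f : C(I, Σ i, Z i) => f t) hg).symm

lemma Joined.sigma_eq {ι : Type} {Z : ι → Type} [∀ i, TopologicalSpace (Z i)] {a b : Σ i, Z i}
    (h : Joined a b) : a.1 = b.1 := by
  obtain ⟨p⟩ := h
  obtain ⟨j, g, hg⟩ := ContinuousMap.exists_lift_sigma p.toContinuousMap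
  have h0 : (⟨j, g 0⟩ : Σ i, Z i) = a :=
    (congrArg (fun f : C(I, Σ i, Z i) => f 0) hg).symm.trans p.source
  have h1 : (⟨j, g 1⟩ : Σ i, Z i) = b :=
    (congrArg (fun f : C(I, Σ i, Z i) => f 1) hg).symm.trans p.target
  rw [← h0, ← h1]

end BddCoh

end

noncomputable section
namespace BddCoh
local notation "I" => unitInterval
open Filter

variable {X : Type} [TopologicalSpace X]

/-! ### Edges of simplices -/

/-- The vertices of a simplex. -/
def vtx {k : ℕ} (i : Fin (k + 1)) : Δ k := stdSimplex.vertex i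

lemma smap_vtx {l k : ℕ} (a : Fin (l + 1) → Fin (k + 1)) (i : Fin (l + 1)) :
    smap a (vtx i) = vtx (a i) := stdSimplex.map_vertex a i

lemma vtx_apply {k : ℕ} (i j : Fin (k + 1)) : (vtx i : Δ k) j = if j = i then 1 else 0 := by
  change (Pi.single i (1 : ℝ) : Fin (k + 1) → ℝ) j = _
  rw [Pi.single_apply]

/-- The standard parametrization of the `1`-simplex. -/
def seg : C(I, Δ 1) where
  toFun t := ⟨![1 - t, t], fun i => by fin_cases i; exacts [sub_nonneg.2 t.2.2, t.2.1], by simp⟩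
  continuous_toFun := by
    refine Continuous.subtype_mk (continuous_pi fun i => ?_) _
    fin_cases i
    · exact continuous_const.sub continuous_subtype_val
    · exact continuous_subtype_val

lemma seg_zero : seg 0 = vtx 0 := by
  refine simplex_ext fun i => ?_
  rw [vtx_apply]
  fin_cases i
  · change (1 - ((0 : I) : ℝ)) = _; simp
  · change ((0 : I) : ℝ) = _; simp

lemma seg_one : seg 1 = vtx 1 := by
  refine simplex_ext fun i => ?_
  rw [vtx_apply]
  fin_cases i
  · change (1 - ((1 : I) : ℝ)) = _; simp
  · change ((1 : I) : ℝ) = _; simp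

/-- The parameter of a point of the `1`-simplex. -/
def segInv : C(Δ 1, I) where
  toFun x := ⟨x 1, x.2.1 1, stdSimplex.le_one x 1⟩
  continuous_toFun := (continuous_coord 1).subtype_mk _

lemma seg_segInv (x : Δ 1) : seg (segInv x) = x := by
  refine simplex_ext fun i => ?_
  have hx := x.2.2
  rw [Fin.sum_univ_two] at hx
  fin_cases i
  · change 1 - x.1 1 = x.1 0; linarith
  · rfl

lemma segInv_of_mem_bd {x : Δ 1} (hx : x ∈ bd 1) : segInv x = 0 ∨ segInv x = 1 := by
  obtain ⟨i, hi⟩ := hx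
  have h := x.2.2
  rw [Fin.sum_univ_two] at h
  fin_cases i
  · right; refine Subtype.ext ?_
    change x.1 1 = 1
    have : x.1 0 = 0 := hi
    linarith
  · left; exact Subtype.ext hi

/-- The edges of the standard simplex. -/
def edgeΔ {k : ℕ} (i j : Fin (k + 1)) : Path (vtx i : Δ k) (vtx j) where
  toContinuousMap := (smap ![i, j]).comp seg
  source' := by
    change smap ![i, j] (seg 0) = _
    rw [seg_zero, smap_vtx]; rfl
  target' := by
    change smap ![i, j] (seg 1) = _
    rw [seg_one, smap_vtx]; rfl

lemma edgeΔ_apply {k : ℕ} (i j : Fin (k + 1)) (t : I) :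
    edgeΔ i j t = smap ![i, j] (seg t) := rfl

lemma smap_edgeΔ {l k : ℕ} (a : Fin (l + 1) → Fin (k + 1)) (i j : Fin (l + 1)) (t : I) :
    smap a (edgeΔ i j t) = edgeΔ (a i) (a j) t := by
  rw [edgeΔ_apply, edgeΔ_apply, smap_smap]
  congr 2
  funext x; fin_cases x <;> rfl

lemma edgeΔ_self {k : ℕ} (i : Fin (k + 1)) (t : I) : edgeΔ i i t = vtx i := by
  have : (![i, i] : Fin 2 → Fin (k + 1)) = (fun _ : Fin 1 => i) ∘ fun _ => 0 := by
    funext x; fin_cases x <;> rfl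
  rw [edgeΔ_apply, this, ← smap_smap, Subsingleton.elim (α := Δ 0) (smap _ _) (vtx 0), smap_vtx]

instance (k : ℕ) : SimplyConnectedSpace (Δ k) := by
  have : ContractibleSpace (Δ k) :=
    (convex_stdSimplex ℝ (Fin (k + 1))).contractibleSpace ⟨_, (vtx 0 : Δ k).2⟩
  infer_instance

/-- The class of a path. -/
abbrev pc {x y : X} (p : Path x y) : Path.Homotopic.Quotient x y := Path.Homotopic.Quotient.mk p

/-- An edge of a singular simplex, as a path between named points. -/
def ePath {k : ℕ} {σ : SSimplex X k} {v : Fin (k + 1) → X} (hv : ∀ i, σ (vtx i) = v i)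
    (i j : Fin (k + 1)) : Path (v i) (v j) :=
  ((edgeΔ i j).map σ.continuous).cast (hv i).symm (hv j).symm

lemma ePath_apply {k : ℕ} {σ : SSimplex X k} {v : Fin (k + 1) → X} (hv : ∀ i, σ (vtx i) = v i)
    (i j : Fin (k + 1)) (t : I) : ePath hv i j t = σ (edgeΔ i j t) := rfl

lemma pc_map_simplex {k : ℕ} {σ : SSimplex X k} {v : Fin (k + 1) → X} (hv : ∀ i, σ (vtx i) = v i)
    {i j : Fin (k + 1)} (p q : Path (vtx i : Δ k) (vtx j)) :
    pc ((p.map σ.continuous).cast (hv i).symm (hv j).symm) =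
      pc ((q.map σ.continuous).cast (hv i).symm (hv j).symm) := by
  obtain rfl : (fun i => σ (vtx i)) = v := funext hv
  exact Path.Homotopic.Quotient.eq.2 ((SimplyConnectedSpace.paths_homotopic p q).map σ)

lemma ePath_trans {k : ℕ} {σ : SSimplex X k} {v : Fin (k + 1) → X} (hv : ∀ i, σ (vtx i) = v i)
    (i j l : Fin (k + 1)) : (pc (ePath hv i j)).trans (pc (ePath hv j l)) = pc (ePath hv i l) := by
  rw [← Path.Homotopic.Quotient.mk_trans]
  refine Eq.trans ?_ (pc_map_simplex hv ((edgeΔ i j).trans (edgeΔ j l)) (edgeΔ i l))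
  congr 1
  rw [Path.map_trans]
  obtain rfl : (fun i => σ (vtx i)) = v := funext hv
  rfl

lemma ePath_self {k : ℕ} {σ : SSimplex X k} {v : Fin (k + 1) → X} (hv : ∀ i, σ (vtx i) = v i)
    (i : Fin (k + 1)) : pc (ePath hv i i) = Path.Homotopic.Quotient.refl (v i) := by
  rw [← Path.Homotopic.Quotient.mk_refl]
  congr 1
  refine Path.ext (funext fun t => ?_)
  rw [ePath_apply, edgeΔ_self, hv]; rfl

/-! ### Special cochains -/

/-- Paths which are constant or contained in `Y`. -/
def AdmPath (Y : Set X) {x y : X} (c : Path x y) : Prop := (∀ t, c t = x) ∨ ∀ t, c t ∈ Y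

/-- Cochains depending only on the edges of a simplex, up to homotopy and up to moving the vertices
inside `Y`. -/
def GInv (Y : Set X) {k : ℕ} (F : SCochain X k) : Prop :=
  ∀ (σ σ' : SSimplex X k) (v v' : Fin (k + 1) → X) (hv : ∀ i, σ (vtx i) = v i)
    (hv' : ∀ i, σ' (vtx i) = v' i) (c : ∀ i, Path (v i) (v' i)), (∀ i, AdmPath Y (c i)) →
    (∀ i j, (pc (ePath hv i j)).trans (pc (c j)) = (pc (c i)).trans (pc (ePath hv' i j))) →
    (F σ = F σ')

/-- Alternating cochains which depend only on the edges of a simplex, up to homotopy and up to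
moving the vertices inside `Y`. -/
structure Special (Y : Set X) {k : ℕ} (F : SCochain X k) : Prop where
  alt : IsAlt F
  ginv : GInv Y F

lemma comp_smap_vtx {k l : ℕ} {σ : SSimplex X k} {v : Fin (k + 1) → X} (hv : ∀ i, σ (vtx i) = v i)
    (a : Fin (l + 1) → Fin (k + 1)) : ∀ i, (σ.comp (smap a)) (vtx i) = (v ∘ a) i := fun i => by
  rw [ContinuousMap.comp_apply, smap_vtx, hv]; rfl

lemma ePath_comp {k l : ℕ} {σ : SSimplex X k} {v : Fin (k + 1) → X} (hv : ∀ i, σ (vtx i) = v i)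
    (a : Fin (l + 1) → Fin (k + 1)) (i j : Fin (l + 1)) :
    ePath (comp_smap_vtx hv a) i j = ePath hv (a i) (a j) := by
  refine Path.ext (funext fun t => ?_)
  rw [ePath_apply, ePath_apply, ContinuousMap.comp_apply, smap_edgeΔ]

lemma GInv.altCo {Y : Set X} {k : ℕ} {F : SCochain X k} (hF : GInv Y F) : GInv Y (altCo F) := by
  intro σ σ' v v' hv hv' c hc h
  simp only [BddCoh.altCo]
  congr 1
  refine Finset.sum_congr rfl fun π _ => ?_
  congr 1
  refine hF _ _ _ _ (comp_smap_vtx hv π) (comp_smap_vtx hv' π) (fun i => c (π i))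
    (fun i => hc (π i)) fun i j => ?_
  rw [ePath_comp, ePath_comp]
  exact h (π i) (π j)

lemma Special.vanEdge {Y : Set X} {k : ℕ} {F : SCochain X k} (hF : Special Y F) : VanEdge Y F := by
  intro σ a b hab hadm
  have h1 := hF.alt σ (Equiv.swap a b)
  rw [Equiv.Perm.sign_swap hab] at h1
  set π := Equiv.swap a b
  have hv : ∀ i, σ (vtx i) = σ (vtx i) := fun _ => rfl
  have h2 : F σ = F (σ.comp (smap π)) := by
    refine hF.ginv _ _ _ _ hv (comp_smap_vtx hv π)
      (fun i => ePath hv i (π i)) (fun i => ?_) fun i j => ?_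
    · have hab' : ∀ i t, i ≠ a → i ≠ b → edgeΔ i (π i) t = vtx i := fun i t h h' => by
        rw [show π i = i from Equiv.swap_apply_of_ne_of_ne h h', edgeΔ_self]
      have hE : ∀ i, i = a ∨ i = b → ∀ t, ∃ x, smap ![a, b] x = edgeΔ i (π i) t := by
        rintro i (rfl | rfl) t
        · exact ⟨seg t, by rw [edgeΔ_apply, Equiv.swap_apply_left]⟩
        · refine ⟨smap ![1, 0] (seg t), ?_⟩
          rw [edgeΔ_apply, Equiv.swap_apply_right, smap_smap]
          congr 2
          funext x; fin_cases x <;> rfl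
      by_cases hi : i = a ∨ i = b
      · rcases hadm with h | h
        · left
          intro t
          rw [ePath_apply]
          obtain ⟨x, hx⟩ := hE i hi t
          obtain ⟨y, hy⟩ := hE i hi 0
          rw [← hx]
          rw [(edgeΔ i (π i)).source] at hy
          rw [← hy]
          exact h x y
        · right
          intro t
          rw [ePath_apply]
          obtain ⟨x, hx⟩ := hE i hi t
          rw [← hx]
          exact h x
      · rw [not_or] at hi
        left
        intro t
        rw [ePath_apply, hab' i t hi.1 hi.2]
    · rw [ePath_comp hv, ePath_trans, ePath_trans]
  rw [← h2] at h1
  simp at h1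
  linarith

lemma Special.mem_vanishingOn {Y : Set X} {k : ℕ} {F : SCochain X (k + 1)} (hF : Special Y F) :
    F ∈ vanishingOn X Y (k + 1) := fun σ hσ =>
  hF.vanEdge σ 0 1 (by simp) (Or.inr fun _ => hσ ⟨_, rfl⟩)

lemma VanEdge.zero {Y : Set X} {k : ℕ} : VanEdge Y (0 : SCochain X k) := fun _ _ _ _ _ => rfl

lemma VanEdge.altOp_eq_zero {Y : Set X} {k : ℕ} {G : SCochain X (k + 1)} (hG : VanEdge Y G) :
    altOp G = 0 := by
  funext σ
  refine tpair_eq_zero (fun a => ?_) _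
  obtain ⟨p, q, hpq, hv⟩ := Fintype.exists_ne_map_eq_of_card_lt a (by simp)
  refine hG _ p q hpq (Or.inl fun x y => ?_)
  rw [ContinuousMap.comp_assoc, smap_comp]
  have : (a ∘ ![p, q]) = (fun _ : Fin 1 => a p) ∘ fun _ => 0 := by
    funext x; fin_cases x
    · rfl
    · exact hv.symm
  rw [this, ← smap_comp]
  change σ (smap _ (smap _ x)) = σ (smap _ (smap _ y))
  rw [Subsingleton.elim (α := Δ 0) (smap _ x) (smap _ y)]

/-! ### Averaging over labels -/

/-- The iterated limit over labels. -/
def labelLim : ∀ n : ℕ, ((Fin n → ℕ) → ℝ) → ℝ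
  | 0 => fun g => g Fin.elim0
  | n + 1 => fun g => ulim (hyperfilter ℕ) fun a => labelLim n fun l => g (Fin.cons a l)

lemma isMean_labelLim : ∀ n, IsMean (labelLim n)
  | 0 => isMean_eval _
  | n + 1 => (isMean_ulim _).bind fun a => (isMean_labelLim n).map fun l => (Fin.cons a l : Fin (n + 1) → ℕ)

lemma labelLim_face : ∀ (n : ℕ) (i : Fin (n + 1)) (g : (Fin n → ℕ) → ℝ),
    labelLim (n + 1) (fun l => g (l ∘ i.succAbove)) = labelLim n g := by
  intro n
  induction n with
  | zero =>
    intro i g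
    have : ∀ l : Fin 0 → ℕ, l = Fin.elim0 := fun l => Subsingleton.elim _ _
    simp only [labelLim, this]
    exact (isMean_ulim _).const _
  | succ n ih =>
    intro i g
    induction i using Fin.cases with
    | zero =>
      change ulim _ (fun a => labelLim (n + 1) fun l => g (Fin.cons a l ∘ Fin.succAbove 0)) = _
      have : ∀ (a : ℕ) (l : Fin (n + 1) → ℕ), (Fin.cons a l : Fin (n + 2) → ℕ) ∘ Fin.succAbove 0 = l :=
        fun a l => by funext x; simp
      simp only [this]
      exact (isMean_ulim _).const _
    | succ i =>
      change ulim _ (fun a => labelLim (n + 1) fun l => g (Fin.cons a l ∘ Fin.succAbove i.succ)) =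
        ulim _ fun a => labelLim n fun l => g (Fin.cons a l)
      congr 1
      funext a
      rw [← ih i]
      congr 1
      funext l
      congr 1
      funext x
      refine Fin.cases ?_ (fun x => ?_) x <;> simp

lemma labelLim_congr : ∀ (n : ℕ) (S : Finset ℕ) (g g' : (Fin n → ℕ) → ℝ),
    (∀ l, Function.Injective l → (∀ i, l i ∉ S) → g l = g' l) → labelLim n g = labelLim n g' := by
  intro n
  induction n with
  | zero =>
    intro S g g' h
    exact h _ (fun x => x.elim0) (fun x => x.elim0)
  | succ n ih =>
    intro S g g' h
    refine ulim_congr _ ?_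
    have hS : ∀ᶠ a in (hyperfilter ℕ : Filter ℕ), a ∉ S :=
      (Set.Finite.compl_mem_hyperfilter (s := (S : Set ℕ)) S.finite_toSet)
    filter_upwards [hS] with a ha
    refine ih (insert a S) _ _ fun l hl hlS => h _ ?_ ?_
    · refine Fin.cons_injective_iff.2 ⟨?_, hl⟩
      rintro ⟨x, hx⟩
      exact hlS x (by rw [hx]; exact Finset.mem_insert_self _ _)
    · intro i
      refine Fin.cases ?_ (fun i => ?_) i
      · simpa using ha
      · simpa using fun hh => hlS i (Finset.mem_insert_of_mem hh)

lemma lcob_lcob {L : Type} {k : ℕ} (f : LCo X L k) (σ : SSimplex X (k + 2)) (l : Fin (k + 3) → L) :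
    lcob (lcob f) σ l = 0 := by
  change ∑ i : Fin (k + 3), (-1 : ℝ) ^ (i : ℕ) * ∑ j : Fin (k + 2), (-1 : ℝ) ^ (j : ℕ) *
    f (faceOf (faceOf σ i) j) ((l ∘ i.succAbove) ∘ j.succAbove) = 0
  rw [← sum_succAbove_succAbove (A := ℝ) (fun b => f (σ.comp (smap b)) (l ∘ b))]
  refine Finset.sum_congr rfl fun i _ => ?_
  rw [Finset.mul_sum]
  refine Finset.sum_congr rfl fun j _ => ?_
  rw [faceOf, faceOf, face_eq_smap, face_eq_smap, ContinuousMap.comp_assoc, smap_comp, smul_eq_mul,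
    mul_assoc, Function.comp_assoc]

/-! ### Spaces of simplices -/

/-- Simplices, topologized as the disjoint union of the spaces with prescribed boundary. -/
abbrev BdTotal (X : Type) [TopologicalSpace X] (i : ℕ) : Type := Σ c : bd i → X, BdFibre X i c

/-- The simplex given by a point of the total space. -/
def bdVal (X : Type) [TopologicalSpace X] (i : ℕ) : C(BdTotal X i, C(Δ i, X)) where
  toFun z := z.2.1
  continuous_toFun := continuous_sigma fun _ => continuous_subtype_val

lemma bdVal_bijective (i : ℕ) : Function.Bijective (bdVal X i) := by
  constructor
  · rintro ⟨c, g, hg⟩ ⟨c', g', hg'⟩ h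
    have h' : g = g' := h
    subst h'
    obtain rfl : c = c' := funext fun x => (hg x.1 x.2).symm.trans (hg' x.1 x.2)
    rfl
  · intro g
    exact ⟨⟨fun x => g x.1, g, fun _ _ => rfl⟩, rfl⟩

lemma bdVal_rel {i : ℕ} (z z' : BdTotal X i) (h : Joined z z') :
    ∀ x ∈ bd i, bdVal X i z x = bdVal X i z' x := by
  have := Joined.sigma_eq h
  obtain ⟨c, g⟩ := z
  obtain ⟨c', g'⟩ := z'
  simp only at this
  subst this
  exact fun x hx => g.eq_on_bd g' hx

lemma bdVal_lift {i : ℕ} (p : C(I, C(Δ i, X))) (hp : ∀ t, ∀ x ∈ bd i, p t x = p 0 x) :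
    ∃ c : C(I, BdTotal X i), ∀ t, bdVal X i (c t) = p t :=
  ⟨⟨fun t => ⟨fun x => p 0 x.1, p t, fun x hx => hp t x hx⟩,
    continuous_sigmaMk.comp (p.continuous.subtype_mk _)⟩, fun _ => rfl⟩

lemma bdVal_hasInvMean {n : ℕ} (z : BdTotal X (n + 1)) :
    HasInvMean (FundamentalGroup (BdTotal X (n + 1)) z) :=
  hasInvMean_sigma z.1 z.2 (hasInvMean_of_comm (BdFibre.comm z.2))

/-- The part of `X` over an index: all of `Y`, or a single point outside of `Y`. -/
def PtFibre (Y : Set X) (c : Option X) : Type := {x : X // (x ∈ Y ∧ c = none) ∨ (x ∉ Y ∧ c = some x)}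

instance (Y : Set X) (c : Option X) : TopologicalSpace (PtFibre Y c) := instTopologicalSpaceSubtype

/-- `X`, topologized as the disjoint union of `Y` and of the points outside of `Y`. -/
abbrev PtTotal (Y : Set X) : Type := Σ c : Option X, PtFibre Y c

/-- The constant simplex at a point. -/
def ptVal (Y : Set X) : C(PtTotal Y, C(Δ 0, X)) where
  toFun z := ContinuousMap.const _ z.2.1
  continuous_toFun := continuous_sigma fun _ =>
    ContinuousMap.continuous_const'.comp continuous_subtype_val

lemma ptVal_bijective (Y : Set X) : Function.Bijective (ptVal Y) := by
  constructor
  · rintro ⟨c, x, hx⟩ ⟨c', x', hx'⟩ h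
    have h' : x = x' := congrArg (fun g : C(Δ 0, X) => g (vtx 0)) h
    subst h'
    obtain rfl : c = c' := by
      rcases hx with ⟨h1, rfl⟩ | ⟨h1, rfl⟩ <;> rcases hx' with ⟨h2, rfl⟩ | ⟨h2, rfl⟩
      · rfl
      · exact absurd h1 h2
      · exact absurd h2 h1
      · rfl
    rfl
  · intro g
    have hg : ∀ x, g x = g (vtx 0) := fun x => by rw [Subsingleton.elim x (vtx 0)]
    by_cases h : g (vtx 0) ∈ Y
    · exact ⟨⟨none, g (vtx 0), Or.inl ⟨h, rfl⟩⟩, ContinuousMap.ext fun x => (hg x).symm⟩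
    · exact ⟨⟨some (g (vtx 0)), g (vtx 0), Or.inr ⟨h, rfl⟩⟩, ContinuousMap.ext fun x => (hg x).symm⟩

lemma ptVal_edge (Y : Set X) (c : C(I, PtTotal Y)) :
    (∀ t t', ptVal Y (c t) = ptVal Y (c t')) ∨ ∀ t x, ptVal Y (c t) x ∈ Y := by
  obtain ⟨j, g, rfl⟩ := ContinuousMap.exists_lift_sigma c
  cases j with
  | none =>
    right
    intro t x
    change (g t).1 ∈ Y
    rcases (g t).2 with h | h
    · exact h.1
    · exact absurd h.2 (by simp)
  | some x =>
    left
    intro t t'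
    have : ∀ t, (g t).1 = x := fun t => by
      rcases (g t).2 with h | h
      · exact absurd h.2 (by simp)
      · exact (Option.some.inj h.2).symm
    ext y
    change (g t).1 = (g t').1
    rw [this, this]

lemma ptVal_lift (Y : Set X) {x y : X} (p : Path x y) (hp : AdmPath Y p) :
    ∃ c : C(I, PtTotal Y), ∀ t s, ptVal Y (c t) s = p t := by
  have hconst : (∀ t, p t = x) → ∃ c : C(I, PtTotal Y), ∀ t s, ptVal Y (c t) s = p t := by
    intro h
    obtain ⟨z, hz⟩ := (ptVal_bijective Y).2 (ContinuousMap.const _ x)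
    refine ⟨ContinuousMap.const _ z, fun t s => ?_⟩
    rw [ContinuousMap.const_apply, hz, h t]; rfl
  rcases hp with h | h
  · exact hconst h
  · exact ⟨⟨fun t => ⟨none, p t, Or.inl ⟨h t, rfl⟩⟩,
      continuous_sigmaMk.comp (p.continuous.subtype_mk _)⟩, fun _ _ => rfl⟩

lemma ptVal_hasInvMean {Y : Set X} (hY : ∀ y : Y, HasInvMean (FundamentalGroup Y y)) (z : PtTotal Y) :
    HasInvMean (FundamentalGroup (PtTotal Y) z) := by
  obtain ⟨c, z⟩ := z
  refine hasInvMean_sigma c z ?_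
  cases c with
  | none =>
    have hm : ∀ z : PtFibre Y none, z.1 ∈ Y := fun z => by
      rcases z.2 with h | h
      · exact h.1
      · exact absurd h.2 (by simp)
    let j : C(Y, PtFibre Y none) := ⟨fun y => ⟨y.1, Or.inl ⟨y.2, rfl⟩⟩,
      continuous_subtype_val.subtype_mk _⟩
    refine (hY ⟨z.1, hm z⟩).of_surjective (FundamentalGroup.map j ⟨z.1, hm z⟩) fun p => ?_
    obtain ⟨p, rfl⟩ := Path.Homotopic.Quotient.mk_surjective (FundamentalGroup.toPath p)
    refine ⟨FundamentalGroup.fromPath (Path.Homotopic.Quotient.mk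
      ⟨⟨fun t => ⟨(p t).1, hm _⟩, (continuous_subtype_val.comp p.continuous).subtype_mk _⟩,
        Subtype.ext (show (p 0).1 = z.1 by rw [p.source]),
        Subtype.ext (show (p 1).1 = z.1 by rw [p.target])⟩), ?_⟩
    refine (FundamentalGroup.map_apply _ _ _).trans ?_
    change Path.Homotopic.Quotient.map (Path.Homotopic.Quotient.mk _) _ = _
    rw [← Path.Homotopic.Quotient.mk_map]
    congr 1
  | some x =>
    have hs : Subsingleton (PtFibre Y (some x)) := by
      refine ⟨fun a b => ?_⟩
      have : ∀ z : PtFibre Y (some x), z.1 = x := fun z => by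
        rcases z.2 with h | h
        · exact absurd h.2 (by simp)
        · exact (Option.some.inj h.2).symm
      exact Subtype.ext ((this a).trans (this b).symm)
    refine hasInvMean_of_comm fun a b => ?_
    obtain ⟨a, rfl⟩ := Path.Homotopic.Quotient.mk_surjective (FundamentalGroup.toPath a)
    obtain ⟨b, rfl⟩ := Path.Homotopic.Quotient.mk_surjective (FundamentalGroup.toPath b)
    have : a = b := Path.ext (funext fun t => Subsingleton.elim _ _)
    rw [this]

end BddCoh

end

noncomputable section
namespace BddCoh
local notation "I" => unitInterval

variable {X : Type} [TopologicalSpace X]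

/-- Cancelling in a square of paths. -/
lemma exists_square {x y x' y' x'' y'' : X} (hx : x'' = x') (hy : y'' = y') (s : Path x y)
    (c : Path x x') (d : Path y y') (c' : Path x x'') (d' : Path y y'') (s' : Path x' y')
    (b : Path x'' y'') (hc : ∀ t, c' t = c t) (hd : ∀ t, d' t = d t)
    (h1 : (s.trans d').Homotopic (c'.trans b))
    (h2 : (pc s).trans (pc d) = (pc c).trans (pc s')) :
    ∃ F : C(I × I, X), (∀ t, F (0, t) = b t) ∧ (∀ t, F (1, t) = s' t) ∧
      (∀ r, F (r, 0) = x') ∧ ∀ r, F (r, 1) = y' := by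
  subst hx hy
  obtain rfl : c' = c := Path.ext (funext hc)
  obtain rfl : d' = d := Path.ext (funext hd)
  have h3 : (pc c').trans (pc b) = (pc c').trans (pc s') := by
    rw [← h2, ← Path.Homotopic.Quotient.mk_trans, ← Path.Homotopic.Quotient.mk_trans]
    exact (Path.Homotopic.Quotient.eq.2 h1).symm
  have h4 := congrArg (fun p => (pc c').symm.trans p) h3
  simp only [← Path.Homotopic.Quotient.trans_assoc, Path.Homotopic.Quotient.symm_trans,
    Path.Homotopic.Quotient.refl_trans] at h4
  obtain ⟨F⟩ := Path.Homotopic.Quotient.exact h4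
  exact ⟨F.toContinuousMap, F.map_zero_left, F.map_one_left, F.source, F.target⟩

/-- Moving the vertices of a simplex along paths. -/
lemma relP_of_paths {Y : Set X} {k : ℕ} {σ σ' : SSimplex X k} {v v' : Fin (k + 1) → X}
    (hv : ∀ i, σ (vtx i) = v i) (hv' : ∀ i, σ' (vtx i) = v' i) (c : ∀ i, Path (v i) (v' i))
    (hc : ∀ i, AdmPath Y (c i))
    (h : ∀ i j, (pc (ePath hv i j)).trans (pc (c j)) = (pc (c i)).trans (pc (ePath hv' i j))) :
    RelP (ptVal Y) σ σ' := by
  have hsm0 : ∀ (a : Fin 1 → Fin (k + 1)) (x : Δ 0), smap a x = vtx (a 0) := fun a x => by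
    rw [Subsingleton.elim x (vtx 0), smap_vtx]
  obtain ⟨m, m0, mθ⟩ := exists_move (i := 0) σ
    (fun a => (c (a 0)).toContinuousMap.comp ⟨Prod.fst, continuous_fst⟩)
    (fun a _ x => by
      change c (a 0) 0 = _
      rw [hsm0, (c (a 0)).source, hv])
    (fun a _ t x hx => absurd hx (notMem_bd_zero x))
  have mc : ∀ i t, m (t, vtx i) = c i t := by
    intro i t
    have := mθ (fun _ => i) (fun x y hxy => absurd (Subsingleton.elim (α := Fin 1) x y) hxy.ne) t (vtx 0)
    rw [hsm0] at this
    exact this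
  refine ⟨hend m, hpath m m0 (fun _ => rfl), fun a ha => ?_, fun a ha => ?_, fun a ha => ?_⟩
  · obtain ⟨g, hg⟩ := ptVal_lift Y (c (a 0)) (hc (a 0))
    refine ⟨g, fun t => ?_⟩
    ext x
    rw [hg]
    change _ = m (t, smap a x)
    rw [hsm0, mc]
  · ext x
    change m (1, smap a x) = σ' (smap a x)
    rw [hsm0, mc, (c _).target, hv']
  · set i := a 0
    set j := a 1
    have haij : a = ![i, j] := by funext x; fin_cases x <;> rfl
    let M : σ.Homotopy (hend m) :=
      { toContinuousMap := m, map_zero_left := m0, map_one_left := fun _ => rfl }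
    have hend_v : ∀ i, hend m (vtx i) = v' i := fun i => by
      change m (1, vtx i) = _
      rw [mc, (c i).target]
    obtain rfl : (fun i => σ (vtx i)) = v := funext hv
    obtain ⟨F, F0, F1, Fs, Ft⟩ := exists_square (hend_v i) (hend_v j) (ePath hv i j) (c i) (c j)
      (M.evalAt (vtx i)) (M.evalAt (vtx j)) (ePath hv' i j)
      ((edgeΔ i j).map (hend m).continuous) (mc i) (mc j)
      (Path.Homotopic.map_trans_evalAt M (edgeΔ i j)) (h i j)
    have hsg : ∀ x : Δ 1, edgeΔ i j (segInv x) = smap a x := fun x => by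
      rw [edgeΔ_apply, seg_segInv, haij]
    refine hRel_of (F.comp ((ContinuousMap.id I).prodMap segInv)) (fun x => ?_) (fun x => ?_) ?_
    · change F (0, segInv x) = hend m (smap a x)
      rw [F0, ← hsg]; rfl
    · change F (1, segInv x) = σ' (smap a x)
      rw [F1, ← hsg]; rfl
    · intro t x hx
      change F (t, segInv x) = hend m (smap a x)
      rw [← hsg]
      rcases segInv_of_mem_bd hx with h | h
      · rw [h, Fs, Path.source, hend_v]
      · rw [h, Ft, Path.target, hend_v]

/-- Bounded cochains whose coboundary vanishes on simplices with inessential edges are, up to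
bounded coboundaries, labelled cochains invariant under moving vertices. -/
theorem exists_labelled {Y : Set X} (hY : ∀ y : Y, HasInvMean (FundamentalGroup Y y)) {k : ℕ}
    (f : SCochain X (k + 1)) {C : ℝ} (hf : ∀ σ, |f σ| ≤ C) (hG : VanEdge Y (scob X (k + 1) f)) :
    ∃ (f' : LCo X ℕ (k + 1)) (b : LCo X ℕ k), (∀ σ l, |f' σ l| ≤ C) ∧
      (∃ B, ∀ σ l, |b σ l| ≤ B) ∧ (∀ σ l, f' σ l - f σ = lcob b σ l) ∧
      ∀ σ σ' l, Function.Injective l → RelP (ptVal Y) σ σ' → f' σ l = f' σ' l := by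
  have hcob : ∀ (f' : LCo X ℕ (k + 1)) (b : LCo X ℕ k), (∀ σ l, f' σ l - f σ = lcob b σ l) →
      ∀ σ l, lcob f' σ l = scob X (k + 1) f σ := by
    intro f' b h σ l
    have h1 := lcob_lcob b σ l
    have h2 : lcob b = fun σ l => f' σ l - f σ := by funext σ l; exact (h σ l).symm
    rw [h2] at h1
    simp only [lcob, mul_sub, Finset.sum_sub_distrib] at h1
    exact sub_eq_zero.1 h1
  have hadd : ∀ (f' f'' : LCo X ℕ (k + 1)) (b b' : LCo X ℕ k),
      (∀ σ l, f' σ l - f σ = lcob b σ l) → (∀ σ l, f'' σ l - f' σ l = lcob b' σ l) →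
      ∀ σ l, f'' σ l - f σ = lcob (fun σ l => b σ l + b' σ l) σ l := by
    intro f' f'' b b' h h' σ l
    have : lcob (fun σ l => b σ l + b' σ l) σ l = lcob b σ l + lcob b' σ l := by
      simp only [lcob, mul_add, Finset.sum_add_distrib]
    rw [this, ← h, ← h']; ring
  have hQ : ∀ d j : ℕ, j + d = k + 1 →
      ∃ (f' : LCo X ℕ (k + 1)) (b : LCo X ℕ k), (∀ σ l, |f' σ l| ≤ C) ∧
        (∃ B, ∀ σ l, |b σ l| ≤ B) ∧ (∀ σ l, f' σ l - f σ = lcob b σ l) ∧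
        ∀ σ σ' l, Function.Injective l → RelR j σ σ' → f' σ l = f' σ' l := by
    intro d
    induction d with
    | zero =>
      intro j hj
      obtain rfl : j = k + 1 := hj
      refine ⟨fun σ _ => f σ, fun _ _ => 0, fun σ _ => hf σ, ⟨0, by simp⟩, by simp [lcob], ?_⟩
      intro σ σ' l _ h
      rw [relR_self_iff.1 h]
    | succ d ih =>
      intro j hj
      obtain ⟨f', b, h1, ⟨B, h2⟩, h3, h4⟩ := ih (j + 1) (by omega)
      obtain ⟨f'', b', h1', ⟨B', h2'⟩, h3', h4'⟩ := exists_averaged (bdVal X (j + 1))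
        (bdVal_bijective _) bdVal_rel bdVal_hasInvMean Y (by simp) f' h1 hG (hcob f' b h3) h4
      refine ⟨f'', fun σ l => b σ l + b' σ l, h1', ⟨B + B', fun σ l =>
        (abs_add_le _ _).trans (add_le_add (h2 σ l) (h2' σ l))⟩, hadd f' f'' b b' h3 h3', ?_⟩
      intro σ σ' l hl h
      exact h4' σ σ' l hl (relP_of_relR _ bdVal_rel bdVal_lift h)
  obtain ⟨f', b, h1, ⟨B, h2⟩, h3, h4⟩ := hQ (k + 1) 0 (by omega)
  obtain ⟨f'', b', h1', ⟨B', h2'⟩, h3', h4'⟩ := exists_averaged (ptVal Y) (ptVal_bijective Y)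
    (fun z z' _ x hx => absurd hx (notMem_bd_zero x)) (ptVal_hasInvMean hY) Y
    (fun _ => ptVal_edge Y) f' h1 hG (hcob f' b h3) h4
  exact ⟨f'', fun σ l => b σ l + b' σ l, h1', ⟨B + B', fun σ l =>
    (abs_add_le _ _).trans (add_le_add (h2 σ l) (h2' σ l))⟩, hadd f' f'' b b' h3 h3', h4'⟩

/-- Bounded cochains whose coboundary vanishes on simplices with inessential edges are special up
to bounded coboundaries. -/
theorem exists_special {Y : Set X} (hY : ∀ y : Y, HasInvMean (FundamentalGroup Y y)) {k : ℕ}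
    (f : SCochain X (k + 1)) {C : ℝ} (hf : ∀ σ, |f σ| ≤ C) (hG : VanEdge Y (scob X (k + 1) f)) :
    ∃ (F : SCochain X (k + 1)) (b : SCochain X k), (∀ σ, |F σ| ≤ C) ∧ b ∈ bddCochains X k ∧
      F - f = scob X k b ∧ Special Y F := by
  obtain ⟨f', b, h1, ⟨B, h2⟩, h3, h4⟩ := exists_labelled hY f hf hG
  let F₀ : SCochain X (k + 1) := fun σ => labelLim (k + 2) (f' σ)
  let b₀ : SCochain X k := fun σ => labelLim (k + 1) (b σ)
  have hM := isMean_labelLim (k + 2)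
  have hF₀ : ∀ σ, |F₀ σ| ≤ C := fun σ => hM.abs_le _ _ (h1 σ)
  have hsub : F₀ - f = scob X k b₀ := by
    funext σ
    have e1 := hM.sub (f := f' σ) (g := fun _ => f σ) ⟨C, h1 σ⟩ (bdd_const _)
    rw [hM.const] at e1
    change F₀ σ - f σ = ∑ i : Fin (k + 2), ((-1 : ℝ) ^ (i : ℕ)) * b₀ (faceOf σ i)
    rw [← e1]
    simp only [h3, lcob]
    rw [hM.sum _ fun i _ => Bdd.smul _ ⟨B, fun l => h2 _ _⟩]
    refine Finset.sum_congr rfl fun i _ => ?_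
    rw [hM.smul _ _ ⟨B, fun l => h2 _ _⟩, labelLim_face]
  have hinv : GInv Y F₀ := by
    intro σ σ' v v' hv hv' c hc h
    exact labelLim_congr _ ∅ _ _ fun l hl _ => h4 σ σ' l hl (relP_of_paths hv hv' c hc h)
  have hcob : scob X (k + 1) F₀ = scob X (k + 1) f := by
    rw [← sub_eq_zero, ← map_sub, hsub, scob_scob]
  refine ⟨altCo F₀, b₀ + altOp F₀, abs_altCo_le hF₀, ?_, ?_, isAlt_altCo F₀, hinv.altCo⟩
  · exact Submodule.add_mem _ ⟨B, fun σ => (isMean_labelLim _).abs_le _ _ (h2 σ)⟩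
      ⟨_, fun σ => abs_altOp_le hF₀ σ⟩
  · have h5 := altCo_sub F₀
    rw [hcob, hG.altOp_eq_zero, add_zero] at h5
    rw [map_add, ← hsub, ← h5]; abel

lemma scob_apply {k : ℕ} (f : SCochain X k) (σ : SSimplex X (k + 1)) :
    scob X k f σ = ∑ i : Fin (k + 2), (-1 : ℝ) ^ (i : ℕ) * f (faceOf σ i) := rfl

lemma abs_scob_le {k : ℕ} {f : SCochain X k} {C : ℝ} (hf : ∀ σ, |f σ| ≤ C)
    (σ : SSimplex X (k + 1)) : |scob X k f σ| ≤ (k + 2) * C := by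
  rw [scob_apply]
  refine (Finset.abs_sum_le_sum_abs _ _).trans ?_
  refine (Finset.sum_le_card_nsmul _ _ C fun i _ => ?_).trans ?_
  · rw [abs_mul, abs_pow, abs_neg, abs_one, one_pow, one_mul]
    exact hf _
  · simp

/-- Extension by zero of a cochain on `Y`. -/
lemma exists_extend_cochain (Y : Set X) {k : ℕ} (c : SCochain Y k) :
    ∃ c' : SCochain X k, (∀ τ : SSimplex Y k, c' ((subIncl Y).comp τ) = c τ) ∧
      ∀ C, (∀ τ, |c τ| ≤ C) → 0 ≤ C → ∀ σ, |c' σ| ≤ C := by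
  classical
  refine ⟨fun σ => if h : ∃ τ : SSimplex Y k, (subIncl Y).comp τ = σ then c h.choose else 0, ?_, ?_⟩
  · intro τ
    have h : ∃ τ' : SSimplex Y k, (subIncl Y).comp τ' = (subIncl Y).comp τ := ⟨τ, rfl⟩
    simp only [dif_pos h]
    congr 1
    ext x
    exact congrArg (fun g : SSimplex X k => g x) h.choose_spec
  · intro C hC h0 σ
    dsimp only
    split_ifs
    · exact hC _
    · simpa using h0

lemma exists_lift_subIncl {Y : Set X} {k : ℕ} {σ : SSimplex X k} (h : Set.range σ ⊆ Y) :
    ∃ τ : SSimplex Y k, (subIncl Y).comp τ = σ :=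
  ⟨⟨fun x => ⟨σ x, h ⟨x, rfl⟩⟩, σ.continuous.subtype_mk _⟩, rfl⟩

/-- The relative version: a relative cochain of degree at least two differs from a special one by
the coboundary of a relative one. -/
theorem exists_special_rel {Y : Set X} (hY : ∀ y : Y, HasInvMean (FundamentalGroup Y y)) {k : ℕ}
    (f : SCochain X (k + 2)) (hfY : f ∈ vanishingOn X Y (k + 2)) {C : ℝ} (hf : ∀ σ, |f σ| ≤ C)
    (hG : VanEdge Y (scob X (k + 2) f)) :
    ∃ (F : SCochain X (k + 2)) (b : SCochain X (k + 1)), (∀ σ, |F σ| ≤ C) ∧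
      b ∈ relBC X Y (k + 1) ∧ F - f = scob X (k + 1) b ∧ Special Y F := by
  obtain ⟨F, b, hF, ⟨B, hB⟩, hFf, hS⟩ := exists_special hY f hf hG
  let bY : SCochain Y (k + 1) := pb (subIncl Y) (k + 1) b
  have hbY : scob Y (k + 1) bY = 0 := by
    rw [pb_scob, ← hFf]
    funext τ
    have hr : Set.range ((subIncl Y).comp τ) ⊆ Y := by
      rintro - ⟨x, rfl⟩; exact (τ x).2
    change F _ - f _ = 0
    rw [hS.mem_vanishingOn _ hr, hfY _ hr, sub_zero]
  have hUniv : ∀ y : (Set.univ : Set Y), HasInvMean (FundamentalGroup (Set.univ : Set Y) y) := by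
    intro y
    refine (hY y.1).of_surjective (FundamentalGroup.map
      (⟨fun z => ⟨z, trivial⟩, by fun_prop⟩ : C(Y, (Set.univ : Set Y))) y.1) fun p => ?_
    obtain ⟨p, rfl⟩ := Path.Homotopic.Quotient.mk_surjective (FundamentalGroup.toPath p)
    refine ⟨FundamentalGroup.fromPath (Path.Homotopic.Quotient.mk
      (p.map continuous_subtype_val)), ?_⟩
    refine (FundamentalGroup.map_apply _ _ _).trans ?_
    change Path.Homotopic.Quotient.map (Path.Homotopic.Quotient.mk _) _ = _
    rw [← Path.Homotopic.Quotient.mk_map]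
    congr 1
  obtain ⟨F', c, -, ⟨D, hD⟩, hF'c, hS'⟩ := exists_special hUniv bY (fun τ => hB _)
    (by rw [hbY]; exact VanEdge.zero)
  have hF'0 : F' = 0 := funext fun τ => hS'.mem_vanishingOn τ (Set.subset_univ _)
  obtain ⟨c', hc', hcb⟩ := exists_extend_cochain Y c
  have hsc : ∀ τ : SSimplex Y (k + 1), scob X k c' ((subIncl Y).comp τ) = -bY τ := by
    intro τ
    have h1 : scob Y k c τ = -bY τ := by rw [← hF'c, hF'0]; simp
    rw [← h1]
    rw [scob_apply, scob_apply]
    refine Finset.sum_congr rfl fun i _ => ?_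
    rw [← hc']; rfl
  refine ⟨F, b + scob X k c', hF, ⟨Submodule.add_mem _ ⟨B, hB⟩ ?_, ?_⟩, ?_, hS⟩
  · exact ⟨_, abs_scob_le (hcb |D| (fun τ => (hD τ).trans (le_abs_self D)) (abs_nonneg D))⟩
  · intro σ hσ
    obtain ⟨τ, rfl⟩ := exists_lift_subIncl hσ
    rw [Pi.add_apply, hsc]
    exact add_neg_cancel _
  · rw [map_add, scob_scob, add_zero, hFf]

end BddCoh

end

noncomputable section
namespace BddCoh
open CategoryTheory

/-! ### Words in a graph of groupoids -/

section Words

variable {𝒩 𝒬 : Type} [Groupoid.{0} 𝒩] [Groupoid.{0} 𝒬] (i : Bool → 𝒬 ⥤ 𝒩)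

/-- Words from `p`: morphisms of `𝒩`, alternating with crossings from one side of `𝒬` to the
other. -/
inductive Word (p : 𝒩) : 𝒩 → Type
  | base {x : 𝒩} (γ : p ⟶ x) : Word p x
  | cross (s : 𝒬) (b b' : Bool) (h : b ≠ b') (w : Word p ((i b).obj s)) {x : 𝒩}
      (γ : (i b').obj s ⟶ x) : Word p x

variable {i} {p : 𝒩}

namespace Word

/-- Right multiplication by a morphism. -/
def mul : ∀ {x y : 𝒩}, Word i p x → (x ⟶ y) → Word i p y
  | _, _, base γ, g => base (γ ≫ g)
  | _, _, cross s b b' h w γ, g => cross s b b' h w (γ ≫ g)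

@[simp] lemma base_mul {x y : 𝒩} (γ : p ⟶ x) (g : x ⟶ y) :
    (base γ : Word i p x).mul g = base (γ ≫ g) := rfl

@[simp] lemma cross_mul (s : 𝒬) (b b' : Bool) (h : b ≠ b') (w : Word i p ((i b).obj s)) {x y : 𝒩}
    (γ : (i b').obj s ⟶ x) (g : x ⟶ y) :
    (cross s b b' h w γ).mul g = cross s b b' h w (γ ≫ g) := rfl

@[simp] lemma mul_id {x : 𝒩} (w : Word i p x) : w.mul (𝟙 x) = w := by cases w <;> simp

@[simp] lemma mul_mul {x y z : 𝒩} (w : Word i p x) (g : x ⟶ y) (h : y ⟶ z) :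
    (w.mul g).mul h = w.mul (g ≫ h) := by cases w <;> simp

/-- Equality of words up to sliding crossings. -/
inductive Eqv : ∀ {x : 𝒩}, Word i p x → Word i p x → Prop
  | base {x : 𝒩} (γ : p ⟶ x) : Eqv (base γ) (base γ)
  | cross {s s' : 𝒬} {b b' : Bool} (h : b ≠ b') {w : Word i p ((i b).obj s)}
      {w' : Word i p ((i b).obj s')} {x : 𝒩} (c : s ⟶ s') (γ : (i b').obj s' ⟶ x) :
      Eqv (w.mul ((i b).map c)) w' →
      Eqv (cross s b b' h w ((i b').map c ≫ γ)) (cross s' b b' h w' γ)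

lemma Eqv.of_eq {s s' : 𝒬} {b b' : Bool} (h : b ≠ b') {w : Word i p ((i b).obj s)}
    {w' : Word i p ((i b).obj s')} {x : 𝒩} (c : s ⟶ s') {γ' : (i b').obj s ⟶ x}
    {γ : (i b').obj s' ⟶ x} (hγ : γ' = (i b').map c ≫ γ) (hw : Eqv (w.mul ((i b).map c)) w') :
    Eqv (Word.cross s b b' h w γ') (Word.cross s' b b' h w' γ) := by
  subst hγ; exact Eqv.cross h c γ hw

lemma Eqv.refl {x : 𝒩} (w : Word i p x) : Eqv w w := by
  induction w with
  | base γ => exact .base γ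
  | cross s b b' h w γ ih => exact .of_eq h (𝟙 s) (by simp) (by simpa using ih)

lemma Eqv.mul {x y : 𝒩} {w w' : Word i p x} (h : Eqv w w') (g : x ⟶ y) :
    Eqv (w.mul g) (w'.mul g) := by
  cases h with
  | base γ => exact .base _
  | cross h c γ hw => exact .of_eq h c (by simp) hw

lemma Eqv.symm {x : 𝒩} {w w' : Word i p x} (h : Eqv w w') : Eqv w' w := by
  induction h with
  | base γ => exact .base _
  | @cross s s' b b' h w w' x c γ _ ih =>
    refine .of_eq h (inv c) (by simp) ?_
    simpa [← Functor.map_comp] using ih.mul ((i b).map (inv c))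

lemma Eqv.trans {x : 𝒩} {w w' w'' : Word i p x} (h : Eqv w w') (h' : Eqv w' w'') :
    Eqv w w'' := by
  induction h with
  | base γ => exact h'
  | @cross s s' b b' h w w' x c γ hw ih =>
    cases h' with
    | @cross _ s'' _ _ _ _ w'' _ c' γ' hw' =>
      refine .of_eq h (c ≫ c') (by simp) ?_
      have h1 : Eqv w' (w''.mul ((i b).map (inv c'))) := by
        simpa [← Functor.map_comp] using hw'.mul ((i b).map (inv c'))
      have h2 := (ih h1).mul ((i b).map c')
      simpa [← Functor.map_comp] using h2

/-- The last letter is a morphism of `𝒬` on the side `b`. -/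
def IsBd (s : 𝒬) (b : Bool) (w : Word i p ((i b).obj s)) : Prop :=
  ∃ (s' : 𝒬) (b₀ : Bool) (h : b₀ ≠ b) (w' : Word i p ((i b₀).obj s')) (c : s' ⟶ s),
    w = cross s' b₀ b h w' ((i b).map c)

/-- Reduced words. -/
def Red : ∀ {x : 𝒩}, Word i p x → Prop
  | _, base _ => True
  | _, cross s b _ _ w _ => Red w ∧ ¬ IsBd s b w

lemma Red.mul {x y : 𝒩} {w : Word i p x} (h : Red w) (g : x ⟶ y) : Red (w.mul g) := by
  cases w <;> exact h

lemma red_base {x : 𝒩} (γ : p ⟶ x) : Red (base γ : Word i p x) := trivial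

lemma isBd_mul {s s' : 𝒬} {b : Bool} {w : Word i p ((i b).obj s)} (h : IsBd s b w) (d : s ⟶ s') :
    IsBd s' b (w.mul ((i b).map d)) := by
  obtain ⟨s₀, b₀, h₀, w₀, c, rfl⟩ := h
  exact ⟨s₀, b₀, h₀, w₀, c ≫ d, by simp⟩

lemma isBd_mul_iff {s s' : 𝒬} {b : Bool} {w : Word i p ((i b).obj s)} (d : s ⟶ s') :
    IsBd s' b (w.mul ((i b).map d)) ↔ IsBd s b w := by
  refine ⟨fun h => ?_, fun h => isBd_mul h d⟩
  simpa [← Functor.map_comp] using isBd_mul h (inv d)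

lemma Eqv.isBd {s : 𝒬} {b : Bool} {w w' : Word i p ((i b).obj s)} (h : Eqv w w')
    (hw : IsBd s b w) : IsBd s b w' := by
  obtain ⟨s₀, b₀, h₀, w₀, c, rfl⟩ := hw
  generalize hγ : (i b).map c = γ₀ at h
  cases h with
  | @cross _ s' _ _ _ _ w' _ c' γ hw' =>
    refine ⟨s', b₀, h₀, w', inv c' ≫ c, ?_⟩
    rw [Functor.map_comp, hγ]
    simp

end Word

variable (i p) in
/-- Reduced words up to sliding. -/
def wordSetoid (x : 𝒩) : Setoid {w : Word i p x // w.Red} where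
  r w w' := w.1.Eqv w'.1
  iseqv := ⟨fun _ => .refl _, .symm, .trans⟩

variable (i p) in
/-- Morphisms of the groupoid generated by `𝒩` and the crossings. -/
def RW (x : 𝒩) : Type := Quotient (wordSetoid i p x)

namespace RW

/-- The class of a reduced word. -/
def mk {x : 𝒩} (w : Word i p x) (hw : w.Red) : RW i p x := Quotient.mk (wordSetoid i p x) ⟨w, hw⟩

lemma mk_eq_mk {x : 𝒩} {w w' : Word i p x} {hw : w.Red} {hw' : w'.Red} :
    mk w hw = mk w' hw' ↔ w.Eqv w' := Quotient.eq (r := wordSetoid i p x)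

lemma ind {x : 𝒩} {P : RW i p x → Prop} (h : ∀ w hw, P (mk w hw)) (y : RW i p x) : P y :=
  Quotient.ind (fun w => h w.1 w.2) y

/-- Right multiplication. -/
def mul {x y : 𝒩} (w : RW i p x) (g : x ⟶ y) : RW i p y :=
  Quotient.map (sa := wordSetoid i p x) (sb := wordSetoid i p y)
    (fun w => ⟨w.1.mul g, w.2.mul g⟩) (fun _ _ h => h.mul g) w

lemma mk_mul {x y : 𝒩} (w : Word i p x) (hw : w.Red) (g : x ⟶ y) :
    (mk w hw).mul g = mk (w.mul g) (hw.mul g) := rfl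

@[simp] lemma mul_id {x : 𝒩} (w : RW i p x) : w.mul (𝟙 x) = w := by
  induction w using ind with
  | h w hw => rw [mk_mul, mk_eq_mk, Word.mul_id]; exact .refl _

@[simp] lemma mul_mul {x y z : 𝒩} (w : RW i p x) (g : x ⟶ y) (h : y ⟶ z) :
    (w.mul g).mul h = w.mul (g ≫ h) := by
  induction w using ind with
  | h w hw => rw [mk_mul, mk_mul, mk_mul, mk_eq_mk, Word.mul_mul]; exact .refl _

lemma red_cross {s : 𝒬} {b : Bool} {w : Word i p ((i b).obj s)} (hw : w.Red)
    (hb : ¬ w.IsBd s b) {b' : Bool} (h : b ≠ b') {x : 𝒩} (γ : (i b').obj s ⟶ x) :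
    (Word.cross s b b' h w γ).Red := ⟨hw, hb⟩

/-- Compatibility of the two sides of `𝒬`. -/
def Compat (i : Bool → 𝒬 ⥤ 𝒩) : Prop :=
  ∀ (b b' : Bool) {s s' : 𝒬} (c c' : s ⟶ s'), (i b).map c = (i b).map c' →
    (i b').map c = (i b').map c'

open Classical in
/-- Crossing, on reduced words. -/
def crossW (s : 𝒬) (b b' : Bool) (h : b ≠ b') (w : {w : Word i p ((i b).obj s) // w.Red}) :
    RW i p ((i b').obj s) :=
  if hb : ∃ (s' : 𝒬) (w' : Word i p ((i b').obj s')) (c : s' ⟶ s),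
      w.1 = Word.cross s' b' b h.symm w' ((i b).map c) then
    (mk hb.choose_spec.choose (by
      have := hb.choose_spec.choose_spec.choose_spec
      have h2 := w.2
      rw [this] at h2
      exact h2.1)).mul ((i b').map hb.choose_spec.choose_spec.choose)
  else mk (Word.cross s b b' h w.1 (𝟙 _)) (red_cross w.2 (by
    rintro ⟨s', b₀, h₀, w', c, hw⟩
    obtain rfl : b₀ = b' := by cases b₀ <;> cases b <;> cases b' <;> simp_all
    exact hb ⟨s', w', c, hw⟩) h _)

lemma isBd_iff {s : 𝒬} {b b' : Bool} (h : b ≠ b') {w : Word i p ((i b).obj s)} :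
    w.IsBd s b ↔ ∃ (s' : 𝒬) (w' : Word i p ((i b').obj s')) (c : s' ⟶ s),
      w = Word.cross s' b' b h.symm w' ((i b).map c) := by
  constructor
  · rintro ⟨s', b₀, h₀, w', c, hw⟩
    obtain rfl : b₀ = b' := by cases b₀ <;> cases b <;> cases b' <;> simp_all
    exact ⟨s', w', c, hw⟩
  · rintro ⟨s', w', c, hw⟩
    exact ⟨s', b', h.symm, w', c, hw⟩

lemma crossW_of_not {s : 𝒬} {b b' : Bool} (h : b ≠ b') {w : Word i p ((i b).obj s)} (hw : w.Red)
    (hb : ¬ w.IsBd s b) :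
    crossW s b b' h ⟨w, hw⟩ = mk (Word.cross s b b' h w (𝟙 _)) (red_cross hw hb h _) := by
  unfold crossW
  rw [dif_neg]
  rwa [← isBd_iff h]

lemma mul_eq_of_cross_eq (hc : Compat i) {s s₁ s₂ : 𝒬} {b b' : Bool} (h : b' ≠ b)
    {w₁ : Word i p ((i b').obj s₁)} {w₂ : Word i p ((i b').obj s₂)} {c₁ : s₁ ⟶ s} {c₂ : s₂ ⟶ s}
    {h₁ : w₁.Red} {h₂ : w₂.Red}
    (he : (Word.cross s₁ b' b h w₁ ((i b).map c₁)).Eqv (Word.cross s₂ b' b h w₂ ((i b).map c₂))) :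
    (mk w₁ h₁).mul ((i b').map c₁) = (mk w₂ h₂).mul ((i b').map c₂) := by
  generalize hg₁ : (i b).map c₁ = g₁ at he
  generalize hg₂ : (i b).map c₂ = g₂ at he
  cases he with
  | cross _ c _ hw =>
    subst hg₂
    rw [← Functor.map_comp] at hg₁
    rw [hc b b' _ _ hg₁, Functor.map_comp, ← mul_mul, mk_mul, mk_eq_mk.2 hw]

lemma crossW_of_eq (hc : Compat i) {s s' : 𝒬} {b b' : Bool} (h : b ≠ b')
    (w' : Word i p ((i b').obj s')) (c : s' ⟶ s)
    (hw : (Word.cross s' b' b h.symm w' ((i b).map c)).Red) :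
    crossW s b b' h ⟨_, hw⟩ = (mk w' hw.1).mul ((i b').map c) := by
  have hb : ∃ (s'' : 𝒬) (w'' : Word i p ((i b').obj s'')) (c' : s'' ⟶ s),
      Word.cross s' b' b h.symm w' ((i b).map c) = Word.cross s'' b' b h.symm w'' ((i b).map c') :=
    ⟨s', w', c, rfl⟩
  unfold crossW
  rw [dif_pos hb]
  refine (mul_eq_of_cross_eq hc h.symm ?_).symm
  have := hb.choose_spec.choose_spec.choose_spec
  rw [← this]
  exact .refl _

/-- Crossing to the other side. -/
def X (hc : Compat i) (s : 𝒬) (b b' : Bool) (h : b ≠ b') (y : RW i p ((i b).obj s)) :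
    RW i p ((i b').obj s) :=
  Quotient.lift (s := wordSetoid i p _) (crossW s b b' h) (by
    rintro ⟨w, hw⟩ ⟨w', hw'⟩ (hww : w.Eqv w')
    by_cases hb : w.IsBd s b
    · have hb' := hww.isBd hb
      obtain ⟨s₁, w₁, c₁, rfl⟩ := (isBd_iff h).1 hb
      obtain ⟨s₂, w₂, c₂, rfl⟩ := (isBd_iff h).1 hb'
      rw [crossW_of_eq hc, crossW_of_eq hc]
      exact mul_eq_of_cross_eq hc h.symm hww
    · have hb' : ¬ w'.IsBd s b := fun h' => hb (hww.symm.isBd h')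
      rw [crossW_of_not h hw hb, crossW_of_not h hw' hb', mk_eq_mk]
      exact .of_eq h (𝟙 s) (by simp) (by simpa using hww)) y

variable (hc : Compat i)

lemma X_mk_of_not {s : 𝒬} {b b' : Bool} (h : b ≠ b') {w : Word i p ((i b).obj s)} (hw : w.Red)
    (hb : ¬ w.IsBd s b) :
    X hc s b b' h (mk w hw) = mk (Word.cross s b b' h w (𝟙 _)) (red_cross hw hb h _) :=
  crossW_of_not h hw hb

lemma X_mk_of_eq {s s' : 𝒬} {b b' : Bool} (h : b ≠ b')
    (w' : Word i p ((i b').obj s')) (c : s' ⟶ s)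
    (hw : (Word.cross s' b' b h.symm w' ((i b).map c)).Red) :
    X hc s b b' h (mk _ hw) = (mk w' hw.1).mul ((i b').map c) :=
  crossW_of_eq hc h w' c hw

lemma mk_cross {s : 𝒬} {b b' : Bool} (h : b ≠ b') {w : Word i p ((i b).obj s)} {x : 𝒩}
    (γ : (i b').obj s ⟶ x) (hw : (Word.cross s b b' h w γ).Red) :
    mk _ hw = (X hc s b b' h (mk w hw.1)).mul γ := by
  rw [X_mk_of_not hc h hw.1 hw.2, mk_mul, mk_eq_mk]
  simpa using Word.Eqv.refl _

lemma X_X {s : 𝒬} {b b' : Bool} (h : b ≠ b') (y : RW i p ((i b).obj s)) :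
    X hc s b' b h.symm (X hc s b b' h y) = y := by
  induction y using ind with
  | h w hw =>
  by_cases hb : w.IsBd s b
  · obtain ⟨s₁, w₁, c₁, rfl⟩ := (isBd_iff h).1 hb
    rw [X_mk_of_eq, mk_mul, X_mk_of_not hc h.symm _ (fun h' => hw.2 ((Word.isBd_mul_iff _).1 h')),
      mk_eq_mk]
    exact (Word.Eqv.of_eq h.symm c₁ (by simp) (.refl _)).symm
  · rw [X_mk_of_not hc h hw hb]
    have := X_mk_of_eq hc h.symm w (𝟙 s) (by simpa using red_cross hw hb h (𝟙 _))
    simpa using this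

lemma X_mul {s s' : 𝒬} {b b' : Bool} (h : b ≠ b') (y : RW i p ((i b).obj s)) (d : s ⟶ s') :
    X hc s' b b' h (y.mul ((i b).map d)) = (X hc s b b' h y).mul ((i b').map d) := by
  induction y using ind with
  | h w hw =>
  by_cases hb : w.IsBd s b
  · obtain ⟨s₁, w₁, c₁, rfl⟩ := (isBd_iff h).1 hb
    rw [X_mk_of_eq, mk_mul, mul_mul, ← Functor.map_comp, ← X_mk_of_eq hc h w₁ (c₁ ≫ d) ⟨hw.1, hw.2⟩]
    simp
  · rw [X_mk_of_not hc h hw hb, mk_mul, mk_mul,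
      X_mk_of_not hc h _ (fun h' => hb ((Word.isBd_mul_iff _).1 h')), mk_eq_mk]
    exact (Word.Eqv.of_eq h d (by simp) (.refl _)).symm

/-- Induction on reduced words. -/
lemma rec_on {P : ∀ x, RW i p x → Prop} (hbase : ∀ {x} (γ : p ⟶ x), P x (mk (.base γ) (Word.red_base γ)))
    (hcross : ∀ {s b b'} (h : b ≠ b') (w : Word i p ((i b).obj s)) (hw : w.Red) {x}
      (γ : (i b').obj s ⟶ x), ¬ w.IsBd s b → P _ (mk w hw) →
      P _ ((X hc s b b' h (mk w hw)).mul γ)) {x} (y : RW i p x) : P x y := by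
  induction y using ind with
  | h w hw =>
  induction w with
  | base γ => exact hbase γ
  | cross s b b' h w γ ih =>
    rw [mk_cross hc h]
    exact hcross h w hw.1 γ hw.2 (ih hw.1)

end RW

/-! ### Special classes of morphisms and the retraction of words -/

/-- A wide subgroupoid containing both images of `𝒬`. -/
structure BdSub (i : Bool → 𝒬 ⥤ 𝒩) where
  /-- The morphisms in the subgroupoid. -/
  P : ∀ {x y : 𝒩}, (x ⟶ y) → Prop
  id : ∀ x, P (𝟙 x)
  comp : ∀ {x y z} {f : x ⟶ y} {g : y ⟶ z}, P f → P g → P (f ≫ g)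
  inv : ∀ {x y} {f : x ⟶ y}, P f → P (inv f)
  map : ∀ b {s s' : 𝒬} (c : s ⟶ s'), P ((i b).map c)

variable (ℬ : BdSub i)

variable (p) in
/-- Morphisms from `p` up to right multiplication by the subgroupoid. -/
def specSetoid : Setoid (Σ x : 𝒩, (p ⟶ x)) where
  r g h := ℬ.P (inv g.2 ≫ h.2)
  iseqv := ⟨fun g => by simpa using ℬ.id _, fun {g h} H => by simpa using ℬ.inv H,
    fun {f g h} H H' => by simpa using ℬ.comp H H'⟩

variable (p) in
/-- Special classes of morphisms from `p`. -/
def Spec : Type := Quotient (specSetoid p ℬ)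

/-- The special class of a morphism. -/
def Spec.mk {x : 𝒩} (γ : p ⟶ x) : Spec p ℬ := Quotient.mk (specSetoid p ℬ) ⟨x, γ⟩

variable {ℬ}

lemma Spec.mk_eq_mk {x y : 𝒩} {γ : p ⟶ x} {γ' : p ⟶ y} :
    Spec.mk ℬ γ = Spec.mk ℬ γ' ↔ ℬ.P (inv γ ≫ γ') := Quotient.eq (r := specSetoid p ℬ)

lemma Spec.mk_comp {x y : 𝒩} (γ : p ⟶ x) {g : x ⟶ y} (hg : ℬ.P g) :
    Spec.mk ℬ (γ ≫ g) = Spec.mk ℬ γ := by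
  symm
  rw [Spec.mk_eq_mk]
  simpa

lemma Spec.ind {P : Spec p ℬ → Prop} (h : ∀ x (γ : p ⟶ x), P (Spec.mk ℬ γ)) (v : Spec p ℬ) : P v :=
  Quotient.ind (fun w => h w.1 w.2) v

/-- Left multiplication on special classes. -/
def Spec.lmul {p' : 𝒩} (g : p ⟶ p') (v : Spec p' ℬ) : Spec p ℬ :=
  Quotient.map (sa := specSetoid p' ℬ) (sb := specSetoid p ℬ) (fun w => ⟨w.1, g ≫ w.2⟩)
    (fun a b h => by
      change ℬ.P (inv a.2 ≫ b.2) at h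
      change ℬ.P (inv (g ≫ a.2) ≫ (g ≫ b.2))
      simpa) v

lemma Spec.lmul_mk {p' x : 𝒩} (g : p ⟶ p') (γ : p' ⟶ x) :
    Spec.lmul g (Spec.mk ℬ γ) = Spec.mk ℬ (g ≫ γ) := rfl

variable (ℬ) in
/-- The class of the innermost letter. -/
def Word.ret : ∀ {x : 𝒩}, Word i p x → Spec p ℬ
  | _, .base γ => Spec.mk ℬ γ
  | _, .cross _ _ _ _ w _ => w.ret

lemma Word.ret_mul {x y : 𝒩} (w : Word i p x) {g : x ⟶ y} (hg : ℬ.P g) :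
    (w.mul g).ret ℬ = w.ret ℬ := by
  cases w with
  | base γ => exact Spec.mk_comp γ hg
  | cross => rfl

lemma Word.Eqv.ret {x : 𝒩} {w w' : Word i p x} (h : w.Eqv w') : w.ret ℬ = w'.ret ℬ := by
  induction h with
  | base => rfl
  | @cross s s' b b' h w w' x c γ hw ih =>
    simp only [Word.ret]
    rw [← ih, Word.ret_mul _ (ℬ.map b c)]

namespace RW

variable (ℬ) in
/-- The class of the innermost letter. -/
def ret {x : 𝒩} (y : RW i p x) : Spec p ℬ :=
  Quotient.lift (s := wordSetoid i p x) (fun w => w.1.ret ℬ) (fun _ _ h => Word.Eqv.ret h) y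

lemma ret_mk {x : 𝒩} (w : Word i p x) (hw : w.Red) : (mk w hw).ret ℬ = w.ret ℬ := rfl

lemma ret_mul {x y : 𝒩} (w : RW i p x) {g : x ⟶ y} (hg : ℬ.P g) :
    (w.mul g).ret ℬ = w.ret ℬ := by
  induction w using ind with
  | h w hw => exact Word.ret_mul w hg

lemma ret_X (hc : Compat i) {s : 𝒬} {b b' : Bool} (h : b ≠ b') (y : RW i p ((i b).obj s)) :
    (X hc s b b' h y).ret ℬ = y.ret ℬ := by
  induction y using ind with
  | h w hw =>
  by_cases hb : w.IsBd s b
  · obtain ⟨s₁, w₁, c₁, rfl⟩ := (isBd_iff h).1 hb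
    rw [X_mk_of_eq, ret_mul _ (ℬ.map _ _)]
    rfl
  · rw [X_mk_of_not hc h hw hb]
    rfl

end RW

/-! ### Left translation of words -/

section Translate

variable (hc : RW.Compat i) {p' : 𝒩}

/-- Left translation on words. -/
def Word.lact (w : RW i p p') : ∀ {x : 𝒩}, Word i p' x → RW i p x
  | _, .base γ => w.mul γ
  | _, .cross s b b' h u γ => (RW.X hc s b b' h (u.lact w)).mul γ

lemma Word.lact_mul (w : RW i p p') {x y : 𝒩} (u : Word i p' x) (g : x ⟶ y) :
    (u.mul g).lact hc w = (u.lact hc w).mul g := by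
  cases u <;> simp [Word.lact]

lemma Word.Eqv.lact (w : RW i p p') {x : 𝒩} {u u' : Word i p' x} (h : u.Eqv u') :
    u.lact hc w = u'.lact hc w := by
  induction h with
  | base => rfl
  | @cross s s' b b' h u u' x c γ hw ih =>
    simp only [Word.lact]
    rw [← ih, Word.lact_mul, RW.X_mul, RW.mul_mul]

namespace RW

/-- Left translation. -/
def lact (w : RW i p p') {x : 𝒩} (u : RW i p' x) : RW i p x :=
  Quotient.lift (s := wordSetoid i p' x) (fun u => u.1.lact hc w)
    (fun _ _ h => Word.Eqv.lact hc w h) u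

lemma lact_mk (w : RW i p p') {x : 𝒩} (u : Word i p' x) (hu : u.Red) :
    lact hc w (mk u hu) = u.lact hc w := rfl

lemma lact_mul (w : RW i p p') {x y : 𝒩} (u : RW i p' x) (g : x ⟶ y) :
    lact hc w (u.mul g) = (lact hc w u).mul g := by
  induction u using ind with
  | h u hu => exact Word.lact_mul hc w u g

lemma lact_X (w : RW i p p') {s : 𝒬} {b b' : Bool} (h : b ≠ b') (u : RW i p' ((i b).obj s)) :
    lact hc w (X hc s b b' h u) = X hc s b b' h (lact hc w u) := by
  induction u using ind with
  | h u hu =>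
  by_cases hb : u.IsBd s b
  · obtain ⟨s₁, w₁, c₁, rfl⟩ := (isBd_iff h).1 hb
    rw [X_mk_of_eq, lact_mul, lact_mk, lact_mk]
    simp only [Word.lact]
    rw [X_mul, X_X]
  · rw [X_mk_of_not hc h hu hb, lact_mk, lact_mk]
    simp only [Word.lact, mul_id]

/-- The base word of a morphism. -/
def base {x : 𝒩} (γ : p ⟶ x) : RW i p x := mk (.base γ) (Word.red_base γ)

lemma base_mul {x y : 𝒩} (γ : p ⟶ x) (g : x ⟶ y) :
    (base γ : RW i p x).mul g = base (γ ≫ g) := rfl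

lemma lact_base (w : RW i p p') {x : 𝒩} (γ : p' ⟶ x) : lact hc w (base γ) = w.mul γ := rfl

lemma lact_lact {p'' : 𝒩} (w : RW i p p') (w' : RW i p' p'') {x : 𝒩} (u : RW i p'' x) :
    lact hc w (lact hc w' u) = lact hc (lact hc w w') u := by
  induction u using rec_on hc with
  | hbase γ =>
    change lact hc w (lact hc w' (base γ)) = lact hc _ (base γ)
    rw [lact_base, lact_base, lact_mul]
  | hcross h u hu γ hb ih => rw [lact_mul, lact_mul, lact_mul, lact_X, lact_X, lact_X, ih]

lemma base_lact {x : 𝒩} (u : RW i p x) : lact hc (base (𝟙 p)) u = u := by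
  induction u using rec_on hc with
  | hbase γ =>
    change lact hc _ (base γ) = base γ
    rw [lact_base, base_mul, Category.id_comp]
  | hcross h u hu γ hb ih => rw [lact_mul, lact_X, ih]

lemma exists_lact_eq {x : 𝒩} (u' : RW i p' x) (u : RW i p x) : ∃ w, lact hc w u' = u := by
  induction u' using rec_on hc with
  | hbase γ =>
    refine ⟨u.mul (inv γ), ?_⟩
    change lact hc _ (base γ) = u
    rw [lact_base, mul_mul]; simp
  | @hcross s b b' h u₁ hu₁ x γ hb ih =>
    obtain ⟨w, hw⟩ := ih (X hc s b' b h.symm (u.mul (inv γ)))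
    refine ⟨w, ?_⟩
    rw [lact_mul, lact_X, hw, X_X, mul_mul]; simp

end RW

/-- Concatenation of words. -/
def Word.concat : ∀ {x : 𝒩}, Word i p' x → Word i p p' → Word i p x
  | _, .base γ, w => w.mul γ
  | _, .cross s b b' h u γ, w => .cross s b b' h (u.concat w) γ

lemma Word.lact_eq_of_red (w : Word i p p') (hw : w.Red) {x : 𝒩} (u : Word i p' x)
    (h : (u.concat w).Red) : u.lact hc (RW.mk w hw) = RW.mk (u.concat w) h := by
  induction u with
  | base γ => rfl
  | cross s b b' hb u γ ih =>
    simp only [Word.lact]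
    rw [ih h.1, ← RW.mk_cross hc hb γ h]
    rfl

lemma Word.ret_concat_base (g : p ⟶ p') {x : 𝒩} (u : Word i p' x) :
    (u.concat (.base g)).ret ℬ = Spec.lmul g (u.ret ℬ) := by
  induction u with
  | base γ => rfl
  | cross s b b' hb u γ ih => exact ih

lemma Word.ret_concat_cross {s : 𝒬} {b b' : Bool} (h : b ≠ b') (w : Word i p ((i b).obj s))
    (γ : (i b').obj s ⟶ p') {x : 𝒩} (u : Word i p' x) :
    (u.concat (.cross s b b' h w γ)).ret ℬ = w.ret ℬ := by
  induction u with
  | base γ => rfl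
  | cross s b b' hb u γ ih => exact ih

lemma Word.IsBd.of_concat {w : Word i p p'} {s : 𝒬} {b : Bool} {u : Word i p' ((i b).obj s)}
    (h : (u.concat w).IsBd s b) : u.IsBd s b ∨ ∃ δ, u = .base δ ∧ (w.mul δ).IsBd s b := by
  cases u with
  | base γ => exact .inr ⟨γ, rfl, h⟩
  | cross s₁ b₁ b₁' h₁ u γ' =>
    obtain ⟨s', b₀, h₀, w', c, h⟩ := h
    simp only [Word.concat] at h
    generalize hg : (i b).map c = g at h
    injection h with h1 h2 h3 h4 h5 h6
    subst h3
    cases h1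
    cases h2
    cases h6
    exact .inl ⟨s₁, b₁, h₁, u, c, by rw [hg]⟩

lemma Word.red_concat_base (g : p ⟶ p') {x : 𝒩} (u : Word i p' x) (hu : u.Red) :
    (u.concat (.base g)).Red := by
  induction u with
  | base γ => trivial
  | cross s b b' hb u γ ih =>
    refine ⟨ih hu.1, fun h => hu.2 ?_⟩
    refine h.of_concat.resolve_right ?_
    rintro ⟨δ, -, s', b₀, h₀, w', c, h⟩
    cases h

lemma Word.red_concat_cross {s : 𝒬} {b b' : Bool} (h : b ≠ b') (w : Word i p ((i b).obj s))
    (γ : (i b').obj s ⟶ p') (hw : (Word.cross s b b' h w γ).Red) {x : 𝒩} (u : Word i p' x)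
    (hu : u.Red) : (u.concat (.cross s b b' h w γ)).Red ∨ u.ret ℬ = Spec.mk ℬ (inv γ) := by
  induction u with
  | base γ => exact .inl hw
  | cross s₂ b₂ b₂' hb u γ' ih =>
    rcases ih hu.1 with hr | hr
    · by_cases hbd : (u.concat (.cross s b b' h w γ)).IsBd s₂ b₂
      · right
        obtain ⟨δ, rfl, s', b₀, h₀, w', c, h⟩ := hbd.of_concat.resolve_left hu.2
        generalize hg : (i b₂).map c = g at h
        simp only [Word.cross_mul] at h
        injection h with h1 h2 h3 h4 h5 h6
        cases h1
        cases h3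
        cases h6
        obtain rfl : δ = inv γ ≫ (i b').map c := by rw [hg]; simp
        exact Spec.mk_comp _ (ℬ.map _ _)
      · exact .inl ⟨hr, hbd⟩
    · exact .inr hr

namespace RW

lemma ret_base_lact (g : p ⟶ p') {x : 𝒩} (u : RW i p' x) :
    (lact hc (base g) u).ret ℬ = Spec.lmul g (u.ret ℬ) := by
  induction u using ind with
  | h u hu =>
  rw [lact_mk, base, Word.lact_eq_of_red hc _ _ u (Word.red_concat_base g u hu), ret_mk,
    Word.ret_concat_base]
  rfl

/-- A translation is a translation by a morphism, or it is constant after retraction away from one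
special class. -/
lemma lact_dichotomy (w : RW i p p') : (∃ g : p ⟶ p', w = base g) ∨
    ∃ v : Spec p' ℬ, ∀ {x : 𝒩} (u : RW i p' x), u.ret ℬ = v ∨ (lact hc w u).ret ℬ = w.ret ℬ := by
  induction w using ind with
  | h w hw =>
  cases w with
  | base g => exact .inl ⟨g, rfl⟩
  | cross s b b' h w γ =>
    refine .inr ⟨Spec.mk ℬ (inv γ), fun {x} u => ?_⟩
    induction u using ind with
    | h u hu =>
    refine (Word.red_concat_cross (ℬ := ℬ) h w γ hw u hu).symm.imp id fun hr => ?_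
    rw [lact_mk, Word.lact_eq_of_red hc _ _ u hr, ret_mk, Word.ret_concat_cross]
    rfl

end RW

end Translate
end Words
end BddCoh

end

noncomputable section
namespace BddCoh
open CategoryTheory
local notation "I" => unitInterval

/-! ### Special cochains as functions of special classes -/

section PathClasses

variable {X : Type} [TopologicalSpace X]

/-- The morphism of a path. -/
def hm {x y : X} (c : Path x y) : (⟨x⟩ : FundamentalGroupoid X) ⟶ ⟨y⟩ := pc c

lemma hm_surj {x y : FundamentalGroupoid X} (g : x ⟶ y) : ∃ c : Path x.as y.as, hm c = g :=
  Quotient.exists_rep g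

lemma hm_trans {x y z : X} (c : Path x y) (d : Path y z) : hm (c.trans d) = hm c ≫ hm d :=
  Path.Homotopic.Quotient.mk_trans c d

lemma hm_refl (x : X) : hm (Path.refl x) = 𝟙 _ := rfl

lemma hm_const {x : X} (c : Path x x) (h : ∀ t, c t = x) : hm c = 𝟙 _ := by
  rw [← hm_refl]
  congr 1
  exact Path.ext (funext h)

lemma hm_symm {x y : X} (c : Path x y) : hm c.symm = inv (hm c) := by
  refine (IsIso.inv_eq_of_hom_inv_id ?_).symm
  rw [← hm_trans, ← hm_refl]
  exact Path.Homotopic.Quotient.eq.2 ⟨(Path.Homotopy.reflTransSymm c).symm⟩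

lemma hm_eq {x y : X} {c d : Path x y} : hm c = hm d ↔ c.Homotopic d :=
  Path.Homotopic.Quotient.eq

/-- The edge morphism of a singular simplex. -/
def eHom {k : ℕ} {σ : SSimplex X k} {v : Fin (k + 1) → X} (hv : ∀ i, σ (vtx i) = v i)
    (i j : Fin (k + 1)) : (⟨v i⟩ : FundamentalGroupoid X) ⟶ ⟨v j⟩ := hm (ePath hv i j)

lemma eHom_comp {k : ℕ} {σ : SSimplex X k} {v : Fin (k + 1) → X} (hv : ∀ i, σ (vtx i) = v i)
    (i j l : Fin (k + 1)) : eHom hv i j ≫ eHom hv j l = eHom hv i l := ePath_trans hv i j l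

lemma eHom_self {k : ℕ} {σ : SSimplex X k} {v : Fin (k + 1) → X} (hv : ∀ i, σ (vtx i) = v i)
    (i : Fin (k + 1)) : eHom hv i i = 𝟙 _ := ePath_self hv i

/-- Paths in the total space of a homotopy of simplices are determined by their ends. -/
lemma hm_map_eq {k : ℕ} (h : C(I × Δ k, X)) {a b : I × Δ k} (c d : Path a b) :
    hm (c.map h.continuous) = hm (d.map h.continuous) := by
  have : ContractibleSpace (Δ k) :=
    (convex_stdSimplex ℝ (Fin (k + 1))).contractibleSpace ⟨_, (vtx 0 : Δ k).2⟩
  have : ContractibleSpace I :=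
    (convex_Icc (0 : ℝ) 1).contractibleSpace ⟨0, by simp⟩
  exact hm_eq.2 ((SimplyConnectedSpace.paths_homotopic c d).map h)

lemma hm_cast_square {x₁ x₂ x₃ x₄ y₁ y₂ y₃ y₄ : X} {c : Path x₁ x₃} {c' : Path x₂ x₄}
    {d : Path x₁ x₂} {d' : Path x₃ x₄} (h₁ : y₁ = x₁) (h₂ : y₂ = x₂) (h₃ : y₃ = x₃) (h₄ : y₄ = x₄)
    (h : hm c ≫ hm d' = hm d ≫ hm c') :
    hm (c.cast h₁ h₃) ≫ hm (d'.cast h₃ h₄) = hm (d.cast h₁ h₂) ≫ hm (c'.cast h₂ h₄) := by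
  subst h₁ h₂ h₃ h₄
  exact h

/-- There is a simplex with prescribed edges. -/
lemma exists_simplex_of_edges {k : ℕ} {p : X} {v : Fin (k + 1) → X}
    (γ : ∀ i, (⟨p⟩ : FundamentalGroupoid X) ⟶ ⟨v i⟩) :
    ∃ (σ : SSimplex X k) (hv : ∀ i, σ (vtx i) = v i), ∀ i j, eHom hv i j = inv (γ i) ≫ γ j := by
  choose c hc using fun i => hm_surj (γ i)
  obtain ⟨h, h0, h1⟩ := exists_move (i := 0) (ContinuousMap.const (Δ k) p)
    (fun a => ⟨fun z => c (a 0) z.1, (c (a 0)).continuous.comp continuous_fst⟩)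
    (fun a _ x => (c (a 0)).source) (fun a _ t x hx => absurd hx (notMem_bd_zero x))
  have hvt : ∀ i t, h (t, vtx i) = c i t := by
    intro i t
    have := h1 (fun _ => i) (Subsingleton.strictMono (α := Fin 1) _) t (vtx 0)
    rwa [smap_vtx] at this
  have hv : ∀ i, (h.comp (ContinuousMap.prodMk (ContinuousMap.const _ 1) (ContinuousMap.id (Δ k))))
      (vtx i) = v i := fun i => by
    change h (1, vtx i) = _
    rw [hvt]; exact (c i).target
  refine ⟨_, hv, fun i j => ?_⟩
  rw [IsIso.eq_inv_comp, ← hc i, ← hc j]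
  let P (i : Fin (k + 1)) : Path ((0 : I), (vtx i : Δ k)) (1, vtx i) :=
    { toFun := fun t => (t, vtx i), continuous_toFun := by fun_prop, source' := rfl, target' := rfl }
  let Q (t : I) (i j : Fin (k + 1)) : Path (t, (vtx i : Δ k)) (t, vtx j) :=
    { toFun := fun s => (t, edgeΔ i j s), continuous_toFun := by fun_prop,
      source' := by simp, target' := by simp }
  have key := hm_map_eq h ((P i).trans (Q 1 i j)) ((Q 0 i j).trans (P j))
  rw [Path.map_trans, Path.map_trans, hm_trans, hm_trans] at key
  have e0 : ∀ i, h (0, vtx i) = p := fun i => h0 _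
  have e1 : ∀ i, h (1, vtx i) = v i := hv
  have hP : ∀ i, c i = ((P i).map h.continuous).cast (e0 i).symm (e1 i).symm := fun i =>
    Path.ext (funext fun t => (hvt i t).symm)
  have hQ : ePath hv i j = ((Q 1 i j).map h.continuous).cast (e1 i).symm (e1 j).symm := rfl
  have hQ0 : Path.refl p = ((Q 0 i j).map h.continuous).cast (e0 i).symm (e0 j).symm :=
    Path.ext (funext fun t => (h0 _).symm)
  have : hm (c i) ≫ eHom hv i j = hm (Path.refl p) ≫ hm (c j) := by
    rw [eHom, hQ, hP i, hP j, hQ0]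
    exact hm_cast_square (e0 i).symm (e0 j).symm (e1 i).symm (e1 j).symm key
  rw [this, hm_refl, Category.id_comp]

end PathClasses

section Values

variable {N Q : Type} [TopologicalSpace N] [TopologicalSpace Q] {j : Bool → C(Q, N)} {B : Set N}

/-- The functors induced by two maps. -/
abbrev sides (j : Bool → C(Q, N)) (b : Bool) : FundamentalGroupoid Q ⥤ FundamentalGroupoid N :=
  FundamentalGroupoid.map (j b)

/-- The subgroupoid of paths in `B`. -/
def bdSub (hj : ∀ b s, j b s ∈ B) : BdSub (sides j) where
  P {x y} g := ∃ c : Path x.as y.as, AdmPath B c ∧ hm c = g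
  id x := ⟨Path.refl _, .inl fun _ => rfl, rfl⟩
  comp := by
    rintro x y z f g ⟨c, hc, rfl⟩ ⟨d, hd, rfl⟩
    rcases hc with hc | hc
    · obtain ⟨x⟩ := x
      obtain ⟨y⟩ := y
      obtain rfl : x = y := (hc 1).symm.trans c.target
      refine ⟨d, hd, ?_⟩
      rw [hm_const c hc]
      exact (Category.id_comp _).symm
    · rcases hd with hd | hd
      · obtain ⟨z⟩ := z
        obtain ⟨y⟩ := y
        obtain rfl : y = z := (hd 1).symm.trans d.target
        refine ⟨c, .inr hc, ?_⟩
        rw [hm_const d hd]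
        exact (Category.comp_id _).symm
      · refine ⟨c.trans d, .inr fun t => ?_, hm_trans c d⟩
        have : c.trans d t ∈ Set.range (c.trans d) := ⟨t, rfl⟩
        rw [Path.trans_range] at this
        rcases this with ⟨s, hs⟩ | ⟨s, hs⟩
        · exact hs ▸ hc s
        · exact hs ▸ hd s
  inv := by
    rintro x y f ⟨c, hc, rfl⟩
    refine ⟨c.symm, hc.imp (fun h t => ?_) (fun h t => h _), hm_symm c⟩
    exact (h _).trans ((h 1).symm.trans c.target)
  map b {s s'} g := by
    obtain ⟨c, rfl⟩ := hm_surj g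
    exact ⟨c.map (j b).continuous, .inr fun t => hj _ _, rfl⟩

variable (hj : ∀ b s, j b s ∈ B)

/-- The simplex `σ` has edges given by the classes `ρ`. -/
def Spans {p : N} {k : ℕ} (ρ : Fin (k + 1) → Spec (⟨p⟩ : FundamentalGroupoid N) (bdSub hj))
    (σ : SSimplex N k) : Prop :=
  ∃ (v : Fin (k + 1) → N) (hv : ∀ i, σ (vtx i) = v i)
    (γ : ∀ i, (⟨p⟩ : FundamentalGroupoid N) ⟶ ⟨v i⟩),
    (∀ i, Spec.mk _ (γ i) = ρ i) ∧ ∀ i j, eHom hv i j = inv (γ i) ≫ γ j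

variable {hj} {p : N} {k : ℕ} {ρ : Fin (k + 1) → Spec (⟨p⟩ : FundamentalGroupoid N) (bdSub hj)}

lemma exists_spans (ρ : Fin (k + 1) → Spec (⟨p⟩ : FundamentalGroupoid N) (bdSub hj)) :
    ∃ σ, Spans hj ρ σ := by
  have : ∀ i, ∃ (x : FundamentalGroupoid N) (γ : (⟨p⟩ : FundamentalGroupoid N) ⟶ x),
      Spec.mk _ γ = ρ i := fun i => by
    induction ρ i using Spec.ind with
    | h x γ => exact ⟨x, γ, rfl⟩
  choose x γ hγ using this
  obtain ⟨σ, hv, hσ⟩ := exists_simplex_of_edges (v := fun i => (x i).as) γ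
  exact ⟨σ, _, hv, γ, hγ, hσ⟩

/-- The value of a special cochain on a tuple of special classes. -/
def tval (F : SCochain N k) (ρ : Fin (k + 1) → Spec (⟨p⟩ : FundamentalGroupoid N) (bdSub hj)) : ℝ :=
  F (exists_spans ρ).choose

lemma GInv.eq_of_spans {F : SCochain N k} (hF : GInv B F) {σ σ' : SSimplex N k}
    (h : Spans hj ρ σ) (h' : Spans hj ρ σ') : F σ = F σ' := by
  obtain ⟨v, hv, γ, hγ, he⟩ := h
  obtain ⟨v', hv', γ', hγ', he'⟩ := h'
  have : ∀ i, (bdSub hj).P (inv (γ i) ≫ γ' i) := fun i =>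
    Spec.mk_eq_mk.1 ((hγ i).trans (hγ' i).symm)
  choose c hc hc' using this
  refine hF σ σ' v v' hv hv' c hc fun i l => ?_
  change eHom hv i l ≫ hm (c l) = hm (c i) ≫ eHom hv' i l
  rw [he, he', hc', hc']
  simp

lemma GInv.tval_eq {F : SCochain N k} (hF : GInv B F) {σ : SSimplex N k} (h : Spans hj ρ σ) :
    tval F ρ = F σ := hF.eq_of_spans (exists_spans ρ).choose_spec h

lemma Spans.comp {σ : SSimplex N k} (h : Spans hj ρ σ) {l : ℕ} (a : Fin (l + 1) → Fin (k + 1)) :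
    Spans hj (ρ ∘ a) (σ.comp (smap a)) := by
  obtain ⟨v, hv, γ, hγ, he⟩ := h
  refine ⟨v ∘ a, comp_smap_vtx hv a, fun i => γ (a i), fun i => hγ _, fun i l => ?_⟩
  rw [← he]
  exact congrArg pc (ePath_comp hv a i l)

lemma Spans.lmul {σ : SSimplex N k} (h : Spans hj ρ σ) {p' : N}
    (g : (⟨p'⟩ : FundamentalGroupoid N) ⟶ ⟨p⟩) : Spans hj (Spec.lmul g ∘ ρ) σ := by
  obtain ⟨v, hv, γ, hγ, he⟩ := h
  exact ⟨v, hv, fun i => g ≫ γ i, fun i => by simp [← hγ, Spec.lmul_mk], fun i l => by simp [he]⟩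

lemma spans_edges (σ : SSimplex N k) {v : Fin (k + 1) → N} (hv : ∀ i, σ (vtx i) = v i)
    (g : (⟨p⟩ : FundamentalGroupoid N) ⟶ ⟨v 0⟩) :
    Spans hj (fun i => Spec.mk _ (g ≫ eHom hv 0 i)) σ :=
  ⟨v, hv, fun i => g ≫ eHom hv 0 i, fun _ => rfl, fun i l => by
    have : eHom hv 0 l = eHom hv 0 i ≫ eHom hv i l := (eHom_comp hv 0 i l).symm
    simp [this]⟩

lemma Special.tval_lmul {F : SCochain N k} (hF : Special B F) {p' : N}
    (g : (⟨p'⟩ : FundamentalGroupoid N) ⟶ ⟨p⟩) :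
    tval F (Spec.lmul g ∘ ρ) = tval F ρ := by
  obtain ⟨σ, hσ⟩ := exists_spans ρ
  rw [hF.ginv.tval_eq hσ, hF.ginv.tval_eq (hσ.lmul g)]

lemma Special.tval_eq_zero {F : SCochain N k} (hF : Special B F) {i l : Fin (k + 1)} (hil : i ≠ l)
    (h : ρ i = ρ l) : tval F ρ = 0 := by
  obtain ⟨σ, hσ⟩ := exists_spans ρ
  have h1 := hF.alt σ (Equiv.swap i l)
  have h2 : ρ ∘ Equiv.swap i l = ρ := by
    funext x
    simp only [Function.comp_apply, Equiv.swap_apply_def]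
    split_ifs with a b
    · rw [a, h]
    · rw [b, h]
    · rfl
  have h3 := hσ.comp (Equiv.swap i l)
  rw [h2] at h3
  rw [hF.ginv.eq_of_spans h3 hσ, Equiv.Perm.sign_swap hil] at h1
  rw [hF.ginv.tval_eq hσ]
  push_cast at h1
  linarith

lemma tval_scob {F : SCochain N k} (hF : GInv B F)
    (ρ : Fin (k + 2) → Spec (⟨p⟩ : FundamentalGroupoid N) (bdSub hj)) :
    tval (scob N k F) ρ =
      ∑ i : Fin (k + 2), (-1 : ℝ) ^ (i : ℕ) * tval F (fun l => ρ (i.succAbove l)) := by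
  obtain hσ := (exists_spans ρ).choose_spec
  rw [tval, scob_apply]
  refine Finset.sum_congr rfl fun i _ => ?_
  have := hσ.comp i.succAbove
  rw [← face_eq_smap] at this
  exact congrArg _ (hF.tval_eq this).symm

lemma abs_tval_le {F : SCochain N k} {C : ℝ} (hF : ∀ σ, |F σ| ≤ C) : |tval F ρ| ≤ C := hF _

end Values
end BddCoh

end

noncomputable section
namespace BddCoh
open CategoryTheory
local notation "I" => unitInterval

/-! ### The covering of a glued space -/

section Covering

variable {N Q M : Type} [TopologicalSpace N] [TopologicalSpace Q] [TopologicalSpace M]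

/-- A pair of neighbourhoods of `m`: the preimage of the larger one under the gluing map is a disjoint
union of neighbourhoods of the points over `m` in which homotopy classes of paths are determined by
their ends, and points of the preimage of the smaller one are joined there to a point over `m`. -/
structure IsGood (j : Bool → C(Q, N)) (B : Set N) (q : C(N, M)) (m : M) (V' V : Set M) : Prop where
  sub : V' ⊆ V
  joined : ∀ n', q n' ∈ V' → ∃ (n : N) (γ : Path n n'), q n = m ∧ ∀ t, q (γ t) ∈ V
  hm_eq : ∀ {n n' : N} (γ γ' : Path n n'), (∀ t, q (γ t) ∈ V) → (∀ t, q (γ' t) ∈ V) → hm γ = hm γ'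
  eq : ∀ {n n' : N} (γ : Path n n'), (∀ t, q (γ t) ∈ V) → q n = m → q n' = m → n = n'
  joined_side : ∀ b s, q (j b s) ∈ V' →
    ∃ (s' : Q) (c : Path s' s), q (j b s') = m ∧ ∀ t, q (j b (c t)) ∈ V
  joined_bd : ∀ n' ∈ B, q n' ∈ V' →
    ∃ (n : N) (γ : Path n n'), q n = m ∧ ∀ t, γ t ∈ B ∧ q (γ t) ∈ V

/-- The space `M` is obtained from `N` by gluing the two copies of `Q` in `B`. -/
structure GlueHyp (j : Bool → C(Q, N)) (B : Set N) (q : C(N, M)) : Prop where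
  mem : ∀ b s, j b s ∈ B
  inj : ∀ {b b' s s'}, j b s = j b' s' → b = b' ∧ s = s'
  q_side : ∀ b b' s, q (j b s) = q (j b' s)
  q_eq : ∀ {n n'}, q n = q n' → n = n' ∨ ∃ s b b', b ≠ b' ∧ n = j b s ∧ n' = j b' s
  surj : Function.Surjective q
  compat : RW.Compat (sides j)
  good : ∀ (m : M) (W : Set M), IsOpen W → m ∈ W →
    ∃ V' V : Set M, V ⊆ W ∧ m ∈ V' ∧ IsOpen V' ∧ IsGood j B q m V' V

lemma mem_trans {q : C(N, M)} {V : Set M} {a b c : N} {γ : Path a b} {γ' : Path b c}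
    (h : ∀ t, q (γ t) ∈ V) (h' : ∀ t, q (γ' t) ∈ V) : ∀ t, q (γ.trans γ' t) ∈ V := by
  intro t
  have : γ.trans γ' t ∈ Set.range (γ.trans γ') := ⟨t, rfl⟩
  rw [Path.trans_range] at this
  rcases this with ⟨s, hs⟩ | ⟨s, hs⟩
  · exact hs ▸ h s
  · exact hs ▸ h' s

variable {j : Bool → C(Q, N)} {B : Set N} {q : C(N, M)}

/-- Reduced words between points. -/
abbrev PW (j : Bool → C(Q, N)) (p n : N) : Type :=
  RW (sides j) (⟨p⟩ : FundamentalGroupoid N) (⟨n⟩ : FundamentalGroupoid N)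

namespace GlueHyp

variable (H : GlueHyp j B q) (p : N)

/-- Crossing from one side to the other. -/
def X {p : N} (s : Q) (b b' : Bool) (h : b ≠ b') (y : PW j p (j b s)) : PW j p (j b' s) :=
  RW.X H.compat ⟨s⟩ b b' h y

lemma X_X {p : N} (s : Q) (b b' : Bool) (h : b ≠ b') (y : PW j p (j b s)) :
    H.X s b' b h.symm (H.X s b b' h y) = y := RW.X_X H.compat h y

lemma X_mul {p : N} {s s' : Q} {b b' : Bool} (h : b ≠ b') (y : PW j p (j b s)) (c : Path s s') :
    H.X s' b b' h (y.mul (hm (c.map (j b).continuous))) =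
      (H.X s b b' h y).mul (hm (c.map (j b').continuous)) :=
  RW.X_mul H.compat h y (hm c)

/-- The identifications made by crossings. -/
inductive ERel : (Σ n, PW j p n) → (Σ n, PW j p n) → Prop
  | refl a : ERel a a
  | cross (s : Q) (b b' : Bool) (h : b ≠ b') (y : PW j p (j b s)) :
      ERel ⟨j b s, y⟩ ⟨j b' s, H.X s b b' h y⟩

variable {H p} in
lemma ERel.of_eq {a c : Σ n, PW j p n} (hac : H.ERel p a c) {s : Q} {b b' : Bool} (h : b ≠ b')
    {y : PW j p (j b s)} (ha : a = ⟨j b s, y⟩) : c = a ∨ c = ⟨j b' s, H.X s b b' h y⟩ := by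
  cases hac with
  | refl => exact .inl rfl
  | cross s₁ b₁ b₁' h₁ y₁ =>
    right
    obtain ⟨h2, h3⟩ := Sigma.mk.inj ha
    obtain ⟨rfl, rfl⟩ := H.inj h2
    obtain rfl := eq_of_heq h3
    obtain rfl : b' = b₁' := by cases b' <;> cases b₁ <;> cases b₁' <;> simp_all
    rfl

/-- The total space of the covering. -/
def eSetoid : Setoid (Σ n, PW j p n) where
  r := H.ERel p
  iseqv := by
    have hs : ∀ {a c}, H.ERel p a c → H.ERel p c a := by
      intro a c h
      cases h with
      | refl => exact .refl _
      | cross s b b' h y =>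
        have := ERel.cross (H := H) (p := p) s b' b h.symm (H.X s b b' h y)
        rwa [X_X] at this
    refine ⟨.refl, hs, fun {a c d} h h' => ?_⟩
    cases h with
    | refl => exact h'
    | cross s b b' h y =>
      rcases h'.of_eq h.symm rfl with rfl | rfl
      · exact .cross _ _ _ _ _
      · rw [X_X]; exact .refl _

/-- The total space of the covering. -/
def E : Type := Quotient (H.eSetoid p)

variable {p}

/-- The point of the covering given by a word. -/
def el {n : N} (y : PW j p n) : H.E p := Quotient.mk (H.eSetoid p) ⟨n, y⟩

lemma el_cross {s : Q} {b b' : Bool} (h : b ≠ b') (y : PW j p (j b s)) :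
    H.el (H.X s b b' h y) = H.el y :=
  (Quotient.sound (s := H.eSetoid p) (ERel.cross s b b' h y)).symm

lemma ind {P : H.E p → Prop} (h : ∀ n (y : PW j p n), P (H.el y)) (e : H.E p) : P e :=
  Quotient.ind (fun a => h a.1 a.2) e

lemma el_cases {n n' : N} {y : PW j p n} {y' : PW j p n'} (h : H.el y = H.el y') :
    (⟨n, y⟩ : Σ n, PW j p n) = ⟨n', y'⟩ ∨ ∃ (s : Q) (b b' : Bool) (hb : b ≠ b') (z : PW j p (j b s)),
      (⟨n, y⟩ : Σ n, PW j p n) = ⟨j b s, z⟩ ∧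
        (⟨n', y'⟩ : Σ n, PW j p n) = ⟨j b' s, H.X s b b' hb z⟩ := by
  have h' : H.ERel p ⟨n, y⟩ ⟨n', y'⟩ := (Quotient.eq (r := H.eSetoid p)).1 h
  generalize ha : (⟨n, y⟩ : Σ n, PW j p n) = a at h'
  generalize hc : (⟨n', y'⟩ : Σ n, PW j p n) = c at h'
  cases h' with
  | refl => exact .inl rfl
  | cross s b b' hb z => exact .inr ⟨s, b, b', hb, z, rfl, rfl⟩

lemma el_inj {n : N} {y y' : PW j p n} (h : H.el y = H.el y') : y = y' := by
  rcases H.el_cases h with h | ⟨s, b, b', hb, z, h1, h2⟩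
  · exact eq_of_heq (Sigma.mk.inj h).2
  · exact absurd (H.inj ((Sigma.mk.inj h1).1.symm.trans (Sigma.mk.inj h2).1)).1 hb

/-- The covering projection. -/
def proj (e : H.E p) : M :=
  Quotient.lift (s := H.eSetoid p) (fun a => q a.1) (by
    intro a c (h : H.ERel p a c)
    cases h with
    | refl => rfl
    | cross s b b' h y => exact H.q_side b b' s) e

@[simp] lemma proj_el {n : N} (y : PW j p n) : H.proj (H.el y) = q n := rfl

lemma exists_el (e : H.E p) {n : N} (hn : q n = H.proj e) : ∃ y : PW j p n, H.el y = e := by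
  induction e using ind with
  | h n' y' =>
  rcases H.q_eq hn with rfl | ⟨s, b, b', hb, rfl, rfl⟩
  · exact ⟨y', rfl⟩
  · exact ⟨H.X s b' b hb.symm y', H.el_cross _ _⟩

/-- The points `e` and `e'` are joined by a path over `V` which does not cross. -/
def Tr (V : Set M) (e e' : H.E p) : Prop :=
  ∃ (n n' : N) (y : PW j p n) (γ : Path n n'), e = H.el y ∧ e' = H.el (y.mul (hm γ)) ∧
    ∀ t, q (γ t) ∈ V

lemma Tr.mono {V V' : Set M} (h : V ⊆ V') {e e' : H.E p} (ht : H.Tr V e e') : H.Tr V' e e' := by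
  obtain ⟨n, n', y, γ, h1, h2, h3⟩ := ht
  exact ⟨n, n', y, γ, h1, h2, fun t => h (h3 t)⟩

lemma Tr.proj_mem {V : Set M} {e e' : H.E p} (ht : H.Tr V e e') : H.proj e' ∈ V := by
  obtain ⟨n, n', y, γ, h1, rfl, h3⟩ := ht
  simpa using h3 1

lemma Tr.refl {V : Set M} {e : H.E p} (he : H.proj e ∈ V) : H.Tr V e e := by
  induction e using ind with
  | h n y =>
  refine ⟨n, n, y, Path.refl n, rfl, ?_, fun t => he⟩
  rw [hm_refl, RW.mul_id]

variable {V' V : Set M} {m : M}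

lemma Tr.eq_el (hV : IsGood j B q m V' V) {e e' : H.E p} (he : H.proj e = m)
    (he' : H.proj e' ∈ V') (ht : H.Tr V e e') {n n' : N} {y' : PW j p n'} (hy' : e' = H.el y') (γ : Path n n') (hγ : ∀ t, q (γ t) ∈ V)
    (hn : q n = m) : e = H.el (y'.mul (hm γ.symm)) := by
  obtain ⟨n₁, n₁', y₁, γ₁, rfl, rfl, h3⟩ := ht
  have key : ∀ {n n₁ n' : N} (y₁ : PW j p n₁) (γ₁ : Path n₁ n') (γ : Path n n'), q n₁ = m → q n = m →
      (∀ t, q (γ₁ t) ∈ V) → (∀ t, q (γ t) ∈ V) →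
      H.el y₁ = H.el ((y₁.mul (hm γ₁)).mul (hm γ.symm)) := by
    intro n n₁ n' y₁ γ₁ γ h1 h2 h3 h4
    obtain rfl := hV.eq (γ₁.trans γ.symm) (mem_trans h3 fun t => h4 _) h1 h2
    rw [hV.hm_eq γ₁ γ h3 h4, RW.mul_mul, hm_symm]
    simp
  rcases H.el_cases hy' with h | ⟨s, b, b', hb, z, h1, h2⟩
  · obtain ⟨rfl, h⟩ := Sigma.mk.inj h
    obtain rfl := eq_of_heq h
    exact key y₁ γ₁ γ he hn h3 hγ
  · obtain ⟨rfl, h1⟩ := Sigma.mk.inj h1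
    obtain ⟨rfl, h2⟩ := Sigma.mk.inj h2
    obtain rfl := eq_of_heq h1
    obtain rfl := eq_of_heq h2
    obtain ⟨s', c, hs', hc⟩ := hV.joined_side b s he'
    have hc' : ∀ t, q (j b' (c t)) ∈ V := fun t => by rw [H.q_side b' b]; exact hc t
    rw [key y₁ γ₁ (c.map (j b).continuous) he hs' h3 hc]
    set z := y₁.mul (hm γ₁)
    have e1 := H.X_mul hb z c.symm
    have e2 : H.el (z.mul (hm (c.map (j b).continuous).symm)) =
        H.el ((H.X s b b' hb z).mul (hm (c.map (j b').continuous).symm)) := by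
      rw [← H.el_cross hb]
      exact congrArg H.el e1
    rw [e2]
    have e3 := key ((H.X s b b' hb z).mul (hm (c.map (j b').continuous).symm))
      (c.map (j b').continuous) γ ((H.q_side b' b s').trans hs') hn hc' hγ
    rw [e3]
    congr 2
    rw [RW.mul_mul, hm_symm]
    simp

lemma exists_tr (hV : IsGood j B q m V' V) (e : H.E p) (he : H.proj e = m) {x : M} (hx : x ∈ V') :
    ∃ e', H.proj e' = x ∧ H.Tr V e e' := by
  obtain ⟨n', rfl⟩ := H.surj x
  obtain ⟨n, γ, hn, hγ⟩ := hV.joined n' hx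
  obtain ⟨y, rfl⟩ := H.exists_el e (hn.trans he.symm)
  exact ⟨_, rfl, n, n', y, γ, rfl, rfl, hγ⟩

lemma exists_tr' (hV : IsGood j B q m V' V) (e' : H.E p) (he : H.proj e' ∈ V') :
    ∃ e, H.proj e = m ∧ H.Tr V e e' := by
  induction e' using ind with
  | h n' y =>
  obtain ⟨n, γ, hn, hγ⟩ := hV.joined n' he
  refine ⟨H.el (y.mul (hm γ.symm)), hn, n, n', _, γ, rfl, ?_, hγ⟩
  rw [RW.mul_mul, hm_symm]
  simp

lemma Tr.left_unique (hV : IsGood j B q m V' V) {e₁ e₂ e' : H.E p} (h₁ : H.proj e₁ = m)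
    (h₂ : H.proj e₂ = m) (hV' : H.proj e' ∈ V') (t₁ : H.Tr V e₁ e') (t₂ : H.Tr V e₂ e') :
    e₁ = e₂ := by
  induction e' using ind with
  | h n' y =>
  obtain ⟨n, γ, hn, hγ⟩ := hV.joined n' hV'
  rw [t₁.eq_el H hV h₁ hV' rfl γ hγ hn, t₂.eq_el H hV h₂ hV' rfl γ hγ hn]

lemma Tr.right_unique (hV : IsGood j B q m V' V) {e e₁ e₂ : H.E p} (h : H.proj e = m)
    (h₁₂ : H.proj e₁ = H.proj e₂) (hV' : H.proj e₁ ∈ V') (t₁ : H.Tr V e e₁) (t₂ : H.Tr V e e₂) :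
    e₁ = e₂ := by
  induction e₁ using ind with
  | h n' y =>
  obtain ⟨y', rfl⟩ := H.exists_el e₂ h₁₂
  obtain ⟨n, γ, hn, hγ⟩ := hV.joined n' hV'
  have := H.el_inj ((t₁.eq_el H hV h hV' rfl γ hγ hn).symm.trans
    (t₂.eq_el H hV h (h₁₂ ▸ hV') rfl γ hγ hn))
  have h' := congrArg (fun z => RW.mul z (hm γ)) this
  rw [hm_symm] at h'
  simp only [RW.mul_mul, IsIso.inv_hom_id, RW.mul_id] at h'
  rw [h']

lemma Tr.trans (hV : IsGood j B q m V' V) {e e' e'' : H.E p} (h : H.proj e = m)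
    (hV' : H.proj e' ∈ V') (t₁ : H.Tr V e e') (t₂ : H.Tr V e' e'') : H.Tr V e e'' := by
  obtain ⟨n', n'', y', γ', rfl, rfl, hγ'⟩ := t₂
  obtain ⟨n, γ, hn, hγ⟩ := hV.joined n' hV'
  refine ⟨n, n'', _, γ.trans γ', t₁.eq_el H hV h hV' rfl γ hγ hn, ?_, mem_trans hγ hγ'⟩
  rw [RW.mul_mul, hm_symm, hm_trans]
  simp

instance : TopologicalSpace (H.E p) where
  IsOpen O := ∀ e ∈ O, ∃ V : Set M, IsOpen V ∧ H.proj e ∈ V ∧ ∀ e', H.Tr V e e' → e' ∈ O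
  isOpen_univ := fun e _ => ⟨Set.univ, isOpen_univ, trivial, fun _ _ => trivial⟩
  isOpen_inter := by
    rintro O O' h h' e ⟨he, he'⟩
    obtain ⟨V, hV, hm, ht⟩ := h e he
    obtain ⟨V', hV', hm', ht'⟩ := h' e he'
    exact ⟨V ∩ V', hV.inter hV', ⟨hm, hm'⟩, fun e' h'' =>
      ⟨ht _ (Tr.mono H Set.inter_subset_left h''), ht' _ (Tr.mono H Set.inter_subset_right h'')⟩⟩
  isOpen_sUnion := by
    rintro S hS e ⟨O, hO, he⟩
    obtain ⟨V, hV, hm, ht⟩ := hS O hO e he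
    exact ⟨V, hV, hm, fun e' h => ⟨O, hO, ht e' h⟩⟩

lemma isOpen_iff {O : Set (H.E p)} : IsOpen O ↔
    ∀ e ∈ O, ∃ V : Set M, IsOpen V ∧ H.proj e ∈ V ∧ ∀ e', H.Tr V e e' → e' ∈ O := Iff.rfl

lemma continuous_proj : Continuous (H.proj : H.E p → M) := by
  refine continuous_def.2 fun V hV => (H.isOpen_iff).2 fun e he => ⟨V, hV, he, fun _ h => ?_⟩
  exact h.proj_mem

lemma isOpen_tr (hV : IsGood j B q m V' V) (hVo : IsOpen V') (e : H.E p) (he : H.proj e = m) :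
    IsOpen {e' | H.Tr V e e' ∧ H.proj e' ∈ V'} :=
  (H.isOpen_iff).2 fun _ he' => ⟨V', hVo, he'.2, fun _ h =>
    ⟨Tr.trans H hV he he'.2 he'.1 (Tr.mono H hV.sub h), h.proj_mem⟩⟩

lemma isOpenMap_proj : IsOpenMap (H.proj : H.E p → M) := by
  intro O hO
  refine isOpen_iff_mem_nhds.2 ?_
  rintro - ⟨e, he, rfl⟩
  obtain ⟨V, hV, hm, ht⟩ := (H.isOpen_iff).1 hO e he
  obtain ⟨V', W, hVV', hm', hV', hg⟩ := H.good _ V hV hm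
  refine Filter.mem_of_superset (hV'.mem_nhds hm') fun x hx => ?_
  obtain ⟨e', rfl, he'⟩ := H.exists_tr hg e rfl hx
  exact ⟨e', ht e' (Tr.mono H hVV' he'), rfl⟩

/-- The projection is a covering map. -/
lemma isCoveringMap : IsCoveringMap (H.proj : H.E p → M) := by
  intro m
  obtain ⟨V', V, -, hm, hVo, hV⟩ := H.good m Set.univ isOpen_univ trivial
  let F := {e : H.E p // H.proj e = m}
  let _ : TopologicalSpace F := ⊥
  have : DiscreteTopology F := ⟨rfl⟩
  suffices h : IsEvenlyCovered (H.proj : H.E p → M) m F from h.to_isEvenlyCovered_preimage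
  choose base hbase htr using fun e : H.proj (p := p) ⁻¹' V' => H.exists_tr' hV e.1 e.2
  choose sec hsec hsectr using fun z : V' × F => H.exists_tr hV z.2.1 z.2.2 z.1.2
  let f : H.proj (p := p) ⁻¹' V' ≃ V' × F :=
    { toFun := fun e => (⟨H.proj e.1, e.2⟩, ⟨base e, hbase e⟩)
      invFun := fun z => ⟨sec z, by rw [Set.mem_preimage, hsec]; exact z.1.2⟩
      left_inv := fun e => Subtype.ext
        (Tr.right_unique H hV (hbase e) (hsec _)
          (by rw [hsec]; exact e.2) (hsectr (⟨_, e.2⟩, ⟨base e, hbase e⟩)) (htr e))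
      right_inv := fun z => Prod.ext (Subtype.ext (hsec z)) (Subtype.ext
        (Tr.left_unique H hV (hbase _) z.2.2 (by rw [hsec]; exact z.1.2) (htr _) (hsectr z))) }
  have hcont : Continuous f := by
    refine Continuous.prodMk ?_ ?_
    · exact Continuous.subtype_mk (H.continuous_proj.comp continuous_subtype_val) _
    · refine continuous_discrete_rng.2 fun e₀ => ?_
      convert (H.isOpen_tr hV hVo e₀.1 e₀.2).preimage continuous_subtype_val using 1
      ext e
      constructor
      · rintro rfl; exact ⟨htr e, e.2⟩
      · intro h
        exact Subtype.ext (Tr.left_unique H hV (hbase _) e₀.2 e.2 (htr e) h.1)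
  have hopen : IsOpenMap f := by
    intro O hO
    refine isOpen_iff_mem_nhds.2 ?_
    rintro - ⟨e, he, rfl⟩
    obtain ⟨O', hO', rfl⟩ := isOpen_induced_iff.1 hO
    have hW := H.isOpenMap_proj _ (hO'.inter (H.isOpen_tr hV hVo (base e) (hbase e)))
    have : (Subtype.val ⁻¹' (H.proj '' (O' ∩ {e' | H.Tr V (base e) e' ∧ H.proj e' ∈ V'}))) ×ˢ {(f e).2} ∈
        nhds (f e) :=
      prod_mem_nhds ((hW.preimage continuous_subtype_val).mem_nhds ⟨e.1, ⟨he, htr e, e.2⟩, rfl⟩)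
        ((isOpen_discrete _).mem_nhds rfl)
    refine Filter.mem_of_superset this ?_
    rintro ⟨x, z⟩ ⟨⟨e', ⟨h1, h2⟩, h3⟩, rfl⟩
    refine ⟨⟨e', by rw [Set.mem_preimage, h3]; exact x.2⟩, h1, Prod.ext (Subtype.ext h3) ?_⟩
    exact Subtype.ext (Tr.left_unique H hV (hbase _) (hbase _) h2.2 (htr _) h2.1)
  exact ⟨inferInstance, V', hm, hVo, hVo.preimage H.continuous_proj,
    f.toHomeomorphOfContinuousOpen hcont hopen, fun _ => rfl⟩

end GlueHyp

end Covering
end BddCoh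

end

noncomputable section
namespace BddCoh
open CategoryTheory
local notation "I" => unitInterval

/-! ### Transfer of special cochains to a glued space -/

instance (k : ℕ) : LocallyPathConnectedSpace (Δ k) :=
  (convex_stdSimplex ℝ (Fin (k + 1))).locallyPathConnectedSpace

lemma RW.ret_mul_or {𝒩 𝒬 : Type} [Groupoid.{0} 𝒩] [Groupoid.{0} 𝒬] {i : Bool → 𝒬 ⥤ 𝒩} (ℬ : BdSub i)
    {p p' : 𝒩} (w : RW i p p') : (∃ g : p ⟶ p', w = base g) ∨
    ∀ {x : 𝒩} (γ : p' ⟶ x), (w.mul γ).ret ℬ = w.ret ℬ := by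
  induction w using RW.ind with
  | h w hw =>
  cases w with
  | base g => exact .inl ⟨g, rfl⟩
  | cross s b b' h w γ => exact .inr fun γ => rfl

namespace GlueHyp

variable {N Q M : Type} [TopologicalSpace N] [TopologicalSpace Q] [TopologicalSpace M]
  {j : Bool → C(Q, N)} {B : Set N} {q : C(N, M)} (H : GlueHyp j B q) {p p' : N}

/-- Special classes of paths starting at `p`. -/
abbrev V (p : N) : Type := Spec (⟨p⟩ : FundamentalGroupoid N) (bdSub H.mem)

/-- The retraction of the covering. -/
def ret (e : H.E p) : H.V p :=
  Quotient.lift (s := H.eSetoid p) (fun a => a.2.ret (bdSub H.mem)) (by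
    intro a c (h : H.ERel p a c)
    cases h with
    | refl => rfl
    | cross s b b' h y => exact (RW.ret_X H.compat h y).symm) e

lemma ret_el {n : N} (y : PW j p n) : H.ret (H.el y) = y.ret (bdSub H.mem) := rfl

/-- Left translation on the covering. -/
def actFun (w : PW j p p') (e : H.E p') : H.E p :=
  Quotient.map (sa := H.eSetoid p') (sb := H.eSetoid p)
    (fun a => ⟨a.1, RW.lact H.compat w a.2⟩) (by
    intro a c (h : H.ERel p' a c)
    change H.ERel p _ _
    cases h with
    | refl => exact .refl _
    | cross s b b' h y =>
      have := ERel.cross (H := H) s b b' h (RW.lact H.compat w y)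
      convert this using 2
      exact RW.lact_X H.compat w h y) e

lemma actFun_el (w : PW j p p') {n : N} (y : PW j p' n) :
    H.actFun w (H.el y) = H.el (RW.lact H.compat w y) := rfl

lemma proj_actFun (w : PW j p p') (e : H.E p') : H.proj (H.actFun w e) = H.proj e := by
  induction e using ind with
  | h n y => rfl

/-- Left translation on the covering. -/
def act (w : PW j p p') : C(H.E p', H.E p) where
  toFun := H.actFun w
  continuous_toFun := by
    refine continuous_def.2 fun O hO => H.isOpen_iff.2 fun e he => ?_
    obtain ⟨V, hV, hm, ht⟩ := H.isOpen_iff.1 hO _ he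
    rw [proj_actFun] at hm
    refine ⟨V, hV, hm, fun e' h => ht _ ?_⟩
    obtain ⟨n, n', y, γ, rfl, rfl, h⟩ := h
    refine ⟨n, n', RW.lact H.compat w y, γ, rfl, ?_, h⟩
    rw [actFun_el, RW.lact_mul]

lemma act_el (w : PW j p p') {n : N} (y : PW j p' n) :
    H.act w (H.el y) = H.el (RW.lact H.compat w y) := rfl

lemma proj_act (w : PW j p p') (e : H.E p') : H.proj (H.act w e) = H.proj e := H.proj_actFun w e

lemma act_act {p'' : N} (w : PW j p p') (w' : PW j p' p'') (e : H.E p'') :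
    H.act w (H.act w' e) = H.act (RW.lact H.compat w w') e := by
  induction e using ind with
  | h n y => rw [act_el, act_el, act_el, RW.lact_lact]

lemma act_one (e : H.E p) : H.act (RW.base (𝟙 _)) e = e := by
  induction e using ind with
  | h n y => rw [act_el, RW.base_lact]

lemma act_base_base {p'' : N} (g : (⟨p⟩ : FundamentalGroupoid N) ⟶ ⟨p'⟩)
    (g' : (⟨p'⟩ : FundamentalGroupoid N) ⟶ ⟨p''⟩) (e : H.E p'') :
    H.act (RW.base g) (H.act (RW.base g') e) = H.act (RW.base (g ≫ g')) e := by
  rw [act_act]; rfl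

lemma ret_act_base (g : (⟨p⟩ : FundamentalGroupoid N) ⟶ ⟨p'⟩) (e : H.E p') :
    H.ret (H.act (RW.base g) e) = Spec.lmul g (H.ret e) := by
  induction e using ind with
  | h n y => exact RW.ret_base_lact H.compat g y

lemma exists_act_eq {e' : H.E p'} {e : H.E p} (h : H.proj e' = H.proj e) :
    ∃ w, H.act w e' = e := by
  induction e' using ind with
  | h n y' =>
  obtain ⟨y, rfl⟩ := H.exists_el e h
  obtain ⟨w, hw⟩ := RW.exists_lact_eq H.compat y' y
  exact ⟨w, by rw [act_el, hw]⟩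

variable {k : ℕ}

/-- Lifts of a simplex to the coverings. -/
def Lift (σ : SSimplex M k) (p : N) : Type :=
  {σ' : C(Δ k, H.E p) // ∀ x, H.proj (σ' x) = σ x}

variable {H} {σ : SSimplex M k}

lemma Lift.eq {l l' : H.Lift σ p} (x : Δ k) (h : l.1 x = l'.1 x) : l = l' := by
  refine Subtype.ext (ContinuousMap.ext fun z => ?_)
  exact congrFun (H.isCoveringMap.eq_of_comp_eq l.1.continuous l'.1.continuous
    (funext fun x => (l.2 x).trans (l'.2 x).symm) x h) z

lemma Lift.exists (σ : SSimplex M k) (x : Δ k) (e : H.E p) (h : H.proj e = σ x) :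
    ∃ l : H.Lift σ p, l.1 x = e := by
  obtain ⟨F, ⟨h1, h2⟩, -⟩ := H.isCoveringMap.existsUnique_continuousMap_lifts σ x e h
  exact ⟨⟨F, fun z => congrFun h2 z⟩, h1⟩

/-- Translation of lifts. -/
def Lift.act (w : PW j p p') (l : H.Lift σ p') : H.Lift σ p :=
  ⟨(H.act w).comp l.1, fun x => (H.proj_act w _).trans (l.2 x)⟩

/-- Restriction of lifts. -/
def Lift.face {σ : SSimplex M (k + 1)} (l : H.Lift σ p) (i : Fin (k + 2)) :
    H.Lift (faceOf σ i) p := ⟨l.1.comp (BddCoh.face i), fun _ => l.2 _⟩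

/-- The special classes of the vertices of a lift. -/
def Lift.vals (l : H.Lift σ p) (i : Fin (k + 1)) : H.V p := H.ret (l.1 (vtx i))

variable (H) in
/-- Equivalence of lifts under translations by paths. -/
def liftSetoid (σ : SSimplex M k) : Setoid (Σ p, H.Lift σ p) where
  r a c := ∃ g : (⟨c.1⟩ : FundamentalGroupoid N) ⟶ ⟨a.1⟩, a.2.act (RW.base g) = c.2
  iseqv := by
    refine ⟨fun a => ⟨𝟙 _, Lift.eq (vtx 0) (H.act_one _)⟩, ?_, ?_⟩
    · rintro ⟨p, l⟩ ⟨p', l'⟩ ⟨(g : (⟨p'⟩ : FundamentalGroupoid N) ⟶ ⟨p⟩), (rfl : l.act (RW.base g) = l')⟩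
      refine ⟨inv g, Lift.eq (vtx 0) ?_⟩
      change H.act _ (H.act _ _) = _
      rw [act_base_base, IsIso.inv_hom_id, act_one]
    · rintro ⟨p, l⟩ ⟨p', l'⟩ ⟨p'', l''⟩
        ⟨(g : (⟨p'⟩ : FundamentalGroupoid N) ⟶ ⟨p⟩), (rfl : l.act (RW.base g) = l')⟩
        ⟨(g' : (⟨p''⟩ : FundamentalGroupoid N) ⟶ ⟨p'⟩), (rfl : Lift.act (RW.base g') _ = l'')⟩
      exact ⟨g' ≫ g, Lift.eq (vtx 0) (H.act_base_base _ _ _).symm⟩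

variable (H) in
/-- Classes of lifts. -/
def Om (σ : SSimplex M k) : Type := Quotient (H.liftSetoid σ)

/-- The class of a lift. -/
def Lift.cls (l : H.Lift σ p) : H.Om σ := Quotient.mk (H.liftSetoid σ) ⟨p, l⟩

lemma Lift.cls_eq {l : H.Lift σ p} {l' : H.Lift σ p'} : l.cls = l'.cls ↔
    ∃ g : (⟨p'⟩ : FundamentalGroupoid N) ⟶ ⟨p⟩, l.act (RW.base g) = l' :=
  Quotient.eq (r := H.liftSetoid σ)

lemma Om.ind {P : H.Om σ → Prop} (h : ∀ p (l : H.Lift σ p), P l.cls) (ω : H.Om σ) : P ω :=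
  Quotient.ind (fun a => h a.1 a.2) ω

/-- The value of a special cochain on a class of lifts. -/
def Om.val (F : SCochain N k) (ω : H.Om σ) : ℝ :=
  tval F (Quotient.out (s := H.liftSetoid σ) ω).2.vals

lemma Lift.val_cls {F : SCochain N k} (hF : Special B F) (l : H.Lift σ p) :
    l.cls.val F = tval F l.vals := by
  set a := Quotient.out (s := H.liftSetoid σ) l.cls with ha
  have : a.2.cls = l.cls := Quotient.out_eq (s := H.liftSetoid σ) l.cls
  obtain ⟨g, hg⟩ := Lift.cls_eq.1 this
  have h2 : l.vals = Spec.lmul g ∘ a.2.vals := by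
    funext i
    rw [← hg]
    exact H.ret_act_base g _
  rw [h2, hF.tval_lmul]
  rfl

/-- Restriction of classes of lifts. -/
def Om.face {σ : SSimplex M (k + 1)} (i : Fin (k + 2)) (ω : H.Om σ) : H.Om (faceOf σ i) :=
  Quotient.map (sa := H.liftSetoid σ) (sb := H.liftSetoid (faceOf σ i))
    (fun a => ⟨a.1, a.2.face i⟩) (by
    rintro ⟨p, l⟩ ⟨p', l'⟩ ⟨(g : (⟨p'⟩ : FundamentalGroupoid N) ⟶ ⟨p⟩), (rfl : l.act (RW.base g) = l')⟩
    exact ⟨g, rfl⟩) ω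

lemma Om.face_cls {σ : SSimplex M (k + 1)} (i : Fin (k + 2)) (l : H.Lift σ p) :
    Om.face i l.cls = (l.face i).cls := rfl

lemma Om.face_bijective {σ : SSimplex M (k + 1)} (i : Fin (k + 2)) :
    Function.Bijective (Om.face i : H.Om σ → H.Om (faceOf σ i)) := by
  constructor
  · intro ω ω' h
    induction ω using Om.ind with
    | h p l =>
    induction ω' using Om.ind with
    | h p' l' =>
    rw [face_cls, face_cls, Lift.cls_eq] at h
    obtain ⟨g, hg⟩ := h
    refine Lift.cls_eq.2 ⟨g, Lift.eq (BddCoh.face i (vtx 0)) ?_⟩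
    exact DFunLike.congr_fun (congrArg Subtype.val hg) (vtx 0)
  · intro ω
    induction ω using Om.ind with
    | h p l =>
    obtain ⟨l', hl'⟩ := Lift.exists σ (BddCoh.face i (vtx 0)) (l.1 (vtx 0)) (l.2 _)
    exact ⟨l'.cls, congrArg Lift.cls (Lift.eq (vtx 0) hl')⟩

lemma Lift.exists_act (l : H.Lift σ p) (l' : H.Lift σ p') : ∃ w, l'.act w = l := by
  obtain ⟨w, hw⟩ := H.exists_act_eq ((l'.2 (vtx 0)).trans (l.2 (vtx 0)).symm)
  exact ⟨w, Lift.eq (vtx 0) hw⟩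

lemma vals_injective_of_ne_zero {F : SCochain N k} (hF : Special B F) {ρ : Fin (k + 1) → H.V p}
    (h : tval F ρ ≠ 0) : Function.Injective ρ := fun i l hil => by
  by_contra hne
  exact h (hF.tval_eq_zero hne hil)

lemma Om.subsingleton_support {F : SCochain N (k + 2)} (hF : Special B F) (σ : SSimplex M (k + 2)) :
    (Function.support (Om.val F : H.Om σ → ℝ)).Subsingleton := by
  intro ω hω ω' hω'
  induction ω using Om.ind with
  | h p l =>
  induction ω' using Om.ind with
  | h p' l' =>
  rw [Function.mem_support, Lift.val_cls hF] at hω hω'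
  have h1 := vals_injective_of_ne_zero hF hω
  have h2 := vals_injective_of_ne_zero hF hω'
  obtain ⟨w, rfl⟩ := l.exists_act l'
  rcases RW.lact_dichotomy (ℬ := bdSub H.mem) H.compat w with ⟨g, rfl⟩ | ⟨v, hv⟩
  · exact (Lift.cls_eq.2 ⟨g, rfl⟩).symm
  · exfalso
    have key : ∀ i, l'.vals i = v ∨ (l'.act w).vals i = w.ret (bdSub H.mem) := by
      intro i
      change H.ret (l'.1 (vtx i)) = v ∨ H.ret (H.act w (l'.1 (vtx i))) = _
      induction l'.1 (vtx i) using GlueHyp.ind with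
      | h n y => exact hv y
    have a01 : (0 : Fin (k + 3)) ≠ 1 := by simp
    have a02 : (0 : Fin (k + 3)) ≠ 2 := by
      simp [Fin.ext_iff, Nat.mod_eq_of_lt (show 2 < k + 3 by omega)]
    have a12 : (1 : Fin (k + 3)) ≠ 2 := by
      simp [Fin.ext_iff, Nat.mod_eq_of_lt (show 2 < k + 3 by omega)]
    rcases key 0 with h | h <;> rcases key 1 with h' | h' <;> rcases key 2 with h'' | h''
    · exact a01 (h2 (h.trans h'.symm))
    · exact a01 (h2 (h.trans h'.symm))
    · exact a02 (h2 (h.trans h''.symm))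
    · exact a12 (h1 (h'.trans h''.symm))
    · exact a12 (h2 (h'.trans h''.symm))
    · exact a02 (h1 (h.trans h''.symm))
    · exact a01 (h1 (h.trans h'.symm))
    · exact a01 (h1 (h.trans h'.symm))

variable (H) in
/-- The transfer of a special cochain to the glued space. -/
def T (F : SCochain N k) : SCochain M k := fun σ => ∑ᶠ ω : H.Om σ, ω.val F

lemma abs_T_le {F : SCochain N (k + 2)} (hF : Special B F) {C : ℝ} (hC : ∀ σ, |F σ| ≤ C) (hC0 : 0 ≤ C)
    (σ : SSimplex M (k + 2)) : |H.T F σ| ≤ C := by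
  by_cases h : ∃ ω : H.Om σ, ω.val F ≠ 0
  · obtain ⟨ω, hω⟩ := h
    have : H.T F σ = ω.val F := finsum_eq_single _ _ fun ω' hne => by
      by_contra h'
      exact hne (Om.subsingleton_support hF σ h' hω)
    rw [this]
    exact abs_tval_le hC
  · push Not at h
    rw [T, finsum_eq_zero_of_forall_eq_zero h]
    simpa

lemma T_add {F G : SCochain N (k + 2)} (hF : Special B F) (hG : Special B G) :
    H.T (F + G) = H.T F + H.T G := by
  funext σ
  exact finsum_add_distrib (Om.subsingleton_support hF σ).finite
    (Om.subsingleton_support hG σ).finite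

lemma T_zero : H.T (0 : SCochain N k) = 0 := by
  funext σ
  exact finsum_eq_zero_of_forall_eq_zero fun ω => rfl

lemma T_scob {F : SCochain N (k + 2)} (hF : Special B F) (hdF : Special B (scob N (k + 2) F)) :
    H.T (scob N (k + 2) F) = scob M (k + 2) (H.T F) := by
  funext σ
  rw [scob_apply]
  have : ∀ ω : H.Om σ, ω.val (scob N (k + 2) F) =
      ∑ i : Fin (k + 4), (-1 : ℝ) ^ (i : ℕ) * (Om.face i ω).val F := by
    intro ω
    induction ω using Om.ind with
    | h p l =>
    rw [Lift.val_cls hdF, tval_scob hF.ginv]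
    refine Finset.sum_congr rfl fun i _ => ?_
    rw [Om.face_cls, Lift.val_cls hF]
    congr 2
    funext r
    change H.ret (l.1 (vtx _)) = H.ret (l.1 (BddCoh.face i (vtx r)))
    rw [face_eq_smap, smap_vtx]
  rw [T, finsum_congr this, finsum_sum_comm]
  · refine Finset.sum_congr rfl fun i _ => ?_
    rw [← mul_finsum]
    congr 1
    exact finsum_eq_of_bijective (Om.face i) (Om.face_bijective i) fun _ => rfl
  · intro i _
    refine Set.Finite.subset
      ((Om.subsingleton_support hF (faceOf σ i)).preimage (Om.face_bijective i).1).finite ?_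
    intro ω hω h0
    apply hω
    change _ * (Om.face i ω).val F = 0
    have : (Om.face i ω).val F = 0 := by simpa using h0
    rw [this, mul_zero]

lemma isLocallyConstant_ret (l : H.Lift σ p) (hσ : Set.range σ ⊆ q '' B) :
    IsLocallyConstant fun x => H.ret (l.1 x) := by
  refine (IsLocallyConstant.iff_exists_open _).2 fun x => ?_
  obtain ⟨V', V, -, hm, hVo, hV⟩ := H.good (H.proj (l.1 x)) Set.univ isOpen_univ trivial
  refine ⟨_, (H.isOpen_tr hV hVo (l.1 x) rfl).preimage l.1.continuous,
    ⟨Tr.refl H (hV.sub hm), hm⟩,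
    fun x' hx' => ?_⟩
  obtain ⟨n', hn', hq⟩ := hσ ⟨x', rfl⟩
  rw [← l.2] at hq
  obtain ⟨hx'', hV'⟩ : H.Tr V (l.1 x) (l.1 x') ∧ H.proj (l.1 x') ∈ V' := hx'
  obtain ⟨n, γ, hn, hγ⟩ := hV.joined_bd n' hn' (by rw [hq]; exact hV')
  obtain ⟨y', hy'⟩ := H.exists_el (l.1 x') hq
  rw [hx''.eq_el H hV rfl hV' hy'.symm γ (fun t => (hγ t).2) hn, ← hy', ret_el, ret_el, RW.ret_mul]
  exact ⟨γ.symm, .inr fun t => (hγ _).1, rfl⟩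

lemma T_mem_vanishingOn {F : SCochain N (k + 1)} (hF : Special B F) :
    H.T F ∈ vanishingOn M (q '' B) (k + 1) := by
  intro σ hσ
  refine finsum_eq_zero_of_forall_eq_zero fun ω => ?_
  induction ω using Om.ind with
  | h p l =>
  rw [Lift.val_cls hF]
  refine hF.tval_eq_zero (i := 0) (l := 1) (by simp) ?_
  exact (isLocallyConstant_ret l hσ).apply_eq_of_preconnectedSpace _ _

variable (H) in
/-- The canonical lift of a simplex which comes from `N`. -/
def canonLift (σ : SSimplex N k) : H.Lift (q.comp σ) (σ (vtx 0)) :=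
  ⟨⟨fun x => H.el (RW.base (hm ((PathConnectedSpace.somePath (vtx 0) x).map σ.continuous))), by
    refine continuous_def.2 fun O hO => isOpen_iff_mem_nhds.2 fun x hx => ?_
    obtain ⟨V, hV, hm', ht⟩ := H.isOpen_iff.1 hO _ hx
    have hn : (q.comp σ) ⁻¹' V ∈ nhds x := (hV.preimage (q.comp σ).continuous).mem_nhds hm'
    obtain ⟨W, ⟨hW, hWp⟩, hWV⟩ := (path_connected_basis x).mem_iff.1 hn
    refine Filter.mem_of_superset hW fun x' hx' => ht _ ?_
    obtain ⟨c, hc⟩ := hWp.joinedIn x (mem_of_mem_nhds hW) x' hx'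
    refine ⟨σ x, σ x', _, c.map σ.continuous, rfl, ?_, fun t => hWV (hc t)⟩
    rw [RW.base_mul, ← hm_trans, ← Path.map_trans]
    exact congrArg (fun z => H.el (RW.base z))
      (hm_eq.2 ((SimplyConnectedSpace.paths_homotopic _ _).map σ))⟩, fun x => rfl⟩

lemma canonLift_vtx (σ : SSimplex N k) (i : Fin (k + 1)) : (H.canonLift σ).1 (vtx i) =
    H.el (RW.base (eHom (σ := σ) (v := fun i => σ (vtx i)) (fun _ => rfl) 0 i)) := by
  change H.el _ = _
  congr 2
  exact hm_eq.2 ((SimplyConnectedSpace.paths_homotopic _ _).map σ)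

lemma T_comp {F : SCochain N (k + 2)} (hF : Special B F) (σ : SSimplex N (k + 2)) :
    H.T F (q.comp σ) = F σ := by
  have h1 : (H.canonLift σ).cls.val F = F σ := by
    rw [Lift.val_cls hF]
    have hs := spans_edges (hj := H.mem) σ (v := fun i => σ (vtx i)) (fun _ => rfl) (𝟙 _)
    rw [← hF.ginv.tval_eq hs]
    congr 1
    funext i
    rw [Category.id_comp]
    change H.ret ((H.canonLift σ).1 (vtx i)) = _
    rw [canonLift_vtx]
    rfl
  rw [← h1]
  refine finsum_eq_single _ _ fun ω hω => ?_
  induction ω using Om.ind with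
  | h p l =>
  obtain ⟨w, rfl⟩ := l.exists_act (H.canonLift σ)
  rcases RW.ret_mul_or (bdSub H.mem) w with ⟨g, rfl⟩ | hw
  · exact absurd (Lift.cls_eq.2 ⟨g, rfl⟩).symm hω
  · rw [Lift.val_cls hF]
    have hv : ∀ i, ((H.canonLift σ).act w).vals i = w.ret (bdSub H.mem) := fun i => by
      change H.ret (H.act w ((H.canonLift σ).1 (vtx i))) = _
      rw [canonLift_vtx]
      exact hw _
    exact hF.tval_eq_zero (i := 0) (l := 1) (by simp) ((hv 0).trans (hv 1).symm)

end GlueHyp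
end BddCoh

end

noncomputable section
namespace BddCoh
open CategoryTheory Topology
local notation "I" => unitInterval

/-! ### Local structure of manifolds with boundary -/

/-- Every point of `M` has arbitrarily small open neighbourhoods parametrized by convex sets, in which
`B` corresponds to the vanishing of the first coordinate. -/
def LocParam (n : ℕ) (M : Type) [TopologicalSpace M] (B : Set M) : Prop :=
  ∀ (x : M) (O : Set M), IsOpen O → x ∈ O → ∃ (K : Set (Fin n → ℝ)) (φ : K → M),
    Convex ℝ K ∧ IsOpenEmbedding φ ∧ x ∈ Set.range φ ∧ Set.range φ ⊆ O ∧
    ∀ k, (φ k ∈ B ↔ ∀ i : Fin n, (i : ℕ) = 0 → k.1 i = 0)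

lemma convex_halfSpace (n : ℕ) : Convex ℝ (halfSpace n) := by
  intro x hx y hy a b ha hb _ j hj
  have h1 := hx j hj
  have h2 := hy j hj
  simp only [Pi.add_apply, Pi.smul_apply, smul_eq_mul]
  positivity

lemma IsTopMfdWithBdry.locParam {n : ℕ} {M : Type} [TopologicalSpace M] {B : Set M}
    (h : IsTopMfdWithBdry n M B) : LocParam n M B := by
  intro x O hO hx
  obtain ⟨U, V, e, hU, hV, hxU, hB⟩ := h.2 x
  have hV' : IsOpen ((fun z : V => z.1) '' (e.symm ⁻¹' (Subtype.val ⁻¹' O))) :=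
    hV.isOpenMap_subtype_val _ ((hO.preimage continuous_subtype_val).preimage e.symm.continuous)
  obtain ⟨V₁, hV₁, hV₁'⟩ := isOpen_induced_iff.1 hV'
  have hex : ((e ⟨x, hxU⟩ : halfSpace n) : Fin n → ℝ) ∈ V₁ := by
    have : (e ⟨x, hxU⟩ : halfSpace n) ∈ Subtype.val ⁻¹' V₁ := by
      rw [hV₁']
      exact ⟨e ⟨x, hxU⟩, by simpa using hx, rfl⟩
    exact this
  obtain ⟨ε, hε, hball⟩ := Metric.isOpen_iff.1 hV₁ _ hex
  set K : Set (Fin n → ℝ) := Metric.ball ((e ⟨x, hxU⟩ : halfSpace n) : Fin n → ℝ) ε ∩ halfSpace n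
  have hK : ∀ k : K, ∃ hk : (⟨k.1, k.2.2⟩ : halfSpace n) ∈ V, (e.symm ⟨_, hk⟩ : M) ∈ O := by
    intro k
    have : (⟨k.1, k.2.2⟩ : halfSpace n) ∈ Subtype.val ⁻¹' V₁ := hball k.2.1
    rw [hV₁'] at this
    obtain ⟨⟨z, hzV⟩, hz, rfl⟩ := this
    exact ⟨hzV, hz⟩
  let ι : K → V := fun k => ⟨⟨k.1, k.2.2⟩, (hK k).1⟩
  have hι : IsOpenEmbedding ι := by
    have hc : Continuous ι := by fun_prop
    refine ⟨IsEmbedding.of_comp hc (continuous_subtype_val.comp continuous_subtype_val)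
      (IsEmbedding.subtypeVal (p := fun k => k ∈ K)), ?_⟩
    have : Set.range ι = (fun z : V => (z.1.1 : Fin n → ℝ)) ⁻¹'
        Metric.ball ((e ⟨x, hxU⟩ : halfSpace n) : Fin n → ℝ) ε := by
      ext z
      constructor
      · rintro ⟨k, rfl⟩; exact k.2.1
      · intro hz; exact ⟨⟨z.1.1, hz, z.1.2⟩, rfl⟩
    rw [this]
    exact Metric.isOpen_ball.preimage (continuous_subtype_val.comp continuous_subtype_val)
  refine ⟨K, fun k => (e.symm (ι k) : M), (convex_ball _ _).inter (convex_halfSpace n),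
    hU.isOpenEmbedding_subtypeVal.comp (e.symm.isOpenEmbedding.comp hι), ?_, ?_, fun k => ?_⟩
  · refine ⟨⟨_, Metric.mem_ball_self hε, (e ⟨x, hxU⟩ : halfSpace n).2⟩, ?_⟩
    change (e.symm (e ⟨x, hxU⟩) : M) = x
    simp
  · rintro - ⟨k, rfl⟩
    exact (hK k).2
  · rw [← hB]
    simp [ι]

lemma LocParam.sigma {n : ℕ} {ι : Type} {M : ι → Type} [∀ i, TopologicalSpace (M i)]
    {B : ∀ i, Set (M i)} (h : ∀ i, LocParam n (M i) (B i)) :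
    LocParam n (Σ i, M i) {a | a.2 ∈ B a.1} := by
  rintro ⟨i, x⟩ O hO hx
  obtain ⟨K, φ, h1, h2, ⟨k, hk⟩, h4, h5⟩ := h i x _ (hO.preimage continuous_sigmaMk) hx
  refine ⟨K, fun k => ⟨i, φ k⟩, h1, IsOpenEmbedding.sigmaMk.comp h2, ⟨k, congrArg _ hk⟩, ?_, h5⟩
  rintro - ⟨k, rfl⟩
  exact h4 ⟨k, rfl⟩

lemma LocParam.isClosed {n : ℕ} {M : Type} [TopologicalSpace M] {B : Set M} (h : LocParam n M B) :
    IsClosed B := by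
  refine ⟨isOpen_iff_mem_nhds.2 fun x hx => ?_⟩
  obtain ⟨K, φ, h1, h2, ⟨k, rfl⟩, -, h5⟩ := h x Set.univ isOpen_univ trivial
  have : IsClosed {k : K | ∀ i : Fin n, (i : ℕ) = 0 → k.1 i = 0} := by
    simp only [Set.ofPred_forall]
    refine isClosed_iInter fun i => isClosed_iInter fun _ => ?_
    exact isClosed_eq ((continuous_apply i).comp continuous_subtype_val) continuous_const
  refine Filter.mem_of_superset ((h2.isOpenMap _ this.isOpen_compl).mem_nhds
    ⟨k, fun h => hx ((h5 k).2 h), rfl⟩) ?_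
  rintro - ⟨k', hk', rfl⟩ hB
  exact hk' ((h5 k').1 hB)

section Param

variable {n : ℕ} {M : Type} [TopologicalSpace M] {K : Set (Fin n → ℝ)} {φ : K → M}

lemma exists_path_of_convex (hφ : Continuous φ) {K' : Set (Fin n → ℝ)} (hK' : Convex ℝ K')
    (hKK' : K' ⊆ K) {k k' : K} (hk : k.1 ∈ K') (hk' : k'.1 ∈ K') :
    ∃ γ : Path (φ k) (φ k'), ∀ t, ∃ z : K, z.1 ∈ K' ∧ γ t = φ z := by
  obtain ⟨c, hc⟩ := (hK'.isPathConnected ⟨_, hk⟩).joinedIn _ hk _ hk'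
  refine ⟨⟨⟨fun t => φ ⟨c t, hKK' (hc t)⟩, by fun_prop⟩, ?_, ?_⟩, fun t => ⟨_, hc t, rfl⟩⟩
  · simp
  · simp

lemma hm_eq_of_param (hK : Convex ℝ K) (hφ : IsEmbedding φ) {a b : M} (γ γ' : Path a b)
    (hγ : ∀ t, γ t ∈ Set.range φ) (hγ' : ∀ t, γ' t ∈ Set.range φ) : hm γ = hm γ' := by
  have lift : ∀ {a b : M} (γ : Path a b), (∀ t, γ t ∈ Set.range φ) →
      ∃ c : C(I, K), ∀ t, φ (c t) = γ t := by
    intro a b γ hγ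
    refine ⟨⟨fun t => hφ.toHomeomorph.symm ⟨γ t, hγ t⟩, by fun_prop⟩, fun t => ?_⟩
    exact congrArg Subtype.val (hφ.toHomeomorph.apply_symm_apply ⟨γ t, hγ t⟩)
  obtain ⟨c, hc⟩ := lift γ hγ
  obtain ⟨c', hc'⟩ := lift γ' hγ'
  have h0 : c' 0 = c 0 := hφ.injective (by rw [hc, hc']; simp)
  have h1 : c' 1 = c 1 := hφ.injective (by rw [hc, hc']; simp)
  have : ContractibleSpace K := hK.contractibleSpace ⟨_, (c 0).2⟩
  obtain rfl : φ (c 0) = a := by rw [hc]; simp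
  obtain rfl : φ (c 1) = b := by rw [hc]; simp
  let p : Path (c 0) (c 1) := ⟨c, rfl, rfl⟩
  let p' : Path (c 0) (c 1) := ⟨c', h0, h1⟩
  obtain rfl : p.map hφ.continuous = γ := Path.ext (funext hc)
  obtain rfl : p'.map hφ.continuous = γ' := Path.ext (funext hc')
  exact hm_eq.2 ((SimplyConnectedSpace.paths_homotopic p p').map ⟨φ, hφ.continuous⟩)

end Param

/-! ### Good neighbourhoods in a glued space -/

lemma path_mem_of_disjoint {N F : Type} [TopologicalSpace N] {G : F → Set N} (hG : ∀ a, IsOpen (G a))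
    (hd : Pairwise fun a b => Disjoint (G a) (G b)) {x y : N} (γ : Path x y)
    (hγ : ∀ t, ∃ a, γ t ∈ G a) {a : F} (hx : x ∈ G a) (t : I) : γ t ∈ G a := by
  have hs : IsPreconnected (Set.range γ) := isPreconnected_range γ.continuous
  have hne : (Set.range γ ∩ G a).Nonempty := ⟨x, ⟨0, γ.source⟩, hx⟩
  refine hs.subset_left_of_subset_union (hG a)
    (isOpen_iUnion fun b => isOpen_iUnion fun _ : b ≠ a => hG b) ?_ ?_ hne (Set.mem_range_self t)
  · rw [Set.disjoint_iUnion_right]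
    refine fun b => Set.disjoint_iUnion_right.2 fun hb => hd hb.symm
  · rintro - ⟨t, rfl⟩
    obtain ⟨b, hb⟩ := hγ t
    by_cases hab : b = a
    · exact .inl (hab ▸ hb)
    · exact .inr (Set.mem_iUnion₂.2 ⟨b, hab, hb⟩)

section Good

variable {N Q M : Type} [TopologicalSpace N] [TopologicalSpace Q] [TopologicalSpace M]
  {j : Bool → C(Q, N)} {B : Set N} {q : C(N, M)} {n : ℕ}

lemma exists_nhds_of_closedMap (hq : IsClosedMap q) {m : M} {G : Set N} (hG : IsOpen G)
    (hm : ∀ x, q x = m → x ∈ G) : ∃ V : Set M, IsOpen V ∧ m ∈ V ∧ ∀ x, q x ∈ V → x ∈ G := by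
  refine ⟨(q '' Gᶜ)ᶜ, (hq _ hG.isClosed_compl).isOpen_compl, ?_, fun x hx => ?_⟩
  · rintro ⟨x, hx, rfl⟩
    exact hx (hm x rfl)
  · by_contra h
    exact hx ⟨x, h, rfl⟩

lemma exists_isGood [T2Space N] (hN : LocParam n N B) (hq : IsClosedMap q)
    (hs : Function.Surjective q) (hfin : ∀ m, (q ⁻¹' {m}).Finite)
    (hj : ∀ b s, j b s ∈ B) (hlift : ∀ (b : Bool) (s : Q) {x : N} (γ : Path x (j b s)), (∀ t, γ t ∈ B) →
      ∃ (s' : Q) (c : Path s' s), ∀ t, j b (c t) = γ t)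
    (m : M) (W : Set M) (hW : IsOpen W) (hmW : m ∈ W) :
    ∃ V' V : Set M, V ⊆ W ∧ m ∈ V' ∧ IsOpen V' ∧ IsGood j B q m V' V := by
  let F := {x : N // q x = m}
  obtain ⟨U, hU, hd⟩ := (hfin m).t2_separation
  choose K φ hK hφ hx hsub _ using fun x : F => hN x.1 (U x.1 ∩ q ⁻¹' W)
    ((hU x.1).2.inter (hW.preimage q.continuous)) ⟨(hU x.1).1, by
      change q x.1 ∈ W; rw [x.2]; exact hmW⟩
  have hdis : Pairwise fun a b : F => Disjoint (Set.range (φ a)) (Set.range (φ b)) :=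
    fun a b hab => (hd a.2 b.2 fun h => hab (Subtype.ext h)).mono
      ((hsub a).trans Set.inter_subset_left) ((hsub b).trans Set.inter_subset_left)
  obtain ⟨V, hVo, hmV, hV⟩ := exists_nhds_of_closedMap hq (m := m)
    (isOpen_iUnion fun a : F => (hφ a).isOpen_range) (fun x h => Set.mem_iUnion.2 ⟨⟨x, h⟩, hx _⟩)
  choose K' φ' hK' hφ' hx' hsub' hB' using fun x : F =>
    hN x.1 (q ⁻¹' V ∩ {z | z ∈ B → x.1 ∈ B}) ((hVo.preimage q.continuous).inter (by
      by_cases h : x.1 ∈ B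
      · simp [h]
      · simpa only [h, imp_false] using! hN.isClosed.isOpen_compl)) ⟨by
      change q x.1 ∈ V; rw [x.2]; exact hmV, fun h => h⟩
  obtain ⟨V', hVo', hmV', hV'⟩ := exists_nhds_of_closedMap hq (m := m)
    (isOpen_iUnion fun a : F => (hφ' a).isOpen_range) (fun x h => Set.mem_iUnion.2 ⟨⟨x, h⟩, hx' _⟩)
  have hVc : ∀ {x y : N} (γ : Path x y), (∀ t, q (γ t) ∈ V) → ∀ {a : F}, x ∈ Set.range (φ a) →
      ∀ t, γ t ∈ Set.range (φ a) := fun {_ _} γ hγ {a} ha t =>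
    path_mem_of_disjoint (fun a => (hφ a).isOpen_range) hdis γ
      (fun t => Set.mem_iUnion.1 (hV _ (hγ t))) ha t
  have hbd : ∀ n' ∈ B, q n' ∈ V' →
      ∃ (n : N) (γ : Path n n'), q n = m ∧ ∀ t, γ t ∈ B ∧ q (γ t) ∈ V := by
    intro n' hn' hqn'
    obtain ⟨a, k', rfl⟩ := Set.mem_iUnion.1 (hV' _ hqn')
    have haB : a.1 ∈ B := (hsub' a ⟨k', rfl⟩).2 hn'
    obtain ⟨k, hk⟩ := hx' a
    rw [← hk, hB'] at haB
    rw [hB'] at hn'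
    have hconv : Convex ℝ (K' a ∩ {z | ∀ i : Fin n, (i : ℕ) = 0 → z i = 0}) := by
      refine (hK' a).inter fun x hx y hy r s _ _ _ i hi => ?_
      simp [hx i hi, hy i hi]
    obtain ⟨γ, hγ⟩ := exists_path_of_convex (hφ' a).continuous hconv Set.inter_subset_left
      ⟨k.2, haB⟩ ⟨k'.2, hn'⟩
    refine ⟨_, γ, by rw [hk]; exact a.2, fun t => ?_⟩
    obtain ⟨z, hz, hz'⟩ := hγ t
    rw [hz']
    exact ⟨(hB' a z).2 hz.2, (hsub' a ⟨z, rfl⟩).1⟩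
  refine ⟨V', V, fun x hx => ?_, hmV', hVo', ?_, ?_, ?_, ?_, ?_, hbd⟩
  · obtain ⟨n', rfl⟩ := hs x
    obtain ⟨a, ha⟩ := Set.mem_iUnion.1 (hV _ hx)
    exact (hsub a ha).2
  · intro x hx
    obtain ⟨n', rfl⟩ := hs x
    obtain ⟨a, ha⟩ := Set.mem_iUnion.1 (hV' _ hx)
    exact (hsub' a ha).1
  · intro n' hn'
    obtain ⟨a, k', rfl⟩ := Set.mem_iUnion.1 (hV' _ hn')
    obtain ⟨k, hk⟩ := hx' a
    obtain ⟨γ, hγ⟩ := exists_path_of_convex (hφ' a).continuous (hK' a) subset_rfl k.2 k'.2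
    refine ⟨_, γ, by rw [hk]; exact a.2, fun t => ?_⟩
    obtain ⟨z, -, hz'⟩ := hγ t
    rw [hz']
    exact (hsub' a ⟨z, rfl⟩).1
  · intro x y γ γ' hγ hγ'
    obtain ⟨a, ha⟩ := Set.mem_iUnion.1 (hV x (by simpa using hγ 0))
    exact hm_eq_of_param (hK a) (hφ a).isEmbedding γ γ' (hVc γ hγ ha) (hVc γ' hγ' ha)
  · intro x y γ hγ hxm hym
    have h1 := hVc γ hγ (hx ⟨x, hxm⟩) 1
    rw [γ.target] at h1
    by_contra hne
    exact Set.disjoint_left.1 (hdis (i := ⟨x, hxm⟩) (j := ⟨y, hym⟩)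
      fun h => hne (congrArg Subtype.val h)) h1 (hx ⟨y, hym⟩)
  · intro b s hbs
    obtain ⟨x, γ, hxm, hγ⟩ := hbd (j b s) (hj b s) hbs
    obtain ⟨s', c, hc⟩ := hlift b s γ fun t => (hγ t).1
    refine ⟨s', c, ?_, fun t => by rw [hc]; exact (hγ t).2⟩
    have := hc 0
    rw [c.source, γ.source] at this
    rw [this, hxm]

end Good
end BddCoh

end

noncomputable section
namespace BddCoh
open CategoryTheory Topology
local notation "I" => unitInterval

/-! ### Paths in disjoint unions -/

section Sigma

variable {ι : Type} {Y : ι → Type} [∀ i, TopologicalSpace (Y i)]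

lemma exists_lift_sigma_path {x : Σ i, Y i} {i : ι} {a : Y i} (γ : Path x ⟨i, a⟩) :
    ∃ g : C(I, Y i), (∀ t, γ t = ⟨i, g t⟩) ∧ g 1 = a := by
  obtain ⟨i', g, hg, h⟩ := γ.continuous.exists_lift_sigma
  have h1 : (⟨i', g 1⟩ : Σ i, Y i) = ⟨i, a⟩ := (congrFun h 1).symm.trans γ.target
  obtain ⟨rfl, h2⟩ := Sigma.mk.inj h1
  exact ⟨⟨g, hg⟩, fun t => congrFun h t, eq_of_heq h2⟩

lemma exists_lift_sigma_path_path {i : ι} {a b : Y i} (γ : Path (⟨i, a⟩ : Σ i, Y i) ⟨i, b⟩) :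
    ∃ g : Path a b, g.map continuous_sigmaMk = γ := by
  obtain ⟨g, hg, hg1⟩ := exists_lift_sigma_path γ
  have hg0 : g 0 = a := by
    have := (hg 0).symm.trans γ.source
    exact eq_of_heq (Sigma.mk.inj this).2
  exact ⟨⟨g, hg0, hg1⟩, Path.ext (funext fun t => (hg t).symm)⟩

lemma Path.Homotopic.of_comp_eq_id {X : Type} [TopologicalSpace X] {f : C(X, X)}
    (hf : f = ContinuousMap.id X) {a b : X} {γ γ' : Path a b}
    (h : (γ.map f.continuous).Homotopic (γ'.map f.continuous)) : γ.Homotopic γ' := by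
  subst hf
  exact h

lemma homotopic_of_sigma {i : ι} {a b : Y i} {γ γ' : Path a b}
    (h : (γ.map (continuous_sigmaMk (σ := Y))).Homotopic (γ'.map continuous_sigmaMk)) :
    γ.Homotopic γ' := by
  classical
  let r : C(Σ i, Y i, Y i) :=
    ⟨fun z => if hz : z.1 = i then hz ▸ z.2 else a, by
      refine continuous_sigma fun i' => ?_
      by_cases hi : i' = i
      · subst hi
        simpa using continuous_id'
      · simpa [hi] using continuous_const⟩
  refine Path.Homotopic.of_comp_eq_id (f := r.comp ⟨_, continuous_sigmaMk (σ := Y) (i := i)⟩) ?_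
    (h.map r)
  ext x
  simp [r]

end Sigma

namespace GluingData

variable {k : ℕ} (D : GluingData k)

/-- The disjoint union of the pieces. -/
abbrev Tot : Type := Σ j, D.piece j

/-- The disjoint union of the gluing hypersurfaces. -/
abbrev Seam : Type := Σ e, ↥(D.S₁ e)

/-- The boundary of the disjoint union of the pieces. -/
def totBdry : Set D.Tot := {a | a.2 ∈ D.bdry a.1}

/-- The two sides of the gluing hypersurfaces. -/
def side : Bool → C(D.Seam, D.Tot)
  | true => ⟨fun s => ⟨D.j₁ s.1, s.2.1⟩, by
      exact continuous_sigma fun e => continuous_sigmaMk.comp continuous_subtype_val⟩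
  | false => ⟨fun s => ⟨D.j₂ s.1, (D.glue s.1 s.2).1⟩, by
      exact continuous_sigma fun e =>
        continuous_sigmaMk.comp (continuous_subtype_val.comp (D.glue e).continuous)⟩

/-- The gluing map. -/
def quo : C(D.Tot, D.Glued) := ⟨Quot.mk D.rel, continuous_quot_mk⟩

lemma side_mem (b : Bool) (s : D.Seam) : D.side b s ∈ D.totBdry := by
  cases b
  · exact D.sub₂ _ (D.glue s.1 s.2).2
  · exact D.sub₁ _ s.2.2

lemma component_eq {c c' : Σ j, Set (D.piece j)}
    (hc : ∃ y ∈ D.bdry c.1, c.2 = connectedComponentIn (D.bdry c.1) y)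
    (hc' : ∃ y ∈ D.bdry c'.1, c'.2 = connectedComponentIn (D.bdry c'.1) y)
    {a : D.piece c.1} {a' : D.piece c'.1} (ha : a ∈ c.2) (ha' : a' ∈ c'.2)
    (h : (⟨c.1, a⟩ : D.Tot) = ⟨c'.1, a'⟩) : c = c' := by
  obtain ⟨i, S⟩ := c
  obtain ⟨i', S'⟩ := c'
  obtain ⟨h1, h2⟩ := Sigma.mk.inj h
  obtain rfl : i = i' := h1
  obtain rfl : a = a' := eq_of_heq h2
  obtain ⟨y, -, hS⟩ := hc
  obtain ⟨y', -, hS'⟩ := hc'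
  change S = connectedComponentIn (D.bdry i) y at hS
  change S' = connectedComponentIn (D.bdry i) y' at hS'
  have e1 : connectedComponentIn (D.bdry i) y = _ := connectedComponentIn_eq (hS ▸ ha)
  have e2 : connectedComponentIn (D.bdry i) y' = _ := connectedComponentIn_eq (hS' ▸ ha')
  rw [hS, hS', e1, e2]

lemma side_inj {b b' : Bool} {s s' : D.Seam} (h : D.side b s = D.side b' s') : b = b' ∧ s = s' := by
  obtain ⟨e, s⟩ := s
  obtain ⟨e', s'⟩ := s'
  cases b <;> cases b'
  · have := D.used_inj (a₁ := .inr e) (a₂ := .inr e')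
      (D.component_eq (D.comp₂ e) (D.comp₂ e') (D.glue e s).2 (D.glue e' s').2 h)
    obtain rfl : e = e' := by simpa using this
    have h2 : (D.glue e s).1 = (D.glue e s').1 := eq_of_heq (Sigma.mk.inj h).2
    rw [(D.glue e).injective (Subtype.ext h2)]
    exact ⟨rfl, rfl⟩
  · have := D.used_inj (a₁ := .inr e) (a₂ := .inl e')
      (D.component_eq (D.comp₂ e) (D.comp₁ e') (D.glue e s).2 s'.2 h)
    simp at this
  · have := D.used_inj (a₁ := .inl e) (a₂ := .inr e')
      (D.component_eq (D.comp₁ e) (D.comp₂ e') s.2 (D.glue e' s').2 h)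
    simp at this
  · have := D.used_inj (a₁ := .inl e) (a₂ := .inl e')
      (D.component_eq (D.comp₁ e) (D.comp₁ e') s.2 s'.2 h)
    obtain rfl : e = e' := by simpa using this
    have h2 : s.1 = s'.1 := eq_of_heq (Sigma.mk.inj h).2
    rw [Subtype.ext h2]
    exact ⟨rfl, rfl⟩

lemma quo_side (b b' : Bool) (s : D.Seam) : D.quo (D.side b s) = D.quo (D.side b' s) := by
  have : D.quo (D.side true s) = D.quo (D.side false s) :=
    Quot.sound ⟨s.1, s.2, rfl, rfl⟩
  cases b <;> cases b'
  · rfl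
  · exact this.symm
  · exact this
  · rfl

lemma quo_eq {n n' : D.Tot} (h : D.quo n = D.quo n') :
    n = n' ∨ ∃ s b b', b ≠ b' ∧ n = D.side b s ∧ n' = D.side b' s := by
  have h' := Quot.eqvGen_exact h
  induction h' with
  | rel a c hac =>
    obtain ⟨e, s, rfl, rfl⟩ := hac
    exact .inr ⟨⟨e, s⟩, true, false, by simp, rfl, rfl⟩
  | refl a => exact .inl rfl
  | symm a c _ ih =>
    rcases ih (Quot.eqvGen_sound ‹_›) with rfl | ⟨s, b, b', hb, rfl, rfl⟩
    · exact .inl rfl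
    · exact .inr ⟨s, b', b, hb.symm, rfl, rfl⟩
  | trans a c d _ _ ih ih' =>
    rcases ih (Quot.eqvGen_sound ‹_›) with rfl | ⟨s, b, b', hb, rfl, rfl⟩
    · exact ih' h
    · rcases ih' (Quot.eqvGen_sound ‹_›) with rfl | ⟨s₁, b₁, b₁', hb₁, h1, rfl⟩
      · exact .inr ⟨s, b, b', hb, rfl, rfl⟩
      · obtain ⟨rfl, rfl⟩ := D.side_inj h1
        obtain rfl : b = b₁' := by cases b <;> cases b' <;> cases b₁' <;> simp_all
        exact .inl rfl

lemma quo_surjective : Function.Surjective D.quo := Quot.mk_surjective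

lemma quo_fibre_finite (m : D.Glued) : (D.quo ⁻¹' {m}).Finite := by
  obtain ⟨n, rfl⟩ := D.quo_surjective m
  by_cases h : ∃ s b, n = D.side b s
  · obtain ⟨s, b, rfl⟩ := h
    refine (Set.finite_range fun b => D.side b s).subset fun n' hn' => ?_
    rcases D.quo_eq hn' with rfl | ⟨s', b₁, b₁', hb, rfl, h2⟩
    · exact ⟨b, rfl⟩
    · obtain ⟨-, rfl⟩ := D.side_inj h2
      exact ⟨b₁, rfl⟩
  · refine (Set.finite_singleton n).subset fun n' hn' => ?_
    rcases D.quo_eq hn' with rfl | ⟨s', b₁, b₁', hb, rfl, h2⟩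
    · rfl
    · exact absurd ⟨s', b₁', h2⟩ h

lemma exists_lift_component {i : Fin k} {S : Set (D.piece i)}
    (hS : ∃ y ∈ D.bdry i, S = connectedComponentIn (D.bdry i) y) {s : D.piece i} (hs : s ∈ S)
    {x : D.Tot} (γ : Path x ⟨i, s⟩) (hγ : ∀ t, γ t ∈ D.totBdry) :
    ∃ g : C(I, S), (∀ t, γ t = ⟨i, (g t).1⟩) ∧ (g 1).1 = s := by
  obtain ⟨g, hg, hg1⟩ := exists_lift_sigma_path γ
  have hb : ∀ t, g t ∈ D.bdry i := fun t => by
    have := hγ t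
    rw [hg] at this
    exact this
  obtain ⟨y, hy, rfl⟩ := hS
  have hsub : Set.range g ⊆ connectedComponentIn (D.bdry i) y := by
    rw [connectedComponentIn_eq hs]
    refine (isPreconnected_range g.continuous).subset_connectedComponentIn ⟨1, hg1⟩ ?_
    rintro - ⟨t, rfl⟩
    exact hb t
  exact ⟨⟨fun t => ⟨g t, hsub ⟨t, rfl⟩⟩, by fun_prop⟩, hg, hg1⟩

lemma exists_lift_side (b : Bool) (s : D.Seam) {x : D.Tot} (γ : Path x (D.side b s))
    (hγ : ∀ t, γ t ∈ D.totBdry) : ∃ (s' : D.Seam) (c : Path s' s), ∀ t, D.side b (c t) = γ t := by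
  obtain ⟨e, s⟩ := s
  cases b
  · obtain ⟨g, hg, hg1⟩ := D.exists_lift_component (D.comp₂ e) (D.glue e s).2 γ hγ
    refine ⟨⟨e, (D.glue e).symm (g 0)⟩, ⟨⟨fun t => ⟨e, (D.glue e).symm (g t)⟩, ?_⟩, rfl, ?_⟩,
      fun t => ?_⟩
    · exact continuous_sigmaMk.comp ((D.glue e).symm.continuous.comp g.continuous)
    · change (⟨e, _⟩ : D.Seam) = ⟨e, s⟩
      congr 1
      rw [Homeomorph.symm_apply_eq]
      exact Subtype.ext hg1
    · refine Eq.trans ?_ (hg t).symm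
      change (⟨D.j₂ e, (D.glue e ((D.glue e).symm (g t))).1⟩ : D.Tot) = _
      simp
  · obtain ⟨g, hg, hg1⟩ := D.exists_lift_component (D.comp₁ e) s.2 γ hγ
    refine ⟨⟨e, g 0⟩, ⟨⟨fun t => ⟨e, g t⟩, ?_⟩, rfl, ?_⟩, fun t => (hg t).symm⟩
    · exact continuous_sigmaMk.comp g.continuous
    · change (⟨e, _⟩ : D.Seam) = ⟨e, s⟩
      congr 1
      exact Subtype.ext hg1

lemma Compatible.iff {D : GluingData k} (hD : D.Compatible) {e : D.E} {s : D.S₁ e} (l : Path s s) :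
    hm (l.map (subIncl (D.S₁ e)).continuous) = 𝟙 _ ↔
      hm ((l.map (D.glue e).continuous).map (subIncl (D.S₂ e)).continuous) = 𝟙 _ := by
  have h := hD e s
  constructor
  · intro h1
    have : pi1Map (D.glue e : C(D.S₁ e, D.S₂ e)) s (hm l) ∈
        MonoidHom.ker (pi1Map (subIncl (D.S₂ e)) ((D.glue e) s)) := by
      rw [← h]
      exact ⟨hm l, MonoidHom.mem_ker.2 h1, rfl⟩
    exact MonoidHom.mem_ker.1 this
  · intro h1
    have : pi1Map (D.glue e : C(D.S₁ e, D.S₂ e)) s (hm l) ∈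
        MonoidHom.ker (pi1Map (subIncl (D.S₂ e)) ((D.glue e) s)) := MonoidHom.mem_ker.2 h1
    rw [← h] at this
    obtain ⟨l', hl', he⟩ := this
    obtain ⟨c, rfl⟩ := hm_surj (x := ⟨s⟩) (y := ⟨s⟩) l'
    have h2 : (c.map (D.glue e).continuous).Homotopic (l.map (D.glue e).continuous) :=
      hm_eq.1 he
    have h3 : c.Homotopic l := by
      refine Path.Homotopic.of_comp_eq_id
        (f := ((D.glue e).symm : C(D.S₂ e, D.S₁ e)).comp (D.glue e : C(D.S₁ e, D.S₂ e))) ?_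
        (h2.map ((D.glue e).symm : C(D.S₂ e, D.S₁ e)))
      ext x
      simp
    rw [← hm_eq.2 (h3.map (subIncl (D.S₁ e)))]
    exact MonoidHom.mem_ker.1 hl'

lemma Compatible.compat {D : GluingData k} (hD : D.Compatible) : RW.Compat (sides D.side) := by
  have key : ∀ {s : D.Seam} (l : Path s s) (b b' : Bool), hm (l.map (D.side b).continuous) = 𝟙 _ →
      hm (l.map (D.side b').continuous) = 𝟙 _ := by
    rintro ⟨e, s⟩ l b b' h
    obtain ⟨g, rfl⟩ := exists_lift_sigma_path_path l
    have h1 : hm ((g.map (continuous_sigmaMk (σ := fun e => ↥(D.S₁ e)))).map (D.side true).continuous) = 𝟙 _ ↔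
        hm (g.map (subIncl (D.S₁ e)).continuous) = 𝟙 _ := by
      constructor
      · intro h
        rw [← hm_refl, hm_eq] at h ⊢
        exact homotopic_of_sigma h
      · intro h
        rw [← hm_refl, hm_eq] at h ⊢
        exact h.map ⟨_, continuous_sigmaMk (σ := D.piece)⟩
    have h2 : hm ((g.map (continuous_sigmaMk (σ := fun e => ↥(D.S₁ e)))).map (D.side false).continuous) = 𝟙 _ ↔
        hm ((g.map (D.glue e).continuous).map (subIncl (D.S₂ e)).continuous) = 𝟙 _ := by
      constructor
      · intro h
        rw [← hm_refl, hm_eq] at h ⊢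
        exact homotopic_of_sigma h
      · intro h
        rw [← hm_refl, hm_eq] at h ⊢
        exact h.map ⟨_, continuous_sigmaMk (σ := D.piece)⟩
    cases b <;> cases b'
    · exact h
    · exact h1.2 ((hD.iff g).2 (h2.1 h))
    · exact h2.2 ((hD.iff g).1 (h1.1 h))
    · exact h
  intro b b' s s' c c' h
  obtain ⟨c, rfl⟩ := hm_surj c
  obtain ⟨c', rfl⟩ := hm_surj c'
  have h' : hm (c.map (D.side b).continuous) = hm (c'.map (D.side b).continuous) := h
  change hm (c.map (D.side b').continuous) = hm (c'.map (D.side b').continuous)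
  have := key (c.trans c'.symm) b b' (by
    rw [Path.map_trans, ← Path.map_symm, hm_trans, hm_symm, h']
    simp)
  rw [Path.map_trans, ← Path.map_symm, hm_trans, hm_symm] at this
  rwa [IsIso.comp_inv_eq, Category.id_comp] at this

/-- A compatible gluing of manifolds satisfies the hypotheses of the transfer. -/
lemma glueHyp {n : ℕ} (hcomp : ∀ j, CompactSpace (D.piece j))
    (hmfd : ∀ j, IsTopMfdWithBdry n (D.piece j) (D.bdry j)) (hcompat : D.Compatible)
    (hT2 : T2Space D.Glued) : GlueHyp D.side D.totBdry D.quo where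
  mem := D.side_mem
  inj := D.side_inj
  q_side := D.quo_side
  q_eq := D.quo_eq
  surj := D.quo_surjective
  compat := hcompat.compat
  good := by
    have : ∀ j, T2Space (D.piece j) := fun j => (hmfd j).1
    exact exists_isGood (LocParam.sigma fun j => (hmfd j).locParam) D.quo.continuous.isClosedMap
      D.quo_surjective D.quo_fibre_finite D.side_mem D.exists_lift_side

lemma hasInvMean_totBdry (hamen : ∀ j, AmenableComponents ↥(D.bdry j)) (y : D.totBdry) :
    HasInvMean (FundamentalGroup D.totBdry y) := by
  obtain ⟨⟨i, a⟩, ha⟩ := y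
  let y : D.bdry i := ⟨a, ha⟩
  let ι : C(connectedComponent y, D.totBdry) := ⟨fun z => ⟨⟨i, z.1.1⟩, z.1.2⟩, by
    exact Continuous.subtype_mk (continuous_sigmaMk.comp
      (continuous_subtype_val.comp continuous_subtype_val)) _⟩
  refine HasInvMean.of_surjective (pi1Map ι ⟨y, mem_connectedComponent⟩) ?_
    (hamen i y).hasInvMean
  intro l
  obtain ⟨c, rfl⟩ := hm_surj (x := ⟨ι ⟨y, mem_connectedComponent⟩⟩)
    (y := ⟨ι ⟨y, mem_connectedComponent⟩⟩) l
  obtain ⟨g, hg⟩ := exists_lift_sigma_path_path (Y := D.piece) (a := a) (b := a)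
    (c.map (continuous_subtype_val (p := (· ∈ D.totBdry))))
  have hg' : ∀ t, (⟨i, g t⟩ : D.Tot) = (c t).1 := fun t => congrArg (fun p => p t) hg
  have hb : ∀ t, g t ∈ D.bdry i := fun t => by
    have : (⟨i, g t⟩ : D.Tot) ∈ D.totBdry := by rw [hg']; exact (c t).2
    exact this
  let g₁ : C(I, D.bdry i) := ⟨fun t => ⟨g t, hb t⟩, by fun_prop⟩
  have hy : g₁ 0 = y := Subtype.ext g.source
  have hy1 : g₁ 1 = y := Subtype.ext g.target
  have hcc : ∀ t, g₁ t ∈ connectedComponent y := fun t =>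
    (isPreconnected_range g₁.continuous).subset_connectedComponent ⟨0, hy⟩ ⟨t, rfl⟩
  let l : Path (⟨y, mem_connectedComponent⟩ : connectedComponent y) ⟨y, mem_connectedComponent⟩ :=
    ⟨⟨fun t => ⟨g₁ t, hcc t⟩, by fun_prop⟩, Subtype.ext hy, Subtype.ext hy1⟩
  refine ⟨hm l, ?_⟩
  have : l.map ι.continuous = c := Path.ext (funext fun t => Subtype.ext (hg' t))
  rw [← this]
  rfl

end GluingData
end BddCoh

end

noncomputable section
namespace BddCoh
open CategoryTheory Topology
local notation "I" => unitInterval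

/-! ### Seminorms of transferred classes -/

section Norm

variable {N Q M : Type} [TopologicalSpace N] [TopologicalSpace Q] [TopologicalSpace M]
  {j : Bool → C(Q, N)} {B : Set N} {q : C(N, M)}

lemma Special.sub {k : ℕ} {F G : SCochain N k} (hF : Special B F) (hG : Special B G) :
    Special B (F - G) :=
  ⟨fun σ π => by rw [Pi.sub_apply, hF.alt, hG.alt, Pi.sub_apply, mul_sub],
    fun σ σ' v v' hv hv' c hc h => by
      rw [Pi.sub_apply, Pi.sub_apply, hF.ginv σ σ' v v' hv hv' c hc h,
        hG.ginv σ σ' v v' hv hv' c hc h]⟩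

lemma special_ulim {k : ℕ} (u : Ultrafilter ℕ) {F : ℕ → SCochain N k} (hF : ∀ i, Special B (F i))
    (hb : ∀ σ, Bdd fun i => F i σ) : Special B fun σ => ulim u fun i => F i σ :=
  ⟨fun σ π => by
    simp only [(hF _).alt σ π]
    exact (isMean_ulim u).smul _ _ (hb σ),
    fun σ σ' v v' hv hv' c hc h => by
      simp only [(hF _).ginv σ σ' v v' hv hv' c hc h]⟩

lemma exists_special_cocycle (hY : ∀ y : B, HasInvMean (FundamentalGroup B y)) {k : ℕ}
    {f : SCochain N (k + 2)} (hf : f ∈ relBZ N B (k + 2)) {C : ℝ} (hC : ∀ σ, |f σ| ≤ C) :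
    ∃ F, Special B F ∧ (∀ σ, |F σ| ≤ C) ∧ scob N (k + 2) F = 0 ∧ F - f ∈ relBB N B (k + 2) := by
  have h0 : scob N (k + 2) f = 0 := hf.2
  obtain ⟨F, b, h1, h2, h3, h4⟩ := exists_special_rel hY f hf.1.2 hC (by rw [h0]; exact VanEdge.zero)
  refine ⟨F, h4, h1, ?_, b, h2, h3.symm⟩
  rw [← sub_add_cancel F f, map_add, h3, scob_scob, h0, add_zero]

/-- The morphism of a singular edge. -/
def edgeHom {σ : SSimplex N 1} {a b : N} (ha : σ (vtx 0) = a) (hb : σ (vtx 1) = b) :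
    (⟨a⟩ : FundamentalGroupoid N) ⟶ ⟨b⟩ :=
  hm (((edgeΔ 0 1).map σ.continuous).cast ha.symm hb.symm)

lemma spans_edge (hj : ∀ b s, j b s ∈ B) {σ : SSimplex N 1} {p a b : N} (ha : σ (vtx 0) = a)
    (hb : σ (vtx 1) = b) (g : (⟨p⟩ : FundamentalGroupoid N) ⟶ ⟨a⟩) :
    Spans hj ![Spec.mk _ g, Spec.mk _ (g ≫ edgeHom ha hb)] σ := by
  subst ha hb
  convert spans_edges (hj := hj) σ (v := fun i => σ (vtx i)) (fun _ => rfl) g using 1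
  funext i
  fin_cases i
  · change Spec.mk _ g = Spec.mk _ (g ≫ eHom (σ := σ) (v := fun i => σ (vtx i)) (fun _ => rfl) 0 0)
    rw [eHom_self, Category.comp_id]
  · rfl

/-- Concatenation of edges for special cochains of degree one. -/
lemma Special.exists_concat (hj : ∀ b s, j b s ∈ B) {U : SCochain N 1} (hU : Special B U) {K : ℝ}
    (hK : ∀ σ, |scob N 1 U σ| ≤ K) {σ γ : SSimplex N 1} (h : σ (vtx 1) = γ (vtx 0)) :
    ∃ s : SSimplex N 1, s (vtx 1) = γ (vtx 1) ∧ |U s - U σ - U γ| ≤ K ∧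
      (Set.range γ ⊆ B → U s = U σ) := by
  let p : FundamentalGroupoid N := ⟨σ (vtx 1)⟩
  let g₀ : p ⟶ ⟨σ (vtx 0)⟩ := inv (edgeHom rfl rfl)
  let g₂ : p ⟶ ⟨γ (vtx 1)⟩ := edgeHom h.symm rfl
  let ρ : Fin 3 → Spec p (bdSub hj) := ![Spec.mk _ g₀, Spec.mk _ (𝟙 p), Spec.mk _ g₂]
  have s1 : Spans hj ![ρ 0, ρ 1] σ := by
    have := spans_edge hj rfl rfl g₀
    rwa [IsIso.inv_hom_id] at this
  have s2 : Spans hj ![ρ 1, ρ 2] γ := by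
    have := spans_edge hj h.symm rfl (𝟙 p)
    rwa [Category.id_comp] at this
  let v : Fin 2 → N := ![σ (vtx 0), γ (vtx 1)]
  let g : ∀ i, p ⟶ ⟨v i⟩ := fun i => match i with
    | 0 => g₀
    | 1 => g₂
  obtain ⟨s, hsv, hs⟩ := exists_simplex_of_edges (p := σ (vtx 1)) (v := v) g
  have s3 : Spans hj ![ρ 0, ρ 2] s := ⟨v, hsv, g, fun i => by fin_cases i <;> rfl, hs⟩
  refine ⟨s, hsv 1, ?_, fun hγ => ?_⟩
  · have h1 := tval_scob hU.ginv ρ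
    have h2 : |tval (scob N 1 U) ρ| ≤ K := abs_tval_le hK
    have e0 : (fun l : Fin 2 => ρ ((0 : Fin 3).succAbove l)) = ![ρ 1, ρ 2] := by
      funext l; fin_cases l <;> rfl
    have e1 : (fun l : Fin 2 => ρ ((1 : Fin 3).succAbove l)) = ![ρ 0, ρ 2] := by
      funext l; fin_cases l <;> rfl
    have e2 : (fun l : Fin 2 => ρ ((2 : Fin 3).succAbove l)) = ![ρ 0, ρ 1] := by
      funext l; fin_cases l <;> rfl
    rw [Fin.sum_univ_three, e0, e1, e2, hU.ginv.tval_eq s1, hU.ginv.tval_eq s2,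
      hU.ginv.tval_eq s3] at h1
    rw [h1] at h2
    rw [abs_le] at h2 ⊢
    norm_num at h2
    constructor <;> linarith [h2.1, h2.2]
  · have : ρ 2 = ρ 1 := by
      refine (Spec.mk_eq_mk.2 ?_).symm
      rw [IsIso.inv_id, Category.id_comp]
      exact ⟨((edgeΔ 0 1).map γ.continuous).cast h rfl, .inr fun t => hγ ⟨_, rfl⟩, rfl⟩
    rw [this] at s3
    exact hU.ginv.eq_of_spans s3 s1

/-- The primitive of a special coboundary of degree two can be chosen bounded by the coboundary. -/
lemma Special.exists_small_primitive (hj : ∀ b s, j b s ∈ B) {U : SCochain N 1} (hU : Special B U)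
    {C K : ℝ} (hC : ∀ σ, |U σ| ≤ C) (hK : ∀ σ, |scob N 1 U σ| ≤ K) :
    ∃ U', (∀ σ, |U' σ| ≤ K) ∧ U' ∈ vanishingOn N B 1 ∧ scob N 1 U' = scob N 1 U := by
  let w : N → ℝ := fun x => ⨆ σ : {σ : SSimplex N 1 // σ (vtx 1) = x}, U σ.1
  have hbdd : ∀ x, BddAbove (Set.range fun σ : {σ : SSimplex N 1 // σ (vtx 1) = x} => U σ.1) :=
    fun x => ⟨C, by rintro - ⟨σ, rfl⟩; exact (abs_le.1 (hC _)).2⟩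
  have hne : ∀ x, Nonempty {σ : SSimplex N 1 // σ (vtx 1) = x} :=
    fun x => ⟨⟨ContinuousMap.const _ x, rfl⟩⟩
  have h1 : ∀ γ : SSimplex N 1, w (γ (vtx 0)) + U γ - K ≤ w (γ (vtx 1)) := by
    intro γ
    have : w (γ (vtx 0)) ≤ w (γ (vtx 1)) - U γ + K := by
      have := hne (γ (vtx 0))
      refine ciSup_le fun σ => ?_
      obtain ⟨s, hs, hs', -⟩ := hU.exists_concat hj hK σ.2
      have h2 : U s ≤ w (γ (vtx 1)) := le_ciSup (hbdd _) ⟨s, hs⟩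
      linarith [(abs_le.1 hs').1]
    linarith
  have h2 : ∀ γ : SSimplex N 1, Set.range γ ⊆ B → w (γ (vtx 0)) ≤ w (γ (vtx 1)) := by
    intro γ hγ
    have := hne (γ (vtx 0))
    refine ciSup_le fun σ => ?_
    obtain ⟨s, hs, -, hs'⟩ := hU.exists_concat hj hK σ.2
    rw [← hs' hγ]
    exact le_ciSup (hbdd _) ⟨s, hs⟩
  let rev : SSimplex N 1 → SSimplex N 1 := fun γ => γ.comp (smap (Equiv.swap (0 : Fin 2) 1))
  have r0 : ∀ γ, rev γ (vtx 0) = γ (vtx 1) := fun γ => by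
    change γ (smap _ (vtx 0)) = _
    rw [smap_vtx, Equiv.swap_apply_left]
  have r1 : ∀ γ, rev γ (vtx 1) = γ (vtx 0) := fun γ => by
    change γ (smap _ (vtx 1)) = _
    rw [smap_vtx, Equiv.swap_apply_right]
  have rU : ∀ γ, U (rev γ) = -U γ := fun γ => by
    rw [hU.alt γ, Equiv.Perm.sign_swap (by simp)]
    simp
  have hdw : ∀ γ, scob N 0 (fun τ => w (τ (vtx 0))) γ = w (γ (vtx 1)) - w (γ (vtx 0)) := by
    intro γ
    have e : ∀ i : Fin 2, (faceOf γ i) (vtx 0) = γ (vtx (i.succAbove 0)) := fun i => by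
      change γ (face i (vtx 0)) = _
      rw [face_eq_smap, smap_vtx]
    rw [scob_apply, Fin.sum_univ_two, e, e]
    simp only [Fin.succAbove_zero, Fin.succ_zero_eq_one, Fin.isValue, Fin.val_zero, pow_zero, one_mul,
      Fin.val_one, pow_one, neg_mul]
    rfl
  refine ⟨U - scob N 0 (fun τ => w (τ (vtx 0))), fun γ => ?_, fun γ hγ => ?_, ?_⟩
  · rw [Pi.sub_apply, hdw, abs_le]
    have a := h1 γ
    have b := h1 (rev γ)
    rw [r0, r1, rU] at b
    constructor <;> linarith
  · rw [Pi.sub_apply, hdw, hU.mem_vanishingOn γ hγ]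
    have a := h2 γ hγ
    have b := h2 (rev γ) (by
      rintro - ⟨x, rfl⟩
      exact hγ ⟨_, rfl⟩)
    rw [r0, r1] at b
    linarith
  · rw [map_sub, scob_scob, sub_zero]

/-- Special cocycles are cohomologous by special cochains. -/
lemma exists_special_primitive (hY : ∀ y : B, HasInvMean (FundamentalGroup B y)) {k : ℕ}
    {F F' : SCochain N (k + 2)} (hF : Special B F) (hF' : Special B F')
    (h : F - F' ∈ relBB N B (k + 2)) :
    ∃ (U : SCochain N (k + 1)) (C : ℝ), Special B U ∧ (∀ σ, |U σ| ≤ C) ∧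
      scob N (k + 1) U = F - F' := by
  obtain ⟨u, ⟨⟨C, hC⟩, -⟩, hu⟩ := h
  obtain ⟨U, b, h1, h2, h3, h4⟩ := exists_special hY u hC (by rw [hu]; exact (hF.sub hF').vanEdge)
  refine ⟨U, C, h4, h1, ?_⟩
  rw [← hu, ← sub_eq_zero, ← map_sub, h3, scob_scob]

/-- In degree two the seminorm of a class is attained by a special cocycle. -/
lemma exists_special_minimal (hj : ∀ b s, j b s ∈ B)
    (hY : ∀ y : B, HasInvMean (FundamentalGroup B y)) {f : SCochain N 2} {r : ℝ}
    (h : ∀ ε > 0, ∃ F, Special B F ∧ (∀ σ, |F σ| ≤ r + ε) ∧ scob N 2 F = 0 ∧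
      F - f ∈ relBB N B 2) :
    ∃ F, Special B F ∧ (∀ σ, |F σ| ≤ r) ∧ scob N 2 F = 0 ∧ F - f ∈ relBB N B 2 := by
  choose F hF hFb hF0 hFf using fun i : ℕ => h ((i : ℝ) + 1)⁻¹ (by positivity)
  have hle : ∀ i : ℕ, ((i : ℝ) + 1)⁻¹ ≤ 1 := fun i => inv_le_one_of_one_le₀ (by simp)
  have hF1 : ∀ i σ, |F i σ| ≤ r + 1 := fun i σ => (hFb i σ).trans (by linarith [hle i])
  have hU : ∀ i, ∃ U' : SCochain N 1, (∀ σ, |U' σ| ≤ 2 * r + 2) ∧ U' ∈ vanishingOn N B 1 ∧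
      scob N 1 U' = F i - F 0 := by
    intro i
    have hd : F i - F 0 ∈ relBB N B 2 := by
      have := Submodule.sub_mem _ (hFf i) (hFf 0)
      rwa [sub_sub_sub_cancel_right] at this
    obtain ⟨U, C, h1, h2, h3⟩ := exists_special_primitive hY (hF i) (hF 0) hd
    obtain ⟨U', a, b, c⟩ := h1.exists_small_primitive hj (K := 2 * r + 2) h2 (fun σ => by
      rw [h3, Pi.sub_apply]
      refine (abs_sub _ _).trans ?_
      linarith [hF1 i σ, hF1 0 σ])
    exact ⟨U', a, b, c.trans h3⟩
  choose U hUb hUv hUs using hU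
  let u : Ultrafilter ℕ := Filter.hyperfilter ℕ
  have hu := isMean_ulim u
  have hb : ∀ σ, Bdd fun i => F i σ := fun σ => ⟨r + 1, fun i => hF1 i σ⟩
  have hbU : ∀ σ, Bdd fun i => U i σ := fun σ => ⟨2 * r + 2, fun i => hUb i σ⟩
  let L : SCochain N 2 := fun σ => ulim u fun i => F i σ
  let W : SCochain N 1 := fun σ => ulim u fun i => U i σ
  have hLW : L - F 0 = scob N 1 W := by
    funext σ
    have e1 : scob N 1 W σ = ulim u fun i => scob N 1 (U i) σ := by
      rw [scob_apply]
      simp only [scob_apply]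
      rw [hu.sum]
      · refine Finset.sum_congr rfl fun i _ => ?_
        exact (hu.smul _ _ (hbU _)).symm
      · intro i _
        obtain ⟨C, hC⟩ := hbU (faceOf σ i)
        refine ⟨C, fun l => ?_⟩
        rw [abs_mul, abs_pow, abs_neg, abs_one, one_pow, one_mul]
        exact hC l
    rw [e1]
    simp only [hUs, Pi.sub_apply]
    rw [hu.sub (hb σ) (bdd_const _), hu.const]
  refine ⟨L, special_ulim u hF hb, fun σ => ?_, ?_, ?_⟩
  · have ht := (tendsto_ulim u (hb σ)).abs
    have ht2 : Filter.Tendsto (fun i : ℕ => r + ((i : ℝ) + 1)⁻¹) u (𝓝 (r + 0)) :=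
      (tendsto_const_nhds.add (tendsto_inv_atTop_zero.comp
        (Filter.tendsto_atTop_add_const_right _ 1 tendsto_natCast_atTop_atTop))).mono_left
        Nat.hyperfilter_le_atTop
    rw [add_zero] at ht2
    exact le_of_tendsto_of_tendsto ht ht2 (Filter.Eventually.of_forall fun i => hFb i σ)
  · have : L = F 0 + scob N 1 W := by rw [← hLW]; abel
    rw [this, map_add, hF0, scob_scob, add_zero]
  · have : L - f = (F 0 - f) + scob N 1 W := by rw [← hLW]; abel
    rw [this]
    refine Submodule.add_mem _ (hFf 0) ⟨W, ⟨⟨2 * r + 2, fun σ => hu.abs_le _ _ fun i => hUb i σ⟩,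
      fun σ hσ => ?_⟩, rfl⟩
    change ulim u (fun i => U i σ) = 0
    simp only [hUv _ σ hσ]
    exact hu.const 0

namespace GlueHyp

lemma T_mem_relBZ (H : GlueHyp j B q) {k : ℕ} {F : SCochain N (k + 2)} (hF : Special B F) {C : ℝ}
    (hC : ∀ σ, |F σ| ≤ C) (hC0 : 0 ≤ C) (h0 : scob N (k + 2) F = 0) :
    H.T F ∈ relBZ M (q '' B) (k + 2) := by
  refine ⟨⟨⟨C, abs_T_le hF hC hC0⟩, T_mem_vanishingOn hF⟩, ?_⟩
  refine LinearMap.mem_ker.2 ?_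
  rw [← T_scob hF, h0, T_zero]
  rw [h0]
  exact ⟨fun _ _ => by simp, fun _ _ _ _ _ _ _ _ _ => rfl⟩

/-- Classes on `N` extend to the glued space without increasing the seminorm. -/
theorem exists_extension (H : GlueHyp j B q) (hY : ∀ y : B, HasInvMean (FundamentalGroup B y))
    {k : ℕ} {f : SCochain N (k + 2)} {r : ℝ} (hr : 0 ≤ r)
    (h : ∀ ε > 0, ∃ g ∈ relBZ N B (k + 2), g - f ∈ relBB N B (k + 2) ∧ ∀ σ, |g σ| ≤ r + ε) :
    ∃ Ψ ∈ relBZ M (q '' B) (k + 2), pb q (k + 2) Ψ - f ∈ relBB N B (k + 2) ∧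
      ∀ ε > 0, ∃ Ψ' ∈ relBZ M (q '' B) (k + 2), Ψ' - Ψ ∈ relBB M (q '' B) (k + 2) ∧
        ∀ σ, |Ψ' σ| ≤ r + ε := by
  have h' : ∀ ε > 0, ∃ F, Special B F ∧ (∀ σ, |F σ| ≤ r + ε) ∧ scob N (k + 2) F = 0 ∧
      F - f ∈ relBB N B (k + 2) := by
    intro ε hε
    obtain ⟨g, hg, hgf, hb⟩ := h ε hε
    obtain ⟨F, h1, h2, h3, h4⟩ := exists_special_cocycle hY hg hb
    refine ⟨F, h1, h2, h3, ?_⟩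
    have := Submodule.add_mem _ h4 hgf
    rwa [sub_add_sub_cancel] at this
  have hpb : ∀ {F : SCochain N (k + 2)}, Special B F → pb q (k + 2) (H.T F) = F :=
    fun {F} hF => funext fun σ => T_comp hF σ
  rcases k with _ | k
  · obtain ⟨F, h1, h2, h3, h4⟩ := exists_special_minimal H.mem hY h'
    refine ⟨H.T F, H.T_mem_relBZ h1 h2 hr h3, by rwa [hpb h1], fun ε hε =>
      ⟨H.T F, H.T_mem_relBZ h1 h2 hr h3, by rw [sub_self]; exact Submodule.zero_mem _, fun σ => ?_⟩⟩
    exact (abs_T_le h1 h2 hr σ).trans (by linarith)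
  · obtain ⟨F, h1, h2, h3, h4⟩ := h' 1 one_pos
    refine ⟨H.T F, H.T_mem_relBZ h1 h2 (by linarith) h3, by rwa [hpb h1], fun ε hε => ?_⟩
    obtain ⟨F', h1', h2', h3', h4'⟩ := h' ε hε
    refine ⟨H.T F', H.T_mem_relBZ h1' h2' (by linarith) h3', ?_, abs_T_le h1' h2' (by linarith)⟩
    have hd : F' - F ∈ relBB N B (k + 3) := by
      have := Submodule.sub_mem _ h4' h4
      rwa [sub_sub_sub_cancel_right] at this
    obtain ⟨U, C, hU, hC, hUs⟩ := exists_special_primitive hY h1' h1 hd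
    have hd : Special B (scob N (k + 2) U) := by rw [hUs]; exact h1'.sub h1
    refine ⟨H.T U, ⟨⟨max C 0, abs_T_le hU (fun σ => (hC σ).trans (le_max_left _ _))
      (le_max_right _ _)⟩, T_mem_vanishingOn hU⟩, ?_⟩
    rw [← T_scob hU hd, eq_sub_iff_add_eq, ← T_add hd h1, hUs, sub_add_cancel]

end GlueHyp

end Norm
end BddCoh

end

noncomputable section
namespace BddCoh
open CategoryTheory Topology

/-! ### Seminorms and cochains on disjoint unions -/

lemma abs_le_supN {S : Type*} {f : S → ℝ} (hf : ∃ C, ∀ s, |f s| ≤ C) (s : S) : |f s| ≤ supN f := by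
  obtain ⟨C, hC⟩ := hf
  exact le_csInf ⟨max C 0, le_max_right _ _, fun s => (hC s).trans (le_max_left _ _)⟩
    fun C' hC' => hC'.2 s

lemma supN_nonneg {S : Type*} (f : S → ℝ) : 0 ≤ supN f := Real.sInf_nonneg fun _ h => h.1

lemma supN_le {S : Type*} {f : S → ℝ} {C : ℝ} (h0 : 0 ≤ C) (h : ∀ s, |f s| ≤ C) : supN f ≤ C :=
  csInf_le ⟨0, fun _ h => h.1⟩ ⟨h0, h⟩

section Classes

variable {X : Type} [TopologicalSpace X] {Y : Set X} {n : ℕ}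

lemma bcohNorm_nonneg (φ : relBCoh X Y n) : 0 ≤ bcohNorm φ := by
  refine Real.sInf_nonneg ?_
  rintro r ⟨f, -, rfl⟩
  exact supN_nonneg _

lemma bcohNorm_le (f : relBZ X Y n) : bcohNorm (relBCohClass f) ≤ supN f.1 := by
  refine csInf_le ⟨0, ?_⟩ ⟨f, rfl, rfl⟩
  rintro r ⟨f, -, rfl⟩
  exact supN_nonneg _

lemma exists_class_eq (φ : relBCoh X Y n) : ∃ f : relBZ X Y n, relBCohClass f = φ :=
  Submodule.Quotient.mk_surjective _ φ

lemma exists_rep_lt (φ : relBCoh X Y n) {ε : ℝ} (hε : 0 < ε) :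
    ∃ f : relBZ X Y n, relBCohClass f = φ ∧ ∀ σ, |f.1 σ| ≤ bcohNorm φ + ε := by
  obtain ⟨f₀, hf₀⟩ := exists_class_eq φ
  obtain ⟨r, ⟨f, hf, rfl⟩, hr⟩ := exists_lt_of_csInf_lt
    (s := {r : ℝ | ∃ f : relBZ X Y n, relBCohClass f = φ ∧ r = supN f.1}) ⟨_, f₀, hf₀, rfl⟩
    (show bcohNorm φ < bcohNorm φ + ε by linarith)
  exact ⟨f, hf, fun σ => (abs_le_supN f.2.1.1 σ).trans hr.le⟩

lemma class_eq_iff {f g : relBZ X Y n} :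
    relBCohClass f = relBCohClass g ↔ f.1 - g.1 ∈ relBB X Y n :=
  Submodule.Quotient.eq _

end Classes

namespace GluingData

variable {k : ℕ} (D : GluingData k) {n : ℕ}

/-- The inclusion of a piece in the disjoint union. -/
def incl (i : Fin k) : C(D.piece i, D.Tot) := ⟨Sigma.mk i, continuous_sigmaMk⟩

lemma exists_incl_comp (σ : SSimplex D.Tot n) : ∃ i, ∃ τ : SSimplex (D.piece i) n,
    (D.incl i).comp τ = σ := by
  obtain ⟨i, g, hg, h⟩ := σ.continuous.exists_lift_sigma
  exact ⟨i, ⟨g, hg⟩, ContinuousMap.ext fun x => (congrFun h x).symm⟩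

/-- The cochain on the disjoint union given by cochains on the pieces. -/
def comb (f : ∀ i, SCochain (D.piece i) n) : SCochain D.Tot n := fun σ =>
  f (D.exists_incl_comp σ).choose (D.exists_incl_comp σ).choose_spec.choose

lemma comb_incl (f : ∀ i, SCochain (D.piece i) n) {i : Fin k} (τ : SSimplex (D.piece i) n) :
    D.comb f ((D.incl i).comp τ) = f i τ := by
  have key : ∀ {i' : Fin k} {τ' : SSimplex (D.piece i') n},
      (D.incl i').comp τ' = (D.incl i).comp τ → f i' τ' = f i τ := by
    intro i' τ' h
    have h0 : (⟨i', τ' (vtx 0)⟩ : D.Tot) = ⟨i, τ (vtx 0)⟩ := DFunLike.congr_fun h (vtx 0)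
    obtain rfl : i' = i := (Sigma.mk.inj h0).1
    have : τ' = τ := ContinuousMap.ext fun x =>
      eq_of_heq (Sigma.mk.inj (DFunLike.congr_fun h x : (⟨i', τ' x⟩ : D.Tot) = ⟨i', τ x⟩)).2
    rw [this]
  exact key (D.exists_incl_comp _).choose_spec.choose_spec

lemma scob_comb (f : ∀ i, SCochain (D.piece i) n) :
    scob D.Tot n (D.comb f) = D.comb fun i => scob (D.piece i) n (f i) := by
  funext σ
  obtain ⟨i, τ, rfl⟩ := D.exists_incl_comp σ
  rw [comb_incl, scob_apply, scob_apply]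
  exact Finset.sum_congr rfl fun l _ => congrArg _ (D.comb_incl f (faceOf τ l))

lemma comb_mem_relBC {f : ∀ i, SCochain (D.piece i) n}
    (hf : ∀ i, f i ∈ relBC (D.piece i) (D.bdry i) n) :
    D.comb f ∈ relBC D.Tot D.totBdry n := by
  choose C hC using fun i => (hf i).1
  refine ⟨⟨∑ i, |C i|, fun σ => ?_⟩, fun σ hσ => ?_⟩
  · obtain ⟨i, τ, rfl⟩ := D.exists_incl_comp σ
    rw [comb_incl]
    exact ((hC i τ).trans (le_abs_self _)).trans
      (Finset.single_le_sum (f := fun i => |C i|) (fun _ _ => abs_nonneg _) (Finset.mem_univ i))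
  · obtain ⟨i, τ, rfl⟩ := D.exists_incl_comp σ
    rw [comb_incl]
    refine (hf i).2 τ ?_
    rintro - ⟨x, rfl⟩
    exact hσ ⟨x, rfl⟩

lemma comb_mem_relBZ {f : ∀ i, SCochain (D.piece i) n}
    (hf : ∀ i, f i ∈ relBZ (D.piece i) (D.bdry i) n) :
    D.comb f ∈ relBZ D.Tot D.totBdry n := by
  refine ⟨D.comb_mem_relBC fun i => (hf i).1, LinearMap.mem_ker.2 ?_⟩
  rw [scob_comb]
  funext σ
  obtain ⟨i, τ, rfl⟩ := D.exists_incl_comp σ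
  rw [comb_incl, LinearMap.mem_ker.1 (hf i).2]
  rfl

lemma comb_sub_mem_relBB {f g : ∀ i, SCochain (D.piece i) (n + 1)}
    (h : ∀ i, f i - g i ∈ relBB (D.piece i) (D.bdry i) (n + 1)) :
    D.comb f - D.comb g ∈ relBB D.Tot D.totBdry (n + 1) := by
  choose u hu hus using h
  refine ⟨D.comb u, D.comb_mem_relBC hu, ?_⟩
  rw [scob_comb]
  funext σ
  obtain ⟨i, τ, rfl⟩ := D.exists_incl_comp σ
  rw [comb_incl, Pi.sub_apply, comb_incl, comb_incl, hus]
  rfl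

lemma quo_image_totBdry : D.quo '' D.totBdry = D.gluedBdry ∪ D.gluedSet := by
  ext x
  constructor
  · rintro ⟨⟨i, a⟩, ha, rfl⟩
    exact D.emb_mapsTo_bdry i ha
  · rintro (⟨h, -⟩ | h)
    · obtain ⟨i, a, ha, rfl⟩ := Set.mem_iUnion.1 h
      exact ⟨⟨i, a⟩, ha, rfl⟩
    · obtain ⟨e, a, ha, rfl⟩ := Set.mem_iUnion.1 h
      exact ⟨⟨D.j₁ e, a⟩, D.sub₁ e ha, rfl⟩

end GluingData

open GluingData in
/-- **Extension of bounded classes over compatible gluings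
(Proposition 6.2 of Bucher–Burger–Frigerio–Iozzi–Pagliantini–Pozzetti).**
Let `M = D.Glued` be a compact connected oriented `n`-manifold obtained by gluing the
compact connected oriented manifolds `M_j = D.piece j` along boundary components via
compatible homeomorphisms (a gluing `f : S₁ → S₂` is compatible if `f_*(K₁) = K₂`, where
`K_i` is the kernel of the map induced on fundamental groups by the inclusion of `S_i`),
and assume that the fundamental group of every boundary component of every `M_j` is
amenable. Then for every `m ≥ 2` and every `(φ_1, …, φ_k) ∈ ⊕_j H_b^m(M_j, ∂M_j)` there
is `φ ∈ H_b^m(M, ∂M)` with `‖φ‖_∞ ≤ max_j ‖φ_j‖_∞` and `ζ_j^m(φ) = φ_j` for every `j`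
(below, `ψ` denotes the image of `φ` under the isometric isomorphism
`ζ^m : H_b^m(M, ∂M) → H_b^m(M, ∂M ∪ 𝒮)` inverse to the map induced by the inclusion of
pairs, and `ζ_j^m = i_j^m ∘ ζ^m`). -/
theorem extension_of_bounded_classes_compatible_gluing
    (d k : ℕ) (D : GluingData k)
    (hcomp : ∀ j, CompactSpace (D.piece j))
    (hconn : ∀ j, ConnectedSpace (D.piece j))
    (hmfd : ∀ j, IsTopMfdWithBdry (d + 2) (D.piece j) (D.bdry j))
    (hamen : ∀ j, AmenableComponents ↥(D.bdry j))
    (hcompat : D.Compatible)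
    (hgconn : ConnectedSpace D.Glued)
    (hgmfd : IsTopMfdWithBdry (d + 2) D.Glued D.gluedBdry)
    (m : ℕ) (hm : 2 ≤ m)
    (φv : ∀ j, relBCoh (D.piece j) (D.bdry j) m) :
    ∃ (φ : relBCoh D.Glued D.gluedBdry m)
      (ψ : relBCoh D.Glued (D.gluedBdry ∪ D.gluedSet) m),
      relBCohPull (ContinuousMap.id D.Glued)
        (fun x hx => Set.mem_union_left _ hx) m ψ = φ ∧
      (∀ j, relBCohPull (D.emb j) (D.emb_mapsTo_bdry j) m ψ = φv j) ∧
      bcohNorm φ ≤ ⨆ j, bcohNorm (φv j) := by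
  obtain ⟨n, rfl⟩ : ∃ n, m = n + 2 := ⟨m - 2, by omega⟩
  have H := D.glueHyp hcomp hmfd hcompat hgmfd.1
  have hle : ∀ j, bcohNorm (φv j) ≤ ⨆ j, bcohNorm (φv j) := le_ciSup (Set.finite_range _).bddAbove
  have hr : 0 ≤ ⨆ j, bcohNorm (φv j) := Real.iSup_nonneg fun j => bcohNorm_nonneg _
  choose f hf using fun j => exists_class_eq (φv j)
  obtain ⟨Ψ, hΨ, hΨf, hΨn⟩ := H.exists_extension (D.hasInvMean_totBdry hamen)
    (f := D.comb fun j => (f j).1) hr (fun ε hε => by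
      choose g hg hgb using fun j => exists_rep_lt (φv j) hε
      refine ⟨D.comb fun j => (g j).1, D.comb_mem_relBZ fun j => (g j).2,
        D.comb_sub_mem_relBB fun j => class_eq_iff.1 ((hg j).trans (hf j).symm), fun σ => ?_⟩
      obtain ⟨i, τ, rfl⟩ := D.exists_incl_comp σ
      rw [D.comb_incl]
      exact (hgb i τ).trans (by linarith [hle i]))
  rw [D.quo_image_totBdry] at hΨ hΨn
  refine ⟨_, relBCohClass ⟨Ψ, hΨ⟩, rfl, fun j => ?_, ?_⟩
  · rw [← hf j]
    refine class_eq_iff.2 ?_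
    have := pb_mem_relBB (D.incl j) (Y := D.bdry j) (Y' := D.totBdry) (fun _ h => h) (n + 2) hΨf
    convert this using 1
    funext τ
    exact congrArg (Ψ ((D.emb j).comp τ) - ·) (D.comb_incl (fun j => (f j).1) τ).symm
  · refine le_of_forall_pos_le_add fun ε hε => ?_
    obtain ⟨Ψ', hΨ', hd, hb⟩ := hΨn ε hε
    have hmaps : Set.MapsTo (ContinuousMap.id D.Glued) D.gluedBdry (D.gluedBdry ∪ D.gluedSet) :=
      fun x hx => Set.mem_union_left _ hx
    have h1 : relBCohPull (ContinuousMap.id D.Glued) hmaps (n + 2) (relBCohClass ⟨Ψ, hΨ⟩) =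
        relBCohClass ⟨Ψ', pb_mem_relBZ (ContinuousMap.id D.Glued) hmaps (n + 2) hΨ'⟩ := by
      symm
      exact class_eq_iff.2 (pb_mem_relBB (ContinuousMap.id D.Glued) hmaps (n + 2) hd)
    rw [h1]
    exact (bcohNorm_le _).trans (supN_le (by linarith) hb)

end BddCoh
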